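/- Let K ⊂ ℝ^n be a convex body of class C²₊ with 0 in its interior. For x ∈ ∂K° and δ > 0 small, let x_δ be the point of ∂((K_δ)°) on the ray from 0 through x. Then for every x ∈ ∂K°, lim_{δ→0⁺} (⟨x, N_{K°}(x)⟩ / (n δ^{2/(n+1)})) · [(‖x_δ‖/‖x‖)^n − 1] = ⟨x, N_{K°}(x)⟩² / (c_n · κ_{K°}(x)^{1/(n+1)}). -/

import Mathlib

open MeasureTheory Filter Set
open scoped RealInnerProductSpace Topology NNReal ENNReal

noncomputable section

namespace LpAffine

/-- Euclidean space ℝⁿ. -/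
abbrev E (n : ℕ) := EuclideanSpace ℝ (Fin n)

/-- A convex body: a compact convex set with nonempty interior. -/
def IsConvexBody {n : ℕ} (K : Set (E n)) : Prop :=
  Convex ℝ K ∧ IsCompact K ∧ (interior K).Nonempty

/-- The polar body `K° = {y : ⟪x,y⟫ ≤ 1 ∀ x ∈ K}`. -/
def polarBody {n : ℕ} (K : Set (E n)) : Set (E n) := {y | ∀ x ∈ K, ⟪x, y⟫ ≤ 1}

/-- n-dimensional volume (Lebesgue). -/
def vol {n : ℕ} (K : Set (E n)) : ℝ := (volume K).toReal

/-- (n-1)-dimensional Hausdorff measure on ℝⁿ, used as boundary (surface) measure. -/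
def bdMeasure (n : ℕ) : Measure (E n) := μH[(n : ℝ) - 1]

/-- The surface area measure μ_K on ∂K. -/
def surfaceMeasure {n : ℕ} (K : Set (E n)) : Measure (E n) :=
  (bdMeasure n).restrict (frontier K)

/-- The centroid (center of gravity) of K is at the origin. -/
def CentroidAtOrigin {n : ℕ} (K : Set (E n)) : Prop := (∫ x in K, x) = (0 : E n)

/-- ν is an outer unit normal map for K: at each boundary point x, ν x is a unit vector
and the hyperplane through x with normal ν x supports K. -/
def IsOuterNormal {n : ℕ} (K : Set (E n)) (ν : E n → E n) : Prop :=
  ∀ x ∈ frontier K, ‖ν x‖ = 1 ∧ ∀ z ∈ K, ⟪z, ν x⟫ ≤ ⟪x, ν x⟫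

/-- k is the (generalized) Gaussian curvature of K at the boundary point x:
the density of the spherical image measure with respect to the surface measure at x. -/
def IsGaussCurvatureAt {n : ℕ} (K : Set (E n)) (ν : E n → E n) (x : E n) (k : ℝ) : Prop :=
  Tendsto (fun ε : ℝ =>
      (bdMeasure n (ν '' (frontier K ∩ Metric.ball x ε))).toReal /
        (bdMeasure n (frontier K ∩ Metric.ball x ε)).toReal)
    (𝓝[>] 0) (𝓝 k)

/-- κ is a generalized Gauss curvature function for K (defined μ_K-almost everywhere). -/
def IsGaussCurvature {n : ℕ} (K : Set (E n)) (ν : E n → E n) (κ : E n → ℝ) : Prop :=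
  ∀ᵐ x ∂(surfaceMeasure K), IsGaussCurvatureAt K ν x (κ x)

/-- K is of class C²₊ with outer normal map ν and Gaussian curvature κ:
K is a convex body, ν is a continuous outer normal map which maps ∂K bijectively onto the
unit sphere, and κ is a continuous, everywhere strictly positive Gaussian curvature. -/
def IsC2PlusBody {n : ℕ} (K : Set (E n)) (ν : E n → E n) (κ : E n → ℝ) : Prop :=
  IsConvexBody K ∧ IsOuterNormal K ν ∧
    ContinuousOn ν (frontier K) ∧ ContinuousOn κ (frontier K) ∧
    Set.BijOn ν (frontier K) (Metric.sphere (0 : E n) 1) ∧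
    ∀ x ∈ frontier K, IsGaussCurvatureAt K ν x (κ x) ∧ 0 < κ x

/-- The L_p affine surface area
`as_p(K) = ∫_{∂K} κ(x)^{p/(n+p)} / ⟪x, ν x⟫^{n(p-1)/(n+p)} dμ_K(x)`. -/
def asp {n : ℕ} (p : ℝ) (K : Set (E n)) (ν : E n → E n) (κ : E n → ℝ) : ℝ :=
  ∫ x in frontier K,
    κ x ^ (p / ((n : ℝ) + p)) / ⟪x, ν x⟫ ^ ((n : ℝ) * (p - 1) / ((n : ℝ) + p))
    ∂(bdMeasure n)

/-- The convex floating body K_δ: the intersection of all closed halfspaces whose defining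
hyperplanes cut off a set of volume δ from K. -/
def floatingBody {n : ℕ} (K : Set (E n)) (δ : ℝ) : Set (E n) :=
  ⋂ (u : E n) (t : ℝ) (_ : ‖u‖ = 1 ∧ vol (K ∩ {z | t ≤ ⟪z, u⟫}) = δ),
    {z : E n | ⟪z, u⟫ ≤ t}

/-- The surface body K_{f,s}: the intersection of all closed halfspaces H⁺ whose defining
hyperplanes H cut off a set of f μ_K-measure at most s from ∂K. -/
def surfaceBody {n : ℕ} (K : Set (E n)) (f : E n → ℝ) (s : ℝ) : Set (E n) :=
  ⋂ (u : E n) (t : ℝ)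
    (_ : ‖u‖ = 1 ∧ (∫ x in frontier K ∩ {z | t ≤ ⟪z, u⟫}, f x ∂(bdMeasure n)) ≤ s),
    {z : E n | ⟪z, u⟫ ≤ t}

/-- The constant c_n = 2 (|B₂^{n-1}|/(n+1))^{2/(n+1)}. -/
def cn (n : ℕ) : ℝ :=
  2 * ((volume (Metric.closedBall (0 : EuclideanSpace ℝ (Fin (n - 1))) 1)).toReal /
    ((n : ℝ) + 1)) ^ (2 / ((n : ℝ) + 1))

/-- The constant β_n = 2 |B₂^{n-1}|^{2/(n-1)}. -/
def betan (n : ℕ) : ℝ :=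
  2 * ((volume (Metric.closedBall (0 : EuclideanSpace ℝ (Fin (n - 1))) 1)).toReal) ^
    (2 / ((n : ℝ) - 1))

/-- The support function h_K(u) = sup_{x ∈ K} ⟪x, u⟫. -/
def suppFn {n : ℕ} (K : Set (E n)) (u : E n) : ℝ := sSup ((fun x => ⟪x, u⟫) '' K)

/-- The inverse Gauss map N_K⁻¹ : S^{n-1} → ∂K. -/
def gaussInv {n : ℕ} (K : Set (E n)) (ν : E n → E n) : E n → E n :=
  Function.invFunOn ν (frontier K)

/-- The curvature function f_K(u): the reciprocal of the Gaussian curvature at the boundary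
point with outer normal u. -/
def curvFn {n : ℕ} (K : Set (E n)) (ν : E n → E n) (κ : E n → ℝ) (u : E n) : ℝ :=
  1 / κ (gaussInv K ν u)

/-- The L_{-n} affine surface area
`as_{-n}(K) = max_{u ∈ S^{n-1}} f_K(u)^{1/2} h_K(u)^{(n+1)/2}`. -/
def asNegN {n : ℕ} (K : Set (E n)) (ν : E n → E n) (κ : E n → ℝ) : ℝ :=
  sSup ((fun u => curvFn K ν κ u ^ ((1 : ℝ) / 2) * suppFn K u ^ (((n : ℝ) + 1) / 2)) ''
    Metric.sphere (0 : E n) 1)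

/-- K is an ellipsoid: the image of the Euclidean unit ball under an invertible affine map. -/
def IsEllipsoid {n : ℕ} (K : Set (E n)) : Prop :=
  ∃ (L : E n ≃ₗ[ℝ] E n) (c : E n), K = (fun x => L x + c) '' Metric.closedBall (0 : E n) 1

/-- `p` is a subgradient of `u` at `x`. -/
def IsSubgrad {m : ℕ} (u : E m → ℝ) (x p : E m) : Prop := ∀ z, u x + ⟪p, z - x⟫ ≤ u z

/-- `g` is the gradient map of the convex differentiable function `u`: at each point the
subdifferential of `u` is the singleton `{g x}`. -/
structure IsGrad {m : ℕ} (u : E m → ℝ) (g : E m → E m) : Prop where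
  sub : ∀ x, IsSubgrad u x (g x)
  uniq : ∀ x p, IsSubgrad u x p → p = g x

/-- The excess of `u` over its tangent plane at `x`. -/
def exc {m : ℕ} (u : E m → ℝ) (g : E m → E m) (x z : E m) : ℝ := u (x + z) - u x - ⟪g x, z⟫

section Subgradients

variable {m : ℕ} {u : E m → ℝ} {g : E m → E m}

lemma convexOn_of_subgrad (h : ∀ x, IsSubgrad u x (g x)) : ConvexOn ℝ univ u := by
  refine ⟨convex_univ, fun x _ y _ a b ha hb hab => ?_⟩
  have h1 := h (a • x + b • y) x
  have h2 := h (a • x + b • y) y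
  have e1 : x - (a • x + b • y) = b • (x - y) := by
    have : x = (a + b) • x := by rw [hab, one_smul]
    nth_rewrite 1 [this]; module
  have e2 : y - (a • x + b • y) = (-a) • (x - y) := by
    have : y = (a + b) • y := by rw [hab, one_smul]
    nth_rewrite 1 [this]; module
  rw [e1, inner_smul_right] at h1
  rw [e2, inner_smul_right] at h2
  have h3 := mul_le_mul_of_nonneg_left h1 ha
  have h4 := mul_le_mul_of_nonneg_left h2 hb
  simp only [smul_eq_mul]
  have : (a + b) * u (a • x + b • y) ≤ a * u x + b * u y := by nlinarith
  rwa [hab, one_mul] at this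

lemma IsGrad.convexOn (h : IsGrad u g) : ConvexOn ℝ univ u := convexOn_of_subgrad h.sub

lemma continuous_of_convexOn (h : ConvexOn ℝ univ u) : Continuous u :=
  h.locallyLipschitz.continuous

lemma IsGrad.continuous_fun (h : IsGrad u g) : Continuous u := continuous_of_convexOn h.convexOn

lemma IsSubgrad.monotone {x y p q : E m} (hp : IsSubgrad u x p) (hq : IsSubgrad u y q) :
    0 ≤ ⟪p - q, x - y⟫ := by
  have h1 := hp y
  have h2 := hq x
  have e : ⟪p, y - x⟫ = -⟪p, x - y⟫ := by rw [← inner_neg_right, neg_sub]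
  rw [inner_sub_left]; linarith

lemma IsSubgrad.norm_le {x p : E m} {r M : ℝ} (hp : IsSubgrad u x p) (hr : 0 < r)
    (hM : ∀ y, ‖y - x‖ ≤ r → u y ≤ M) : ‖p‖ * r ≤ M - u x := by
  rcases eq_or_ne p 0 with rfl | hp0
  · have := hM x (by simpa using hr.le)
    simp; linarith
  · have hn : 0 < ‖p‖ := norm_pos_iff.2 hp0
    have h1 := hp (x + (r / ‖p‖) • p)
    have h2 := hM (x + (r / ‖p‖) • p) (by
      rw [add_sub_cancel_left, norm_smul, Real.norm_eq_abs, abs_of_pos (div_pos hr hn)]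
      field_simp; exact le_refl _)
    rw [add_sub_cancel_left, inner_smul_right, real_inner_self_eq_norm_sq] at h1
    have : r / ‖p‖ * ‖p‖ ^ 2 = ‖p‖ * r := by field_simp
    linarith

/-- A function with bounded subgradients at two points satisfies a Lipschitz estimate. -/
lemma IsSubgrad.abs_sub_le {x y p q : E m} {L : ℝ} (hp : IsSubgrad u x p) (hq : IsSubgrad u y q)
    (hpL : ‖p‖ ≤ L) (hqL : ‖q‖ ≤ L) : |u x - u y| ≤ L * ‖x - y‖ := by
  have h1 := hp y
  have h2 := hq x
  have h3 := abs_le.1 (abs_real_inner_le_norm p (y - x))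
  have h4 := abs_le.1 (abs_real_inner_le_norm q (x - y))
  have e : ‖y - x‖ = ‖x - y‖ := norm_sub_rev _ _
  rw [e] at h3
  have h5 := mul_le_mul_of_nonneg_right hpL (norm_nonneg (x - y))
  have h6 := mul_le_mul_of_nonneg_right hqL (norm_nonneg (x - y))
  rw [abs_le]; constructor <;> linarith [h3.1, h3.2, h4.1, h4.2]

/-- Minimizing `u - ⟪p, ·⟫` locally at `y` makes `p` a subgradient at `y`. -/
lemma isSubgrad_of_isLocalMin (h : ConvexOn ℝ univ u) {y p : E m}
    (hy : IsLocalMin (fun z => u z - ⟪p, z⟫) y) : IsSubgrad u y p := by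
  have hc : ConvexOn ℝ univ (fun z => u z - ⟪p, z⟫) := by
    have hl : ConcaveOn ℝ univ (fun z : E m => ⟪p, z⟫) := by
      refine ⟨convex_univ, fun a _ b _ s t _ _ _ => ?_⟩
      simp [inner_add_right, inner_smul_right]
    exact h.sub hl
  intro z
  have : u y - ⟪p, y⟫ ≤ u z - ⟪p, z⟫ := IsMinOn.of_isLocalMin_of_convex_univ hy hc z
  rw [inner_sub_right]; linarith

lemma IsGrad.continuous (h : IsGrad u g) : Continuous g := by
  rw [continuous_iff_continuousAt]
  intro x
  have hu := h.continuous_fun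
  obtain ⟨M, hM⟩ := ((isCompact_closedBall x 2).image hu).bddAbove
  have hM' : ∀ y, ‖y - x‖ ≤ 2 → u y ≤ M := fun y hy =>
    hM ⟨y, by simpa [dist_eq_norm] using hy, rfl⟩
  obtain ⟨M', hM''⟩ := ((isCompact_closedBall x 2).image hu).bddBelow
  have hbd : ∀ᶠ y in 𝓝 x, g y ∈ Metric.closedBall (0 : E m) (M - M') := by
    filter_upwards [Metric.ball_mem_nhds x one_pos] with y hy
    have hy' : ‖y - x‖ < 1 := by simpa [dist_eq_norm] using hy
    have := (h.sub y).norm_le (r := 1) (M := M) one_pos (fun z hz => hM' z (by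
      calc ‖z - x‖ = ‖(z - y) + (y - x)‖ := by congr 1; abel
        _ ≤ ‖z - y‖ + ‖y - x‖ := norm_add_le _ _
        _ ≤ 2 := by linarith))
    have h2 : M' ≤ u y := hM'' ⟨y, by simp [dist_eq_norm]; linarith, rfl⟩
    simp only [mem_closedBall_zero_iff]; linarith
  rw [ContinuousAt, tendsto_iff_ultrafilter]
  intro l hl
  have hlb : (l.map g : Filter (E m)) ≤ 𝓟 (Metric.closedBall (0 : E m) (M - M')) := by
    rw [le_principal_iff]; exact hl hbd
  obtain ⟨p, -, hp⟩ := (isCompact_closedBall (0 : E m) (M - M')).ultrafilter_le_nhds _ hlb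
  have hp' : Tendsto g l (𝓝 p) := hp
  have : p = g x := by
    apply h.uniq
    intro z
    have h1 : Tendsto (fun y => u y + ⟪g y, z - y⟫) l (𝓝 (u x + ⟪p, z - x⟫)) := by
      refine ((hu.tendsto x).mono_left hl).add ?_
      exact hp'.inner ((tendsto_const_nhds.sub tendsto_id).mono_left hl)
    exact le_of_tendsto h1 (Eventually.of_forall fun y => h.sub y z)
  rw [← this]; exact hp'

/-- A continuous selection of subgradients is the gradient map. -/
lemma isGrad_of_continuous (h : ∀ x, IsSubgrad u x (g x)) (hg : Continuous g) : IsGrad u g := by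
  refine ⟨h, fun x p hp => ?_⟩
  have key : ∀ d : E m, 0 ≤ ⟪g x - p, d⟫ := by
    intro d
    have h1 : Tendsto (fun t : ℝ => ⟪g (x + t • d) - p, d⟫) (𝓝[>] 0) (𝓝 ⟪g x - p, d⟫) := by
      have : Continuous (fun t : ℝ => ⟪g (x + t • d) - p, d⟫) := by fun_prop
      have := this.tendsto 0
      simp only [zero_smul, add_zero] at this
      exact this.mono_left nhdsWithin_le_nhds
    refine ge_of_tendsto h1 ?_
    filter_upwards [self_mem_nhdsWithin] with t ht
    have := (h (x + t • d)).monotone hp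
    rw [add_sub_cancel_left, inner_smul_right] at this
    exact nonneg_of_mul_nonneg_right this ht
  have h2 := key (-(g x - p))
  rw [inner_neg_right, real_inner_self_eq_norm_sq] at h2
  have h3 : ‖g x - p‖ = 0 := by nlinarith [norm_nonneg (g x - p)]
  exact (sub_eq_zero.1 (norm_eq_zero.1 h3)).symm

lemma IsGrad.exc_nonneg (h : IsGrad u g) (x z : E m) : 0 ≤ exc u g x z := by
  have := h.sub x (x + z)
  rw [add_sub_cancel_left] at this
  unfold exc; linarith

lemma exc_zero (x : E m) : exc u g x 0 = 0 := by simp [exc]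

/-- Subtracting the tangent plane at `x` and translating `x` to the origin. -/
lemma IsGrad.exc (h : IsGrad u g) (x : E m) : IsGrad (exc u g x) (fun z => g (x + z) - g x) := by
  constructor
  · intro z w
    have := h.sub (x + z) (x + w)
    have e : x + w - (x + z) = w - z := by abel
    rw [e] at this
    simp only [LpAffine.exc, inner_sub_left, inner_sub_right] at *
    linarith
  · intro z p hp
    have : IsSubgrad u (x + z) (p + g x) := by
      intro w
      have h1 := hp (w - x)
      simp only [LpAffine.exc, add_sub_cancel] at h1
      have e : w - (x + z) = w - x - z := by abel
      rw [e, inner_add_left]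
      simp only [inner_sub_right] at *
      linarith
    have := h.uniq _ _ this
    rw [← this]; abel

/-- Composition with an affine isomorphism and scaling. -/
lemma IsGrad.comp_linear (h : IsGrad u g) (A : E m ≃L[ℝ] E m) {c : ℝ} (hc : 0 < c) :
    IsGrad (fun z => c * u (A z)) (fun z => c • (A : E m →L[ℝ] E m).adjoint (g (A z))) := by
  constructor
  · intro z w
    have := h.sub (A z) (A w)
    rw [inner_smul_left, ContinuousLinearMap.adjoint_inner_left]
    simp only [ContinuousLinearEquiv.coe_coe, map_sub, RCLike.conj_to_real] at *
    nlinarith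
  · intro z p hp
    have : IsSubgrad u (A z) (c⁻¹ • (A.symm : E m →L[ℝ] E m).adjoint p) := by
      intro w
      have h1 := hp (A.symm w)
      rw [inner_smul_left, ContinuousLinearMap.adjoint_inner_left]
      simp only [ContinuousLinearEquiv.coe_coe, map_sub, RCLike.conj_to_real,
        ContinuousLinearEquiv.symm_apply_apply, ContinuousLinearEquiv.apply_symm_apply] at *
      have h2 := mul_le_mul_of_nonneg_left h1 (inv_nonneg.2 hc.le)
      rw [mul_add, ← mul_assoc, ← mul_assoc, inv_mul_cancel₀ hc.ne', one_mul, one_mul] at h2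
      exact h2
    have h2 := h.uniq _ _ this
    rw [← h2, map_smul, smul_smul, mul_inv_cancel₀ hc.ne', one_smul]
    refine ext_inner_left ℝ fun v => ?_
    rw [ContinuousLinearMap.adjoint_inner_right, ContinuousLinearMap.adjoint_inner_right]
    simp

end Subgradients

/-- The Monge–Ampère measure of `u` (gradient `g`) has density between `a` and `b` on `U`. -/
def MABetween {m : ℕ} (g : E m → E m) (U : Set (E m)) (a b : ℝ) : Prop :=
  ∀ F, IsCompact F → F ⊆ U →
    ENNReal.ofReal a * volume F ≤ volume (g '' F) ∧ volume (g '' F) ≤ ENNReal.ofReal b * volume F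

lemma MABetween.mono {m : ℕ} {g : E m → E m} {U V : Set (E m)} {a b : ℝ}
    (h : MABetween g U a b) (hV : V ⊆ U) : MABetween g V a b :=
  fun F hF hFV => h F hF (hFV.trans hV)

lemma MABetween.exc {m : ℕ} {g : E m → E m} {U : Set (E m)} {a b : ℝ}
    (h : MABetween g U a b) (x : E m) :
    MABetween (fun z => g (x + z) - g x) ((fun z => x + z) ⁻¹' U) a b := by
  intro F hF hFU
  have e : (fun z => g (x + z) - g x) '' F = (fun p => p + (-g x)) '' (g '' ((fun z => x + z) '' F)) := by
    rw [image_image, image_image]; simp [sub_eq_add_neg]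
  have h2 : volume ((fun z => x + z) '' F) = volume F := by
    simp
  rw [e, Set.image_add_right, measure_preimage_add_right, ← h2]
  exact h _ (hF.image (by fun_prop)) (image_subset_iff.2 hFU)

lemma det_adjoint_eq {m : ℕ} (A : E m →L[ℝ] E m) : A.adjoint.det = A.det := by
  have b := EuclideanSpace.basisFun (Fin m) ℝ
  have h := LinearMap.toMatrix_adjoint b b (A : E m →ₗ[ℝ] E m)
  have h2 : (LinearMap.adjoint (A : E m →ₗ[ℝ] E m)).det = (A : E m →ₗ[ℝ] E m).det := by
    rw [← LinearMap.det_toMatrix b.toBasis, h, Matrix.det_conjTranspose, LinearMap.det_toMatrix]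
    simp
  exact h2

open Pointwise in
lemma MABetween.comp_linear {m : ℕ} {g : E m → E m} {U : Set (E m)} {a b : ℝ} 
    (h : MABetween g U a b) (A : E m ≃L[ℝ] E m) {c : ℝ} (hc : 0 < c) :
    MABetween (fun z => c • (A : E m →L[ℝ] E m).adjoint (g (A z))) (A ⁻¹' U)
      (a * (c ^ m * (A : E m →L[ℝ] E m).det ^ 2)) (b * (c ^ m * (A : E m →L[ℝ] E m).det ^ 2)) := by
  intro F hF hFU
  set d := (A : E m →L[ℝ] E m).det with hd
  have e : (fun z => c • (A : E m →L[ℝ] E m).adjoint (g (A z))) '' F =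
      c • ((A : E m →L[ℝ] E m).adjoint '' (g '' (A '' F))) := by
    simp only [← image_smul, image_image]
  have h1 : volume ((fun z => c • (A : E m →L[ℝ] E m).adjoint (g (A z))) '' F) =
      ENNReal.ofReal (c ^ m * |d|) * volume (g '' (A '' F)) := by
    rw [e, Measure.addHaar_smul, Measure.addHaar_image_continuousLinearMap,
      ENNReal.ofReal_mul (pow_nonneg hc.le m), mul_assoc]
    have := det_adjoint_eq (A : E m →L[ℝ] E m)
    unfold ContinuousLinearMap.det at this hd
    rw [this, hd]
    simp [abs_of_pos hc]
  have h2 : volume (A '' F) = ENNReal.ofReal |d| * volume F :=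
    Measure.addHaar_image_continuousLinearMap volume (A : E m →L[ℝ] E m) F
  have h3 := h (A '' F) (hF.image A.continuous) (image_subset_iff.2 hFU)
  have key : ∀ t : ℝ, ENNReal.ofReal (t * (c ^ m * d ^ 2)) * volume F =
      ENNReal.ofReal (c ^ m * |d|) * (ENNReal.ofReal t * volume (A '' F)) := by
    intro t
    have e1 : t * (c ^ m * d ^ 2) = c ^ m * |d| * (|d| * t) := by rw [← sq_abs d]; ring
    rw [h2, e1, ENNReal.ofReal_mul (mul_nonneg (pow_nonneg hc.le m) (abs_nonneg d)),
      ENNReal.ofReal_mul (abs_nonneg d)]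
    ring
  rw [h1, key, key]
  exact ⟨mul_le_mul_right h3.1 _, mul_le_mul_right h3.2 _⟩

section Sections

variable {m : ℕ} {u : E m → ℝ} {g : E m → E m}

lemma volume_box (l r : ℝ) :
    volume {z : E m | ∀ i, z i ∈ Icc l r} = ENNReal.ofReal (r - l) ^ m := by
  have h := (PiLp.volume_preserving_ofLp (Fin m)).measure_preimage
    (s := Icc (fun _ => l) (fun _ => r)) measurableSet_Icc.nullMeasurableSet
  rw [Real.volume_Icc_pi] at h
  simp only [Finset.prod_const, Finset.card_univ, Fintype.card_fin] at h
  rw [← h]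
  congr 1
  ext z
  simp [Pi.le_def, forall_and]

lemma isCompact_box (l r : ℝ) : IsCompact {z : E m | ∀ i, z i ∈ Icc l r} := by
  have h : {z : E m | ∀ i, z i ∈ Icc l r} =
      (WithLp.toLp 2) '' (Set.pi univ fun _ : Fin m => Icc l r) := by
    ext z
    simp only [mem_ofPred_eq, mem_image, mem_univ_pi]
    exact ⟨fun h => ⟨z.ofLp, h, rfl⟩, by rintro ⟨w, hw, rfl⟩; exact hw⟩
  rw [h]
  exact (isCompact_univ_pi fun _ => isCompact_Icc).image (PiLp.continuous_toLp 2 _)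

/-- The continuous linear map with matrix `M`. -/
def matCLM (M : Matrix (Fin m) (Fin m) ℝ) : E m →L[ℝ] E m := Matrix.toEuclideanCLM (𝕜 := ℝ) M

lemma matCLM_apply (M : Matrix (Fin m) (Fin m) ℝ) (z : E m) (i : Fin m) :
    matCLM M z i = (M.mulVec z.ofLp) i := rfl

lemma det_matCLM (M : Matrix (Fin m) (Fin m) ℝ) : (matCLM M).det = M.det := by
  have : (matCLM M : E m →ₗ[ℝ] E m) =
      Matrix.toLin (EuclideanSpace.basisFun (Fin m) ℝ).toBasis
        (EuclideanSpace.basisFun (Fin m) ℝ).toBasis M := by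
    rw [← Matrix.toEuclideanLin_eq_toLin_orthonormal]; rfl
  unfold ContinuousLinearMap.det
  rw [this, LinearMap.det_toLin]

lemma volume_image_box (M : Matrix (Fin m) (Fin m) ℝ) {r : ℝ} (hr : 0 ≤ r) :
    volume (matCLM M '' {z : E m | ∀ i, z i ∈ Icc 0 r}) = ENNReal.ofReal (|M.det| * r ^ m) := by
  rw [Measure.addHaar_image_continuousLinearMap, volume_box, ← ContinuousLinearMap.det, det_matCLM,
    ENNReal.ofReal_mul (abs_nonneg _), ENNReal.ofReal_pow hr, sub_zero]

lemma inner_eq_sum (x y : E m) : ⟪x, y⟫ = ∑ i, x i * y i := by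
  rw [PiLp.inner_apply]
  exact Finset.sum_congr rfl fun i _ => by simp [mul_comm]

/-- Slopes that keep the touching point off the boundary of a section belong to the gradient
image of the section. -/
lemma IsGrad.mem_image_of_lt (h : IsGrad u g) {t : ℝ} {x p : E m}
    (hF : IsCompact {z | u z ≤ t}) (hx : u x ≤ t)
    (hp : ∀ z, u z ≤ t → u x + ⟪p, z - x⟫ < t) : p ∈ g '' {z | u z ≤ t} := by
  have hc := h.continuous_fun
  obtain ⟨y, hy, hmin⟩ := hF.exists_isMinOn ⟨x, hx⟩
    (f := fun z => u z - ⟪p, z⟫) (by fun_prop)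
  have h1 : u y - ⟪p, y⟫ ≤ u x - ⟪p, x⟫ := hmin hx
  have h2 := hp y hy
  rw [inner_sub_right] at h2
  have hlt : u y < t := by linarith
  refine ⟨y, hy, (h.uniq y p ?_).symm⟩
  refine isSubgrad_of_isLocalMin h.convexOn ?_
  filter_upwards [(isOpen_lt hc continuous_const).mem_nhds hlt] with z hz
  exact hmin (le_of_lt hz)

lemma section_ma_upper (h : IsGrad u g) (hm : 0 < m) {t a b : ℝ} (ht : 0 < t)
    (h0 : u 0 = 0)
    (he : ∀ i, u (EuclideanSpace.single i 1) ≤ t) (hpos : ∀ z, 0 ≤ u z)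
    (hMA : MABetween g {z | u z ≤ t} a b) : a ≤ (4 * m * (4 * m + 2)) ^ m * t ^ m := by
  have hm' : (0 : ℝ) < m := by exact_mod_cast hm
  have hconv := h.convexOn
  have hsimp : ∀ y : E m, (∀ i, 0 ≤ y i) → ∑ i, y i ≤ 1 → u y ≤ t := by
    intro y hy hs
    have hS : Convex ℝ {z ∈ univ | u z ≤ t} := hconv.convex_le t
    have e : y = ∑ i, y i • EuclideanSpace.single i (1 : ℝ) + (1 - ∑ i, y i) • (0 : E m) := by
      ext j; simp [Finset.sum_apply, Pi.single_apply]
    have h2 := hS.sum_mem (t := (Finset.univ : Finset (Option (Fin m))))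
      (w := fun o => o.elim (1 - ∑ i, y i) (fun i => y i))
      (z := fun o => o.elim (0 : E m) (fun i => EuclideanSpace.single i (1 : ℝ)))
      (by rintro (_ | i) _ <;> simp [hs, hy]) (by rw [Fintype.sum_option]; simp)
      (by rintro (_ | i) _ <;> simp [h0, ht.le, he])
    rw [Fintype.sum_option] at h2
    simp only [Option.elim] at h2
    rw [add_comm, ← e] at h2
    exact h2.2
  set Q : Set (E m) := {z | ∀ i, z i ∈ Icc (1 / (4 * m) : ℝ) (1 / (2 * m))} with hQ
  have hQ0 : ∀ y ∈ Q, ∀ i, 0 < y i := fun y hy i => lt_of_lt_of_le (by positivity) (hy i).1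
  have hQs : ∀ y ∈ Q, ∑ i, y i ≤ 1 / 2 := by
    intro y hy
    calc ∑ i, y i ≤ ∑ _i : Fin m, 1 / (2 * m : ℝ) := Finset.sum_le_sum fun i _ => (hy i).2
      _ = 1 / 2 := by simp; field_simp
  have hQF : Q ⊆ {z | u z ≤ t} := fun y hy =>
    hsimp y (fun i => (hQ0 y hy i).le) ((hQs y hy).trans (by norm_num))
  have himg : g '' Q ⊆ {z | ∀ i, z i ∈ Icc (-(4 * m * t)) (2 * t)} := by
    rintro _ ⟨y, hy, rfl⟩ i
    have hs := h.sub y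
    constructor
    · have h1 := hs (y + (-y i) • EuclideanSpace.single i (1 : ℝ))
      have h2 := hsimp (y + (-y i) • EuclideanSpace.single i (1 : ℝ)) (fun j => by
        rcases eq_or_ne j i with rfl | hj
        · simp
        · simp [hj, (hQ0 y hy j).le]) (by
        have : ∑ j, (y + (-y i) • EuclideanSpace.single i (1 : ℝ)) j = ∑ j, y j - y i := by
          simp [Finset.sum_add_distrib]; ring
        rw [this]; linarith [hQs y hy, hQ0 y hy i])
      rw [add_sub_cancel_left, inner_smul_right] at h1
      simp only [EuclideanSpace.inner_single_right, one_mul, conj_trivial] at h1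
      have h3 := hpos y
      have h4 : -y i * g y i ≤ t := by linarith
      by_contra hcon
      push Not at hcon
      have h5 := (hy i).1
      have h6 : 1 / (4 * m : ℝ) * (4 * m * t) = t := by field_simp
      have h7 : 1 / (4 * m : ℝ) * (4 * m * t) < y i * (-g y i) :=
        mul_lt_mul' h5 (by linarith) (by positivity) (hQ0 y hy i)
      linarith
    · have h1 := hs (y + (1 / 2 : ℝ) • EuclideanSpace.single i (1 : ℝ))
      have h2 := hsimp (y + (1 / 2 : ℝ) • EuclideanSpace.single i (1 : ℝ)) (fun j => by
        rcases eq_or_ne j i with rfl | hj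
        · simp; linarith [hQ0 y hy j]
        · simp [hj, (hQ0 y hy j).le]) (by
        have : ∑ j, (y + (1 / 2 : ℝ) • EuclideanSpace.single i (1 : ℝ)) j = ∑ j, y j + 1 / 2 := by
          simp [Finset.sum_add_distrib]
        rw [this]; linarith [hQs y hy])
      rw [add_sub_cancel_left, inner_smul_right] at h1
      simp only [EuclideanSpace.inner_single_right, one_mul, conj_trivial] at h1
      have h3 := hpos y
      linarith
  have h1 := ((hMA Q (isCompact_box _ _) hQF).1).trans (measure_mono himg)
  rw [hQ, volume_box, volume_box, ← ENNReal.ofReal_pow (by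
    rw [sub_nonneg]; exact one_div_le_one_div_of_le (by positivity) (by linarith)),
    ← ENNReal.ofReal_mul' (by
      apply pow_nonneg; rw [sub_nonneg]
      exact one_div_le_one_div_of_le (by positivity) (by linarith)),
    ← ENNReal.ofReal_pow (by nlinarith [mul_pos hm' ht]),
    ENNReal.ofReal_le_ofReal_iff (by apply pow_nonneg; nlinarith [mul_pos hm' ht])] at h1
  have e1 : (1 / (2 * m) - 1 / (4 * m) : ℝ) = (4 * m : ℝ)⁻¹ := by field_simp; norm_num
  rw [e1, inv_pow, ← div_eq_mul_inv, div_le_iff₀ (by positivity)] at h1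
  calc a ≤ _ := h1
    _ = _ := by rw [← mul_pow, ← mul_pow]; congr 1; ring

lemma section_position (h : IsGrad u g) (hm : 0 < m) {t a b : ℝ} (hb : 0 ≤ b)
    (hF : IsCompact {z | u z ≤ t})
    (hbox : ∀ z, u z ≤ t → ∀ i, |z i| ≤ 1)
    (hMA : MABetween g {z | u z ≤ t} a b) {x θ : E m} {s : ℝ} (hx : u x ≤ t) (hs : 0 < s)
    (hθ : ∀ z, u z ≤ t → ⟪θ, z⟫ ≤ ⟪θ, x⟫ + s) {z' : E m} (hz' : u z' ≤ t) :
    (t - u x) ^ m * |⟪θ, z'⟫| ≤ 2 * m * 2 ^ m * (4 * m) ^ m * b * s := by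
  have hm' : (1 : ℝ) ≤ m := by exact_mod_cast hm
  rcases hx.eq_or_lt with hx' | hx'
  · rw [hx', sub_self, zero_pow hm.ne', zero_mul]; positivity
  set d := t - u x with hd
  have hd0 : 0 < d := by rw [hd]; linarith
  obtain ⟨i, -, hi⟩ := Finset.exists_max_image (Finset.univ : Finset (Fin m)) (fun i => |θ i|)
    ⟨⟨0, hm⟩, Finset.mem_univ _⟩
  have hθz : |⟪θ, z'⟫| ≤ m * |θ i| := by
    rw [inner_eq_sum]
    calc |∑ j, θ j * z' j| ≤ ∑ j, |θ j * z' j| := Finset.abs_sum_le_sum_abs _ _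
      _ ≤ ∑ _j : Fin m, |θ i| := Finset.sum_le_sum fun j _ => by
          rw [abs_mul]
          calc |θ j| * |z' j| ≤ |θ i| * 1 :=
                mul_le_mul (hi j (Finset.mem_univ _)) (hbox z' hz' j) (abs_nonneg _) (abs_nonneg _)
            _ = |θ i| := mul_one _
      _ = m * |θ i| := by simp
  set M : Matrix (Fin m) (Fin m) ℝ := (1 : Matrix (Fin m) (Fin m) ℝ).updateCol i
    (fun j => (2 * m / s) * θ j) with hM
  have hdet : M.det = 2 * m / s * θ i := by
    rw [hM, ← Matrix.cramer_apply, Matrix.cramer_one]; rfl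
  have happ : ∀ τ : E m, matCLM M τ = τ + τ i • ((2 * m / s) • θ - EuclideanSpace.single i 1) := by
    intro τ
    ext j
    rw [matCLM_apply, Matrix.mulVec, dotProduct, ← Finset.add_sum_erase _ _ (Finset.mem_univ i)]
    have : ∑ k ∈ Finset.univ.erase i, M j k * τ.ofLp k =
        ∑ k ∈ Finset.univ.erase i, (if j = k then τ.ofLp k else 0) := by
      refine Finset.sum_congr rfl fun k hk => ?_
      rw [hM, Matrix.updateCol_ne (Finset.ne_of_mem_erase hk), Matrix.one_apply]
      split_ifs <;> simp
    rw [this, Finset.sum_ite_eq, hM, Matrix.updateCol_self]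
    rcases eq_or_ne j i with rfl | hj
    · simp; ring
    · simp [hj]; ring
  have hsub : matCLM M '' {z : E m | ∀ i, z i ∈ Icc 0 (d / (4 * m))} ⊆ g '' {z | u z ≤ t} := by
    rintro _ ⟨τ, hτ, rfl⟩
    refine h.mem_image_of_lt hF hx fun z hz => ?_
    have e : ⟪matCLM M τ, z - x⟫ = ∑ j ∈ Finset.univ.erase i, τ j * (z j - x j) +
        τ i * (2 * m / s) * ⟪θ, z - x⟫ := by
      rw [happ, inner_add_left, inner_smul_left, inner_sub_left, inner_smul_left, inner_eq_sum τ,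
        ← Finset.add_sum_erase _ _ (Finset.mem_univ i), EuclideanSpace.inner_single_left]
      simp; ring
    have h1 : ∑ j ∈ Finset.univ.erase i, τ j * (z j - x j) ≤
        ∑ j ∈ (Finset.univ.erase i : Finset (Fin m)), d / (4 * m) * 2 := by
      refine Finset.sum_le_sum fun j _ => ?_
      have a1 := abs_le.1 (hbox z hz j)
      have a2 := abs_le.1 (hbox x hx j)
      have a3 := hτ j
      calc τ j * (z j - x j) ≤ τ j * 2 := mul_le_mul_of_nonneg_left (by linarith) a3.1
        _ ≤ _ := mul_le_mul_of_nonneg_right a3.2 (by norm_num)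
    rw [Finset.sum_const, Finset.card_erase_of_mem (Finset.mem_univ i), Finset.card_univ,
      Fintype.card_fin, nsmul_eq_mul, Nat.cast_sub hm, Nat.cast_one] at h1
    have h2 : τ i * (2 * m / s) * ⟪θ, z - x⟫ ≤ d / 2 := by
      have a3 := hτ i
      have a4 : ⟪θ, z - x⟫ ≤ s := by rw [inner_sub_right]; linarith [hθ z hz]
      calc τ i * (2 * m / s) * ⟪θ, z - x⟫ ≤ τ i * (2 * m / s) * s :=
            mul_le_mul_of_nonneg_left a4 (mul_nonneg a3.1 (by positivity))
        _ = τ i * (2 * m) := by field_simp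
        _ ≤ d / (4 * m) * (2 * m) := mul_le_mul_of_nonneg_right a3.2 (by positivity)
        _ = d / 2 := by field_simp; norm_num
    have h3 : ((m : ℝ) - 1) * (d / (4 * m) * 2) < d / 2 := by
      have : ((m : ℝ) - 1) * (d / (4 * m) * 2) = d / 2 - d / (2 * m) := by field_simp; ring
      have h4 : 0 < d / (2 * m) := by positivity
      linarith
    rw [e]; linarith
  have hvolF : volume {z | u z ≤ t} ≤ ENNReal.ofReal (2 ^ m) := by
    refine (measure_mono (t := {z : E m | ∀ i, z i ∈ Icc (-1) 1}) fun z hz i =>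
      abs_le.1 (hbox z hz i)).trans ?_
    rw [volume_box, ← ENNReal.ofReal_pow (by norm_num)]; norm_num
  have h1 := (measure_mono hsub).trans ((hMA _ hF subset_rfl).2)
  rw [volume_image_box M (by positivity)] at h1
  have h2 := h1.trans (mul_le_mul_right hvolF _)
  rw [← ENNReal.ofReal_mul hb, ENNReal.ofReal_le_ofReal_iff (by positivity), hdet, abs_mul,
    abs_of_pos (by positivity : 0 < 2 * m / s), div_pow] at h2
  have h3 : |θ i| * d ^ m * (2 * m) ≤ b * 2 ^ m * (4 * m) ^ m * s := by
    have h5 : (0 : ℝ) < (4 * m) ^ m := by positivity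
    have : 2 * m / s * |θ i| * (d ^ m / (4 * m) ^ m) = |θ i| * d ^ m * (2 * m) / ((4 * m) ^ m * s) := by
      field_simp
    rw [this, div_le_iff₀ (by positivity)] at h2
    linarith
  have hdm : 0 ≤ d ^ m := by positivity
  have h4 := mul_le_mul_of_nonneg_left hθz hdm
  have h6 : 0 ≤ b * 2 ^ m * (4 * m) ^ m * s := by positivity
  nlinarith [mul_nonneg (sub_nonneg.2 hm') h6]

/-- Constant in the position lemma. -/
def posConst (m : ℕ) : ℝ := max ((4 * m * (4 * m + 2) : ℝ) ^ m) (2 * m * 2 ^ m * (4 * m) ^ m) + 1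

lemma one_le_posConst (m : ℕ) : 1 ≤ posConst m := by
  unfold posConst
  have : (0:ℝ) ≤ (4 * m * (4 * m + 2)) ^ m := by positivity
  linarith [le_max_left ((4 * m * (4 * m + 2) : ℝ) ^ m) (2 * m * 2 ^ m * (4 * m) ^ m)]

/-- A compact section admits a linear change of coordinates putting it in the unit cube while
containing the coordinate vectors. -/
lemma exists_normalization {F : Set (E m)} (hF : IsCompact F) (h0 : F ∈ 𝓝 (0 : E m)) :
    ∃ W : E m ≃L[ℝ] E m, (∀ i, W (EuclideanSpace.single i 1) ∈ F) ∧
      ∀ z ∈ F, ∀ i, |W.symm z i| ≤ 1 := by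
  set D : (Fin m → E m) → ℝ := fun v => (Matrix.of fun j i => v i j).det with hD
  have hDc : Continuous D := by
    refine Continuous.matrix_det ?_
    refine continuous_matrix fun i j => ?_
    simp only [Matrix.of_apply]; fun_prop
  have hcpt : IsCompact (Set.pi univ fun _ : Fin m => F) := isCompact_univ_pi fun _ => hF
  obtain ⟨r, hr, hrF⟩ := Metric.nhds_basis_closedBall.mem_iff.1 h0
  have hne : (fun i => r • EuclideanSpace.single i 1 : Fin m → E m) ∈ Set.pi univ fun _ : Fin m => F := by
    intro i _
    apply hrF
    simp [norm_smul, abs_of_pos hr]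
  obtain ⟨v, hvF, hv⟩ := hcpt.exists_isMaxOn ⟨_, hne⟩ (f := fun v => |D v|)
    (hDc.abs.continuousOn)
  have hDv : D v ≠ 0 := by
    have h1 := hv hne
    have : D (fun i => r • EuclideanSpace.single i 1) = r ^ m := by
      have : (Matrix.of fun j i => (r • EuclideanSpace.single i 1 : E m) j) =
          r • (1 : Matrix (Fin m) (Fin m) ℝ) := by
        ext j i; simp [Matrix.one_apply]
      simp only [hD]
      rw [this, Matrix.det_smul]; simp
    simp only [mem_ofPred_eq] at h1
    rw [this] at h1
    intro h2
    rw [h2] at h1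
    simp only [abs_zero] at h1
    have : 0 < |r ^ m| := by positivity
    linarith
  set M : Matrix (Fin m) (Fin m) ℝ := Matrix.of fun j i => v i j with hM
  have hdet : (matCLM M).det ≠ 0 := by rw [det_matCLM]; exact hDv
  set W := (matCLM M).toContinuousLinearEquivOfDetNeZero hdet with hW
  have hWapp : ∀ z, W z = matCLM M z := fun z => rfl
  refine ⟨W, fun i => ?_, fun z hz i => ?_⟩
  · have : W (EuclideanSpace.single i 1) = v i := by
      rw [hWapp]; ext j; rw [matCLM_apply]; simp [hM]
    rw [this]; exact hvF i (mem_univ _)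
  · have hWz : W.symm z = (D v)⁻¹ • WithLp.toLp 2 (M.cramer z.ofLp) := by
      rw [ContinuousLinearEquiv.symm_apply_eq, map_smul, hWapp]
      ext j
      have := congrFun (Matrix.mulVec_cramer M z.ofLp) j
      rw [PiLp.smul_apply, matCLM_apply, this]
      have hdd : M.det = D v := rfl
      simp [hdd, hDv]
    rw [hWz]
    have h1 : (M.cramer z.ofLp) i = D (Function.update v i z) := by
      rw [Matrix.cramer_apply]
      simp only [hD]
      congr 1
      ext j k
      rcases eq_or_ne k i with rfl | hk
      · simp
      · simp [hk, hM]
    have h2 : |D (Function.update v i z)| ≤ |D v| := by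
      apply hv
      intro k _
      rcases eq_or_ne k i with rfl | hk
      · simpa using hz
      · simpa [hk] using hvF k (mem_univ _)
    rw [PiLp.smul_apply, smul_eq_mul, abs_mul, abs_inv]
    simp only [h1]
    rw [inv_mul_le_iff₀ (abs_pos.2 hDv), mul_one]; exact h2

/-- Normalization and position of points in a section. -/
lemma exists_section_position (h : IsGrad u g) (hm : 0 < m) {t a b : ℝ} (ha : 0 < a) (hb : 0 ≤ b)
    (ht : 0 < t) (hF : IsCompact {z | u z ≤ t}) (h0 : u 0 = 0) (hpos : ∀ z, 0 ≤ u z)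
    (hMA : MABetween g {z | u z ≤ t} a b) :
    (∃ W : E m ≃L[ℝ] E m, (∀ i, u (W (EuclideanSpace.single i 1)) ≤ t) ∧
      (∀ z, u z ≤ t → ∀ i, |W.symm z i| ≤ 1) ∧
      a * (W : E m →L[ℝ] E m).det ^ 2 ≤ posConst m * t ^ m ∧
      t ^ m ≤ posConst m * b * (W : E m →L[ℝ] E m).det ^ 2) ∧
    ∀ (x θ : E m) (s : ℝ), u x ≤ t → 0 < s → (∀ z, u z ≤ t → ⟪θ, z⟫ ≤ ⟪θ, x⟫ + s) →
      ∀ z', u z' ≤ t → a * (t - u x) ^ m * |⟪θ, z'⟫| ≤ posConst m ^ 2 * b * t ^ m * s := by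
  obtain ⟨W, hW1, hW2⟩ := exists_normalization hF
    ((isOpen_lt h.continuous_fun continuous_const).mem_nhds (by
      simpa [h0] using ht : (0 : E m) ∈ {z | u z < t}) |> fun hh => mem_of_superset hh
        fun z (hz : u z < t) => hz.le)
  set d2 := (W : E m →L[ℝ] E m).det ^ 2 with hd2
  have hd2' : 0 ≤ d2 := sq_nonneg _
  have h' := h.comp_linear W one_pos
  have hMA' := hMA.comp_linear W one_pos
  simp only [one_pow, one_mul, one_smul] at h' hMA'
  have hF' : IsCompact {z | u (W z) ≤ t} := by
    have : {z | u (W z) ≤ t} = W.symm '' {z | u z ≤ t} := by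
      rw [W.symm.image_eq_preimage_symm]; rfl
    rw [this]; exact hF.image W.symm.continuous
  have h0' : u (W 0) = 0 := by simpa using h0
  have hbox : ∀ z, u (W z) ≤ t → ∀ i, |z i| ≤ 1 := fun z hz i => by
    simpa using hW2 (W z) hz i
  have hA := section_ma_upper h' hm ht h0' hW1 (fun z => hpos _) hMA'
  have hC1 : (4 * m * (4 * m + 2) : ℝ) ^ m ≤ posConst m :=
    (le_max_left _ _).trans (by unfold posConst; linarith)
  have hC2 : (2 * m * 2 ^ m * (4 * m) ^ m : ℝ) ≤ posConst m :=
    (le_max_right _ _).trans (by unfold posConst; linarith)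
  have hA' : a * d2 ≤ posConst m * t ^ m := hA.trans
    (mul_le_mul_of_nonneg_right hC1 (by positivity))
  have hP : ∀ (x θ : E m) (s : ℝ), u (W x) ≤ t → 0 < s →
      (∀ z, u (W z) ≤ t → ⟪θ, z⟫ ≤ ⟪θ, x⟫ + s) →
      ∀ z', u (W z') ≤ t → (t - u (W x)) ^ m * |⟪θ, z'⟫| ≤ posConst m * (b * d2) * s := by
    intro x θ s hx hs hθ z' hz'
    refine (section_position h' hm (mul_nonneg hb hd2') hF' hbox hMA' hx hs hθ hz').trans ?_
    have : 0 ≤ (b * d2) * s := by positivity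
    nlinarith
  refine ⟨⟨W, hW1, hW2, hA', ?_⟩, ?_⟩
  · have i : Fin m := ⟨0, hm⟩
    have := hP 0 (EuclideanSpace.single i 1) 1 (by rw [h0']; exact ht.le) one_pos (fun z hz => by
      rw [EuclideanSpace.inner_single_left, inner_zero_right]
      simpa using (abs_le.1 (hbox z hz i)).2) (EuclideanSpace.single i 1) (hW1 i)
    rw [h0', sub_zero] at this
    simpa [mul_assoc] using this
  · intro x θ s hx hs hθ z' hz'
    have key := hP (W.symm x) ((W : E m →L[ℝ] E m).adjoint θ) s (by simpa using hx) hs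
      (fun z hz => by
        rw [ContinuousLinearMap.adjoint_inner_left, ContinuousLinearMap.adjoint_inner_left]
        simpa using hθ _ hz) (W.symm z') (by simpa using hz')
    rw [ContinuousLinearMap.adjoint_inner_left] at key
    simp only [ContinuousLinearEquiv.coe_coe, ContinuousLinearEquiv.apply_symm_apply] at key
    have h1 := mul_le_mul_of_nonneg_left key ha.le
    have hp := one_le_posConst m
    have h2 : posConst m * b * s * (a * d2) ≤ posConst m * b * s * (posConst m * t ^ m) :=
      mul_le_mul_of_nonneg_left hA' (by positivity)
    nlinarith

end Sections

section Doubling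

variable {m : ℕ} {u : E m → ℝ} {g : E m → E m}

lemma exc_exc (x y z : E m) :
    exc (exc u g x) (fun w => g (x + w) - g x) y z = exc u g (x + y) z := by
  simp only [exc, inner_sub_left, inner_add_right, add_assoc]; ring

lemma exc_smul_le (h : IsGrad u g) (x z : E m) {s t : ℝ} (hs : 0 ≤ s) (hst : s ≤ t) :
    t * exc u g x (s • z) ≤ s * exc u g x (t • z) := by
  rcases hs.eq_or_lt with rfl | hs
  · simp [exc_zero]
  have ht : 0 < t := hs.trans_le hst
  have hc := (h.exc x).convexOn.2 (mem_univ (t • z)) (mem_univ 0) (div_nonneg hs.le ht.le)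
    (sub_nonneg.2 ((div_le_one ht).2 hst)) (by ring)
  rw [smul_zero, add_zero, smul_smul, div_mul_cancel₀ _ ht.ne', exc_zero, smul_zero, add_zero,
    smul_eq_mul] at hc
  calc t * exc u g x (s • z) ≤ t * (s / t * exc u g x (t • z)) := mul_le_mul_of_nonneg_left hc ht.le
    _ = _ := by field_simp

lemma exc_smul_mono (h : IsGrad u g) (x z : E m) {s t : ℝ} (hs : 0 ≤ s) (hst : s ≤ t) :
    exc u g x (s • z) ≤ exc u g x (t • z) := by
  rcases (hs.trans hst).eq_or_lt with ht | ht
  · have : s = 0 := le_antisymm (by rw [ht]; exact hst) hs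
    rw [← ht, this]
  have h1 := exc_smul_le h x z hs hst
  have h2 : s * exc u g x (t • z) ≤ t * exc u g x (t • z) :=
    mul_le_mul_of_nonneg_right hst (h.exc_nonneg x _)
  exact le_of_mul_le_mul_left (h1.trans h2) ht

/-- The dilation by which a half-height section can be enlarged. -/
def dilConst (m : ℕ) : ℝ := 1 / (8 * 2 ^ m * posConst m ^ 2)

lemma dilConst_pos (m : ℕ) : 0 < dilConst m := by
  have := one_le_posConst m
  unfold dilConst; positivity

lemma section_dilate (h : IsGrad u g) (hm : 0 < m) {t a b : ℝ} (ha : 0 < a) (hb : 0 ≤ b)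
    (hab : b ≤ 4 * a) (ht : 0 < t) (hF : IsCompact {z | u z ≤ t}) (h0 : u 0 = 0)
    (hpos : ∀ z, 0 ≤ u z) (hMA : MABetween g {z | u z ≤ t} a b) {y : E m} (hy : u y ≤ t / 2) :
    u ((1 + dilConst m) • y) ≤ t := by
  by_contra hcon
  have hlam := dilConst_pos m
  have hconv : Convex ℝ {z | u z ≤ t} := by simpa using h.convexOn.convex_le t
  obtain ⟨f, c, hf1, hf2⟩ := geometric_hahn_banach_closed_point hconv hF.isClosed
    (x := (1 + dilConst m) • y) hcon
  set θ := (InnerProductSpace.toDual ℝ (E m)).symm f with hθ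
  have hfθ : ∀ z, f z = ⟪θ, z⟫ := fun z => by rw [hθ, InnerProductSpace.toDual_symm_apply]
  rw [hfθ, inner_smul_right] at hf2
  have h00 := hf1 0 (by simpa [h0] using ht.le)
  rw [map_zero] at h00
  have hθy : 0 < ⟪θ, y⟫ := by
    by_contra hn
    push Not at hn
    nlinarith
  have key := (exists_section_position h hm ha hb ht hF h0 hpos hMA).2 y θ (dilConst m * ⟪θ, y⟫)
    (by linarith) (mul_pos hlam hθy) (fun z hz => by
      have := hf1 z hz
      rw [hfθ] at this; linarith) y (by linarith)
  rw [abs_of_pos hθy] at key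
  have h1 : (t / 2) ^ m ≤ (t - u y) ^ m := pow_le_pow_left₀ (by linarith) (by linarith) m
  have hp := one_le_posConst m
  have e : posConst m ^ 2 * b * t ^ m * (dilConst m * ⟪θ, y⟫) =
      b / 8 * ((t / 2) ^ m * ⟪θ, y⟫) := by
    unfold dilConst; rw [div_pow]; field_simp
  rw [e] at key
  have h2 : a * ((t / 2) ^ m * ⟪θ, y⟫) ≤ a * (t - u y) ^ m * ⟪θ, y⟫ := by
    rw [mul_assoc]
    exact mul_le_mul_of_nonneg_left (mul_le_mul_of_nonneg_right h1 hθy.le) ha.le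
  have h3 : 0 < (t / 2) ^ m * ⟪θ, y⟫ := by positivity
  nlinarith

/-- The balancing constant of sections. -/
def balConst (m : ℕ) : ℝ := 4 * posConst m ^ 2 + 1

lemma section_balanced (h : IsGrad u g) (hm : 0 < m) {t a b : ℝ} (ha : 0 < a) (hb : 0 ≤ b)
    (hab : b ≤ 4 * a) (ht : 0 < t) (hF : IsCompact {z | u z ≤ t}) (h0 : u 0 = 0)
    (hpos : ∀ z, 0 ≤ u z) (hMA : MABetween g {z | u z ≤ t} a b) {y : E m} (hy : u y ≤ t) :
    u (-((balConst m)⁻¹ • y)) ≤ t := by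
  by_contra hcon
  have hB : 0 < balConst m := by unfold balConst; positivity
  have hconv : Convex ℝ {z | u z ≤ t} := by simpa using h.convexOn.convex_le t
  obtain ⟨f, c, hf1, hf2⟩ := geometric_hahn_banach_closed_point hconv hF.isClosed
    (x := -((balConst m)⁻¹ • y)) hcon
  set θ := (InnerProductSpace.toDual ℝ (E m)).symm f with hθ
  have hfθ : ∀ z, f z = ⟪θ, z⟫ := fun z => by rw [hθ, InnerProductSpace.toDual_symm_apply]
  set s := f (-((balConst m)⁻¹ • y)) with hs
  have h00 := hf1 0 (by simpa [h0] using ht.le)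
  rw [map_zero] at h00
  have hs0 : 0 < s := h00.trans hf2
  have hsy : ⟪θ, y⟫ = -(balConst m * s) := by
    rw [hs, map_neg, map_smul, smul_eq_mul, hfθ]; field_simp
  have key := (exists_section_position h hm ha hb ht hF h0 hpos hMA).2 0 θ s
    (by rw [h0]; exact ht.le) hs0 (fun z hz => by
      have := hf1 z hz
      rw [hfθ] at this
      rw [inner_zero_right, zero_add]; linarith) y hy
  rw [hsy, abs_neg, abs_of_pos (by positivity), h0, sub_zero] at key
  have hq : 0 < t ^ m * s := by positivity
  have hp := one_le_posConst m
  have h1 : a * balConst m * (t ^ m * s) ≤ posConst m ^ 2 * b * (t ^ m * s) := by linarith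
  have h2 := le_of_mul_le_mul_right h1 hq
  unfold balConst at h2
  nlinarith [mul_le_mul_of_nonneg_left hab (sq_nonneg (posConst m))]

/-- The doubling constant. -/
def dblConst (m : ℕ) : ℝ := 2 ^ (⌈(dilConst m)⁻¹⌉₊)

lemma one_le_dblConst (m : ℕ) : 1 ≤ dblConst m := one_le_pow₀ (by norm_num)

lemma section_doubling (h : IsGrad u g) (hm : 0 < m) {t₁ a b : ℝ} (ha : 0 < a) (hb : 0 ≤ b)
    (hab : b ≤ 4 * a) (ht₁ : 0 < t₁) (hF : IsCompact {z | u z ≤ t₁}) (h0 : u 0 = 0)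
    (hpos : ∀ z, 0 ≤ u z) (hMA : MABetween g {z | u z ≤ t₁} a b) {y : E m}
    (hy : dblConst m * u y ≤ t₁) : u ((2 : ℝ) • y) ≤ dblConst m * u y := by
  set N := ⌈(dilConst m)⁻¹⌉₊ with hN
  have hlam := dilConst_pos m
  have hg0 : g 0 = 0 := (h.uniq 0 0 fun z => by simp [h0, hpos]).symm
  have hexc : exc u g 0 = u := by ext z; simp [exc, h0, hg0]
  have step : ∀ τ, 0 < τ → u y ≤ τ → 2 ^ N * τ ≤ t₁ → u ((2 : ℝ) • y) ≤ 2 ^ N * τ := by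
    intro τ hτ hyτ hτ1
    have ind : ∀ j ≤ N, u ((1 + dilConst m) ^ j • y) ≤ 2 ^ j * τ := by
      intro j
      induction j with
      | zero => intro _; simpa using hyτ
      | succ j ih =>
        intro hj
        have hle : (2 : ℝ) ^ (j + 1) * τ ≤ t₁ := (mul_le_mul_of_nonneg_right
          (pow_le_pow_right₀ (by norm_num) hj) hτ.le).trans hτ1
        have hsub : {z | u z ≤ 2 ^ (j + 1) * τ} ⊆ {z | u z ≤ t₁} := fun z hz => le_trans hz hle
        have := section_dilate h hm ha hb hab (t := 2 ^ (j + 1) * τ) (by positivity)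
          (hF.of_isClosed_subset (isClosed_le h.continuous_fun continuous_const) hsub) h0 hpos
          (hMA.mono hsub) (y := (1 + dilConst m) ^ j • y)
          ((ih (by omega)).trans (by rw [pow_succ]; linarith))
        rwa [smul_smul, ← pow_succ'] at this
    have h2 : (2 : ℝ) ≤ (1 + dilConst m) ^ N := by
      have h3 := one_add_mul_le_pow (by linarith : (-2 : ℝ) ≤ dilConst m) N
      have h4 : (dilConst m)⁻¹ ≤ N := Nat.le_ceil _
      have h5 : 1 ≤ N * dilConst m := by
        have := mul_le_mul_of_nonneg_right h4 hlam.le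
        rwa [inv_mul_cancel₀ hlam.ne'] at this
      linarith
    have h3 := exc_smul_mono h 0 y (by norm_num : (0 : ℝ) ≤ 2) h2
    rw [hexc] at h3
    exact h3.trans (ind N le_rfl)
  rcases (hpos y).eq_or_lt with h1 | h1
  · rw [← h1, mul_zero]
    refine le_of_forall_pos_le_add fun ε hε => ?_
    rw [zero_add]
    have h2N : (0 : ℝ) < 2 ^ N := by positivity
    have hmin : 0 < min ε t₁ := lt_min hε ht₁
    refine (step (min ε t₁ / 2 ^ N) (by positivity) (by rw [← h1]; positivity) ?_).trans ?_
    · rw [mul_div_cancel₀ _ h2N.ne']; exact min_le_right _ _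
    · rw [mul_div_cancel₀ _ h2N.ne']; exact min_le_left _ _
  · exact step (u y) h1 le_rfl hy

lemma half_growth_aux {u : E m → ℝ} (h0 : u 0 = 0) (hpos : ∀ z, 0 ≤ u z) {y p : E m} {C : ℝ}
    (hC : 0 ≤ C) (hp : IsSubgrad u ((1 / 2 : ℝ) • y) p)
    (hd : u (-((1 / 2 : ℝ) • y)) - u ((1 / 2 : ℝ) • y) + ⟪p, y⟫ ≤
      C * (u 0 - u ((1 / 2 : ℝ) • y) + ⟪p, (1 / 2 : ℝ) • y⟫)) :
    (2 * C + 1) * u ((1 / 2 : ℝ) • y) ≤ C * u y := by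
  have h1 := hp y
  have h2 := hp 0
  have e : y - (1 / 2 : ℝ) • y = (1 / 2 : ℝ) • y := by module
  rw [e, inner_smul_right] at h1
  rw [zero_sub, inner_neg_right, inner_smul_right, h0] at h2
  rw [inner_smul_right, h0] at hd
  have h3 := hpos (-((1 / 2 : ℝ) • y))
  nlinarith

/-- Every point has a subgradient whose excess is doubling with constant `C`. -/
def SubDbl (C : ℝ) (u : E m → ℝ) : Prop :=
  ∀ x, ∃ p, IsSubgrad u x p ∧ ∀ z, u (x + (2 : ℝ) • z) - u x - ⟪p, (2 : ℝ) • z⟫ ≤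
    C * (u (x + z) - u x - ⟪p, z⟫)

lemma SubDbl.half {C : ℝ} {u : E m → ℝ} (hC : 0 ≤ C) (h : SubDbl C u) {x q : E m}
    (hq : IsSubgrad u x q) (z : E m) :
    (2 * C + 1) * (u (x + (1 / 2 : ℝ) • z) - u x - ⟪q, (1 / 2 : ℝ) • z⟫) ≤
      C * (u (x + z) - u x - ⟪q, z⟫) := by
  obtain ⟨p, hp, hd⟩ := h (x + (1 / 2 : ℝ) • z)
  refine half_growth_aux (u := fun w => u (x + w) - u x - ⟪q, w⟫) (p := p - q) (by simp)
    (fun w => ?_) hC (fun w => ?_) ?_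
  · have := hq (x + w)
    rw [add_sub_cancel_left] at this
    linarith
  · have := hp (x + w)
    rw [add_sub_add_left_eq_sub] at this
    simp only [inner_sub_left, inner_sub_right] at *
    linarith
  · have := hd (-((1 / 2 : ℝ) • z))
    have e1 : x + (1 / 2 : ℝ) • z + (2 : ℝ) • -((1 / 2 : ℝ) • z) = x + -((1 / 2 : ℝ) • z) := by module
    have e2 : x + (1 / 2 : ℝ) • z + -((1 / 2 : ℝ) • z) = x := by module
    rw [e1, e2] at this
    simp only [inner_sub_left, inner_neg_right, inner_smul_right, add_zero, inner_zero_right] at *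
    nlinarith

lemma SubDbl.half_pow {C : ℝ} {u : E m → ℝ} (hC : 0 ≤ C) (h : SubDbl C u) {x q : E m}
    (hq : IsSubgrad u x q) (z : E m) (j : ℕ) :
    (2 * C + 1) ^ j * (u (x + (1 / 2 : ℝ) ^ j • z) - u x - ⟪q, (1 / 2 : ℝ) ^ j • z⟫) ≤
      C ^ j * (u (x + z) - u x - ⟪q, z⟫) := by
  induction j with
  | zero => simp
  | succ j ih =>
    have h1 := h.half hC hq ((1 / 2 : ℝ) ^ j • z)
    rw [smul_smul, ← pow_succ'] at h1
    calc _ = (2 * C + 1) ^ j * ((2 * C + 1) * (u (x + (1 / 2 : ℝ) ^ (j + 1) • z) - u x -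
          ⟪q, (1 / 2 : ℝ) ^ (j + 1) • z⟫)) := by ring
      _ ≤ (2 * C + 1) ^ j * (C * (u (x + (1 / 2 : ℝ) ^ j • z) - u x - ⟪q, (1 / 2 : ℝ) ^ j • z⟫)) :=
          mul_le_mul_of_nonneg_left h1 (by positivity)
      _ = C * ((2 * C + 1) ^ j * (u (x + (1 / 2 : ℝ) ^ j • z) - u x - ⟪q, (1 / 2 : ℝ) ^ j • z⟫)) := by
          ring
      _ ≤ C * (C ^ j * (u (x + z) - u x - ⟪q, z⟫)) := mul_le_mul_of_nonneg_left ih hC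
      _ = _ := by ring

lemma SubDbl.unique {C : ℝ} {u : E m → ℝ} (hC : 0 < C) (h : SubDbl C u) {x p q : E m}
    (hp : IsSubgrad u x p) (hq : IsSubgrad u x q) : p = q := by
  have key : ∀ z, ⟪p - q, z⟫ ≤ 0 := by
    intro z
    set V := u (x + z) - u x - ⟪q, z⟫ with hV
    set ρ := 2 * C / (2 * C + 1) with hρ
    have hρ1 : ρ < 1 := by rw [hρ, div_lt_one (by positivity)]; linarith
    have hj : ∀ j : ℕ, ⟪p - q, z⟫ ≤ ρ ^ j * V := by
      intro j
      have h1 := h.half_pow hC.le hq z j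
      have h2 := hp (x + (1 / 2 : ℝ) ^ j • z)
      rw [add_sub_cancel_left] at h2
      have h3 : (1 / 2 : ℝ) ^ j * ⟪p - q, z⟫ ≤
          u (x + (1 / 2 : ℝ) ^ j • z) - u x - ⟪q, (1 / 2 : ℝ) ^ j • z⟫ := by
        rw [inner_smul_right] at *
        rw [inner_sub_left]; linarith
      have h4 := (mul_le_mul_of_nonneg_left h3 (by positivity : 0 ≤ (2 * C + 1) ^ j)).trans h1
      rw [hρ, div_pow, mul_pow, div_mul_eq_mul_div, le_div_iff₀ (by positivity)]
      calc ⟪p - q, z⟫ * (2 * C + 1) ^ j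
          = 2 ^ j * ((2 * C + 1) ^ j * ((1 / 2 : ℝ) ^ j * ⟪p - q, z⟫)) := by
            rw [one_div, inv_pow]; field_simp
        _ ≤ 2 ^ j * (C ^ j * V) := mul_le_mul_of_nonneg_left h4 (by positivity)
        _ = _ := by ring
    have hlim : Tendsto (fun j : ℕ => ρ ^ j * V) atTop (𝓝 (0 * V)) :=
      (tendsto_pow_atTop_nhds_zero_of_lt_one (by positivity) hρ1).mul_const V
    rw [zero_mul] at hlim
    exact ge_of_tendsto' hlim hj
  have := key (p - q)
  rw [real_inner_self_eq_norm_sq] at this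
  have h3 : ‖p - q‖ = 0 := by nlinarith [norm_nonneg (p - q)]
  exact sub_eq_zero.1 (norm_eq_zero.1 h3)

end Doubling

section Limits

variable {m : ℕ}

/-- Entire convex solutions of `det D²u = 1` (in the sense of Alexandrov) with doubling excess. -/
structure Sol (C : ℝ) (u : E m → ℝ) (g : E m → E m) : Prop where
  grad : IsGrad u g
  dbl : ∀ x z, exc u g x ((2 : ℝ) • z) ≤ C * exc u g x z
  pos : ∀ x z, z ≠ 0 → 0 < exc u g x z
  meas : ∀ F, IsCompact F → volume (g '' F) = volume F

lemma IsGrad.subDbl_of_dbl {C : ℝ} {u : E m → ℝ} {g : E m → E m} (h : IsGrad u g)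
    (hd : ∀ x z, LpAffine.exc u g x ((2 : ℝ) • z) ≤ C * LpAffine.exc u g x z) : SubDbl C u :=
  fun x => ⟨g x, h.sub x, hd x⟩

/-- Functions with doubling excess grow superlinearly. -/
lemma SubDbl.superlinear {C ρ : ℝ} {u : E m → ℝ} (hC : 0 < C) (h : SubDbl C u) (h0 : u 0 = 0)
    (hpos : ∀ z, 0 ≤ u z) (hρ : ∀ z, ρ ≤ ‖z‖ → 1 ≤ u z) (j : ℕ) {w : E m}
    (hw : 2 ^ j * ρ ≤ ‖w‖) : (2 + 1 / C) ^ j ≤ u w := by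
  have h00 : IsSubgrad u 0 0 := fun z => by simp [h0, hpos]
  have h1 := h.half_pow hC.le h00 w j
  simp only [zero_add, inner_zero_left, h0, sub_zero] at h1
  have h2 : 1 ≤ u ((1 / 2 : ℝ) ^ j • w) := by
    apply hρ
    rw [norm_smul, norm_pow, Real.norm_eq_abs, abs_of_pos (by norm_num : (0 : ℝ) < 1 / 2),
      one_div, inv_pow, inv_mul_eq_div, le_div_iff₀ (by positivity)]
    linarith
  have h3 : (2 * C + 1) ^ j ≤ C ^ j * u w := by
    have : 0 ≤ (2 * C + 1) ^ j := by positivity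
    nlinarith
  have e : (2 + 1 / C) ^ j = (2 * C + 1) ^ j / C ^ j := by
    rw [← div_pow]; congr 1; field_simp
  rw [e, div_le_iff₀ (by positivity)]
  linarith

/-- Strict convexity from doubling excess. -/
lemma exc_pos_of_dbl {C ρ : ℝ} {u : E m → ℝ} {g : E m → E m} (hC : 0 < C) (h : IsGrad u g)
    (hd : ∀ x z, exc u g x ((2 : ℝ) • z) ≤ C * exc u g x z) (h0 : u 0 = 0)
    (hpos : ∀ z, 0 ≤ u z) (hρ0 : 0 < ρ) (hρ : ∀ z, ρ ≤ ‖z‖ → 1 ≤ u z) (x z : E m) (hz : z ≠ 0) :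
    0 < exc u g x z := by
  by_contra hcon
  have hz0 : exc u g x z = 0 := le_antisymm (not_lt.1 hcon) (h.exc_nonneg x z)
  have hzn : 0 < ‖z‖ := norm_pos_iff.2 hz
  have hj : ∀ j : ℕ, exc u g x ((2 : ℝ) ^ j • z) ≤ 0 := by
    intro j
    induction j with
    | zero => simp [hz0]
    | succ j ih =>
      have := hd x ((2 : ℝ) ^ j • z)
      rw [smul_smul, ← pow_succ'] at this
      exact this.trans (mul_nonpos_of_nonneg_of_nonpos hC.le ih)
  obtain ⟨j₀, hj₀⟩ := pow_unbounded_of_one_lt ((ρ + ‖x‖) / ‖z‖) (by norm_num : (1 : ℝ) < 2)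
  rw [div_lt_iff₀ hzn] at hj₀
  set D := |u x| + ‖g x‖ * (2 ^ j₀ * ‖z‖) with hD
  have hlow : ∀ j : ℕ, (2 + 1 / C) ^ j ≤ D * 2 ^ j := by
    intro j
    have h2j : (1 : ℝ) ≤ 2 ^ j := one_le_pow₀ (by norm_num)
    have h1 : 2 ^ j * ρ ≤ ‖x + (2 : ℝ) ^ (j + j₀) • z‖ := by
      have h2 := norm_sub_le (x + (2 : ℝ) ^ (j + j₀) • z) x
      rw [add_sub_cancel_left, norm_smul, norm_pow, Real.norm_eq_abs, abs_two, pow_add] at h2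
      have h3 := mul_le_mul_of_nonneg_left hj₀.le (by positivity : (0 : ℝ) ≤ 2 ^ j)
      rw [pow_add]
      nlinarith [norm_nonneg x]
    have h2 := (h.subDbl_of_dbl hd).superlinear hC h0 hpos hρ j h1
    have h3 := hj (j + j₀)
    unfold exc at h3
    rw [inner_smul_right, pow_add] at h3
    have h4 := real_inner_le_norm (g x) z
    have h5 : 2 ^ j * 2 ^ j₀ * ⟪g x, z⟫ ≤ 2 ^ j * 2 ^ j₀ * (‖g x‖ * ‖z‖) :=
      mul_le_mul_of_nonneg_left h4 (by positivity)
    have h6 := le_abs_self (u x)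
    rw [pow_add] at h2
    calc (2 + 1 / C) ^ j ≤ u (x + ((2 : ℝ) ^ j * 2 ^ j₀) • z) := h2
      _ ≤ |u x| * 1 + 2 ^ j * 2 ^ j₀ * (‖g x‖ * ‖z‖) := by linarith
      _ ≤ |u x| * 2 ^ j + 2 ^ j * 2 ^ j₀ * (‖g x‖ * ‖z‖) := by gcongr
      _ = D * 2 ^ j := by rw [hD]; ring
  have hr : 1 < 1 + 1 / (2 * C) := by
    have : 0 < 1 / (2 * C) := by positivity
    linarith
  obtain ⟨j, hj'⟩ := pow_unbounded_of_one_lt D hr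
  have := hlow j
  have e : (2 + 1 / C) ^ j = (1 + 1 / (2 * C)) ^ j * 2 ^ j := by
    rw [← mul_pow]; congr 1; field_simp
  rw [e] at this
  have := le_of_mul_le_mul_right this (by positivity)
  linarith

variable {ι : Type*} {l : Ultrafilter ι} {u : ι → E m → ℝ} {g : ι → E m → E m}

lemma exists_bound_of_dbl {C ρ : ℝ} (hC : 0 < C) (hρ : 0 < ρ)
    (h0 : ∀ k, u k 0 = 0) (hg0 : ∀ k, g k 0 = 0)
    (hin : ∀ k z, ‖z‖ ≤ ρ → u k z ≤ 1)
    (hdbl : ∀ R, ∀ᶠ k in (l : Filter ι), ∀ x z, ‖x‖ ≤ R → ‖z‖ ≤ R →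
      exc (u k) (g k) x ((2 : ℝ) • z) ≤ C * exc (u k) (g k) x z) (R : ℝ) :
    ∃ M : ℝ, ∀ᶠ k in (l : Filter ι), ∀ z, ‖z‖ ≤ R → u k z ≤ M := by
  obtain ⟨j, hj⟩ := pow_unbounded_of_one_lt (R / ρ) (by norm_num : (1 : ℝ) < 2)
  refine ⟨C ^ j, ?_⟩
  filter_upwards [hdbl (2 ^ j * ρ)] with k hk z hz
  have key : ∀ i ≤ j, ∀ w, ‖w‖ ≤ ρ → u k ((2 : ℝ) ^ i • w) ≤ C ^ i := by
    intro i
    induction i with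
    | zero => intro _ w hw; simpa using hin k w hw
    | succ i ih =>
      intro hi w hw
      have h1 := hk 0 ((2 : ℝ) ^ i • w) (by simp; positivity) (by
        rw [norm_smul, norm_pow, Real.norm_eq_abs, abs_two]
        exact mul_le_mul (pow_le_pow_right₀ (by norm_num) (by omega)) hw (norm_nonneg _)
          (by positivity))
      simp only [exc, zero_add, h0, hg0, inner_zero_left, sub_zero] at h1
      rw [smul_smul, ← pow_succ'] at h1
      refine h1.trans ?_
      rw [pow_succ']
      exact mul_le_mul_of_nonneg_left (ih (by omega) w hw) hC.le
  have := key j le_rfl ((2 : ℝ)⁻¹ ^ j • z) (by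
    rw [norm_smul, norm_pow, norm_inv, Real.norm_eq_abs, abs_two, inv_pow, inv_mul_le_iff₀ (by positivity)]
    rw [div_lt_iff₀ hρ] at hj; linarith)
  rwa [smul_smul, ← mul_pow, mul_inv_cancel₀ (by norm_num), one_pow, one_smul] at this

lemma exists_ultra_lim {F : Type*} [NormedAddCommGroup F] [ProperSpace F] (f : ι → F) (M : ℝ)
    (h : ∀ᶠ k in (l : Filter ι), ‖f k‖ ≤ M) : ∃ y, Tendsto f l (𝓝 y) := by
  have : (l.map f : Filter F) ≤ 𝓟 (Metric.closedBall 0 M) := by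
    rw [le_principal_iff]
    exact h.mono fun k hk => by simpa using hk
  obtain ⟨y, -, hy⟩ := (isCompact_closedBall (0 : F) M).ultrafilter_le_nhds _ this
  exact ⟨y, hy⟩

/-- Pointwise ultralimits of convex functions are limits along convergent arguments, too, and
subgradients converge. -/
structure UltraLim (l : Ultrafilter ι) (u : ι → E m → ℝ) (g : ι → E m → E m)
    (v : E m → ℝ) (q : E m → E m) : Prop where
  grad : ∀ k, IsGrad (u k) (g k)
  lim : ∀ z, Tendsto (fun k => u k z) l (𝓝 (v z))
  limg : ∀ z, Tendsto (fun k => g k z) l (𝓝 (q z))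
  bound : ∀ R, ∃ L, ∀ᶠ k in (l : Filter ι), ∀ z, ‖z‖ ≤ R → ‖g k z‖ ≤ L
  gradv : IsGrad v q

lemma UltraLim.unif {v : E m → ℝ} {q : E m → E m} (h : UltraLim l u g v q) (R : ℝ) {η : ℝ}
    (hη : 0 < η) : ∀ᶠ k in (l : Filter ι), ∀ z, ‖z‖ ≤ R → |u k z - v z| ≤ η := by
  by_contra hcon
  rw [← Ultrafilter.eventually_not] at hcon
  have hch : ∀ k, ∃ z, (¬ ∀ z, ‖z‖ ≤ R → |u k z - v z| ≤ η) → ‖z‖ ≤ R ∧ η < |u k z - v z| := by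
    intro k
    by_cases hk : ∀ z, ‖z‖ ≤ R → |u k z - v z| ≤ η
    · exact ⟨0, fun h => absurd hk h⟩
    · push Not at hk
      obtain ⟨z, hz⟩ := hk
      exact ⟨z, fun _ => hz⟩
  choose z hz using hch
  have hzR : ∀ᶠ k in (l : Filter ι), ‖z k‖ ≤ R := hcon.mono fun k hk => (hz k hk).1
  obtain ⟨z₀, hz₀⟩ := exists_ultra_lim z R hzR
  have hz₀R : ‖z₀‖ ≤ R := le_of_tendsto hz₀.norm hzR
  obtain ⟨L, hL⟩ := h.bound R
  have h1 : Tendsto (fun k => L * ‖z k - z₀‖ + |u k z₀ - v z₀| + |v z₀ - v (z k)|) l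
      (𝓝 (L * ‖z₀ - z₀‖ + |v z₀ - v z₀| + |v z₀ - v z₀|)) := by
    refine (((hz₀.sub tendsto_const_nhds).norm.const_mul L).add
      ((h.lim z₀).sub tendsto_const_nhds).abs).add (tendsto_const_nhds.sub ?_).abs
    exact (h.gradv.continuous_fun.tendsto z₀).comp hz₀
  simp only [sub_self, norm_zero, mul_zero, abs_zero, add_zero] at h1
  obtain ⟨k, hk1, hk2, hk3, hk4⟩ :=
    ((h1.eventually (gt_mem_nhds hη)).and (hcon.and (hzR.and hL))).exists
  have h2 := ((h.grad k).sub (z k)).abs_sub_le ((h.grad k).sub z₀) (hk4 _ hk3) (hk4 _ hz₀R)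
  have h3 := (hz k hk2).2
  have h4 := abs_add_le (u k (z k) - u k z₀ + (u k z₀ - v z₀)) (v z₀ - v (z k))
  have h5 := abs_add_le (u k (z k) - u k z₀) (u k z₀ - v z₀)
  have e : u k (z k) - u k z₀ + (u k z₀ - v z₀) + (v z₀ - v (z k)) = u k (z k) - v (z k) := by ring
  rw [e] at h4
  linarith

lemma UltraLim.unifg {v : E m → ℝ} {q : E m → E m} (h : UltraLim l u g v q) (R : ℝ) {η : ℝ}
    (hη : 0 < η) : ∀ᶠ k in (l : Filter ι), ∀ z, ‖z‖ ≤ R → ‖g k z - q z‖ ≤ η := by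
  by_contra hcon
  rw [← Ultrafilter.eventually_not] at hcon
  have hch : ∀ k, ∃ z, (¬ ∀ z, ‖z‖ ≤ R → ‖g k z - q z‖ ≤ η) → ‖z‖ ≤ R ∧ η < ‖g k z - q z‖ := by
    intro k
    by_cases hk : ∀ z, ‖z‖ ≤ R → ‖g k z - q z‖ ≤ η
    · exact ⟨0, fun h => absurd hk h⟩
    · push Not at hk
      obtain ⟨z, hz⟩ := hk
      exact ⟨z, fun _ => hz⟩
  choose z hz using hch
  have hzR : ∀ᶠ k in (l : Filter ι), ‖z k‖ ≤ R := hcon.mono fun k hk => (hz k hk).1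
  obtain ⟨z₀, hz₀⟩ := exists_ultra_lim z R hzR
  obtain ⟨L, hL⟩ := h.bound R
  obtain ⟨p, hp⟩ := exists_ultra_lim (l := l) (fun k => g k (z k)) L (by
    filter_upwards [hL, hzR] with k h1 h2 using h1 _ h2)
  have huz : Tendsto (fun k => u k (z k)) l (𝓝 (v z₀)) := by
    have h1 : Tendsto (fun k => v (z k)) l (𝓝 (v z₀)) :=
      (h.gradv.continuous_fun.tendsto z₀).comp hz₀
    have h2 : Tendsto (fun k => u k (z k) - v (z k)) l (𝓝 0) := by
      rw [Metric.tendsto_nhds]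
      intro ε hε
      filter_upwards [h.unif R (half_pos hε), hzR] with k hk1 hk2
      rw [Real.dist_eq, sub_zero]
      linarith [hk1 _ hk2]
    simpa using h2.add h1
  have hpq : p = q z₀ := by
    apply h.gradv.uniq
    intro w
    refine le_of_tendsto_of_tendsto' (huz.add (hp.inner (tendsto_const_nhds.sub hz₀))) (h.lim w) ?_
    exact fun k => (h.grad k).sub (z k) w
  have h1 : Tendsto (fun k => ‖g k (z k) - q (z k)‖) l (𝓝 ‖p - q z₀‖) :=
    (hp.sub ((h.gradv.continuous.tendsto z₀).comp hz₀)).norm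
  rw [hpq, sub_self, norm_zero] at h1
  obtain ⟨k, hk1, hk2⟩ := ((h1.eventually (gt_mem_nhds hη)).and hcon).exists
  linarith [(hz k hk2).2]

lemma UltraLim.meas {v : E m → ℝ} {q : E m → E m} (h : UltraLim l u g v q)
    (hpos : ∀ x z, z ≠ 0 → 0 < exc v q x z)
    (hMA : ∀ R ε : ℝ, 0 < ε → ∀ᶠ k in (l : Filter ι),
      MABetween (g k) (Metric.closedBall 0 R) (1 - ε) (1 + ε)) {F : Set (E m)} (hF : IsCompact F) :
    volume (q '' F) = volume F := by
  rcases F.eq_empty_or_nonempty with rfl | hne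
  · simp
  obtain ⟨R, hR⟩ := hF.isBounded.subset_closedBall (0 : E m)
  have hqc := h.gradv.continuous
  have hqF := hF.image hqc
  have lower : ∀ (ε r : ℝ), 0 < ε → 0 < r →
      ENNReal.ofReal (1 - ε) * volume F ≤ volume (Metric.cthickening r (q '' F)) := by
    intro ε r hε hr
    obtain ⟨k, hk1, hk2⟩ := ((hMA R ε hε).and (h.unifg R hr)).exists
    refine ((hk1 F hF hR).1).trans (measure_mono ?_)
    rintro _ ⟨x, hx, rfl⟩
    refine Metric.mem_cthickening_of_dist_le _ _ _ _ (mem_image_of_mem q hx) ?_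
    rw [dist_eq_norm]
    exact hk2 x (by simpa using hR hx)
  have upper : ∀ (ε r : ℝ), 0 < ε → 0 < r →
      volume (q '' F) ≤ ENNReal.ofReal (1 + ε) * volume (Metric.cthickening r F) := by
    intro ε r hε hr
    have hcpt : IsCompact (F ×ˢ Metric.sphere (0 : E m) r) := hF.prod (isCompact_sphere 0 r)
    have hcont : Continuous fun p : E m × E m => exc v q p.1 p.2 := by
      have := h.gradv.continuous_fun
      unfold exc; fun_prop
    obtain ⟨η, hη, hηF⟩ : ∃ η > 0, ∀ x ∈ F, ∀ z, ‖z‖ = r → η ≤ exc v q x z := by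
      rcases (F ×ˢ Metric.sphere (0 : E m) r).eq_empty_or_nonempty with he | hne'
      · refine ⟨1, one_pos, fun x hx z hz => ?_⟩
        have : (x, z) ∈ F ×ˢ Metric.sphere (0 : E m) r := ⟨hx, by simpa using hz⟩
        rw [he] at this; exact this.elim
      · obtain ⟨⟨x₀, z₀⟩, ⟨-, hz₀⟩, hmin⟩ := hcpt.exists_isMinOn hne' hcont.continuousOn
        refine ⟨exc v q x₀ z₀, hpos _ _ ?_, fun x hx z hz => hmin (a := (x, z)) ⟨hx, by simpa using hz⟩⟩
        have hz₀' : ‖z₀‖ = r := by simpa using hz₀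
        rw [← norm_pos_iff, hz₀']; exact hr
    obtain ⟨k, hk1, hk2⟩ := ((hMA (R + r) ε hε).and (h.unif (R + r) (by positivity : 0 < η / 4))).exists
    have hthick : Metric.cthickening r F ⊆ Metric.closedBall 0 (R + r) := by
      refine (Metric.cthickening_subset_of_subset r hR).trans ?_
      rw [cthickening_closedBall hr.le]
      · rw [add_comm]
      · exact (norm_nonneg _).trans (by simpa using hR hne.some_mem)
    refine (measure_mono ?_).trans (hk1 _ hF.cthickening hthick).2
    rintro _ ⟨x, hx, rfl⟩
    have hxR : ‖x‖ ≤ R := by simpa using hR hx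
    have huk := (h.grad k).continuous_fun
    obtain ⟨y, hy, hmin⟩ := (isCompact_closedBall x r).exists_isMinOn ⟨x, by simp [hr.le]⟩
      (f := fun z => u k z - ⟪q x, z⟫) (by fun_prop)
    have hb : ∀ z, ‖z - x‖ ≤ r → ‖z‖ ≤ R + r := fun z hz => by
      have := norm_add_le (z - x) x
      rw [sub_add_cancel] at this; linarith
    have hyx : ‖y - x‖ ≤ r := by simpa [dist_eq_norm] using hy
    have hlt : ‖y - x‖ < r := by
      refine lt_of_le_of_ne hyx fun heq => ?_
      have h1 := hηF x hx (y - x) heq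
      have h2 : u k y - ⟪q x, y⟫ ≤ u k x - ⟪q x, x⟫ := hmin (Metric.mem_closedBall_self hr.le)
      have h3 := abs_le.1 (hk2 y (hb y hyx))
      have h4 := abs_le.1 (hk2 x (by linarith))
      unfold exc at h1
      rw [add_sub_cancel, inner_sub_right] at h1
      linarith [h3.1, h4.2]
    refine ⟨y, Metric.mem_cthickening_of_dist_le _ _ _ _ hx (by rw [dist_eq_norm]; exact hyx), ?_⟩
    refine ((h.grad k).uniq y (q x) (isSubgrad_of_isLocalMin (h.grad k).convexOn ?_)).symm
    filter_upwards [Metric.isOpen_ball.mem_nhds (show y ∈ Metric.ball x r by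
      simpa [dist_eq_norm] using hlt)] with z hz
    exact hmin (Metric.ball_subset_closedBall hz)
  have lim1 : Tendsto (fun r : ℝ => volume (Metric.cthickening r (q '' F))) (𝓝[>] 0)
      (𝓝 (volume (q '' F))) :=
    (tendsto_measure_cthickening_of_isCompact hqF).mono_left nhdsWithin_le_nhds
  have lim2 : Tendsto (fun r : ℝ => volume (Metric.cthickening r F)) (𝓝[>] 0) (𝓝 (volume F)) :=
    (tendsto_measure_cthickening_of_isCompact hF).mono_left nhdsWithin_le_nhds
  have hFfin : volume F ≠ ∞ := hF.measure_lt_top.ne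
  have cst : ∀ s : ℝ, Tendsto (fun ε : ℝ => ENNReal.ofReal (1 + s * ε) * volume F) (𝓝[>] 0)
      (𝓝 (volume F)) := by
    intro s
    have h1 : Tendsto (fun ε : ℝ => 1 + s * ε) (𝓝[>] 0) (𝓝 1) := by
      have : Continuous fun ε : ℝ => 1 + s * ε := by fun_prop
      simpa using (this.tendsto 0).mono_left nhdsWithin_le_nhds
    have := ENNReal.Tendsto.mul_const (b := volume F) (ENNReal.tendsto_ofReal h1) (Or.inr hFfin)
    simpa using this
  apply le_antisymm
  · refine ge_of_tendsto (cst 1) ?_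
    filter_upwards [self_mem_nhdsWithin] with ε hε
    rw [one_mul]
    have h1 := ENNReal.Tendsto.const_mul (a := ENNReal.ofReal (1 + ε)) lim2 (Or.inr ENNReal.ofReal_ne_top)
    refine ge_of_tendsto h1 ?_
    filter_upwards [self_mem_nhdsWithin] with r hr using upper ε r hε hr
  · refine le_of_tendsto (cst (-1)) ?_
    filter_upwards [self_mem_nhdsWithin] with ε hε
    refine ge_of_tendsto lim1 ?_
    filter_upwards [self_mem_nhdsWithin] with r hr
    have := lower ε r hε hr
    rwa [sub_eq_add_neg, ← neg_one_mul] at this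

/-- Compactness: normalized sequences with Monge–Ampère density tending to one and asymptotically
doubling excess have ultralimits that are entire solutions. -/
theorem exists_sol_ultralim {C ρ ρ' : ℝ} (hC : 0 < C) (hρ : 0 < ρ)
    (hgrad : ∀ k, IsGrad (u k) (g k)) (h0 : ∀ k, u k 0 = 0) (hpos : ∀ k z, 0 ≤ u k z)
    (hin : ∀ k z, ‖z‖ ≤ ρ → u k z ≤ 1) (hout : ∀ k z, u k z ≤ 1 → ‖z‖ ≤ ρ')
    (hdbl : ∀ R, ∀ᶠ k in (l : Filter ι), ∀ x z, ‖x‖ ≤ R → ‖z‖ ≤ R →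
      exc (u k) (g k) x ((2 : ℝ) • z) ≤ C * exc (u k) (g k) x z)
    (hMA : ∀ R ε : ℝ, 0 < ε → ∀ᶠ k in (l : Filter ι),
      MABetween (g k) (Metric.closedBall 0 R) (1 - ε) (1 + ε)) :
    ∃ v q, UltraLim l u g v q ∧ Sol C v q := by
  have hg0 : ∀ k, g k 0 = 0 := fun k => ((hgrad k).uniq 0 0 fun z => by simp [h0, hpos]).symm
  have hbd := exists_bound_of_dbl (l := l) hC hρ h0 hg0 hin hdbl
  have hbg : ∀ R, ∃ L, ∀ᶠ k in (l : Filter ι), ∀ z, ‖z‖ ≤ R → ‖g k z‖ ≤ L := by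
    intro R
    obtain ⟨M, hM⟩ := hbd (R + 1)
    refine ⟨M, hM.mono fun k hk z hz => ?_⟩
    have := ((hgrad k).sub z).norm_le (r := 1) (M := M) one_pos (fun y hy => hk y (by
      have := norm_add_le (y - z) z
      rw [sub_add_cancel] at this; linarith))
    linarith [hpos k z]
  have hv : ∀ z, ∃ y, Tendsto (fun k => u k z) l (𝓝 y) := fun z => by
    obtain ⟨M, hM⟩ := hbd ‖z‖
    refine exists_ultra_lim _ M (hM.mono fun k hk => ?_)
    rw [Real.norm_eq_abs, abs_of_nonneg (hpos k z)]; exact hk z le_rfl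
  have hq : ∀ z, ∃ y, Tendsto (fun k => g k z) l (𝓝 y) := fun z => by
    obtain ⟨L, hL⟩ := hbg ‖z‖
    exact exists_ultra_lim _ L (hL.mono fun k hk => hk z le_rfl)
  choose v hv using hv
  choose q hq using hq
  have hsub : ∀ x, IsSubgrad v x (q x) := fun x z =>
    le_of_tendsto_of_tendsto' ((hv x).add ((hq x).inner tendsto_const_nhds)) (hv z)
      fun k => (hgrad k).sub x z
  have hd : ∀ x z, exc v q x ((2 : ℝ) • z) ≤ C * exc v q x z := by
    intro x z
    have hlim : ∀ w, Tendsto (fun k => exc (u k) (g k) x w) l (𝓝 (exc v q x w)) := fun w =>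
      ((hv _).sub (hv _)).sub ((hq x).inner tendsto_const_nhds)
    refine le_of_tendsto_of_tendsto (hlim _) ((hlim z).const_mul C) ?_
    filter_upwards [hdbl (max ‖x‖ ‖z‖)] with k hk
    exact hk x z (le_max_left _ _) (le_max_right _ _)
  have hsd : SubDbl C v := fun x => ⟨q x, hsub x, hd x⟩
  have hgv : IsGrad v q := ⟨hsub, fun x p hp => hsd.unique hC hp (hsub x)⟩
  have hU : UltraLim l u g v q := ⟨hgrad, hv, hq, hbg, hgv⟩
  have hv0 : v 0 = 0 := tendsto_nhds_unique (hv 0) (by simp [h0])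
  have hvpos : ∀ z, 0 ≤ v z := fun z => ge_of_tendsto' (hv z) fun k => hpos k z
  have hvout : ∀ z, |ρ'| + 1 ≤ ‖z‖ → 1 ≤ v z := fun z hz => ge_of_tendsto' (hv z) fun k => by
    by_contra hcon
    have := hout k z (by linarith)
    linarith [le_abs_self ρ']
  have hp := exc_pos_of_dbl hC hgv hd hv0 hvpos (by positivity) hvout
  exact ⟨v, q, hU, hgv, hd, hp, fun F hF => hU.meas hp hMA hF⟩

end Limits

section Mat

variable {m : ℕ}

/-- The arithmetic-geometric mean inequality for eigenvalues. -/
lemma det_le_trace_pow {ι : Type*} [Fintype ι] [DecidableEq ι] {A : Matrix ι ι ℝ}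
    (hA : A.PosSemidef) :
    0 ≤ A.trace ∧ (Fintype.card ι : ℝ) ^ Fintype.card ι * A.det ≤ A.trace ^ Fintype.card ι := by
  have hn : ∀ i, 0 ≤ hA.1.eigenvalues i := hA.eigenvalues_nonneg
  have ht : A.trace = ∑ i, hA.1.eigenvalues i := by simpa using hA.1.trace_eq_sum_eigenvalues
  have hd : A.det = ∏ i, hA.1.eigenvalues i := by simpa using hA.1.det_eq_prod_eigenvalues
  rcases isEmpty_or_nonempty ι with he | he
  · simp
  have hc : (0 : ℝ) < Fintype.card ι := by exact_mod_cast Fintype.card_pos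
  refine ⟨ht ▸ Finset.sum_nonneg fun i _ => hn i, ?_⟩
  have h := Real.geom_mean_le_arith_mean Finset.univ (fun _ => (1 : ℝ)) hA.1.eigenvalues
    (fun _ _ => zero_le_one) (by simpa using hc) (fun i _ => hn i)
  simp only [Real.rpow_one, one_mul, Finset.sum_const, Finset.card_univ, nsmul_eq_mul, mul_one,
    ← ht, ← hd] at h
  have hd0 : 0 ≤ A.det := hA.det_nonneg
  have h2 := pow_le_pow_left₀ (Real.rpow_nonneg hd0 _) h (Fintype.card ι)
  rw [← Real.rpow_natCast, ← Real.rpow_mul hd0, inv_mul_cancel₀ hc.ne', Real.rpow_one, div_pow,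
    le_div_iff₀ (by positivity)] at h2
  linarith

lemma det_le_trace_inv_mul_pow {ι : Type*} [Fintype ι] [DecidableEq ι] {X B : Matrix ι ι ℝ}
    (hX : X.PosDef) (hX1 : X.det = 1) (hB : B.PosSemidef) :
    0 ≤ (X⁻¹ * B).trace ∧
      (Fintype.card ι : ℝ) ^ Fintype.card ι * B.det ≤ (X⁻¹ * B).trace ^ Fintype.card ι := by
  obtain ⟨T, hT⟩ : ∃ T : Matrix ι ι ℝ, X⁻¹ = T.conjTranspose * T := by
    open scoped MatrixOrder in
    obtain ⟨T, hT⟩ := CStarAlgebra.nonneg_iff_eq_star_mul_self.1 hX.inv.posSemidef.nonneg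
    exact ⟨T, hT⟩
  have hTB : (T * B * T.conjTranspose).PosSemidef := hB.mul_mul_conjTranspose_same T
  have h1 : (X⁻¹ * B).trace = (T * B * T.conjTranspose).trace := by
    rw [hT, Matrix.mul_assoc, Matrix.trace_mul_comm]
  have hd : T.conjTranspose.det * T.det = 1 := by
    rw [← Matrix.det_mul, ← hT, Matrix.det_nonsing_inv, hX1]; simp
  have h2 : B.det = (T * B * T.conjTranspose).det := by
    rw [Matrix.det_mul, Matrix.det_mul]
    linear_combination -B.det * hd
  rw [h1, h2]
  exact det_le_trace_pow hTB

/-- The concavity of `det ^ (1 / m)`, in the form used on contact sets. -/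
lemma contact_det {X Y Z H : E m →ₗ[ℝ] E m} (hX : X.IsPositive) (hY : Y.IsPositive)
    (hZ : Z.IsPositive) (hX1 : LinearMap.det X = 1) (hY1 : LinearMap.det Y = 1)
    (hZ1 : LinearMap.det Z = 1) (hB : ((2 : ℝ) • X - Y - Z + H).IsPositive) :
    ∃ T : E m →ₗ[ℝ] E m, T.IsPositive ∧ T ∘ₗ X = LinearMap.id ∧
      0 ≤ LinearMap.trace ℝ _ (T ∘ₗ H) ∧
      (m : ℝ) ^ m * LinearMap.det ((2 : ℝ) • X - Y - Z + H) ≤ LinearMap.trace ℝ _ (T ∘ₗ H) ^ m := by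
  set b := EuclideanSpace.basisFun (Fin m) ℝ
  let M : (E m →ₗ[ℝ] E m) → Matrix (Fin m) (Fin m) ℝ :=
    fun A => LinearMap.toMatrix b.toBasis b.toBasis A
  have hMdet : ∀ A, (M A).det = LinearMap.det A := fun A => LinearMap.det_toMatrix b.toBasis A
  have hMX : (M X).PosDef :=
    ((LinearMap.posSemidef_toMatrix_iff b).2 hX).posDef_iff_det_ne_zero.2 (by
      change (M X).det ≠ 0
      rw [hMdet, hX1]; exact one_ne_zero)
  have tr_ge : ∀ {A : E m →ₗ[ℝ] E m}, A.IsPositive → LinearMap.det A = 1 →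
      (m : ℝ) ≤ ((M X)⁻¹ * M A).trace := by
    intro A hA hA1
    have h := det_le_trace_inv_mul_pow hMX (by rw [hMdet, hX1])
      ((LinearMap.posSemidef_toMatrix_iff b).2 hA : (M A).PosSemidef)
    rw [hMdet, hA1, mul_one, Fintype.card_fin] at h
    rcases Nat.eq_zero_or_pos m with rfl | hm
    · simp
    · exact le_of_pow_le_pow_left₀ hm.ne' h.1 h.2
  have hB' := det_le_trace_inv_mul_pow hMX (by rw [hMdet, hX1])
      ((LinearMap.posSemidef_toMatrix_iff b).2 hB : (M _).PosSemidef)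
  rw [hMdet, Fintype.card_fin] at hB'
  have hlin : M ((2 : ℝ) • X - Y - Z + H) = (2 : ℝ) • M X - M Y - M Z + M H := by
    simp [M]
  have hXX : (M X)⁻¹ * M X = 1 := Matrix.nonsing_inv_mul _ (by rw [hMdet, hX1]; exact isUnit_one)
  have htr : ((M X)⁻¹ * M ((2 : ℝ) • X - Y - Z + H)).trace ≤ ((M X)⁻¹ * M H).trace := by
    rw [hlin]
    simp only [Matrix.mul_add, Matrix.mul_sub, Matrix.mul_smul, hXX, Matrix.trace_add,
      Matrix.trace_sub, Matrix.trace_smul, Matrix.trace_one, Fintype.card_fin, smul_eq_mul]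
    have := tr_ge hY hY1
    have := tr_ge hZ hZ1
    linarith
  have hMT : M (Matrix.toLin b.toBasis b.toBasis (M X)⁻¹) = (M X)⁻¹ :=
    LinearMap.toMatrix_toLin _ _ _
  have hcomp : ∀ A, M ((Matrix.toLin b.toBasis b.toBasis (M X)⁻¹) ∘ₗ A) = (M X)⁻¹ * M A := by
    intro A
    refine (LinearMap.toMatrix_comp b.toBasis b.toBasis b.toBasis _ _).trans ?_
    change M _ * M A = _
    rw [hMT]
  have htrace : ∀ A, LinearMap.trace ℝ _ A = (M A).trace := fun A =>
    LinearMap.trace_eq_matrix_trace ℝ b.toBasis A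
  refine ⟨Matrix.toLin b.toBasis b.toBasis (M X)⁻¹, ?_, ?_, ?_, ?_⟩
  · rw [← LinearMap.posSemidef_toMatrix_iff b]
    change (M _).PosSemidef
    rw [hMT]
    exact hMX.inv.posSemidef
  · apply (LinearMap.toMatrix b.toBasis b.toBasis).injective
    change M _ = M _
    rw [hcomp, hXX]
    exact (LinearMap.toMatrix_id _).symm
  · rw [htrace, hcomp]; exact hB'.1.trans htr
  · rw [htrace, hcomp]; exact hB'.2.trans (pow_le_pow_left₀ hB'.1 htr m)

end Mat

section Diff

variable {m : ℕ} {u : E m → ℝ} {g : E m → E m}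

lemma IsGrad.hasFDerivAt (h : IsGrad u g) (x : E m) : HasFDerivAt u (innerSL ℝ (g x)) x := by
  rw [hasFDerivAt_iff_isLittleO, Asymptotics.isLittleO_iff]
  intro c hc
  have h1 := (h.continuous.tendsto x).eventually (Metric.ball_mem_nhds (g x) hc)
  filter_upwards [h1] with z hz
  rw [innerSL_apply_apply, Real.norm_eq_abs]
  have h2 := h.sub x z
  have h3 := h.sub z x
  rw [dist_eq_norm] at hz
  have h4 := real_inner_le_norm (g z - g x) (z - x)
  have h5 : ‖g z - g x‖ * ‖z - x‖ ≤ c * ‖z - x‖ :=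
    mul_le_mul_of_nonneg_right hz.le (norm_nonneg _)
  rw [inner_sub_left] at h4
  rw [← neg_sub z x, inner_neg_right] at h3
  rw [abs_of_nonneg (by linarith)]
  linarith

lemma IsGrad.isPositive_of_hasFDerivAt (h : IsGrad u g) {x : E m} {X : E m →L[ℝ] E m}
    (hX : HasFDerivAt g X x) : (X : E m →ₗ[ℝ] E m).IsPositive := by
  refine ⟨fun v w => ?_, fun v => ?_⟩
  · have h1 : HasFDerivAt (fun z => innerSL ℝ (g z)) ((innerSL ℝ).comp X) x :=
      (innerSL ℝ (E := E m)).hasFDerivAt.comp x hX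
    have := second_derivative_symmetric_of_eventually
      (Eventually.of_forall fun z => h.hasFDerivAt z) h1 v w
    simp only [ContinuousLinearMap.comp_apply, innerSL_apply_apply] at this
    rw [ContinuousLinearMap.coe_coe, this, real_inner_comm]
  · have h1 : HasDerivAt (fun t : ℝ => g (x + t • v)) (X v) 0 := by
      have : HasDerivAt (fun t : ℝ => x + t • v) v 0 := by
        simpa using ((hasDerivAt_id (0 : ℝ)).smul_const v).const_add x
      exact HasFDerivAt.comp_hasDerivAt 0 (by simpa using hX) this
    have h2 := (hasDerivAt_iff_tendsto_slope_zero.1 h1).mono_left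
      (nhdsWithin_mono 0 (fun t (ht : 0 < t) => ht.ne') : 𝓝[>] (0 : ℝ) ≤ _)
    have h3 := h2.inner (𝕜 := ℝ) (tendsto_const_nhds (x := v))
    simp only [ContinuousLinearMap.coe_coe, RCLike.re_to_real]
    refine ge_of_tendsto h3 ?_
    filter_upwards [self_mem_nhdsWithin] with t ht
    have h4 := (h.sub (x + t • v)).monotone (h.sub x)
    rw [add_sub_cancel_left, inner_smul_right] at h4
    simp only [zero_add, zero_smul, add_zero]
    rw [inner_smul_left]
    exact mul_nonneg (inv_nonneg.2 (le_of_lt ht)) (nonneg_of_mul_nonneg_right h4 ht)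

/-- The resolvent of a gradient map. -/
lemma IsGrad.exists_resolvent (h : IsGrad u g) :
    ∃ J : E m → E m, LipschitzWith 1 J ∧ (∀ y, J y + g (J y) = y) ∧ ∀ x, J (x + g x) = x := by
  have hU : ∀ x z : E m, u x + ‖x‖ ^ 2 / 2 + ⟪x + g x, z - x⟫ ≤ u z + ‖z‖ ^ 2 / 2 := by
    intro x z
    have h1 := h.sub x z
    have h2 : ⟪x, z - x⟫ = ⟪x, z⟫ - ‖x‖ ^ 2 := by
      rw [inner_sub_right, real_inner_self_eq_norm_sq]
    have h3 := norm_sub_sq_real x z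
    have h4 := sq_nonneg ‖x - z‖
    rw [inner_add_left]
    linarith
  have hgU : IsGrad (fun x => u x + ‖x‖ ^ 2 / 2) (fun x => x + g x) :=
    isGrad_of_continuous hU (continuous_id.add h.continuous)
  have hcont := hgU.continuous_fun
  have ex : ∀ y, ∃ x, x + g x = y := by
    intro y
    set B := ‖y‖ + ‖g 0‖ + 1 with hB
    set f : E m → ℝ := fun x => u x + ‖x‖ ^ 2 / 2 - ⟪y, x⟫ with hf
    have hfc : Continuous f := by
      have : Continuous fun x : E m => ⟪y, x⟫ := by fun_prop
      exact hcont.sub this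
    obtain ⟨x, hx, hmin⟩ := (isCompact_closedBall (0 : E m) (2 * B)).exists_isMinOn
      ⟨0, by simp; positivity⟩ hfc.continuousOn
    have hglob : ∀ z, f x ≤ f z := by
      intro z
      by_cases hz : z ∈ Metric.closedBall (0 : E m) (2 * B)
      · exact hmin hz
      · have h0 : f x ≤ f 0 := hmin (by simp; positivity)
        refine h0.trans ?_
        have hz' : 2 * B < ‖z‖ := by simpa using hz
        have h1 := h.sub 0 z
        have h2 := abs_le.1 (abs_real_inner_le_norm (g 0) z)
        have h3 := real_inner_le_norm y z
        simp only [hf, norm_zero, inner_zero_right, sub_zero] at h1 ⊢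
        nlinarith [norm_nonneg z, norm_nonneg y, norm_nonneg (g 0)]
    refine ⟨x, (hgU.uniq x y (isSubgrad_of_isLocalMin hgU.convexOn ?_)).symm⟩
    exact Eventually.of_forall hglob
  choose J hJ using ex
  have mono : ∀ x z, ‖x - z‖ ≤ ‖(x + g x) - (z + g z)‖ := by
    intro x z
    have h1 := (h.sub x).monotone (h.sub z)
    have h2 := real_inner_le_norm ((x + g x) - (z + g z)) (x - z)
    have e : (x + g x) - (z + g z) = (x - z) + (g x - g z) := by abel
    have h3 : ⟪(x + g x) - (z + g z), x - z⟫ = ‖x - z‖ ^ 2 + ⟪g x - g z, x - z⟫ := by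
      rw [e, inner_add_left, real_inner_self_eq_norm_sq]
    rcases (norm_nonneg (x - z)).eq_or_lt with h0 | h0
    · rw [← h0]; positivity
    · refine le_of_mul_le_mul_right ?_ h0
      nlinarith
  refine ⟨J, LipschitzWith.of_dist_le_mul fun y z => ?_, hJ, fun x => ?_⟩
  · have := mono (J y) (J z)
    rw [hJ, hJ] at this
    simpa [dist_eq_norm] using this
  · have := mono (J (x + g x)) x
    rw [hJ, sub_self, norm_zero] at this
    exact sub_eq_zero.1 (norm_le_zero_iff.1 this)

/-- Gradients of convex functions are differentiable almost everywhere. -/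
theorem IsGrad.ae_differentiableAt (h : IsGrad u g) : ∀ᵐ x, DifferentiableAt ℝ g x := by
  obtain ⟨J, hJ, hJr, hJl⟩ := h.exists_resolvent
  set N₁ := {y | ¬ DifferentiableAt ℝ J y} with hN₁
  have h1 : volume N₁ = 0 := hJ.ae_differentiableAt (μ := (volume : Measure (E m)))
  set N₂ := {y | DifferentiableAt ℝ J y ∧ (fderiv ℝ J y).det = 0} with hN₂
  have h2 : volume (J '' N₂) = 0 :=
    addHaar_image_eq_zero_of_det_fderivWithin_eq_zero volume
      (fun y hy => hy.1.hasFDerivAt.hasFDerivWithinAt) fun y hy => hy.2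
  have h3 : volume (J '' N₁) = 0 := by
    have h4 := (hJ.lipschitzOnWith (s := N₁)).hausdorffMeasure_image_le
      (d := Module.finrank ℝ (E m)) (by positivity)
    have hac : (μH[(Module.finrank ℝ (E m) : ℝ)] : Measure (E m)) ≪ volume :=
      MeasureTheory.Measure.absolutelyContinuous_isAddHaarMeasure _ _
    have hca : (volume : Measure (E m)) ≪ μH[(Module.finrank ℝ (E m) : ℝ)] :=
      MeasureTheory.Measure.absolutelyContinuous_isAddHaarMeasure _ _
    rw [hac h1, mul_zero] at h4
    exact hca (le_antisymm h4 bot_le)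
  have h5 : ∀ᵐ x, x ∉ J '' N₁ ∪ J '' N₂ := by
    rw [ae_iff]
    simp only [not_not]
    exact measure_union_null h3 h2
  filter_upwards [h5] with x hx
  have hd : DifferentiableAt ℝ J (x + g x) := by
    by_contra hc
    exact hx (Or.inl ⟨_, hc, hJl x⟩)
  have hdet : (fderiv ℝ J (x + g x)).det ≠ 0 := fun hc => hx (Or.inr ⟨_, ⟨hd, hc⟩, hJl x⟩)
  have hG := HasFDerivAt.of_local_left_inverse (f := J) (g := fun z => z + g z) (a := x)
    (f' := (fderiv ℝ J (x + g x)).toContinuousLinearEquivOfDetNeZero hdet)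
    (continuous_id.add h.continuous).continuousAt
    (by simpa using hd.hasFDerivAt) (Eventually.of_forall hJl)
  have := hG.differentiableAt.sub differentiableAt_id
  simpa [Pi.sub_def] using this

variable {C : ℝ}

lemma Sol.injective (h : Sol C u g) : Function.Injective g := by
  intro x y hxy
  by_contra hne
  have h1 := h.pos x (y - x) (sub_ne_zero.2 (Ne.symm hne))
  have h2 := h.grad.sub y x
  unfold exc at h1
  rw [add_sub_cancel] at h1
  rw [← hxy, ← neg_sub y x, inner_neg_right] at h2
  linarith

lemma Sol.volume_image (h : Sol C u g) {s : Set (E m)} (hs : MeasurableSet s) :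
    volume (g '' s) = volume s := by
  have hm : ∀ s, MeasurableSet s → MeasurableSet (g '' s) := fun s hs =>
    hs.image_of_continuousOn_injOn h.grad.continuous.continuousOn h.injective.injOn
  have hc : ∀ s, MeasurableSet s → Measure.comap g volume s = volume (g '' s) := fun s hs =>
    Measure.comap_apply g h.injective hm volume hs
  have hcl : ∀ s : Set (E m), IsClosed s → Measure.comap g volume s = volume s := by
    intro s hs
    have hmono : Monotone fun k : ℕ => s ∩ Metric.closedBall 0 (k : ℝ) := fun i j hij =>
      inter_subset_inter_right _ (Metric.closedBall_subset_closedBall (by exact_mod_cast hij))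
    have hU : s = ⋃ k : ℕ, s ∩ Metric.closedBall 0 (k : ℝ) := by
      rw [← inter_iUnion, Metric.iUnion_closedBall_nat, inter_univ]
    rw [hU, hmono.measure_iUnion, hmono.measure_iUnion]
    refine iSup_congr fun k => ?_
    have hk : IsCompact (s ∩ Metric.closedBall 0 (k : ℝ)) := (isCompact_closedBall 0 _).inter_left hs
    rw [hc _ hk.measurableSet, h.meas _ hk]
  rw [← hc s hs]
  congr 1
  refine Measure.ext_of_generateFrom_of_cover_subset
    (S := {s : Set (E m) | IsClosed s}) (T := range fun k : ℕ => Metric.closedBall (0 : E m) k)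
    ?_ isPiSystem_isClosed ?_ (countable_range _) ?_ ?_ hcl
  · rw [BorelSpace.measurable_eq (α := E m), borel_eq_generateFrom_isClosed]
  · rintro _ ⟨k, rfl⟩
    exact Metric.isClosed_closedBall
  · rw [sUnion_range, Metric.iUnion_closedBall_nat]
  · rintro _ ⟨k, rfl⟩
    rw [hcl _ Metric.isClosed_closedBall]
    exact (isCompact_closedBall _ _).measure_lt_top.ne

/-- Alexandrov solutions solve the equation almost everywhere. -/
theorem Sol.ae_hasFDerivAt (h : Sol C u g) : ∀ᵐ x, ∃ X : E m →L[ℝ] E m, HasFDerivAt g X x ∧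
    (X : E m →ₗ[ℝ] E m).IsPositive ∧ LinearMap.det (X : E m →ₗ[ℝ] E m) = 1 := by
  have hD : MeasurableSet {x | DifferentiableAt ℝ g x} := measurableSet_of_differentiableAt ℝ g
  have hae := h.grad.ae_differentiableAt
  have hdet : Measurable fun x => ENNReal.ofReal |(fderiv ℝ g x).det| :=
    (ContinuousLinearMap.continuous_det.measurable.comp (measurable_fderiv ℝ g)).abs.ennreal_ofReal
  have key : (fun x => ENNReal.ofReal |(fderiv ℝ g x).det|) =ᵐ[volume] fun _ => 1 := by
    refine ae_eq_of_forall_setLIntegral_eq_of_sigmaFinite hdet measurable_const fun s hs _ => ?_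
    have e : (s ∩ {x | DifferentiableAt ℝ g x} : Set (E m)) =ᵐ[volume] s := by
      filter_upwards [hae] with x hx
      exact propext ⟨fun hh => hh.1, fun hh => ⟨hh, hx⟩⟩
    rw [← setLIntegral_congr e, lintegral_abs_det_fderiv_eq_addHaar_image volume (hs.inter hD)
      (fun x hx => hx.2.hasFDerivAt.hasFDerivWithinAt) h.injective.injOn,
      h.volume_image (hs.inter hD), measure_congr e, setLIntegral_const, one_mul]
  filter_upwards [hae, key] with x hx hk
  have hp := h.grad.isPositive_of_hasFDerivAt hx.hasFDerivAt
  refine ⟨fderiv ℝ g x, hx.hasFDerivAt, hp, ?_⟩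
  have h0 : 0 ≤ LinearMap.det (fderiv ℝ g x : E m →ₗ[ℝ] E m) := by
    have := ((LinearMap.posSemidef_toMatrix_iff (EuclideanSpace.basisFun (Fin m) ℝ)).2 hp).det_nonneg
    rwa [LinearMap.det_toMatrix] at this
  have h1 : |LinearMap.det (fderiv ℝ g x : E m →ₗ[ℝ] E m)| = 1 := by
    have := congrArg ENNReal.toReal hk
    simpa [ENNReal.toReal_ofReal] using this
  rwa [abs_of_nonneg h0] at h1

end Diff

section Sections

variable {m : ℕ} {C : ℝ} {u : E m → ℝ} {g : E m → E m}

lemma exc_continuous (h : IsGrad u g) (x : E m) : Continuous (exc u g x) :=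
  (h.exc x).continuous_fun

lemma Sol.exists_lower (h : Sol C u g) (x : E m) {ρ : ℝ} (hρ : 0 < ρ) :
    ∃ c, 0 < c ∧ ∀ z, ρ ≤ ‖z‖ → c * ‖z‖ ≤ exc u g x z := by
  have hg := h.grad
  rcases (Metric.sphere (0 : E m) ρ).eq_empty_or_nonempty with he | hne
  · refine ⟨1, one_pos, fun z hz => absurd he ?_⟩
    have hz0 : 0 < ‖z‖ := hρ.trans_le hz
    exact (nonempty_iff_ne_empty.1 ⟨(ρ / ‖z‖) • z, by
      rw [mem_sphere_zero_iff_norm, norm_smul, Real.norm_eq_abs, abs_of_pos (div_pos hρ hz0),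
        div_mul_cancel₀ _ hz0.ne']⟩)
  · obtain ⟨e, he, hmin⟩ := (isCompact_sphere (0 : E m) ρ).exists_isMinOn hne
      (exc_continuous hg x).continuousOn
    have he0 : e ≠ 0 := fun h0 => by
      rw [mem_sphere_zero_iff_norm, h0, norm_zero] at he; exact hρ.ne he
    refine ⟨exc u g x e / ρ, div_pos (h.pos x e he0) hρ, fun z hz => ?_⟩
    have hz0 : 0 < ‖z‖ := hρ.trans_le hz
    have h1 : (ρ / ‖z‖) • z ∈ Metric.sphere (0 : E m) ρ := by
      rw [mem_sphere_zero_iff_norm, norm_smul, Real.norm_eq_abs, abs_of_pos (div_pos hρ hz0),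
        div_mul_cancel₀ _ hz0.ne']
    have h2 : exc u g x e ≤ exc u g x ((ρ / ‖z‖) • z) := hmin h1
    have h3 := exc_smul_le hg x z (div_nonneg hρ.le hz0.le) ((div_le_one hz0).2 hz)
    rw [one_mul, one_smul] at h3
    calc exc u g x e / ρ * ‖z‖ ≤ (ρ / ‖z‖ * exc u g x z) / ρ * ‖z‖ := by
          gcongr; exact h2.trans h3
      _ = exc u g x z := by field_simp

lemma Sol.isCompact_sec (h : Sol C u g) (x : E m) (t : ℝ) : IsCompact {z | exc u g x z ≤ t} := by
  obtain ⟨c, hc, hl⟩ := h.exists_lower x one_pos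
  refine Metric.isCompact_of_isClosed_isBounded
    (isClosed_le (exc_continuous h.grad x) continuous_const)
    ((Metric.isBounded_closedBall (x := 0) (r := max 1 (t / c))).subset fun z hz => ?_)
  rw [mem_closedBall_zero_iff]
  by_contra hn
  push Not at hn
  have h1 := hl z ((le_max_left _ _).trans hn.le)
  have h2 := (le_max_right 1 (t / c)).trans_lt hn
  rw [div_lt_iff₀ hc] at h2
  rw [mem_ofPred_eq] at hz
  linarith

lemma Sol.exists_sec_subset_ball (h : Sol C u g) (x : E m) {ρ : ℝ} (hρ : 0 < ρ) :
    ∃ t, 0 < t ∧ ∀ z, exc u g x z ≤ t → ‖z‖ < ρ := by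
  obtain ⟨c, hc, hl⟩ := h.exists_lower x hρ
  refine ⟨c * ρ / 2, by positivity, fun z hz => ?_⟩
  by_contra hn
  push Not at hn
  have := hl z hn
  nlinarith [mul_pos hc hρ]

lemma exc_add (x a b : E m) :
    exc u g x (a + b) = exc u g x a + exc u g (x + a) b + ⟪g (x + a) - g x, b⟫ := by
  simp only [exc, inner_sub_left, inner_add_right, add_assoc]; ring

lemma inner_eq_exc_add (x z : E m) :
    ⟪g (x + z) - g x, z⟫ = exc u g x z + exc u g (x + z) (-z) := by
  simp [exc, inner_sub_left]
  ring

lemma Sol.exc_symm_le (h : Sol C u g) (x z : E m) : exc u g (x + z) (-z) ≤ C * exc u g x z := by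
  have h1 := h.dbl x z
  rw [two_smul, exc_add, inner_eq_exc_add] at h1
  linarith [h.grad.exc_nonneg x z, h.grad.exc_nonneg (x + z) z]

lemma Sol.exc_neg_le (h : Sol C u g) (hC : 0 ≤ C) (x z : E m) :
    exc u g x (-z) ≤ C ^ 2 * exc u g x z := by
  have h1 := h.dbl (x + z) (-z)
  have h2 := h.exc_symm_le x z
  have h3 : exc u g x (-z) ≤ exc u g (x + z) ((2 : ℝ) • -z) := by
    have h4 := exc_add (u := u) (g := g) (x + z) (-z) (-z)
    have h5 := inner_eq_exc_add (u := u) (g := g) (x + z) (-z)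
    rw [add_neg_cancel_right] at h4 h5
    rw [two_smul, h4, h5]
    have h6 := h.grad.exc_nonneg (x + z) (-z)
    have h7 := h.grad.exc_nonneg x (- -z)
    linarith
  nlinarith

lemma IsGrad.inner_le_exc (h : IsGrad u g) (x a b : E m) :
    ⟪g (x + a) - g x, b⟫ ≤ LpAffine.exc u g x a + LpAffine.exc u g (x + a) (-b) := by
  have h1 := h.sub x (x + a - b)
  simp only [LpAffine.exc, inner_sub_left, inner_neg_right]
  rw [show x + a - b - x = a - b by abel, inner_sub_right] at h1
  rw [← sub_eq_add_neg]
  linarith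

/-- Quasi-triangle inequality for the excess. -/
lemma Sol.exc_add_le (h : Sol C u g) (hC : 0 ≤ C) (x a b : E m) :
    exc u g x (a + b) ≤ (C ^ 2 + 2) * (exc u g x a + exc u g (x + a) b) := by
  rw [exc_add]
  have h1 := h.grad.inner_le_exc x a b
  have h2 := h.exc_neg_le hC (x + a) b
  nlinarith [h.grad.exc_nonneg x a, h.grad.exc_nonneg (x + a) b, sq_nonneg C]

/-- Comparable concentric and overlapping sections. -/
lemma Sol.engulf (h : Sol C u g) (hC : 0 ≤ C) {x y p : E m} {s t : ℝ}
    (hx : exc u g x (p - x) ≤ t) (hy : exc u g y (p - y) ≤ s) :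
    exc u g x (y - x) ≤ (C ^ 2 + 2) * (t + C * s) := by
  have h1 := h.exc_add_le hC x (p - x) (y - p)
  have h2 := h.exc_symm_le y (p - y)
  rw [add_sub_cancel, neg_sub] at h2
  rw [add_sub_cancel, add_comm (p - x), sub_add_sub_cancel] at h1
  refine h1.trans (mul_le_mul_of_nonneg_left (add_le_add hx (h2.trans ?_)) (by positivity))
  exact mul_le_mul_of_nonneg_left hy hC

/-- Size of the box contained in a normalized section. -/
def secRad (C : ℝ) (m : ℕ) : ℝ := 1 / (m * C ^ 2)

lemma Sol.section_frame (h : Sol C u g) (hC : 1 ≤ C) (hm : 0 < m) (x : E m) {t : ℝ} (ht : 0 < t) :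
    ∃ W : E m ≃L[ℝ] E m, (∀ z : E m, (∀ i, |z i| ≤ secRad C m) → exc u g x (W z) ≤ t) ∧
      (∀ z, exc u g x z ≤ t → ∀ i, |W.symm z i| ≤ 1) ∧
      |(W : E m →L[ℝ] E m).det| ≤ posConst m * √t ^ m ∧
      √t ^ m ≤ posConst m * |(W : E m →L[ℝ] E m).det| := by
  have hg := h.grad
  have hMA : MABetween (fun z => g (x + z) - g x) {z | exc u g x z ≤ t} 1 1 := by
    have h1 : MABetween g univ 1 1 := fun F hF _ => by simp [h.meas F hF]
    exact (h1.exc x).mono (subset_univ _)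
  obtain ⟨⟨W, hW1, hW2, hW3, hW4⟩, -⟩ := exists_section_position (hg.exc x) hm one_pos zero_le_one ht
    (h.isCompact_sec x t) (exc_zero x) (hg.exc_nonneg x) hMA
  set d := (W : E m →L[ℝ] E m).det
  have hp := one_le_posConst m
  have hs : (√t ^ m) ^ 2 = t ^ m := by rw [← pow_mul, mul_comm, pow_mul, Real.sq_sqrt ht.le]
  have hs0 : 0 ≤ √t ^ m := by positivity
  have hm' : (0 : ℝ) < m := by exact_mod_cast hm
  have hp2 : posConst m ≤ posConst m ^ 2 := by nlinarith
  refine ⟨W, fun z hz => ?_, hW2, ?_, ?_⟩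
  · have e : W z = ∑ i : Fin m, (1 / (m : ℝ)) • ((m * z i) • W (EuclideanSpace.single i 1)) := by
      have e1 : z = ∑ i : Fin m, z i • (EuclideanSpace.single i (1 : ℝ)) := by
        ext j; simp [Pi.single_apply]
      conv_lhs => rw [e1]
      rw [map_sum]
      refine Finset.sum_congr rfl fun i _ => ?_
      rw [map_smul, smul_smul]; congr 1; field_simp
    rw [e]
    refine ((hg.exc x).convexOn.map_sum_le (t := Finset.univ) (w := fun _ => 1 / (m : ℝ))
      (fun i _ => by positivity) (by simp [hm'.ne']) (fun i _ => mem_univ _)).trans ?_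
    have hb : ∀ i, exc u g x ((m * z i) • W (EuclideanSpace.single i 1)) ≤ t := by
      intro i
      set e := W (EuclideanSpace.single i 1)
      have h1 : |m * z i| ≤ 1 / C ^ 2 := by
        rw [abs_mul, Nat.abs_cast]
        calc (m : ℝ) * |z i| ≤ m * secRad C m := by gcongr; exact hz i
          _ = 1 / C ^ 2 := by unfold secRad; field_simp
      have hC2 : 1 ≤ C ^ 2 := one_le_pow₀ hC
      have h2 : 1 / C ^ 2 ≤ 1 := (div_le_one (by positivity)).2 hC2
      rcases le_total 0 (m * z i) with h0 | h0
      · rw [abs_of_nonneg h0] at h1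
        have := exc_smul_mono hg x e h0 (h1.trans h2)
        rw [one_smul] at this
        exact this.trans (hW1 i)
      · rw [abs_of_nonpos h0] at h1
        have h3 := exc_smul_le hg x (-e) (neg_nonneg.2 h0) (h1.trans h2)
        rw [one_mul, one_smul, smul_neg, neg_smul, neg_neg] at h3
        have h4 := h.exc_neg_le (zero_le_one.trans hC) x e
        calc _ ≤ _ := h3
          _ ≤ 1 / C ^ 2 * (C ^ 2 * t) := mul_le_mul h1 (h4.trans (by gcongr; exact hW1 i))
              (hg.exc_nonneg _ _) (by positivity)
          _ = t := by field_simp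
    calc ∑ i : Fin m, (1 / (m : ℝ)) • exc u g x ((m * z i) • W (EuclideanSpace.single i 1))
        ≤ ∑ i : Fin m, (1 / (m : ℝ)) • t := Finset.sum_le_sum fun i _ => by
          simp only [smul_eq_mul]; gcongr; exact hb i
      _ = t := by simp [hm'.ne']
  · refine abs_le_of_sq_le_sq' ?_ (by positivity) |>.2 |> fun hh => hh
    rw [sq_abs, mul_pow, hs]
    nlinarith [pow_pos ht m]
  · refine abs_le_of_sq_le_sq' ?_ (by positivity) |>.2
    rw [hs, mul_pow, sq_abs]
    nlinarith [sq_nonneg d]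

lemma volume_image_cube (W : E m ≃L[ℝ] E m) {r : ℝ} (hr : 0 ≤ r) :
    volume (W '' {z : E m | ∀ i, |z i| ≤ r}) =
      ENNReal.ofReal (|(W : E m →L[ℝ] E m).det| * (2 * r) ^ m) := by
  have e : {z : E m | ∀ i, |z i| ≤ r} = {z : E m | ∀ i, z i ∈ Icc (-r) r} := by
    ext z; simp [abs_le]
  have h1 := Measure.addHaar_image_continuousLinearMap volume (W : E m →L[ℝ] E m)
    {z : E m | ∀ i, |z i| ≤ r}
  rw [e, volume_box, ← ContinuousLinearMap.det, sub_neg_eq_add, ← two_mul,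
    ← ENNReal.ofReal_pow (by positivity), ← ENNReal.ofReal_mul (abs_nonneg _)] at h1
  rw [e]; exact h1

def secConst (C : ℝ) (m : ℕ) : ℝ := posConst m * (2 / secRad C m) ^ m

lemma secRad_pos (hC : 1 ≤ C) (hm : 0 < m) : 0 < secRad C m := by unfold secRad; positivity

lemma secRad_le_one (hC : 1 ≤ C) (hm : 0 < m) : secRad C m ≤ 1 := by
  have : (1 : ℝ) ≤ m := by exact_mod_cast hm
  unfold secRad
  exact (div_le_one (by positivity)).2 (one_le_mul_of_one_le_of_one_le this (one_le_pow₀ hC))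

lemma one_le_secConst (hC : 1 ≤ C) (hm : 0 < m) : 1 ≤ secConst C m := by
  refine one_le_mul_of_one_le_of_one_le (one_le_posConst m) (one_le_pow₀ ?_)
  rw [le_div_iff₀ (secRad_pos hC hm)]
  linarith [secRad_le_one hC hm]

lemma Sol.le_volume_sec (h : Sol C u g) (hC : 1 ≤ C) (hm : 0 < m) (x : E m) {t : ℝ} (ht : 0 < t) :
    ENNReal.ofReal ((secConst C m)⁻¹ * √t ^ m) ≤ volume {z | exc u g x z ≤ t} := by
  obtain ⟨W, hW1, -, -, hW4⟩ := h.section_frame hC hm x ht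
  have hr := secRad_pos hC hm
  have h1 : W '' {z : E m | ∀ i, |z i| ≤ secRad C m} ⊆ {z | exc u g x z ≤ t} := by
    rintro _ ⟨z, hz, rfl⟩; exact hW1 z hz
  refine le_trans ?_ (measure_mono h1)
  rw [volume_image_cube W hr.le]
  refine ENNReal.ofReal_le_ofReal ?_
  have hp := one_le_posConst m
  have hd := abs_nonneg (W : E m →L[ℝ] E m).det
  rw [inv_mul_le_iff₀ (zero_lt_one.trans_le (one_le_secConst hC hm))]
  have e : secConst C m * (|(W : E m →L[ℝ] E m).det| * (2 * secRad C m) ^ m) =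
      posConst m * |(W : E m →L[ℝ] E m).det| * 4 ^ m := by
    have : (2 / secRad C m) ^ m * (2 * secRad C m) ^ m = 4 ^ m := by
      rw [← mul_pow]; congr 1; field_simp; norm_num
    unfold secConst
    linear_combination posConst m * |(W : E m →L[ℝ] E m).det| * this
  rw [e]
  exact hW4.trans (le_mul_of_one_le_right (by positivity) (one_le_pow₀ (by norm_num)))

lemma volume_sec_translate (x : E m) (t : ℝ) :
    volume {y | exc u g x (y - x) ≤ t} = volume {z | exc u g x z ≤ t} := by
  have := measure_preimage_add_right volume (-x) {z | exc u g x z ≤ t}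
  rw [← this]; rfl

/-- Image of a section under a map of controlled oscillation in the section. -/
lemma Sol.volume_image_sec_le (h : Sol C u g) (hC : 1 ≤ C) (hm : 0 < m) (x : E m) {t B : ℝ}
    (ht : 0 < t) (hB : 0 ≤ B) {q : E m → E m}
    (hq : ∀ x', exc u g x (x' - x) ≤ t → ∀ w, exc u g x w ≤ t → ⟪q x' - q x, w⟫ ≤ B * t) :
    volume (q '' {y | exc u g x (y - x) ≤ t}) ≤
      ENNReal.ofReal (posConst m * (2 * B / secRad C m) ^ m * √t ^ m) := by
  obtain ⟨W, hW1, -, -, hW4⟩ := h.section_frame hC hm x ht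
  have hr := secRad_pos hC hm
  set r := secRad C m
  have hd0 : (W : E m →L[ℝ] E m).det ≠ 0 := (W.toLinearEquiv.isUnit_det').ne_zero
  have hsub : ((W : E m →L[ℝ] E m).adjoint) '' (q '' {y | exc u g x (y - x) ≤ t}) ⊆
      (fun z => ((W : E m →L[ℝ] E m).adjoint) (q x) + z) ''
        ((ContinuousLinearEquiv.refl ℝ (E m)) '' {z : E m | ∀ i, |z i| ≤ B * t / r}) := by
    rintro _ ⟨_, ⟨x', hx', rfl⟩, rfl⟩
    refine ⟨(W : E m →L[ℝ] E m).adjoint (q x' - q x), ⟨_, fun i => ?_, rfl⟩, by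
      simp⟩
    have key : ∀ s : ℝ, |s| ≤ r →
        s * (W : E m →L[ℝ] E m).adjoint (q x' - q x) i ≤ B * t := by
      intro s hs
      have h1 := hq x' hx' (W (EuclideanSpace.single i s)) (hW1 _ fun j => by
        rcases eq_or_ne j i with rfl | hj
        · simpa using hs
        · simp [hj, hr.le])
      have h2 : ⟪q x' - q x, W (EuclideanSpace.single i s)⟫ =
          ⟪(W : E m →L[ℝ] E m).adjoint (q x' - q x), EuclideanSpace.single i s⟫ := by
        rw [ContinuousLinearMap.adjoint_inner_left]; rfl
      rw [h2, EuclideanSpace.inner_single_right] at h1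
      simpa using h1
    have k1 := key r (by rw [abs_of_pos hr])
    have k2 := key (-r) (by rw [abs_neg, abs_of_pos hr])
    have hfin : ∀ a : ℝ, r * a ≤ B * t → -r * a ≤ B * t → |a| ≤ B * t / r := fun a h1 h2 => by
      rw [le_div_iff₀ hr]
      rcases abs_cases a with ⟨e, -⟩ | ⟨e, -⟩ <;> rw [e] <;> linarith
    exact hfin _ k1 k2
  have h1 := measure_mono (μ := volume) hsub
  rw [Measure.addHaar_image_continuousLinearMap, ← ContinuousLinearMap.det, det_adjoint_eq,
    image_add_left, measure_preimage_add, volume_image_cube _ (by positivity)] at h1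
  have h1' : ENNReal.ofReal |(W : E m →L[ℝ] E m).det| *
      volume (q '' {y | exc u g x (y - x) ≤ t}) ≤ ENNReal.ofReal ((2 * (B * t / r)) ^ m) := by
    refine h1.trans (ENNReal.ofReal_le_ofReal ?_)
    rw [show ((ContinuousLinearEquiv.refl ℝ (E m) : E m ≃L[ℝ] E m) : E m →L[ℝ] E m) =
      ContinuousLinearMap.id ℝ (E m) from rfl]
    simp [ContinuousLinearMap.det]
  have hdp : 0 < |(W : E m →L[ℝ] E m).det| := abs_pos.2 hd0
  have h2 : volume (q '' {y | exc u g x (y - x) ≤ t}) ≤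
      ENNReal.ofReal ((2 * (B * t / r)) ^ m) / ENNReal.ofReal |(W : E m →L[ℝ] E m).det| := by
    rw [ENNReal.le_div_iff_mul_le (Or.inl (by simpa using hdp)) (Or.inl ENNReal.ofReal_ne_top),
      mul_comm]
    exact h1'
  rw [← ENNReal.ofReal_div_of_pos hdp] at h2
  refine h2.trans (ENNReal.ofReal_le_ofReal ?_)
  rw [div_le_iff₀ hdp]
  have hs : √t ^ m * √t ^ m = t ^ m := by rw [← mul_pow, Real.mul_self_sqrt ht.le]
  have e : (2 * (B * t / r)) ^ m = (2 * B / r) ^ m * (√t ^ m * √t ^ m) := by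
    rw [hs, ← mul_pow]; congr 1; ring
  rw [e]
  calc (2 * B / r) ^ m * (√t ^ m * √t ^ m) ≤ (2 * B / r) ^ m *
        (√t ^ m * (posConst m * |(W : E m →L[ℝ] E m).det|)) := by gcongr
    _ = _ := by ring

/-- Maps with controlled oscillation on sections send null sets to null sets. -/
lemma Sol.lusin (h : Sol C u g) (hC : 1 ≤ C) (hm : 0 < m) {q : E m → E m} {B : ℝ} (hB : 0 ≤ B)
    {N : Set (E m)} (hq : ∀ x ∈ N, ∃ r₀, 0 < r₀ ∧ ∀ t, 0 < t → t ≤ r₀ →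
      ∀ x', exc u g x (x' - x) ≤ t → ∀ w, exc u g x w ≤ t → ⟪q x' - q x, w⟫ ≤ B * t)
    (hN0 : volume N = 0) : volume (q '' N) = 0 := by
  have hC0 : 0 ≤ C := zero_le_one.trans hC
  set κ := (C ^ 2 + 2) * (1 + C * 2) with hκ
  have hκ1 : 1 ≤ κ := by nlinarith
  set M := posConst m * (2 * B / secRad C m) ^ m * √κ ^ m * secConst C m with hM
  have hS := one_le_secConst hC hm
  have hr := secRad_pos hC hm
  have hp := one_le_posConst m
  have hM0 : 0 ≤ M := by positivity
  have key : ∀ ε : ℝ≥0∞, 0 < ε → volume (q '' N) ≤ ENNReal.ofReal M * ε := by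
    intro ε hε
    obtain ⟨U, hNU, hUo, hUε⟩ := N.exists_isOpen_lt_of_lt (μ := volume) ε (by rw [hN0]; exact hε)
    have hrad : ∀ x : N, ∃ t, 0 < t ∧ t ≤ 1 ∧ (∀ y, exc u g x (y - x) ≤ t → y ∈ U) ∧
        ∀ x', exc u g x (x' - x) ≤ κ * t → ∀ w, exc u g x w ≤ κ * t →
          ⟪q x' - q x, w⟫ ≤ B * (κ * t) := by
      rintro ⟨x, hx⟩
      obtain ⟨ρ, hρ, hρU⟩ := Metric.isOpen_iff.1 hUo x (hNU hx)
      obtain ⟨t₁, ht₁, hb⟩ := h.exists_sec_subset_ball x hρ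
      obtain ⟨r₀, hr₀, hq'⟩ := hq x hx
      refine ⟨min 1 (min t₁ (r₀ / κ)), by positivity, min_le_left _ _, fun y hy => ?_, ?_⟩
      · exact hρU (mem_ball_iff_norm.2 (hb _ (hy.trans ((min_le_right _ _).trans (min_le_left _ _)))))
      · refine hq' _ (by positivity) ?_
        rw [mul_comm, ← le_div_iff₀ (by positivity)]
        exact (min_le_right _ _).trans (min_le_right _ _)
    choose t ht0 ht1 htU htq using hrad
    obtain ⟨v, -, hvd, hvc⟩ := Vitali.exists_disjoint_subfamily_covering_enlargement
      (fun x : N => {y | exc u g x (y - x) ≤ t x}) univ t 2 one_lt_two (fun x _ => (ht0 x).le) 1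
      (fun x _ => ht1 x) (fun x _ => ⟨x, by simpa [exc_zero] using (ht0 x).le⟩)
    have hvcount : v.Countable := hvd.countable_of_nonempty_interior fun x _ => by
      refine ⟨x, mem_interior_iff_mem_nhds.2 ?_⟩
      have hcont : Continuous fun y : E m => exc u g x (y - x) :=
        (exc_continuous h.grad x).comp (continuous_id.sub continuous_const)
      refine mem_of_superset ((isOpen_lt hcont continuous_const).mem_nhds
        (by simpa [exc_zero] using ht0 x : (x : E m) ∈ {y | exc u g x (y - x) < t x})) ?_
      intro y (hy : exc u g x (y - x) < t x)
      exact hy.le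
    have hcov : q '' N ⊆ ⋃ x ∈ v, q '' {y | exc u g x (y - x) ≤ κ * t x} := by
      rintro _ ⟨a, ha, rfl⟩
      obtain ⟨b, hb, ⟨p, hpa, hpb⟩, hab⟩ := hvc ⟨a, ha⟩ (mem_univ _)
      refine mem_biUnion hb ⟨a, ?_, rfl⟩
      have := h.engulf hC0 hpb (hpa.trans hab)
      rw [mem_ofPred_eq, hκ]
      calc _ ≤ _ := this
        _ = _ := by ring
    have hsec : ∀ x : N, volume (q '' {y | exc u g x (y - x) ≤ κ * t x}) ≤
        ENNReal.ofReal M * volume {y | exc u g x (y - x) ≤ t x} := by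
      intro x
      refine (h.volume_image_sec_le hC hm x (by have := ht0 x; positivity) hB (htq x)).trans ?_
      rw [volume_sec_translate]
      refine le_trans (le_of_eq ?_) (mul_le_mul_right (h.le_volume_sec hC hm x (ht0 x)) _)
      rw [← ENNReal.ofReal_mul hM0, hM, Real.sqrt_mul (by positivity), mul_pow]
      congr 1
      field_simp
    calc volume (q '' N) ≤ volume (⋃ x ∈ v, q '' {y | exc u g x (y - x) ≤ κ * t x}) :=
          measure_mono hcov
      _ ≤ ∑' x : v, volume (q '' {y | exc u g (x : N) (y - (x : N)) ≤ κ * t x}) :=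
          measure_biUnion_le _ hvcount _
      _ ≤ ∑' x : v, ENNReal.ofReal M * volume {y | exc u g (x : N) (y - (x : N)) ≤ t x} :=
          ENNReal.tsum_le_tsum fun x => hsec x
      _ = ENNReal.ofReal M * volume (⋃ x ∈ v, {y | exc u g x (y - x) ≤ t x}) := by
          rw [ENNReal.tsum_mul_left, measure_biUnion hvcount hvd fun x _ =>
            (isClosed_le ((exc_continuous h.grad x).comp (continuous_id.sub continuous_const))
              continuous_const).measurableSet]
      _ ≤ ENNReal.ofReal M * ε := by
          gcongr
          refine (measure_mono (iUnion₂_subset fun x _ y hy => htU x y hy)).trans hUε.le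
  by_contra hne
  have h1 := key 1 one_pos
  have hfin : volume (q '' N) ≠ ⊤ := ne_top_of_le_ne_top (by simp) h1
  set V := volume (q '' N)
  have h2 := key (V / 2 / (ENNReal.ofReal M + 1)) (by
    refine ENNReal.div_pos (ENNReal.div_pos hne (by simp)).ne' (by simp))
  have h3 : ENNReal.ofReal M * (V / 2 / (ENNReal.ofReal M + 1)) ≤ V / 2 := by
    calc _ ≤ (ENNReal.ofReal M + 1) * (V / 2 / (ENNReal.ofReal M + 1)) := by gcongr; simp
      _ ≤ V / 2 := ENNReal.mul_div_le
  exact absurd (h2.trans h3) (not_le.2 (ENNReal.half_lt_self hne hfin))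

end Sections

section Contact

variable {m : ℕ} {C : ℝ} {u : E m → ℝ} {g : E m → E m}

/-- Points of `Ω` at low height where the tangent plane of `F` stays below `F` on `K`. -/
def contactSet (F : E m → ℝ) (p : E m → E m) (K Ω : Set (E m)) (c : ℝ) : Set (E m) :=
  {x | x ∈ Ω ∧ F x < c ∧ ∀ z ∈ K, F x + ⟪p x, z - x⟫ ≤ F z}

lemma measurableSet_contactSet {F : E m → ℝ} {p : E m → E m} {K Ω : Set (E m)} {c : ℝ}
    (hF : Continuous F) (hp : Continuous p) (hΩ : IsOpen Ω) :
    MeasurableSet (contactSet F p K Ω c) := by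
  have h1 : IsClosed {x | ∀ z ∈ K, F x + ⟪p x, z - x⟫ ≤ F z} := by
    have : {x | ∀ z ∈ K, F x + ⟪p x, z - x⟫ ≤ F z} = ⋂ z ∈ K, {x | F x + ⟪p x, z - x⟫ ≤ F z} := by
      ext; simp
    rw [this]
    exact isClosed_biInter fun z _ => isClosed_le
      (hF.add (hp.inner (continuous_const.sub continuous_id))) continuous_const
  exact hΩ.measurableSet.inter ((isOpen_lt hF continuous_const).measurableSet.inter
    h1.measurableSet)

lemma closedBall_subset_image_contactSet {F : E m → ℝ} {p : E m → E m} {K Ω : Set (E m)}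
    {y₀ : E m} {δ D σ : ℝ} (hF : Continuous F)
    (hd : ∀ x, HasFDerivAt F (innerSL ℝ (p x)) x) (hK : IsCompact K) (hΩ : IsOpen Ω) (hΩK : Ω ⊆ K)
    (hy₀ : y₀ ∈ K) (hbd : ∀ z ∈ K, z ∉ Ω → F y₀ + δ ≤ F z) (hD : ∀ x ∈ K, ‖x - y₀‖ ≤ D)
    (hσ : σ * D < δ) :
    Metric.closedBall 0 σ ⊆ p '' contactSet F p K Ω (F y₀ + δ) := by
  intro q hq
  rw [mem_closedBall_zero_iff] at hq
  have hcont : Continuous fun z => F z - ⟪q, z⟫ := hF.sub (continuous_const.inner continuous_id)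
  obtain ⟨x, hxK, hmin⟩ := hK.exists_isMinOn ⟨y₀, hy₀⟩ hcont.continuousOn
  have h1 : F x - ⟪q, x⟫ ≤ F y₀ - ⟪q, y₀⟫ := hmin hy₀
  have h2 : ⟪q, x - y₀⟫ ≤ σ * D := (real_inner_le_norm _ _).trans
    (mul_le_mul hq (hD x hxK) (norm_nonneg _) ((norm_nonneg _).trans hq))
  rw [inner_sub_right] at h2
  have h3 : F x < F y₀ + δ := by linarith
  have hxΩ : x ∈ Ω := by
    by_contra hn
    linarith [hbd x hxK hn]
  have hloc : IsLocalMin (fun z => F z - ⟪q, z⟫) x :=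
    hmin.isLocalMin (mem_of_superset (hΩ.mem_nhds hxΩ) hΩK)
  have hder : HasFDerivAt (fun z => F z - ⟪q, z⟫) (innerSL ℝ (p x) - innerSL ℝ q) x :=
    (hd x).sub (innerSL ℝ q).hasFDerivAt
  have h0 := hloc.hasFDerivAt_eq_zero hder
  have hpq : p x = q := by
    rw [sub_eq_zero] at h0
    exact (innerSL_inj (𝕜 := ℝ)).1 h0
  refine ⟨x, ⟨hxΩ, h3, fun z hz => ?_⟩, hpq⟩
  have : F x - ⟪q, x⟫ ≤ F z - ⟪q, z⟫ := hmin hz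
  rw [hpq, inner_sub_right]
  linarith

/-- Alexandrov–Bakelman–Pucci estimate. -/
lemma abp {F : E m → ℝ} {p : E m → E m} {K Ω : Set (E m)}
    {y₀ : E m} {δ D σ M : ℝ} (hF : Continuous F) (hp : Continuous p)
    (hd : ∀ x, HasFDerivAt F (innerSL ℝ (p x)) x) (hK : IsCompact K) (hΩ : IsOpen Ω) (hΩK : Ω ⊆ K)
    (hy₀ : y₀ ∈ K) (hbd : ∀ z ∈ K, z ∉ Ω → F y₀ + δ ≤ F z) (hD : ∀ x ∈ K, ‖x - y₀‖ ≤ D)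
    (hσ : σ * D < δ)
    (hlus : ∀ N ⊆ contactSet F p K Ω (F y₀ + δ), volume N = 0 → volume (p '' N) = 0)
    (hdet : ∀ᵐ x, x ∈ contactSet F p K Ω (F y₀ + δ) →
      ∃ P : E m →L[ℝ] E m, HasFDerivAt p P x ∧ |P.det| ≤ M) :
    volume (Metric.closedBall (0 : E m) σ) ≤
      ENNReal.ofReal M * volume (contactSet F p K Ω (F y₀ + δ)) := by
  set A := contactSet F p K Ω (F y₀ + δ)
  have hA : MeasurableSet A := measurableSet_contactSet hF hp hΩ
  set Z := toMeasurable volume {x | ¬ (x ∈ A → ∃ P : E m →L[ℝ] E m, HasFDerivAt p P x ∧ |P.det| ≤ M)}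
  have hZ0 : volume Z = 0 := by rw [measure_toMeasurable]; exact hdet
  have hZ : MeasurableSet Z := measurableSet_toMeasurable _ _
  have hgood : ∀ x ∈ A \ Z, ∃ P : E m →L[ℝ] E m, HasFDerivAt p P x ∧ |P.det| ≤ M := by
    intro x hx
    by_contra hn
    exact hx.2 (subset_toMeasurable _ _ fun hh => hn (hh hx.1))
  have h1 : volume (p '' A) ≤ volume (p '' (A \ Z)) + volume (p '' (A ∩ Z)) := by
    rw [← sdiff_union_inter A Z, image_union]
    simpa using measure_union_le (μ := volume) (p '' (A \ Z)) (p '' (A ∩ Z))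
  rw [hlus _ inter_subset_left (measure_mono_null inter_subset_right hZ0), add_zero] at h1
  have h2 := addHaar_image_le_lintegral_abs_det_fderiv volume (f := p) (f' := fderiv ℝ p)
    (hA.diff hZ) fun x hx => by
      obtain ⟨P, hP, -⟩ := hgood x hx
      rw [hP.fderiv]; exact hP.hasFDerivWithinAt
  have h3 : ∫⁻ x in A \ Z, ENNReal.ofReal |(fderiv ℝ p x).det| ≤
      ∫⁻ _ in A \ Z, ENNReal.ofReal M := by
    refine setLIntegral_mono measurable_const fun x hx => ENNReal.ofReal_le_ofReal ?_
    obtain ⟨P, hP, hPM⟩ := hgood x hx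
    rwa [hP.fderiv]
  rw [setLIntegral_const] at h3
  calc _ ≤ volume (p '' A) := measure_mono
        (closedBall_subset_image_contactSet hF hd hK hΩ hΩK hy₀ hbd hD hσ)
    _ ≤ ENNReal.ofReal M * volume (A \ Z) := h1.trans (h2.trans h3)
    _ ≤ _ := by gcongr; exact sdiff_subset

/-- Second derivative test at contact points where the gradient is merely differentiable. -/
lemma inner_nonneg_of_contact {F : E m → ℝ} {p : E m → E m} {x : E m} {P : E m →L[ℝ] E m}
    (hd : ∀ x, HasFDerivAt F (innerSL ℝ (p x)) x) (hP : HasFDerivAt p P x)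
    (hc : ∀ᶠ z in 𝓝 x, F x + ⟪p x, z - x⟫ ≤ F z) (w : E m) : 0 ≤ ⟪P w, w⟫ := by
  have hline : HasDerivAt (fun s : ℝ => ⟪p (x + s • w), w⟫) ⟪P w, w⟫ 0 := by
    have h1 : HasDerivAt (fun s : ℝ => x + s • w) w 0 := by
      simpa using ((hasDerivAt_id (0 : ℝ)).smul_const w).const_add x
    have h2 : HasFDerivAt p P (x + (0 : ℝ) • w) := by simpa using hP
    have h3 := h2.comp_hasDerivAt (0 : ℝ) h1
    have h4 := h3.inner ℝ (hasDerivAt_const (0 : ℝ) w)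
    simpa using h4
  by_contra hneg
  push Not at hneg
  have h5 : ∀ᶠ s in 𝓝[>] (0 : ℝ), ⟪p (x + s • w), w⟫ < ⟪p x, w⟫ := by
    have h6 := (hasDerivAt_iff_tendsto_slope.1 hline).eventually (gt_mem_nhds hneg)
    have h7 : ∀ᶠ s in 𝓝[>] (0 : ℝ), slope (fun s : ℝ => ⟪p (x + s • w), w⟫) 0 s < 0 :=
      h6.filter_mono (nhdsWithin_mono 0 fun (s : ℝ) (hs : 0 < s) => hs.ne')
    filter_upwards [h7, self_mem_nhdsWithin] with s hs hs0
    rw [slope_def_field] at hs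
    simp only [zero_smul, add_zero, sub_zero] at hs
    have := (div_lt_iff₀ (show (0 : ℝ) < s from hs0)).1 hs
    linarith
  have h8 : ∀ᶠ s in 𝓝[>] (0 : ℝ), F x + s * ⟪p x, w⟫ ≤ F (x + s • w) := by
    have hcont : Tendsto (fun s : ℝ => x + s • w) (𝓝[>] 0) (𝓝 x) := by
      have : Continuous fun s : ℝ => x + s • w := by fun_prop
      simpa using (this.tendsto 0).mono_left nhdsWithin_le_nhds
    filter_upwards [hcont.eventually hc] with s hs
    rwa [add_sub_cancel_left, inner_smul_right] at hs
  obtain ⟨ε, hε, hall⟩ := mem_nhdsGT_iff_exists_Ioc_subset.1 (h5.and h8)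
  have hder : ∀ s : ℝ, HasDerivAt (fun s : ℝ => F (x + s • w)) ⟪p (x + s • w), w⟫ s := by
    intro s
    have h1 : HasDerivAt (fun s : ℝ => x + s • w) w s := by
      simpa using ((hasDerivAt_id s).smul_const w).const_add x
    exact ((hd (x + s • w)).comp_hasDerivAt s h1 : _)
  obtain ⟨s, hs, hslope⟩ := exists_hasDerivAt_eq_slope (fun s : ℝ => F (x + s • w)) _
    (show (0 : ℝ) < ε from hε) (fun s _ => (hder s).continuousAt.continuousWithinAt)
    fun s _ => hder s
  have h9 := (hall ⟨hs.1, hs.2.le⟩).1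
  have h10 := (hall ⟨hε, le_rfl⟩).2
  rw [hslope] at h9
  simp only [zero_smul, add_zero, sub_zero] at h9
  rw [div_lt_iff₀ hε] at h9
  linarith

/-- Second differences. -/
def D2 (u : E m → ℝ) (e x : E m) : ℝ := u (x + e) + u (x - e) - 2 * u x

def D2grad (g : E m → E m) (e x : E m) : E m := g (x + e) + g (x - e) - (2 : ℝ) • g x

lemma D2_hasFDerivAt (h : IsGrad u g) (e x : E m) :
    HasFDerivAt (D2 u e) (innerSL ℝ (D2grad g e x)) x := by
  have h1 : HasFDerivAt (fun z => u (z + e)) (innerSL ℝ (g (x + e))) x :=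
    (hasFDerivAt_comp_add_right e).2 (h.hasFDerivAt (x + e))
  have h2 : HasFDerivAt (fun z => u (z - e)) (innerSL ℝ (g (x - e))) x := by
    simpa only [sub_eq_add_neg] using
      (hasFDerivAt_comp_add_right (-e)).2 (h.hasFDerivAt (x + -e))
  have h3 := (h1.add h2).sub ((h.hasFDerivAt x).const_mul 2)
  refine h3.congr_fderiv ?_
  ext w; simp [D2grad]

lemma D2_continuous (h : IsGrad u g) (e : E m) : Continuous (D2 u e) := by
  have := h.continuous_fun
  unfold D2; fun_prop

lemma D2grad_continuous (h : IsGrad u g) (e : E m) : Continuous (D2grad g e) := by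
  have := h.continuous
  unfold D2grad; fun_prop

lemma D2_eq_exc (e x : E m) : D2 u e x = exc u g x e + exc u g x (-e) := by
  simp [D2, exc, sub_eq_add_neg]; ring

lemma D2_nonneg (h : IsGrad u g) (e x : E m) : 0 ≤ D2 u e x := by
  rw [D2_eq_exc (g := g)]; exact add_nonneg (h.exc_nonneg _ _) (h.exc_nonneg _ _)

/-- Contact estimate for the second difference of an entire solution plus a test function. -/
lemma Sol.abp_D2 (h : Sol C u g) (e : E m) {φ : E m → ℝ} {q : E m → E m} {K Ω G : Set (E m)}
    {y₀ : E m} {δ D σ τ : ℝ} (hφ : Continuous φ) (hq : Continuous q)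
    (hd : ∀ x, HasFDerivAt φ (innerSL ℝ (q x)) x) (hK : IsCompact K) (hΩ : IsOpen Ω) (hΩK : Ω ⊆ K)
    (hy₀ : y₀ ∈ K) (hbd : ∀ z ∈ K, z ∉ Ω → (φ y₀ - D2 u e y₀) + δ ≤ φ z - D2 u e z)
    (hD : ∀ x ∈ K, ‖x - y₀‖ ≤ D) (hσ : σ * D < δ)
    (hlus : ∀ N ⊆ contactSet (fun x => φ x - D2 u e x) (fun x => q x - D2grad g e x) K Ω
      (φ y₀ - D2 u e y₀ + δ), volume N = 0 → volume ((fun x => q x - D2grad g e x) '' N) = 0)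
    (hH : ∀ᵐ x, x ∈ Ω → ∀ X : E m →L[ℝ] E m, HasFDerivAt g X x →
      ∃ H : E m →L[ℝ] E m, HasFDerivAt q H x ∧ (H : E m →ₗ[ℝ] E m).IsSymmetric ∧
        ∀ T : E m →ₗ[ℝ] E m, T.IsPositive → T ∘ₗ X = LinearMap.id →
          0 ≤ LinearMap.trace ℝ _ (T ∘ₗ H) → x ∈ G ∧ LinearMap.trace ℝ _ (T ∘ₗ H) ≤ τ * m) 
    (hm : 0 < m) :
    volume (Metric.closedBall (0 : E m) σ) ≤ ENNReal.ofReal (τ ^ m) *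
      volume (contactSet (fun x => φ x - D2 u e x) (fun x => q x - D2grad g e x) K Ω
      (φ y₀ - D2 u e y₀ + δ) ∩ G) := by
  set F : E m → ℝ := fun x => φ x - D2 u e x with hFdef
  set p : E m → E m := fun x => q x - D2grad g e x with hpdef
  have hF : Continuous F := hφ.sub (D2_continuous h.grad e)
  have hp : Continuous p := hq.sub (D2grad_continuous h.grad e)
  have hdF : ∀ x, HasFDerivAt F (innerSL ℝ (p x)) x := fun x => by
    have := (hd x).sub (D2_hasFDerivAt h.grad e x)
    refine this.congr_fderiv ?_
    ext w; simp [hpdef]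
  have hplus : ∀ a : E m, ∀ᵐ x, ∃ X : E m →L[ℝ] E m, HasFDerivAt g X (x + a) ∧
      (X : E m →ₗ[ℝ] E m).IsPositive ∧ LinearMap.det (X : E m →ₗ[ℝ] E m) = 1 := fun a =>
    (measurePreserving_add_right volume a).quasiMeasurePreserving.ae h.ae_hasFDerivAt
  have key : ∀ᵐ x, x ∈ contactSet F p K Ω (F y₀ + δ) →
      x ∈ G ∧ ∃ P : E m →L[ℝ] E m, HasFDerivAt p P x ∧ |P.det| ≤ τ ^ m := by
    filter_upwards [h.ae_hasFDerivAt, hplus e, hplus (-e), hH] with x ⟨X, hX, hXp, hX1⟩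
      ⟨Y, hY, hYp, hY1⟩ ⟨Z, hZ, hZp, hZ1⟩ hx ⟨hxΩ, _, hxc⟩
    obtain ⟨H, hH1, hH2, hH3⟩ := hx hxΩ X hX
    set P : E m →L[ℝ] E m := (2 : ℝ) • X - Y - Z + H with hP
    have hYd : HasFDerivAt (fun z => g (z + e)) Y x := (hasFDerivAt_comp_add_right e).2 hY
    have hZd : HasFDerivAt (fun z => g (z + -e)) Z x := (hasFDerivAt_comp_add_right (-e)).2 hZ
    have hPd : HasFDerivAt p P x := by
      have h1 := hH1.sub ((hYd.add hZd).sub (hX.const_smul (2 : ℝ)))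
      have e1 : p = fun z => q z - (g (z + e) + g (z + -e) - (2 : ℝ) • g z) := by
        funext z; simp [hpdef, D2grad, sub_eq_add_neg]
      rw [e1]
      refine h1.congr_fderiv ?_
      rw [hP]; abel
    have hPc : (P : E m →ₗ[ℝ] E m) = (2 : ℝ) • (X : E m →ₗ[ℝ] E m) - Y - Z + H := by
      ext w; simp [hP]
    have hPp : ((2 : ℝ) • (X : E m →ₗ[ℝ] E m) - Y - Z + H).IsPositive := by
      refine ⟨?_, fun w => ?_⟩
      · exact (((hXp.1.smul (by simp)).sub hYp.1).sub hZp.1).add hH2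
      · rw [← hPc]
        exact inner_nonneg_of_contact hdF hPd (mem_of_superset (hΩ.mem_nhds hxΩ)
          fun z hz => hxc z (hΩK hz)) w
    obtain ⟨T, hT, hTX, htr, hdet⟩ := contact_det hXp hYp hZp hX1 hY1 hZ1 hPp
    obtain ⟨hxG, hle⟩ := hH3 T hT hTX htr
    refine ⟨hxG, P, hPd, ?_⟩
    have hdet0 : 0 ≤ LinearMap.det ((2 : ℝ) • (X : E m →ₗ[ℝ] E m) - (Y : E m →ₗ[ℝ] E m) -
        (Z : E m →ₗ[ℝ] E m) + (H : E m →ₗ[ℝ] E m)) := by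
      have := ((LinearMap.posSemidef_toMatrix_iff
        (EuclideanSpace.basisFun (Fin m) ℝ)).2 hPp).det_nonneg
      rwa [LinearMap.det_toMatrix] at this
    have e2 : P.det = LinearMap.det ((2 : ℝ) • (X : E m →ₗ[ℝ] E m) - (Y : E m →ₗ[ℝ] E m) -
        (Z : E m →ₗ[ℝ] E m) + (H : E m →ₗ[ℝ] E m)) := by
      rw [← hPc]
    rw [e2, abs_of_nonneg hdet0]
    have h3 := hdet.trans (pow_le_pow_left₀ htr hle m)
    have hm' : (0 : ℝ) < (m : ℝ) ^ m := by positivity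
    rw [mul_pow, mul_comm (τ ^ m)] at h3
    exact le_of_mul_le_mul_left h3 hm'
  have hres := abp hF hp hdF hK hΩ hΩK hy₀ hbd hD hσ hlus (key.mono fun x hx hxA => (hx hxA).2)
  refine hres.trans (mul_le_mul_right (measure_mono_ae ?_) _)
  filter_upwards [key] with x hx hxA
  exact ⟨hxA, (hx hxA).1⟩

end Contact

section Growth

variable {m : ℕ} {C : ℝ} {u : E m → ℝ} {g : E m → E m}

lemma exc_translate_hasFDerivAt (h : IsGrad u g) (x₀ x : E m) :
    HasFDerivAt (fun x => exc u g x₀ (x - x₀)) (innerSL ℝ (g x - g x₀)) x := by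
  have h1 : HasFDerivAt (fun x => u x - u x₀ - ⟪g x₀, x - x₀⟫)
      (innerSL ℝ (g x) - innerSL ℝ (g x₀)) x :=
    ((h.hasFDerivAt x).sub_const (u x₀)).sub
      (((innerSL ℝ (g x₀)).hasFDerivAt).comp x ((hasFDerivAt_id x).sub_const x₀))
  have e : (fun x => exc u g x₀ (x - x₀)) = fun x => u x - u x₀ - ⟪g x₀, x - x₀⟫ := by
    funext y; simp [exc]
  rw [e]
  exact h1.congr_fderiv (by ext w; simp)

lemma Sol.exc_midpoint_le (h : Sol C u g) (x a b : E m) {s t : ℝ} (ha : exc u g x a ≤ s)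
    (hb : exc u g x b ≤ t) (hC : 0 ≤ C) : exc u g x (a + b) ≤ C * (s + t) / 2 := by
  have h1 := (h.grad.exc x).convexOn.2 (mem_univ ((2 : ℝ) • a)) (mem_univ ((2 : ℝ) • b))
    (by norm_num : (0 : ℝ) ≤ 1 / 2) (by norm_num : (0 : ℝ) ≤ 1 / 2) (by norm_num)
  simp only [smul_smul] at h1
  norm_num at h1
  have h2 := h.dbl x a
  have h3 := h.dbl x b
  have h4 := mul_le_mul_of_nonneg_left ha hC
  have h5 := mul_le_mul_of_nonneg_left hb hC
  linarith

lemma IsGrad.inner_le_exc_add (h : IsGrad u g) (x a w : E m) :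
    ⟪g (x + a) - g x, w⟫ ≤ LpAffine.exc u g x (a + w) := by
  rw [exc_add]; linarith [h.exc_nonneg x a, h.exc_nonneg (x + a) w]

/-- The gradient of a second difference plus a multiple of the excess has the Lusin property on
contact sets. -/
lemma Sol.lusin_contact (h : Sol C u g) (hC : 1 ≤ C) (hm : 0 < m) (e x₀ : E m) {a c : ℝ}
    (ha : 0 ≤ a) {K Ω : Set (E m)} (hΩ : IsOpen Ω) (hΩK : Ω ⊆ K) {N : Set (E m)}
    (hN : N ⊆ contactSet (fun x => a * exc u g x₀ (x - x₀) - D2 u e x)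
      (fun x => a • (g x - g x₀) - D2grad g e x) K Ω c) (hN0 : volume N = 0) :
    volume ((fun x => a • (g x - g x₀) - D2grad g e x) '' N) = 0 := by
  have hC0 : 0 ≤ C := zero_le_one.trans hC
  set B := (a + 2) * (C + C * (1 + C ^ 2)) with hB
  refine h.lusin hC hm (B := B) (by positivity) (fun x hx => ?_) hN0
  obtain ⟨hxΩ, -, hxc⟩ := hN hx
  obtain ⟨ρ, hρ, hρΩ⟩ := Metric.isOpen_iff.1 hΩ x hxΩ
  obtain ⟨r₀, hr₀, hball⟩ := h.exists_sec_subset_ball x (half_pos hρ)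
  refine ⟨r₀, hr₀, fun t ht htr x' hx' w hw => ?_⟩
  set v := x' - x with hv
  have hxv : x' = x + v := by rw [hv]; abel
  have hcon : exc u g (x + e) (v + -w) + exc u g (x + -e) (v + -w) ≤
      (a + 2) * exc u g x (v + -w) := by
    have h1 : x + (v + -w) ∈ K := by
      refine hΩK (hρΩ (mem_ball_iff_norm.2 ?_))
      rw [add_sub_cancel_left, ← sub_eq_add_neg]
      have := norm_sub_le v w
      linarith [hball v (hx'.trans htr), hball w (hw.trans htr)]
    have h2 := hxc _ h1
    generalize v + -w = d at h2 ⊢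
    have e1 : x + d - x₀ = d + (x - x₀) := by abel
    have e2 : x + d + e = x + e + d := by abel
    have e3 : x + d - e = x + -e + d := by abel
    have e4 : x₀ + (x - x₀) = x := by abel
    have e5 : x₀ + (d + (x - x₀)) = x + d := by abel
    simp only [exc, D2, D2grad, inner_sub_left, inner_add_left, real_inner_smul_left,
      add_sub_cancel_left, e1, e2, e3, e4, e5, inner_add_right, ← sub_eq_add_neg x e] at h2 ⊢
    linarith
  have h3 : exc u g x (v + w) ≤ C * (t + t) / 2 := h.exc_midpoint_le x v w hx' hw hC0
  have h4 : exc u g x (v + -w) ≤ C * (t + C ^ 2 * t) / 2 :=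
    h.exc_midpoint_le x v (-w) hx' ((h.exc_neg_le hC0 x w).trans (by gcongr)) hC0
  have h5 := h.grad.inner_le_exc_add x v w
  have h6 := h.grad.inner_le_exc_add (x + e) v (-w)
  have h7 := h.grad.inner_le_exc_add (x + -e) v (-w)
  have e1 : ⟪(a • (g x' - g x₀) - D2grad g e x') - (a • (g x - g x₀) - D2grad g e x), w⟫ =
      (a + 2) * ⟪g (x + v) - g x, w⟫ + ⟪g (x + e + v) - g (x + e), -w⟫ +
        ⟪g (x + -e + v) - g (x + -e), -w⟫ := by
    rw [show x + e + v = x' + e by rw [hxv]; abel, show x + -e + v = x' - e by rw [hxv]; abel, ← hxv,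
      ← sub_eq_add_neg]
    simp only [D2grad, inner_sub_left, inner_add_left, inner_smul_left, inner_neg_right]
    simp
    ring
  rw [e1]
  have h8 : (a + 2) * ⟪g (x + v) - g x, w⟫ ≤ (a + 2) * (C * (t + t) / 2) := by
    gcongr; exact h5.trans h3
  have h9 : (a + 2) * exc u g x (v + -w) ≤ (a + 2) * (C * (t + C ^ 2 * t) / 2) := by
    gcongr
  rw [hB]
  have h10 : 0 ≤ (a + 2) * (C * (t + C ^ 2 * t) / 2) := by positivity
  nlinarith

/-- Where the second difference is almost maximal in a section, it is large on a fixed portion. -/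
lemma Sol.growth (h : Sol C u g) (hC : 1 ≤ C) (hm : 0 < m) (e x₀ : E m) {s N : ℝ} (hs : 0 < s)
    (hN : 0 < N) (hS : ∀ z, exc u g x₀ z ≤ s → ‖z‖ ≤ 1)
    (hle : ∀ x, exc u g x₀ (x - x₀) ≤ s → D2 u e x ≤ N) (hx₀ : 7 / 8 * N ≤ D2 u e x₀) :
    ENNReal.ofReal ((s / 4) ^ m) * volume (Metric.closedBall (0 : E m) 1) ≤
      volume {x | exc u g x₀ (x - x₀) ≤ s ∧ N / 2 ≤ D2 u e x} := by
  set a := N / (4 * s) with ha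
  have ha0 : 0 < a := by positivity
  have hcont : Continuous fun x : E m => exc u g x₀ (x - x₀) :=
    (exc_continuous h.grad x₀).comp (continuous_id.sub continuous_const)
  have hK : IsCompact {x | exc u g x₀ (x - x₀) ≤ s} := by
    have : {x | exc u g x₀ (x - x₀) ≤ s} = (fun z => z + x₀) '' {z | exc u g x₀ z ≤ s} := by
      rw [image_add_right]; ext x; simp [sub_eq_add_neg]
    rw [this]
    exact (h.isCompact_sec x₀ s).image (by fun_prop)
  have hgc := h.grad.continuous
  have key := h.abp_D2 (φ := fun x => a * exc u g x₀ (x - x₀)) (q := fun x => a • (g x - g x₀)) e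
    (K := {x | exc u g x₀ (x - x₀) ≤ s}) (Ω := {x | exc u g x₀ (x - x₀) < s}) (G := univ)
    (y₀ := x₀) (δ := N / 8) (D := 1) (σ := N / 16) (τ := a) (continuous_const.mul hcont)
    (by fun_prop) (fun x => by
      refine ((exc_translate_hasFDerivAt h.grad x₀ x).const_mul a).congr_fderiv ?_
      ext w; simp) hK (isOpen_lt hcont continuous_const)
    (fun x (hx : _ < s) => hx.le) (by simp [exc_zero, hs.le]) ?_ ?_ (by linarith) ?_ ?_ hm
  · rw [inter_univ] at key
    have hsub : contactSet (fun x => a * exc u g x₀ (x - x₀) - D2 u e x)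
        (fun x => a • (g x - g x₀) - D2grad g e x) {x | exc u g x₀ (x - x₀) ≤ s}
        {x | exc u g x₀ (x - x₀) < s} (a * exc u g x₀ (x₀ - x₀) - D2 u e x₀ + N / 8) ⊆
        {x | exc u g x₀ (x - x₀) ≤ s ∧ N / 2 ≤ D2 u e x} := by
      rintro x ⟨hx1, hx2, -⟩
      have hx1' : exc u g x₀ (x - x₀) < s := hx1
      refine ⟨hx1'.le, ?_⟩
      rw [sub_self, exc_zero] at hx2
      have := mul_nonneg ha0.le (h.grad.exc_nonneg x₀ (x - x₀))
      linarith
    have h1 := key.trans (mul_le_mul_right (measure_mono hsub) _)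
    rw [Measure.addHaar_closedBall' volume 0 (by positivity : 0 ≤ N / 16)] at h1
    rw [finrank_euclideanSpace_fin] at h1
    have e1 : (N / 16) ^ m = a ^ m * (s / 4) ^ m := by
      rw [← mul_pow]; congr 1; rw [ha]; field_simp; norm_num
    rw [e1, ENNReal.ofReal_mul (by positivity), mul_assoc] at h1
    exact (ENNReal.mul_le_mul_iff_right (by simpa using pow_pos ha0 m) ENNReal.ofReal_ne_top).1 h1
  · intro z hz hz'
    have hz1 : exc u g x₀ (z - x₀) ≤ s := hz
    have hz2 : s ≤ exc u g x₀ (z - x₀) := not_lt.1 hz'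
    have hz3 : a * exc u g x₀ (z - x₀) = N / 4 := by
      rw [le_antisymm hz1 hz2, ha]; field_simp
    have := hle z hz1
    simp only [hz3, sub_self, exc_zero, mul_zero]
    linarith
  · intro x hx
    exact hS _ hx
  · intro N hN hN0
    exact h.lusin_contact hC hm e x₀ ha0.le (isOpen_lt hcont continuous_const)
      (fun x (hx : _ < s) => hx.le) hN hN0
  · filter_upwards [h.ae_hasFDerivAt] with x hx _ X hX
    obtain ⟨X', hX', hpos, -⟩ := hx
    rw [hX'.unique hX] at hpos
    refine ⟨a • X, (hX.sub_const (g x₀)).const_smul a, ?_, fun T hT hTX _ => ⟨mem_univ _, ?_⟩⟩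
    · exact hpos.1.smul (by simp)
    · have : T ∘ₗ ((a • X : E m →L[ℝ] E m) : E m →ₗ[ℝ] E m) = a • LinearMap.id := by
        rw [← hTX]; ext w; simp
      rw [this, map_smul, LinearMap.trace_id, finrank_euclideanSpace_fin, smul_eq_mul]

end Growth

section NSol

variable {m : ℕ} {C r ρ : ℝ} {u : E m → ℝ} {g : E m → E m}

/-- Solutions normalised at the origin, with the unit sublevel set between two balls. -/
structure NSol (C r ρ : ℝ) (u : E m → ℝ) (g : E m → E m) : Prop extends Sol C u g where
  zero : u 0 = 0
  nonneg : ∀ z, 0 ≤ u z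
  inner : ∀ z, ‖z‖ ≤ r → u z ≤ 1
  outer : ∀ z, ρ ≤ ‖z‖ → 1 ≤ u z

lemma NSol.grad_zero (h : NSol C r ρ u g) : g 0 = 0 :=
  (h.grad.uniq 0 0 fun z => by simp [h.zero, h.nonneg]).symm

lemma NSol.exc_zero_eq (h : NSol C r ρ u g) (z : E m) : exc u g 0 z = u z := by
  simp [exc, h.zero, h.grad_zero]

lemma NSol.exists_bound (hC : 1 ≤ C) (hr : 0 < r) (R : ℝ) : ∃ M : ℝ, 0 ≤ M ∧
    ∀ (u : E m → ℝ) (g : E m → E m), NSol C r ρ u g → ∀ z, ‖z‖ ≤ R → u z ≤ M ∧ ‖g z‖ ≤ M := by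
  obtain ⟨j, hj⟩ := pow_unbounded_of_one_lt ((R + 1) / r) (by norm_num : (1 : ℝ) < 2)
  rw [div_lt_iff₀ hr] at hj
  refine ⟨C ^ j, by positivity, fun u g h => ?_⟩
  have key : ∀ i (w : E m), ‖w‖ ≤ r → u ((2 : ℝ) ^ i • w) ≤ C ^ i := by
    intro i w hw
    induction i with
    | zero => simpa using h.inner w hw
    | succ i ih =>
      have h1 := h.dbl 0 ((2 : ℝ) ^ i • w)
      rw [h.exc_zero_eq, h.exc_zero_eq, smul_smul, ← pow_succ'] at h1
      refine h1.trans ?_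
      rw [pow_succ']
      exact mul_le_mul_of_nonneg_left ih (by linarith)
  have hb : ∀ z : E m, ‖z‖ ≤ R + 1 → u z ≤ C ^ j := by
    intro z hz
    have := key j (((2 : ℝ) ^ j)⁻¹ • z) (by
      rw [norm_smul, norm_inv, norm_pow, Real.norm_eq_abs, abs_two, inv_mul_le_iff₀ (by positivity)]
      linarith)
    rwa [smul_smul, mul_inv_cancel₀ (by positivity), one_smul] at this
  intro z hz
  refine ⟨hb z (by linarith), ?_⟩
  have := (h.grad.sub z).norm_le one_pos (M := C ^ j) (fun y hy => hb y (by
    have := norm_sub_norm_le y z; linarith))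
  linarith [h.nonneg z]

lemma NSol.exists_exc_lower (hC : 1 ≤ C) (hr : 0 < r) (R : ℝ) : ∃ c : ℝ, 0 < c ∧
    ∀ (u : E m → ℝ) (g : E m → E m), NSol C r ρ u g → ∀ x z, ‖x‖ ≤ R → ‖z‖ = 1 →
      c ≤ exc u g x z := by
  obtain ⟨M, hM0, hM⟩ := NSol.exists_bound (m := m) (ρ := ρ) hC hr R
  obtain ⟨j₀, hj₀⟩ := pow_unbounded_of_one_lt (ρ + R) (by norm_num : (1 : ℝ) < 2)
  have hC0 : 0 < C := by linarith
  have hrt : 1 < 1 + 1 / (2 * C) := by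
    have : 0 < 1 / (2 * C) := by positivity
    linarith
  obtain ⟨j, hj⟩ := pow_unbounded_of_one_lt (M + 2 ^ j₀ * M + 1) hrt
  refine ⟨(C ^ (j + j₀))⁻¹, by positivity, fun u g h x z hx hz => ?_⟩
  have h2j : (1 : ℝ) ≤ 2 ^ j := one_le_pow₀ (by norm_num)
  have h1 : 2 ^ j * ρ ≤ ‖x + (2 : ℝ) ^ (j + j₀) • z‖ := by
    have h2 := norm_sub_le (x + (2 : ℝ) ^ (j + j₀) • z) x
    rw [add_sub_cancel_left, norm_smul, norm_pow, Real.norm_eq_abs, abs_two, pow_add, hz] at h2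
    have h3 := mul_le_mul_of_nonneg_left hj₀.le (by positivity : (0 : ℝ) ≤ 2 ^ j)
    rw [pow_add]
    nlinarith [norm_nonneg x]
  have h2 := (h.grad.subDbl_of_dbl h.dbl).superlinear hC0 h.zero h.nonneg h.outer j h1
  have hk : ∀ i : ℕ, exc u g x ((2 : ℝ) ^ i • z) ≤ C ^ i * exc u g x z := by
    intro i
    induction i with
    | zero => simp
    | succ i ih =>
      have := h.dbl x ((2 : ℝ) ^ i • z)
      rw [smul_smul, ← pow_succ'] at this
      refine this.trans ?_
      rw [pow_succ', mul_assoc]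
      exact mul_le_mul_of_nonneg_left ih hC0.le
  have h3 := hk (j + j₀)
  have e1 : u (x + (2 : ℝ) ^ (j + j₀) • z) =
      exc u g x ((2 : ℝ) ^ (j + j₀) • z) + u x + 2 ^ (j + j₀) * ⟪g x, z⟫ := by
    simp only [exc, real_inner_smul_right]; ring
  have h4 : ⟪g x, z⟫ ≤ M := by
    have := real_inner_le_norm (g x) z
    rw [hz, mul_one] at this
    exact this.trans (hM u g h x hx).2
  have h5 := (hM u g h x hx).1
  have e : (2 + 1 / C) ^ j = (1 + 1 / (2 * C)) ^ j * 2 ^ j := by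
    rw [← mul_pow]; congr 1; field_simp
  rw [e, e1] at h2
  have h6 := mul_le_mul_of_nonneg_right hj.le (by positivity : (0 : ℝ) ≤ 2 ^ j)
  have h7 := mul_le_mul_of_nonneg_left h4 (by positivity : (0 : ℝ) ≤ 2 ^ (j + j₀))
  have h8 : M ≤ M * 2 ^ j := le_mul_of_one_le_right hM0 h2j
  rw [pow_add 2 j j₀] at *
  rw [inv_le_iff_one_le_mul₀' (by positivity)]
  nlinarith

/-- Uniform power lower bound for the excess. -/
lemma NSol.exists_exc_lower_pow (hC : 1 ≤ C) (hr : 0 < r) (R : ℝ) : ∃ c : ℝ, 0 < c ∧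
    ∃ γ : ℕ, 0 < γ ∧ ∀ (u : E m → ℝ) (g : E m → E m), NSol C r ρ u g → ∀ x z, ‖x‖ ≤ R →
      (‖z‖ ≤ 1 → c * ‖z‖ ^ γ ≤ exc u g x z) ∧ (1 ≤ ‖z‖ → c ≤ exc u g x z) := by
  obtain ⟨c, hc, hlow⟩ := NSol.exists_exc_lower (m := m) (ρ := ρ) hC hr R
  obtain ⟨γ, hγ⟩ := pow_unbounded_of_one_lt C (by norm_num : (1 : ℝ) < 2)
  have hC0 : 0 < C := by linarith
  have hγ0 : 0 < γ := Nat.pos_of_ne_zero (by rintro rfl; simp at hγ; linarith)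
  have h2γ : (1 : ℝ) ≤ 2 ^ γ := one_le_pow₀ (by norm_num)
  refine ⟨c / 2 ^ γ, by positivity, γ, hγ0, fun u g h x z hx => ?_⟩
  have hbig : ∀ w : E m, 1 ≤ ‖w‖ → c ≤ exc u g x w := by
    intro w hw
    have hw0 : 0 < ‖w‖ := by linarith
    have h1 := hlow u g h x (‖w‖⁻¹ • w) hx (by
      rw [norm_smul, norm_inv, norm_norm, inv_mul_cancel₀ hw0.ne'])
    have h2 := exc_smul_mono h.grad x w (inv_nonneg.2 hw0.le) (inv_le_one_of_one_le₀ hw)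
    rw [one_smul] at h2
    exact h1.trans h2
  refine ⟨fun hz => ?_, fun hz => (div_le_self hc.le h2γ).trans (hbig z hz)⟩
  rcases eq_or_ne z 0 with rfl | hz0
  · simp [exc_zero, hγ0.ne']
  have hzn : 0 < ‖z‖ := norm_pos_iff.2 hz0
  have hk : ∀ i : ℕ, exc u g x ((2 : ℝ) ^ i • z) ≤ C ^ i * exc u g x z := by
    intro i
    induction i with
    | zero => simp
    | succ i ih =>
      have := h.dbl x ((2 : ℝ) ^ i • z)
      rw [smul_smul, ← pow_succ'] at this
      refine this.trans ?_
      rw [pow_succ', mul_assoc]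
      exact mul_le_mul_of_nonneg_left ih hC0.le
  obtain ⟨k, hk1, hk2⟩ := exists_nat_pow_near (one_le_inv_iff₀.2 ⟨hzn, hz⟩)
    (by norm_num : (1 : ℝ) < 2)
  have h1 : 1 ≤ ‖(2 : ℝ) ^ (k + 1) • z‖ := by
    rw [norm_smul, norm_pow, Real.norm_eq_abs, abs_two]
    exact ((inv_lt_iff_one_lt_mul₀ hzn).1 hk2).le
  have h2 := (hbig _ h1).trans (hk (k + 1))
  have h3 : C ^ (k + 1) ≤ (2 ^ (k + 1)) ^ γ := by
    rw [← pow_mul, mul_comm, pow_mul]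
    exact pow_le_pow_left₀ hC0.le hγ.le _
  have h4 : (2 : ℝ) ^ k * ‖z‖ ≤ 1 := by
    have := mul_le_mul_of_nonneg_right hk1 hzn.le
    rwa [inv_mul_cancel₀ hzn.ne'] at this
  have h5 : ((2 : ℝ) ^ (k + 1)) ^ γ * ‖z‖ ^ γ ≤ 2 ^ γ := by
    rw [← mul_pow]
    exact pow_le_pow_left₀ (by positivity) (by rw [pow_succ]; linarith) _
  have hex := h.grad.exc_nonneg x z
  have h6 : c ≤ (2 ^ (k + 1)) ^ γ * exc u g x z :=
    h2.trans (mul_le_mul_of_nonneg_right h3 hex)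
  rw [div_mul_eq_mul_div, div_le_iff₀ (by positivity)]
  have hzγ : 0 ≤ ‖z‖ ^ γ := by positivity
  calc c * ‖z‖ ^ γ ≤ (2 ^ (k + 1)) ^ γ * exc u g x z * ‖z‖ ^ γ :=
        mul_le_mul_of_nonneg_right h6 hzγ
    _ = (2 ^ (k + 1)) ^ γ * ‖z‖ ^ γ * exc u g x z := by ring
    _ ≤ 2 ^ γ * exc u g x z := mul_le_mul_of_nonneg_right h5 hex
    _ = _ := by ring

/-- Second differences are bounded by gradient differences. -/
lemma D2_le_inner (h : IsGrad u g) (e x : E m) :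
    D2 u e x ≤ ⟪g (x + e), e⟫ - ⟪g (x + -e), e⟫ := by
  have h1 := h.sub (x + e) x
  have h2 := h.sub (x + -e) x
  simp only [D2, sub_eq_add_neg x e]
  rw [show x - (x + e) = -e by abel, inner_neg_right] at h1
  rw [show x - (x + -e) = e by abel] at h2
  linarith

lemma volume_closedBall_diff_le (hm : 0 < m) (e : E m) (he : ‖e‖ ≤ 1) :
    (volume (Metric.closedBall e 3 \ Metric.closedBall (-e) 3)).toReal ≤
      3 ^ m * (m * ‖e‖) * (volume (Metric.closedBall (0 : E m) 1)).toReal := by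
  have hsub : Metric.closedBall e (3 - 2 * ‖e‖) ⊆ Metric.closedBall e 3 ∩ Metric.closedBall (-e) 3 := by
    intro z hz
    rw [mem_closedBall_iff_norm] at hz
    refine ⟨by rw [mem_closedBall_iff_norm]; linarith [norm_nonneg e], ?_⟩
    rw [mem_closedBall_iff_norm, show z - -e = (z - e) + (2 : ℝ) • e by rw [two_smul]; abel]
    refine (norm_add_le _ _).trans ?_
    rw [norm_smul, Real.norm_eq_abs, abs_two]; linarith
  have h1 : Metric.closedBall e 3 \ Metric.closedBall (-e) 3 ⊆
      Metric.closedBall e 3 \ Metric.closedBall e (3 - 2 * ‖e‖) :=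
    fun z hz => ⟨hz.1, fun h => hz.2 (hsub h).2⟩
  have hfin : volume (Metric.closedBall e (3 - 2 * ‖e‖)) ≠ ⊤ := measure_closedBall_lt_top.ne
  have h2 : volume (Metric.closedBall e 3 \ Metric.closedBall e (3 - 2 * ‖e‖)) =
      volume (Metric.closedBall e 3) - volume (Metric.closedBall e (3 - 2 * ‖e‖)) :=
    measure_sdiff (hsub.trans inter_subset_left) Metric.isClosed_closedBall.nullMeasurableSet hfin
  have h3 := ENNReal.toReal_mono (measure_ne_top_of_subset sdiff_subset
    (measure_closedBall_lt_top (x := e) (r := 3)).ne) (measure_mono (μ := volume) h1)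
  rw [h2, ENNReal.toReal_sub_of_le (measure_mono (hsub.trans inter_subset_left))
    measure_closedBall_lt_top.ne, Measure.addHaar_closedBall' volume e (by norm_num : (0:ℝ) ≤ 3),
    Measure.addHaar_closedBall' volume e (by linarith : (0:ℝ) ≤ 3 - 2 * ‖e‖),
    finrank_euclideanSpace_fin, ENNReal.toReal_mul, ENNReal.toReal_mul,
    ENNReal.toReal_ofReal (by positivity),
    ENNReal.toReal_ofReal (pow_nonneg (by linarith) _)] at h3
  refine h3.trans ?_
  rw [← sub_mul]
  refine mul_le_mul_of_nonneg_right ?_ ENNReal.toReal_nonneg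
  have h4 := one_add_mul_le_pow (a := -(2 * ‖e‖ / 3)) (by linarith) m
  have h5 : (3 - 2 * ‖e‖) ^ m = 3 ^ m * (1 + -(2 * ‖e‖ / 3)) ^ m := by
    rw [← mul_pow]; congr 1; ring
  rw [h5]
  have h6 := mul_le_mul_of_nonneg_left h4 (by positivity : (0 : ℝ) ≤ 3 ^ m)
  have h7 : 0 ≤ (3 : ℝ) ^ m * (m * ‖e‖) := by positivity
  nlinarith

lemma setIntegral_translate (f : E m → ℝ) (e : E m) (R : ℝ) :
    ∫ x in Metric.closedBall (0 : E m) R, f (x + e) = ∫ x in Metric.closedBall e R, f x := by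
  have h := (measurePreserving_add_right (volume : Measure (E m)) e).setIntegral_preimage_emb
    (MeasurableEquiv.addRight e).measurableEmbedding f (Metric.closedBall e R)
  rw [← h]
  congr 2
  ext x; simp

/-- Measure bound for large second differences. -/
lemma volume_D2_ge_le (h : IsGrad u g) (hm : 0 < m) {M : ℝ} (hM : ∀ z, ‖z‖ ≤ 4 → ‖g z‖ ≤ M)
    (e : E m) (he : ‖e‖ ≤ 1) (N : ℝ) :
    N * (volume {x : E m | ‖x‖ ≤ 3 ∧ N ≤ D2 u e x}).toReal ≤
      M * 2 * (3 ^ m * m) * (volume (Metric.closedBall (0 : E m) 1)).toReal * ‖e‖ ^ 2 := by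
  set f : E m → ℝ := fun x => ⟪g x, e⟫ with hf
  have hgc := h.continuous
  have hfc : Continuous f := by fun_prop
  have hfi : ∀ a, IntegrableOn f (Metric.closedBall a 3) := fun a =>
    hfc.continuousOn.integrableOn_compact (isCompact_closedBall _ _)
  have hDc : Continuous (D2 u e) := D2_continuous h e
  have hDi : IntegrableOn (D2 u e) (Metric.closedBall 0 3) :=
    hDc.continuousOn.integrableOn_compact (isCompact_closedBall _ _)
  have hM0 : 0 ≤ M := (norm_nonneg _).trans (hM 0 (by simp))
  have h1 : ∫ x in Metric.closedBall (0 : E m) 3, D2 u e x ≤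
      ∫ x in Metric.closedBall (0 : E m) 3, (f (x + e) - f (x + -e)) :=
    integral_mono hDi ((by fun_prop : Continuous fun x : E m => f (x + e) - f (x + -e)).continuousOn.integrableOn_compact
      (isCompact_closedBall _ _)) (fun x => D2_le_inner h e x)
  rw [integral_sub ((by fun_prop : Continuous fun x : E m => f (x + e)).continuousOn.integrableOn_compact
      (isCompact_closedBall _ _)) ((by fun_prop : Continuous fun x : E m => f (x + -e)).continuousOn.integrableOn_compact
      (isCompact_closedBall _ _)), setIntegral_translate, setIntegral_translate,
    ← integral_inter_add_sdiff Metric.isClosed_closedBall.measurableSet (hfi e)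
      (t := Metric.closedBall (-e) 3),
    ← integral_inter_add_sdiff Metric.isClosed_closedBall.measurableSet (hfi (-e))
      (t := Metric.closedBall e 3), inter_comm (Metric.closedBall (-e) 3)] at h1
  have hb : ∀ a b : E m, ‖a‖ = ‖e‖ →
      ‖∫ x in Metric.closedBall a 3 \ Metric.closedBall b 3, f x‖ ≤
        M * ‖e‖ * (volume (Metric.closedBall a 3 \ Metric.closedBall b 3)).toReal := by
    intro a b ha
    refine norm_setIntegral_le_of_norm_le_const
      ((measure_mono sdiff_subset).trans_lt measure_closedBall_lt_top) (fun x hx => ?_)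
    refine (norm_inner_le_norm _ _).trans (mul_le_mul_of_nonneg_right (hM x ?_) (norm_nonneg _))
    have := norm_sub_norm_le x a
    have h3 := mem_closedBall_iff_norm.1 hx.1
    linarith
  have hb1 := (le_abs_self _).trans (hb e (-e) rfl)
  have hb2 := (neg_le_abs _).trans (hb (-e) e (norm_neg e))
  have hv1 := volume_closedBall_diff_le hm e he
  have hv2 := volume_closedBall_diff_le hm (-e) (by rwa [norm_neg])
  rw [neg_neg, norm_neg] at hv2
  have hv1' := mul_le_mul_of_nonneg_left hv1 (by positivity : 0 ≤ M * ‖e‖)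
  have hv2' := mul_le_mul_of_nonneg_left hv2 (by positivity : 0 ≤ M * ‖e‖)
  have h4 := mul_meas_ge_le_integral_of_nonneg
    (Eventually.of_forall fun x => D2_nonneg h e x) hDi N
  rw [measureReal_def, Measure.restrict_apply (measurableSet_le measurable_const hDc.measurable)] at h4
  have e2 : {x | N ≤ D2 u e x} ∩ Metric.closedBall 0 3 = {x : E m | ‖x‖ ≤ 3 ∧ N ≤ D2 u e x} := by
    ext x; simp [and_comm]
  rw [e2] at h4
  refine h4.trans (h1.trans ?_)
  calc _ ≤ M * ‖e‖ * (3 ^ m * (m * ‖e‖) * (volume (Metric.closedBall (0 : E m) 1)).toReal) +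
      M * ‖e‖ * (3 ^ m * (m * ‖e‖) * (volume (Metric.closedBall (0 : E m) 1)).toReal) := by linarith
    _ = _ := by ring

end NSol

section SecondDiff

variable {m : ℕ} {C r ρ : ℝ} {u : E m → ℝ} {g : E m → E m}

/-- Second differences of normalised solutions are controlled near the origin. -/
theorem NSol.exists_D2_le (hC : 1 ≤ C) (hm : 0 < m) (hr : 0 < r) : ∃ T : ℝ, 0 < T ∧
    ∀ (u : E m → ℝ) (g : E m → E m), NSol C r ρ u g → ∀ x e : E m, ‖x‖ ≤ 1 → ‖e‖ ≤ 1 →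
      D2 u e x ≤ T * ‖e‖ ^ 2 := by
  obtain ⟨M, hM0, hM⟩ := NSol.exists_bound (m := m) (ρ := ρ) hC hr 4
  obtain ⟨c, hc, γ, hγ, hlow⟩ := NSol.exists_exc_lower_pow (m := m) (ρ := ρ) hC hr 3
  set B := (volume (Metric.closedBall (0 : E m) 1)).toReal with hB
  have hB0 : 0 < B := ENNReal.toReal_pos (Metric.measure_closedBall_pos _ _ one_pos).ne'
    measure_closedBall_lt_top.ne
  set I := M * 2 * (3 ^ m * m) * B with hI
  have hI0 : 0 ≤ I := by positivity
  set θ : ℝ := (7 / 8 : ℝ) ^ (1 / ((γ * m : ℕ) : ℝ)) with hθ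
  have hγm : 0 < γ * m := Nat.mul_pos hγ hm
  have hθ0 : 0 < θ := Real.rpow_pos_of_pos (by norm_num) _
  have hθ1 : θ < 1 := Real.rpow_lt_one (by norm_num) (by norm_num) (by positivity)
  have hθp : θ ^ (γ * m) = 7 / 8 := by
    rw [hθ, one_div, Real.rpow_inv_natCast_pow (by norm_num) hγm.ne']
  set κ := (c * (1 - θ) ^ γ / 4) ^ m * B with hκ
  have hθ' : 0 < 1 - θ := by linarith
  have hκ0 : 0 < κ := by positivity
  refine ⟨2 * I / κ + 1, by positivity, fun u g h x₀ e hx₀ he => ?_⟩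
  by_contra! hcon
  set N₀ := (2 * I / κ + 1) * ‖e‖ ^ 2 with hN₀
  have he0 : 0 < ‖e‖ := by
    rcases (norm_nonneg e).eq_or_lt with h0 | h0
    · rw [← h0] at hN₀
      rw [norm_eq_zero.1 h0.symm] at hcon
      simp [D2] at hcon
      simp [hN₀] at hcon
      linarith
    · exact h0
  have hN₀0 : 0 < N₀ := by positivity
  have hmeas := fun N : ℝ => volume_D2_ge_le h.grad hm (fun z hz => (hM u g h z hz).2) e he N
  have step : ∀ k : ℕ, ∃ x : E m, ‖x‖ ≤ 2 - θ ^ k ∧ (8 / 7) ^ k * N₀ ≤ D2 u e x := by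
    intro k
    induction k with
    | zero => exact ⟨x₀, by norm_num [hx₀], by simpa using hcon.le⟩
    | succ k ih =>
      obtain ⟨x, hx, hxN⟩ := ih
      have hθk : 0 < θ ^ k := by positivity
      have hθk1 : θ ^ k ≤ 1 := pow_le_one₀ hθ0.le hθ1.le
      set s := c * ((1 - θ) * θ ^ k) ^ γ with hs
      have hr1 : (1 - θ) * θ ^ k < 1 := by nlinarith
      have hs0 : 0 < s := by positivity
      have hx3 : ‖x‖ ≤ 3 := by linarith
      have hsec : ∀ z, exc u g x z ≤ s → ‖z‖ ≤ (1 - θ) * θ ^ k := by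
        intro z hz
        rcases le_total ‖z‖ 1 with h1 | h1
        · have h2 := ((hlow u g h x z hx3).1 h1).trans hz
          exact le_of_pow_le_pow_left₀ hγ.ne' (by positivity) (le_of_mul_le_mul_left h2 hc)
        · have h2 := ((hlow u g h x z hx3).2 h1).trans hz
          have h3 : ((1 - θ) * θ ^ k) ^ γ < 1 := pow_lt_one₀ (by positivity) hr1 hγ.ne'
          nlinarith
      by_contra! hno
      set N := (8 / 7) ^ (k + 1) * N₀ with hN
      have hN0 : 0 < N := by positivity
      have hgr := h.growth hC hm e x hs0 hN0 (fun z hz => (hsec z hz).trans hr1.le)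
        (fun x' hx' => by
          refine (hno x' ?_).le
          have h1 := hsec _ hx'
          have h2 := norm_sub_norm_le x' x
          rw [pow_succ]
          linarith) (by rw [hN, pow_succ]; linarith)
      have hsub : {x' | exc u g x (x' - x) ≤ s ∧ N / 2 ≤ D2 u e x'} ⊆
          {x' : E m | ‖x'‖ ≤ 3 ∧ N / 2 ≤ D2 u e x'} := by
        rintro x' ⟨h1, h2⟩
        refine ⟨?_, h2⟩
        have h3 := hsec _ h1
        have h4 := norm_sub_norm_le x' x
        linarith
      have hfin : volume {x' : E m | ‖x'‖ ≤ 3 ∧ N / 2 ≤ D2 u e x'} ≠ ⊤ :=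
        measure_ne_top_of_subset (s := Metric.closedBall 0 3)
          (fun z hz => mem_closedBall_zero_iff.2 hz.1) measure_closedBall_lt_top.ne
      have h5 := ENNReal.toReal_mono hfin (hgr.trans (measure_mono hsub))
      rw [ENNReal.toReal_mul, ENNReal.toReal_ofReal (by positivity), ← hB] at h5
      have h6 := (mul_le_mul_of_nonneg_left h5 (half_pos hN0).le).trans (hmeas (N / 2))
      rw [← hI] at h6
      have h7 : (s / 4) ^ m * B = κ * (7 / 8) ^ k := by
        rw [hs, hκ, ← hθp, ← pow_mul, mul_comm (γ * m) k, pow_mul, pow_mul, mul_right_comm,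
          ← mul_pow, mul_pow (1 - θ)]
        congr 2
        ring
      rw [h7, hN] at h6
      have h8 : (8 / 7 : ℝ) ^ (k + 1) * N₀ / 2 * (κ * (7 / 8) ^ k) = 4 / 7 * N₀ * κ := by
        have : (8 / 7 : ℝ) ^ k * (7 / 8) ^ k = 1 := by rw [← mul_pow]; norm_num
        rw [pow_succ]
        linear_combination (4 / 7 * N₀ * κ) * this
      rw [h8, hN₀] at h6
      have h9 : (2 * I / κ + 1) * κ = 2 * I + κ := by field_simp
      have h10 : 4 / 7 * ((2 * I / κ + 1) * ‖e‖ ^ 2) * κ = 4 / 7 * (2 * I + κ) * ‖e‖ ^ 2 := by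
        rw [← h9]; ring
      rw [h10] at h6
      have h11 := le_of_mul_le_mul_right h6 (by positivity)
      linarith
  obtain ⟨Q, hQ⟩ := (isCompact_closedBall (0 : E m) 2).bddAbove_image
    (D2_continuous h.grad e).continuousOn
  obtain ⟨k, hk⟩ := pow_unbounded_of_one_lt (Q / N₀) (by norm_num : (1 : ℝ) < 8 / 7)
  obtain ⟨x, hx, hxk⟩ := step k
  have h1 := hQ (mem_image_of_mem _ (show x ∈ Metric.closedBall (0 : E m) 2 by
    have := pow_pos hθ0 k
    simp; linarith))
  rw [div_lt_iff₀ hN₀0] at hk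
  linarith

end SecondDiff

section Global

variable {m : ℕ} {C : ℝ} {u : E m → ℝ} {g : E m → E m}

/-- A determinant is bounded by the norm of one column and powers of the operator norm. -/
lemma abs_det_le (A : E m →L[ℝ] E m) {e : E m} (he : ‖e‖ = 1) :
    |A.det| ≤ ‖A‖ ^ (m - 1) * ‖A e‖ := by
  have hm : 0 < m := by
    rcases Nat.eq_zero_or_pos m with rfl | h
    · rw [Subsingleton.elim e 0, norm_zero] at he; norm_num at he
    · exact h
  let i₀ : Fin m := ⟨0, hm⟩
  have hv : Orthonormal ℝ (({i₀} : Set (Fin m)).domRestrict (fun _ => e)) := by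
    refine ⟨fun i => he, fun i j hij => (hij (Subsingleton.elim i j)).elim⟩
  obtain ⟨b, hb⟩ := hv.exists_orthonormalBasis_extension_of_card_eq (by simp)
  have hb0 : b i₀ = e := hb i₀ rfl
  have : Fact (Module.finrank ℝ (E m) = m) := ⟨finrank_euclideanSpace_fin⟩
  have h1 := b.toBasis.det_comp (A : E m →ₗ[ℝ] E m) b.toBasis
  rw [b.toBasis.det_self, mul_one] at h1
  have h2 := (b.toBasis.orientation).volumeForm_robust' b (fun i => A (b i))
  have h3 := (b.toBasis.orientation).abs_volumeForm_apply_le (fun i => A (b i))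
  have h4 : b.toBasis.det (fun i => A (b i)) = A.det := by
    rw [show A.det = LinearMap.det (A : E m →ₗ[ℝ] E m) from rfl, ← h1]
    congr 1
  rw [h2, h4] at h3
  refine h3.trans ?_
  rw [← Finset.mul_prod_erase Finset.univ _ (Finset.mem_univ i₀), hb0, mul_comm]
  refine mul_le_mul_of_nonneg_right ?_ (norm_nonneg _)
  calc _ ≤ ∏ _i ∈ Finset.univ.erase i₀, ‖A‖ := by
        refine Finset.prod_le_prod (fun i _ => norm_nonneg _) (fun i _ => ?_)
        have := A.le_opNorm (b i)
        rwa [b.norm_eq_one, mul_one] at this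
    _ = _ := by simp

lemma Sol.ma (h : Sol C u g) : MABetween g univ 1 1 := fun F hF _ => by simp [h.meas F hF]

lemma MABetween.meas (h : MABetween g univ 1 1) (F : Set (E m)) (hF : IsCompact F) :
    volume (g '' F) = volume F := by
  obtain ⟨h1, h2⟩ := h F hF (subset_univ _)
  rw [ENNReal.ofReal_one, one_mul] at h1 h2
  exact le_antisymm h2 h1

lemma Sol.shift (h : Sol C u g) (x : E m) : Sol C (exc u g x) (fun z => g (x + z) - g x) where
  grad := h.grad.exc x
  dbl y z := by simpa only [exc_exc] using h.dbl (x + y) z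
  pos y z hz := by simpa only [exc_exc] using h.pos (x + y) z hz
  meas := (show MABetween _ univ 1 1 from (h.ma.exc x)).meas

lemma exc_comp_linear (W : E m ≃L[ℝ] E m) (c : ℝ) (y z : E m) :
    exc (fun z => c * u (W z)) (fun z => c • (W : E m →L[ℝ] E m).adjoint (g (W z))) y z =
      c * exc u g (W y) (W z) := by
  simp only [exc, map_add, real_inner_smul_left, ContinuousLinearMap.adjoint_inner_left,
    ContinuousLinearEquiv.coe_coe]
  ring

lemma Sol.comp_linear (h : Sol C u g) (W : E m ≃L[ℝ] E m) {c : ℝ} (hc : 0 < c)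
    (hd : c ^ m * (W : E m →L[ℝ] E m).det ^ 2 = 1) :
    Sol C (fun z => c * u (W z)) (fun z => c • (W : E m →L[ℝ] E m).adjoint (g (W z))) where
  grad := h.grad.comp_linear W hc
  dbl y z := by
    rw [exc_comp_linear, exc_comp_linear, map_smul, mul_left_comm]
    exact mul_le_mul_of_nonneg_left (h.dbl _ _) hc.le
  pos y z hz := by
    rw [exc_comp_linear]
    exact mul_pos hc (h.pos _ _ (by simpa using hz))
  meas := by
    have := h.ma.comp_linear W hc
    rw [hd, one_mul, preimage_univ] at this
    exact this.meas

/-- Every section of a solution can be normalised by a linear map. -/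
lemma exists_normalize (hC : 1 ≤ C) (hm : 0 < m) : ∃ r ρ : ℝ, 0 < r ∧
    ∀ (u : E m → ℝ) (g : E m → E m), Sol C u g → ∀ (x : E m) (R : ℝ), 0 < R →
      ∃ W : E m ≃L[ℝ] E m, |(W : E m →L[ℝ] E m).det| = √R ^ m ∧
        NSol C r ρ (fun y => R⁻¹ * exc u g x (W y))
          (fun y => R⁻¹ • (W : E m →L[ℝ] E m).adjoint (g (x + W y) - g x)) := by
  have hp := one_le_posConst m
  set P := posConst m with hP
  have hP0 : 0 < P := by linarith
  refine ⟨secRad C m / P, √m * P + 1, div_pos (secRad_pos hC hm) hP0, fun u g h x R hR => ?_⟩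
  obtain ⟨W, hW1, hW2, hW3, hW4⟩ := h.section_frame hC hm x hR
  have hR0 : 0 < √R ^ m := pow_pos (Real.sqrt_pos.2 hR) m
  set d := |(W : E m →L[ℝ] E m).det| with hd
  have hd0 : 0 < d := by
    rcases (abs_nonneg (W : E m →L[ℝ] E m).det).eq_or_lt with h0 | h0
    · rw [hd, ← h0] at hW4; linarith
    · exact h0
  obtain ⟨l, hl0, hl⟩ : ∃ l : ℝ, 0 < l ∧ l ^ m = √R ^ m / d :=
    ⟨(√R ^ m / d) ^ (1 / (m : ℝ)), Real.rpow_pos_of_pos (by positivity) _, by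
      rw [one_div, Real.rpow_inv_natCast_pow (by positivity) hm.ne']⟩
  have hlP : l ≤ P := by
    by_contra! hcon
    have h1 : l ≤ l ^ m := le_self_pow₀ (hp.trans hcon.le) hm.ne'
    rw [hl] at h1
    have h2 : √R ^ m / d ≤ P := (div_le_iff₀ hd0).2 hW4
    linarith
  have hlP' : 1 ≤ l * P := by
    by_contra! hcon
    have h1 : l < 1 := by nlinarith
    have h2 : l ^ m ≤ l := pow_le_of_le_one hl0.le h1.le hm.ne'
    rw [hl, div_le_iff₀ hd0] at h2
    have h3 := mul_le_mul_of_nonneg_left hW3 hl0.le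
    nlinarith
  set W' : E m ≃L[ℝ] E m := W.trans (ContinuousLinearEquiv.smulLeft (Units.mk0 l hl0.ne')) with hW'
  have hWa : ∀ z, W' z = l • W z := fun z => rfl
  have hdet : (W' : E m →L[ℝ] E m).det = l ^ m * (W : E m →L[ℝ] E m).det := by
    have : ((W' : E m →L[ℝ] E m) : E m →ₗ[ℝ] E m) = l • ((W : E m →L[ℝ] E m) : E m →ₗ[ℝ] E m) := by
      ext z; simp [hWa]
    rw [show (W' : E m →L[ℝ] E m).det = LinearMap.det ((W' : E m →L[ℝ] E m) : E m →ₗ[ℝ] E m) from rfl,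
      this, LinearMap.det_smul, finrank_euclideanSpace_fin]
  have hdet' : |(W' : E m →L[ℝ] E m).det| = √R ^ m := by
    rw [hdet, abs_mul, abs_of_pos (pow_pos hl0 m), hl, ← hd]; field_simp
  refine ⟨W', hdet', ?_⟩
  have hsol := (h.shift x).comp_linear W' (inv_pos.2 hR) (by
    rw [← sq_abs, hdet', ← pow_mul, mul_comm m 2, pow_mul, Real.sq_sqrt hR.le, ← mul_pow,
      inv_mul_cancel₀ hR.ne', one_pow])
  refine ⟨hsol, by simp [exc_zero], fun z => mul_nonneg (inv_nonneg.2 hR.le) (h.grad.exc_nonneg _ _),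
    fun z hz => ?_, fun z hz => ?_⟩
  · rw [inv_mul_le_iff₀ hR, mul_one, hWa, ← map_smul]
    refine hW1 _ (fun i => ?_)
    rw [PiLp.smul_apply, smul_eq_mul, abs_mul, abs_of_pos hl0]
    have h1 : |z i| ≤ secRad C m / P := by
      rw [← Real.norm_eq_abs]; exact (PiLp.norm_apply_le z i).trans hz
    calc l * |z i| ≤ P * (secRad C m / P) := mul_le_mul hlP h1 (abs_nonneg _) hP0.le
      _ = secRad C m := by field_simp
  · by_contra! hcon
    rw [inv_mul_lt_iff₀ hR, mul_one] at hcon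
    have h1 := hW2 _ hcon.le
    have h2 : ∀ i, |z i| ≤ P := by
      intro i
      have h3 := h1 i
      rw [hWa, map_smul, W.symm_apply_apply, PiLp.smul_apply, smul_eq_mul, abs_mul,
        abs_of_pos hl0] at h3
      have h4 := mul_le_mul_of_nonneg_right h3 hP0.le
      have h5 := mul_le_mul_of_nonneg_right hlP' (abs_nonneg (z i))
      linarith
    have h3 : ‖z‖ ≤ √m * P := by
      rw [EuclideanSpace.norm_eq, ← Real.sqrt_sq hP0.le, ← Real.sqrt_mul (by positivity)]
      refine Real.sqrt_le_sqrt ?_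
      calc ∑ i, ‖z i‖ ^ 2 ≤ ∑ _i : Fin m, P ^ 2 := Finset.sum_le_sum fun i _ =>
            pow_le_pow_left₀ (norm_nonneg _) (h2 i) 2
        _ = m * P ^ 2 := by simp
    linarith

lemma D2_exc (x e y : E m) : D2 (exc u g x) e y = D2 u e (x + y) := by
  simp only [D2, exc, inner_add_right, inner_sub_right, ← add_assoc, ← add_sub_assoc]; ring

/-- Entire solutions have globally bounded second differences. -/
theorem Sol.exists_D2_le (h : Sol C u g) (hC : 1 ≤ C) (hm : 0 < m) :
    ∃ L : ℝ, 0 < L ∧ ∀ e x, D2 u e x ≤ L * ‖e‖ ^ 2 := by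
  obtain ⟨r, ρ, hr, hnorm⟩ := exists_normalize hC hm
  obtain ⟨T, hT, hD⟩ := NSol.exists_D2_le (ρ := ρ) hC hm hr
  obtain ⟨c, hc, hlow⟩ := h.exists_lower 0 one_pos
  set B := √(T / c) with hB
  have hB0 : 0 < B := Real.sqrt_pos.2 (by positivity)
  refine ⟨T * (B ^ (m - 1)) ^ 2, by positivity, fun e x => ?_⟩
  set S := max ‖e‖ ‖x‖ with hS
  have hS0 : 0 ≤ S := (norm_nonneg e).trans (le_max_left _ _)
  set R := max (c / T) ((B ^ (m - 1) * S) ^ 2 + 1) with hR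
  have hR0 : 0 < R := lt_max_of_lt_left (by positivity)
  obtain ⟨W, hdet, hN⟩ := hnorm u g h 0 R hR0
  have hDW : ∀ w y, ‖W.symm w‖ ≤ 1 → ‖W.symm y‖ ≤ 1 →
      D2 u w y ≤ T * R * ‖W.symm w‖ ^ 2 := by
    intro w y hw hy
    have h1 := hD _ _ hN _ _ hy hw
    have h2 : D2 (fun y => R⁻¹ * exc u g 0 (W y)) (W.symm w) (W.symm y) = R⁻¹ * D2 u w y := by
      have := D2_exc (u := u) (g := g) 0 w y
      rw [zero_add] at this
      rw [← this]
      simp only [D2, map_add, map_sub, W.apply_symm_apply]; ring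
    rw [h2, inv_mul_le_iff₀ hR0] at h1
    linarith
  have hW : ∀ z, ‖W z‖ ≤ B * √R * ‖z‖ := by
    have hunit : ∀ w : E m, ‖w‖ = 1 → 1 ≤ B * √R * ‖W.symm w‖ := by
      intro w hw
      rw [hB, ← Real.sqrt_mul (by positivity), ← Real.sqrt_sq (norm_nonneg (W.symm w)),
        ← Real.sqrt_mul (by positivity), Real.one_le_sqrt, div_mul_eq_mul_div,
        div_mul_eq_mul_div, le_div_iff₀ hc, one_mul]
      rcases le_total ‖W.symm w‖ 1 with h1 | h1
      · have h2 := hDW w 0 h1 (by simp)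
        rw [D2_eq_exc (g := g)] at h2
        have h3 := hlow w hw.ge
        rw [hw, mul_one] at h3
        linarith [h.grad.exc_nonneg 0 (-w)]
      · have h2 : c ≤ T * R := by
          have : c / T ≤ R := le_max_left _ _
          rw [div_le_iff₀ hT] at this; linarith
        exact h2.trans (le_mul_of_one_le_right (by positivity) (one_le_pow₀ h1))
    intro z
    rcases eq_or_ne (W z) 0 with h0 | h0
    · rw [h0, norm_zero]; positivity
    · have hn : 0 < ‖W z‖ := norm_pos_iff.2 h0
      have := hunit (‖W z‖⁻¹ • W z) (by rw [norm_smul, norm_inv, norm_norm, inv_mul_cancel₀ hn.ne'])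
      rw [map_smul, W.symm_apply_apply, norm_smul, norm_inv, norm_norm, mul_left_comm,
        le_inv_mul_iff₀ hn, mul_one] at this
      exact this
  have hop : ‖(W : E m →L[ℝ] E m)‖ ≤ B * √R :=
    ContinuousLinearMap.opNorm_le_bound _ (by positivity) hW
  have hsR : 0 < √R := Real.sqrt_pos.2 hR0
  have hinv : ∀ w, √R * ‖W.symm w‖ ≤ B ^ (m - 1) * ‖w‖ := by
    intro w
    rcases eq_or_ne (W.symm w) 0 with h0 | h0
    · rw [h0, norm_zero, mul_zero]; positivity
    have hn : 0 < ‖W.symm w‖ := norm_pos_iff.2 h0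
    have h1 := abs_det_le (W : E m →L[ℝ] E m) (e := ‖W.symm w‖⁻¹ • W.symm w)
      (by rw [norm_smul, norm_inv, norm_norm, inv_mul_cancel₀ hn.ne'])
    rw [hdet, ContinuousLinearEquiv.coe_coe, map_smul, W.apply_symm_apply, norm_smul, norm_inv,
      norm_norm] at h1
    have h2 : ‖(W : E m →L[ℝ] E m)‖ ^ (m - 1) ≤ (B * √R) ^ (m - 1) :=
      pow_le_pow_left₀ (norm_nonneg _) hop _
    have h3 := h1.trans (mul_le_mul_of_nonneg_right h2 (by positivity))
    have e1 : √R ^ m = √R ^ (m - 1) * √R := by rw [← pow_succ]; congr 1; omega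
    rw [e1, mul_pow] at h3
    have h4 : √R ≤ B ^ (m - 1) * (‖W.symm w‖⁻¹ * ‖w‖) := by
      refine le_of_mul_le_mul_left (a := √R ^ (m - 1)) ?_ (by positivity)
      linarith
    have h5 := mul_le_mul_of_nonneg_right h4 hn.le
    have e2 : B ^ (m - 1) * (‖W.symm w‖⁻¹ * ‖w‖) * ‖W.symm w‖ = B ^ (m - 1) * ‖w‖ := by
      field_simp
    linarith
  have hone : ∀ w : E m, ‖w‖ ≤ S → ‖W.symm w‖ ≤ 1 := by
    intro w hw
    have h1 := hinv w
    have h2 : B ^ (m - 1) * S ≤ √R := by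
      refine Real.le_sqrt_of_sq_le ?_
      have : (B ^ (m - 1) * S) ^ 2 + 1 ≤ R := le_max_right _ _
      linarith
    have h3 : B ^ (m - 1) * ‖w‖ ≤ B ^ (m - 1) * S := by gcongr
    by_contra! hcon
    nlinarith
  refine (hDW e x (hone e (le_max_left _ _)) (hone x (le_max_right _ _))).trans ?_
  have h1 := pow_le_pow_left₀ (by positivity) (hinv e) 2
  rw [mul_pow, mul_pow, Real.sq_sqrt hR0.le] at h1
  have h2 := mul_le_mul_of_nonneg_left h1 hT.le
  linarith

end Global

section LinearizedBounds

variable {m : ℕ} {C L : ℝ} {u : E m → ℝ} {g : E m → E m}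

lemma IsGrad.exc_le_of_D2_le (h : IsGrad u g) (hL : ∀ e x, D2 u e x ≤ L * ‖e‖ ^ 2) (x z : E m) :
    LpAffine.exc u g x z ≤ L * ‖z‖ ^ 2 := by
  have := hL z x
  rw [D2_eq_exc (g := g)] at this
  linarith [h.exc_nonneg x (-z)]

lemma IsGrad.norm_sub_le_of_D2_le (h : IsGrad u g) (hL : ∀ e x, D2 u e x ≤ L * ‖e‖ ^ 2)
    (x a : E m) : ‖g (x + a) - g x‖ ≤ 4 * L * ‖a‖ := by
  set w := g (x + a) - g x with hw
  rcases eq_or_ne w 0 with h0 | h0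
  · rcases eq_or_ne a 0 with ha | ha
    · rw [h0, ha]; simp
    · have h1 := (D2_nonneg h a x).trans (hL a x)
      have h2 : 0 < ‖a‖ ^ 2 := pow_pos (norm_pos_iff.2 ha) 2
      have h3 : 0 ≤ L := by
        by_contra! hc
        nlinarith
      rw [h0, norm_zero]; positivity
  have hn : 0 < ‖w‖ := norm_pos_iff.2 h0
  have ha : a ≠ 0 := by rintro rfl; simp [hw] at h0
  have hL0 : 0 ≤ L := by
    have h1 := (D2_nonneg h a x).trans (hL a x)
    have h2 : 0 < ‖a‖ ^ 2 := pow_pos (norm_pos_iff.2 ha) 2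
    by_contra! hc
    nlinarith
  set b := (‖a‖ / ‖w‖) • w with hb
  have hbn : ‖b‖ = ‖a‖ := by
    rw [hb, norm_smul, norm_div, norm_norm, norm_norm, div_mul_cancel₀ _ hn.ne']
  have h1 := h.inner_le_exc_add x a b
  have h2 := h.exc_le_of_D2_le hL x (a + b)
  have h3 : ‖a + b‖ ^ 2 ≤ (‖a‖ + ‖a‖) ^ 2 := by
    have := norm_add_le a b
    rw [hbn] at this
    gcongr
  have h4 : ⟪w, b⟫ = ‖a‖ * ‖w‖ := by
    rw [hb, inner_smul_right, real_inner_self_eq_norm_sq]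
    field_simp
  rw [← hw, h4] at h1
  have h5 : ‖a‖ * ‖w‖ ≤ L * (‖a‖ + ‖a‖) ^ 2 := h1.trans (h2.trans (by gcongr))
  have : 0 < ‖a‖ := norm_pos_iff.2 ha
  refine le_of_mul_le_mul_left (a := ‖a‖) ?_ this
  linarith

lemma IsGrad.lipschitz_of_D2_le (h : IsGrad u g) (hL : ∀ e x, D2 u e x ≤ L * ‖e‖ ^ 2) :
    LipschitzWith (4 * L).toNNReal g := by
  refine LipschitzWith.of_dist_le_mul fun x y => ?_
  have := h.norm_sub_le_of_D2_le hL y (x - y)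
  rw [add_sub_cancel] at this
  rw [dist_eq_norm, dist_eq_norm]
  refine this.trans ?_
  gcongr
  exact Real.le_coe_toNNReal _

lemma comp_self_of_comp_eq_id {X : E m →L[ℝ] E m} {T : E m →ₗ[ℝ] E m}
    (hTX : T ∘ₗ (X : E m →ₗ[ℝ] E m) = LinearMap.id) (z : E m) : X (T z) = z := by
  have : (X : E m →ₗ[ℝ] E m) * T = 1 := mul_eq_one_comm.1 hTX
  exact LinearMap.congr_fun this z

/-- The inverse of a positive map with bounded norm is bounded below. -/
lemma le_inner_of_comp_eq_id {X : E m →L[ℝ] E m} {T : E m →ₗ[ℝ] E m} {B : ℝ} (hB : 0 < B)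
    (hX : ‖X‖ ≤ B) (hT : T.IsPositive) (hTX : T ∘ₗ (X : E m →ₗ[ℝ] E m) = LinearMap.id) (z : E m) :
    ‖z‖ ^ 2 / B ≤ ⟪T z, z⟫ := by
  have h1 : ∀ w, T (X w) = w := fun w => LinearMap.congr_fun hTX w
  have h2 := hT.re_inner_nonneg_left (z - B⁻¹ • X z)
  simp only [RCLike.re_to_real] at h2
  rw [map_sub, map_smul, h1, inner_sub_left, inner_sub_right, inner_sub_right, inner_smul_right,
    inner_smul_left, inner_smul_left, inner_smul_right, hT.isSymmetric z (X z), h1,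
    real_inner_self_eq_norm_sq] at h2
  simp only [conj_trivial] at h2
  have h3 : ⟪z, X z⟫ ≤ B * ‖z‖ ^ 2 := by
    refine (real_inner_le_norm _ _).trans ?_
    have := X.le_of_opNorm_le hX z
    nlinarith [norm_nonneg z]
  have h4 : B⁻¹ * (B⁻¹ * ⟪z, X z⟫) ≤ B⁻¹ * (B⁻¹ * (B * ‖z‖ ^ 2)) := by gcongr
  have h5 : B⁻¹ * (B⁻¹ * (B * ‖z‖ ^ 2)) = ‖z‖ ^ 2 / B := by field_simp
  have h6 : B⁻¹ * ‖z‖ ^ 2 = ‖z‖ ^ 2 / B := by field_simp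
  linarith

/-- The inverse of a unimodular map with bounded norm has bounded trace. -/
lemma trace_le_of_comp_eq_id {X : E m →L[ℝ] E m} {T : E m →ₗ[ℝ] E m} {B : ℝ}
    (hX : ‖X‖ ≤ B) (hdet : |X.det| = 1) (hTX : T ∘ₗ (X : E m →ₗ[ℝ] E m) = LinearMap.id) :
    LinearMap.trace ℝ _ T ≤ m * B ^ (m - 1) := by
  rw [LinearMap.trace_eq_sum_inner T (EuclideanSpace.basisFun (Fin m) ℝ)]
  have key : ∀ i, ⟪EuclideanSpace.basisFun (Fin m) ℝ i, T (EuclideanSpace.basisFun (Fin m) ℝ i)⟫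
      ≤ B ^ (m - 1) := by
    intro i
    set z := EuclideanSpace.basisFun (Fin m) ℝ i with hz
    have hz1 : ‖z‖ = 1 := (EuclideanSpace.basisFun (Fin m) ℝ).orthonormal.1 i
    have hXT := comp_self_of_comp_eq_id hTX z
    refine (real_inner_le_norm _ _).trans ?_
    rw [hz1, one_mul]
    have hn : 0 < ‖T z‖ := by
      refine norm_pos_iff.2 fun h0 => ?_
      rw [h0, map_zero] at hXT
      rw [← hXT, norm_zero] at hz1
      exact zero_ne_one hz1
    have h1 := abs_det_le X (e := ‖T z‖⁻¹ • T z)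
      (by rw [norm_smul, norm_inv, norm_norm, inv_mul_cancel₀ hn.ne'])
    rw [hdet, map_smul, hXT, norm_smul, hz1, norm_inv, norm_norm, mul_one] at h1
    have h2 : ‖X‖ ^ (m - 1) ≤ B ^ (m - 1) := pow_le_pow_left₀ (norm_nonneg _) hX _
    rw [← div_eq_mul_inv, le_div_iff₀ hn, one_mul] at h1
    exact h1.trans h2
  calc _ ≤ ∑ i : Fin m, B ^ (m - 1) := Finset.sum_le_sum fun i _ => key i
    _ = _ := by simp

/-- Lipschitz images of null sets are null. -/
lemma volume_image_null {f : E m → E m} {s : Set (E m)} {κ : ℝ≥0} (hf : LipschitzOnWith κ f s)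
    {N : Set (E m)} (hN : N ⊆ s) (h0 : volume N = 0) : volume (f '' N) = 0 := by
  have h4 := (hf.mono hN).hausdorffMeasure_image_le (d := Module.finrank ℝ (E m)) (by positivity)
  have hac : (μH[(Module.finrank ℝ (E m) : ℝ)] : Measure (E m)) ≪ volume :=
    MeasureTheory.Measure.absolutelyContinuous_isAddHaarMeasure _ _
  have hca : (volume : Measure (E m)) ≪ μH[(Module.finrank ℝ (E m) : ℝ)] :=
    MeasureTheory.Measure.absolutelyContinuous_isAddHaarMeasure _ _
  rw [hac h0, mul_zero] at h4
  exact hca (le_antisymm h4 bot_le)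

end LinearizedBounds

section Barrier

variable {m : ℕ}

/-- The exponential barrier. -/
def barr (A β : ℝ) (y x : E m) : ℝ := -A * Real.exp (-β * ‖x - y‖ ^ 2)

def barrGrad (A β : ℝ) (y x : E m) : E m :=
  (2 * A * β * Real.exp (-β * ‖x - y‖ ^ 2)) • (x - y)

def barrHess (A β : ℝ) (y x : E m) : E m →L[ℝ] E m :=
  (2 * A * β * Real.exp (-β * ‖x - y‖ ^ 2)) •
    (ContinuousLinearMap.id ℝ (E m) - (2 * β) • (innerSL ℝ (x - y)).smulRight (x - y))

lemma hasFDerivAt_normSq (y x : E m) :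
    HasFDerivAt (fun x : E m => ‖x - y‖ ^ 2) ((2 : ℝ) • innerSL ℝ (x - y)) x := by
  have := ((hasFDerivAt_id (𝕜 := ℝ) x).sub_const y).norm_sq
  refine this.congr_fderiv ?_
  ext w; simp

lemma barr_hasFDerivAt (A β : ℝ) (y x : E m) :
    HasFDerivAt (barr A β y) (innerSL ℝ (barrGrad A β y x)) x := by
  have := (((hasFDerivAt_normSq y x).const_mul (-β)).exp).const_mul (-A)
  refine this.congr_fderiv ?_
  ext w; simp [barrGrad]; ring

lemma barrGrad_hasFDerivAt (A β : ℝ) (y x : E m) :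
    HasFDerivAt (barrGrad A β y) (barrHess A β y x) x := by
  have h1 := (((hasFDerivAt_normSq y x).const_mul (-β)).exp).const_mul (2 * A * β)
  have := h1.smul ((hasFDerivAt_id (𝕜 := ℝ) x).sub_const y)
  refine this.congr_fderiv ?_
  ext1 w
  simp only [barrHess, add_apply, smul_apply,
    ContinuousLinearMap.smulRight_apply, sub_apply,
    ContinuousLinearMap.id_apply, innerSL_apply_apply, smul_eq_mul, id]
  module

lemma barrHess_isSymmetric (A β : ℝ) (y x : E m) :
    (barrHess A β y x : E m →ₗ[ℝ] E m).IsSymmetric := by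
  intro v w
  simp only [barrHess, ContinuousLinearMap.coe_coe, smul_apply,
    ContinuousLinearMap.smulRight_apply, sub_apply,
    ContinuousLinearMap.id_apply, innerSL_apply_apply, inner_smul_left, inner_smul_right,
    inner_sub_left, inner_sub_right, conj_trivial]
  rw [real_inner_comm v x, real_inner_comm v y]
  ring

lemma trace_comp_barrHess (T : E m →ₗ[ℝ] E m) (A β : ℝ) (y x : E m) :
    LinearMap.trace ℝ _ (T ∘ₗ (barrHess A β y x : E m →ₗ[ℝ] E m)) =
      2 * A * β * Real.exp (-β * ‖x - y‖ ^ 2) *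
        (LinearMap.trace ℝ _ T - 2 * β * ⟪T (x - y), x - y⟫) := by
  have : T ∘ₗ (barrHess A β y x : E m →ₗ[ℝ] E m) =
      (2 * A * β * Real.exp (-β * ‖x - y‖ ^ 2)) • (T - (2 * β) •
        (innerₛₗ ℝ (x - y)).smulRight (T (x - y))) := by
    ext1 w
    simp [barrHess]
  rw [this, map_smul, map_sub, map_smul, LinearMap.trace_smulRight]
  simp only [ContinuousLinearMap.coe_coe, innerₛₗ_apply_apply, smul_eq_mul]
  rw [real_inner_comm (x - y)]

lemma norm_barrHess_le {A β R : ℝ} (hA : 0 ≤ A) (hβ : 0 ≤ β) {y x : E m} (hx : ‖x - y‖ ≤ R) :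
    ‖barrHess A β y x‖ ≤ 2 * A * β * (1 + 2 * β * R ^ 2) := by
  have hR : 0 ≤ R := (norm_nonneg _).trans hx
  refine ContinuousLinearMap.opNorm_le_bound _ (by positivity) fun w => ?_
  have h1 : Real.exp (-β * ‖x - y‖ ^ 2) ≤ 1 := Real.exp_le_one_iff.2 (by
    have := mul_nonneg hβ (sq_nonneg ‖x - y‖); linarith)
  simp only [barrHess, smul_apply,
    ContinuousLinearMap.smulRight_apply, sub_apply,
    ContinuousLinearMap.id_apply, innerSL_apply_apply]
  rw [norm_smul, Real.norm_of_nonneg (by positivity)]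
  have h2 : ‖w - (2 * β) • ⟪x - y, w⟫ • (x - y)‖ ≤ (1 + 2 * β * R ^ 2) * ‖w‖ := by
    refine (norm_sub_le _ _).trans ?_
    rw [norm_smul, norm_smul, Real.norm_of_nonneg (by positivity : (0 : ℝ) ≤ 2 * β)]
    have h3 : ‖⟪x - y, w⟫‖ * ‖x - y‖ ≤ R * ‖w‖ * R := by
      gcongr
      exact (norm_inner_le_norm _ _).trans (by gcongr)
    have := mul_le_mul_of_nonneg_left h3 (by positivity : 0 ≤ 2 * β)
    nlinarith
  have h5 : 2 * A * β * Real.exp (-β * ‖x - y‖ ^ 2) ≤ 2 * A * β :=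
    mul_le_of_le_one_right (by positivity) h1
  have h6 := mul_le_mul h5 h2 (norm_nonneg _) (by positivity)
  linarith

lemma barrGrad_lipschitzOnWith {A β : ℝ} (hA : 0 ≤ A) (hβ : 0 ≤ β) (y : E m) (R : ℝ) :
    ∃ κ : ℝ≥0, LipschitzOnWith κ (barrGrad A β y) (Metric.closedBall y R) := by
  rcases lt_or_ge R 0 with hR | hR
  · rw [Metric.closedBall_eq_empty.2 hR]; exact ⟨0, by simp⟩
  refine ⟨⟨2 * A * β * (1 + 2 * β * R ^ 2), by positivity⟩,
    (convex_closedBall y R).lipschitzOnWith_of_nnnorm_hasFDerivWithin_le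
    (fun x _ => (barrGrad_hasFDerivAt A β y x).hasFDerivWithinAt) fun x hx => ?_⟩
  have := norm_barrHess_le hA hβ (mem_closedBall_iff_norm.1 hx)
  exact this

end Barrier

section PointToMeasure

variable {m : ℕ} {C L : ℝ} {u : E m → ℝ} {g : E m → E m}

lemma barr_mem_Icc {A β : ℝ} (hA : 0 ≤ A) (hβ : 0 ≤ β) (y x : E m) :
    barr A β y x ∈ Icc (-A) 0 := by
  have h1 : Real.exp (-β * ‖x - y‖ ^ 2) ≤ 1 := Real.exp_le_one_iff.2 (by
    have := mul_nonneg hβ (sq_nonneg ‖x - y‖); linarith)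
  have h2 := mul_le_mul_of_nonneg_left h1 hA
  have h3 := mul_nonneg hA (Real.exp_pos (-β * ‖x - y‖ ^ 2)).le
  constructor <;> unfold barr <;> linarith

/-- Point-to-measure estimate for second differences: if a second difference is close to its
supremum at a point, then it is so on a fixed fraction of a neighbouring ball. -/
theorem Sol.point_to_measure (h : Sol C u g) (hm : 0 < m) (hL0 : 0 < L)
    (hL : ∀ e x, D2 u e x ≤ L * ‖e‖ ^ 2) :
    ∃ ε K : ℝ, 0 < ε ∧ 1 < K ∧ ∀ (e y : E m) (ρ t M : ℝ), 0 < ρ → 0 < t →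
      (∀ x, D2 u e x ≤ M) → (∃ x₁ ∈ Metric.closedBall y (2 * ρ), M - D2 u e x₁ ≤ t) →
      ENNReal.ofReal ε * volume (Metric.closedBall y ρ) ≤
        volume ({x | M - D2 u e x ≤ K * t} ∩ Metric.closedBall y ρ) := by
  set B := 4 * L with hB
  have hB0 : 0 < B := by positivity
  have hm' : (0 : ℝ) < m := by exact_mod_cast hm
  set α := m * B ^ m with hα
  have hα0 : 0 < α := by positivity
  set d := Real.exp (-(4 * α)) - Real.exp (-(9 * α)) with hd
  have hd0 : 0 < d := sub_pos.2 (Real.exp_lt_exp.2 (by linarith))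
  set a := 2 / d with ha
  have ha0 : 0 < a := by positivity
  set c₁ := 2 * a * α * B ^ (m - 1) with hc₁
  have hc₁0 : 0 < c₁ := by positivity
  have hlip := h.grad.lipschitz_of_D2_le hL
  have hXB : ∀ x (X : E m →L[ℝ] E m), HasFDerivAt g X x → ‖X‖ ≤ B := fun x X hX => by
    have := hX.le_of_lipschitz hlip
    rwa [Real.coe_toNNReal _ hB0.le] at this
  refine ⟨(6 * c₁)⁻¹ ^ m, a + 2, by positivity, by linarith, ?_⟩
  rintro e y ρ t M hρ ht hM ⟨x₁, hx₁, hs₁⟩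
  set A := a * t with hA
  have hA0 : 0 < A := by positivity
  set β := α / ρ ^ 2 with hβ
  have hβ0 : 0 < β := by positivity
  have hx₁' : ‖x₁ - y‖ ≤ 2 * ρ := mem_closedBall_iff_norm.1 hx₁
  set K := Metric.closedBall y (3 * ρ) with hK
  set Ω := Metric.ball y (3 * ρ) with hΩ
  have hφ₁ : barr A β y x₁ ≤ -A * Real.exp (-(4 * α)) := by
    have h1 : β * ‖x₁ - y‖ ^ 2 ≤ 4 * α := by
      calc β * ‖x₁ - y‖ ^ 2 ≤ β * (2 * ρ) ^ 2 := by gcongr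
        _ = 4 * α := by rw [hβ]; field_simp; ring
    have h2 : Real.exp (-(4 * α)) ≤ Real.exp (-β * ‖x₁ - y‖ ^ 2) :=
      Real.exp_le_exp.2 (by linarith)
    have := mul_le_mul_of_nonneg_left h2 hA0.le
    unfold barr; linarith
  have hbd : ∀ z ∈ K, z ∉ Ω → (barr A β y x₁ - D2 u e x₁) + t ≤ barr A β y z - D2 u e z := by
    intro z hz hz'
    have h0 : ‖z - y‖ = 3 * ρ := by
      refine le_antisymm (mem_closedBall_iff_norm.1 hz) (not_lt.1 fun hc => hz' ?_)
      exact mem_ball_iff_norm.2 hc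
    have h1 : barr A β y z = -A * Real.exp (-(9 * α)) := by
      unfold barr
      rw [h0]; congr 2; rw [hβ]; field_simp; ring
    have h2 : A * d = 2 * t := by rw [hA, ha]; field_simp
    have h3 := hM z
    rw [hd] at h2
    linarith
  have hmain := h.abp_D2 e (φ := barr A β y) (q := barrGrad A β y) (K := K) (Ω := Ω)
    (G := Metric.closedBall y ρ) (y₀ := x₁) (δ := t) (D := 5 * ρ) (σ := t / (6 * ρ))
    (τ := c₁ * t / ρ ^ 2)
    (continuous_iff_continuousAt.2 fun x => (barr_hasFDerivAt A β y x).continuousAt)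
    (continuous_iff_continuousAt.2 fun x => (barrGrad_hasFDerivAt A β y x).continuousAt)
    (barr_hasFDerivAt A β y) (isCompact_closedBall _ _) Metric.isOpen_ball
    Metric.ball_subset_closedBall
    (Metric.closedBall_subset_closedBall (by linarith) hx₁) hbd
    (fun x hx => by
      have h1 := mem_closedBall_iff_norm.1 hx
      have h2 := norm_sub_le (x - y) (x₁ - y)
      rw [sub_sub_sub_cancel_right] at h2
      linarith)
    (by rw [div_mul_eq_mul_div, div_lt_iff₀ (by positivity)]; nlinarith [mul_pos ht hρ])
    ?_ ?_ hm
  · set S := contactSet (fun x => barr A β y x - D2 u e x)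
      (fun x => barrGrad A β y x - D2grad g e x) K Ω (barr A β y x₁ - D2 u e x₁ + t) ∩
      Metric.closedBall y ρ with hS
    have hsub : S ⊆ {x | M - D2 u e x ≤ (a + 2) * t} ∩ Metric.closedBall y ρ := by
      rintro x ⟨⟨_, hx2, _⟩, hx4⟩
      refine ⟨?_, hx4⟩
      have h1 := (barr_mem_Icc hA0.le hβ0.le y x).1
      have h2 := (barr_mem_Icc hA0.le hβ0.le y x₁).2
      simp only at hx2
      change M - D2 u e x ≤ (a + 2) * t
      rw [add_mul, ← hA]; linarith
    refine le_trans ?_ (measure_mono hsub)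
    have hτ : 0 < c₁ * t / ρ ^ 2 := by positivity
    rw [Measure.addHaar_closedBall' _ _ (by positivity)] at hmain ⊢
    rw [finrank_euclideanSpace_fin] at hmain ⊢
    have e1 : ENNReal.ofReal ((t / (6 * ρ)) ^ m) =
        ENNReal.ofReal ((c₁ * t / ρ ^ 2) ^ m) *
          (ENNReal.ofReal ((6 * c₁)⁻¹ ^ m) * ENNReal.ofReal (ρ ^ m)) := by
      rw [← ENNReal.ofReal_mul (by positivity), ← ENNReal.ofReal_mul (by positivity), ← mul_pow,
        ← mul_pow]
      congr 2; field_simp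
    rw [e1, mul_assoc] at hmain
    have h2 := (ENNReal.mul_le_mul_iff_right (by simpa using pow_pos hτ m)
      ENNReal.ofReal_ne_top).1 hmain
    rwa [mul_assoc] at h2
  · intro N hN hN0
    obtain ⟨κ, hκ⟩ := barrGrad_lipschitzOnWith hA0.le hβ0.le y (3 * ρ)
    have hD : ∃ κ' : ℝ≥0, LipschitzWith κ' (D2grad g e) := by
      have h1 : LipschitzWith _ fun x => g (x + e) := hlip.comp (LipschitzWith.id.add
        (LipschitzWith.const e))
      have h2 : LipschitzWith _ fun x => g (x - e) := hlip.comp (LipschitzWith.id.sub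
        (LipschitzWith.const e))
      have h3 : LipschitzWith _ fun x => (2 : ℝ) • g x := (lipschitzWith_smul (2 : ℝ)).comp hlip
      exact ⟨_, (h1.add h2).sub h3⟩
    obtain ⟨κ', hκ'⟩ := hD
    refine volume_image_null (s := K) (hκ.sub hκ'.lipschitzOnWith) (fun x hx => ?_) hN0
    exact Metric.ball_subset_closedBall (hN hx).1
  · filter_upwards [h.ae_hasFDerivAt] with x ⟨Y, hY, _, hY1⟩ _ X hX
    obtain rfl := hX.unique hY
    refine ⟨barrHess A β y x, barrGrad_hasFDerivAt A β y x, barrHess_isSymmetric A β y x, ?_⟩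
    intro T hT hTX htr
    have hXn := hXB x X hX
    have h1 := le_inner_of_comp_eq_id hB0 hXn hT hTX (x - y)
    have h2 := trace_le_of_comp_eq_id hXn
      (by change |LinearMap.det (X : E m →ₗ[ℝ] E m)| = 1; rw [hY1, abs_one]) hTX
    rw [trace_comp_barrHess] at htr ⊢
    have hc0 : 0 < 2 * A * β * Real.exp (-β * ‖x - y‖ ^ 2) := by positivity
    have h3 := nonneg_of_mul_nonneg_right htr hc0
    have hBm : B ^ m = B ^ (m - 1) * B := by rw [← pow_succ]; congr 1; omega
    constructor
    · rw [mem_closedBall_iff_norm]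
      have h4 : 2 * β * (‖x - y‖ ^ 2 / B) ≤ m * B ^ (m - 1) := by
        have := mul_le_mul_of_nonneg_left h1 (by positivity : 0 ≤ 2 * β)
        linarith
      have h5 : 2 * ‖x - y‖ ^ 2 ≤ ρ ^ 2 := by
        rw [hβ, hα, hBm] at h4
        have h6 : 2 * (m * (B ^ (m - 1) * B) / ρ ^ 2) * (‖x - y‖ ^ 2 / B) =
            m * B ^ (m - 1) * (2 * ‖x - y‖ ^ 2 / ρ ^ 2) := by field_simp
        rw [h6] at h4
        have h7 : 2 * ‖x - y‖ ^ 2 / ρ ^ 2 ≤ 1 := by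
          refine le_of_mul_le_mul_left (a := m * B ^ (m - 1)) ?_ (by positivity)
          linarith
        rwa [div_le_one (by positivity)] at h7
      refine abs_le_of_sq_le_sq' ?_ hρ.le |>.2
      linarith [sq_nonneg ‖x - y‖]
    · have h4 : 2 * A * β * Real.exp (-β * ‖x - y‖ ^ 2) ≤ 2 * A * β := by
        refine mul_le_of_le_one_right (by positivity) (Real.exp_le_one_iff.2 ?_)
        have := mul_nonneg hβ0.le (sq_nonneg ‖x - y‖); linarith
      have h5 : LinearMap.trace ℝ _ T - 2 * β * ⟪T (x - y), x - y⟫ ≤ m * B ^ (m - 1) := by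
        have h6 : 0 ≤ 2 * β * ⟪T (x - y), x - y⟫ :=
          mul_nonneg (by positivity) (le_trans (by positivity) h1)
        linarith
      have h7 := mul_le_mul h4 h5 h3 (by positivity)
      refine h7.trans (le_of_eq ?_)
      rw [hc₁, hA, hβ]; ring

end PointToMeasure

section InkSpots

variable {m : ℕ}

/-- If every point of `A` is the centre of a ball of bounded radius filled in a fixed proportion
by `D`, then the volume of `A` is controlled by that of `D`. -/
lemma volume_le_of_density {A D : Set (E m)} {ε R : ℝ} (hD : MeasurableSet D)
    (h : ∀ x ∈ A, ∃ r, 0 < r ∧ r ≤ R ∧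
      ENNReal.ofReal ε * volume (Metric.closedBall x r) ≤ volume (D ∩ Metric.closedBall x r)) :
    ENNReal.ofReal ε * volume A ≤ ENNReal.ofReal (5 ^ m) * volume D := by
  choose! r hr0 hrR hr using h
  obtain ⟨U, hUA, hdisj, hcov⟩ := Vitali.exists_disjoint_subfamily_covering_enlargement_closedBall
    A id r R hrR 5 (by norm_num)
  have hcount : U.Countable := hdisj.countable_of_nonempty_interior fun x hx =>
    ⟨x, Metric.ball_subset_interior_closedBall (Metric.mem_ball_self (hr0 x (hUA hx)))⟩
  have h1 : A ⊆ ⋃ x ∈ U, Metric.closedBall x (5 * r x) := fun x hx => by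
    obtain ⟨y, hy, hxy⟩ := hcov x hx
    exact mem_biUnion hy (hxy (Metric.mem_closedBall_self (hr0 x hx).le))
  calc ENNReal.ofReal ε * volume A
      ≤ ENNReal.ofReal ε * ∑' x : U, volume (Metric.closedBall (x : E m) (5 * r x)) := by
        gcongr
        exact (measure_mono h1).trans (measure_biUnion_le _ hcount _)
    _ = ∑' x : U, ENNReal.ofReal ε * volume (Metric.closedBall (x : E m) (5 * r x)) :=
        ENNReal.tsum_mul_left.symm
    _ ≤ ∑' x : U, ENNReal.ofReal (5 ^ m) * volume (D ∩ Metric.closedBall (x : E m) (r x)) := by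
        refine ENNReal.tsum_le_tsum fun x => ?_
        have h2 := hr x (hUA x.2)
        have h0 := hr0 x (hUA x.2)
        have e1 : volume (Metric.closedBall (x : E m) (5 * r x)) =
            ENNReal.ofReal (5 ^ m) * volume (Metric.closedBall (x : E m) (r x)) := by
          rw [Measure.addHaar_closedBall' _ _ (by positivity),
            Measure.addHaar_closedBall' _ _ h0.le, finrank_euclideanSpace_fin, mul_pow,
            ENNReal.ofReal_mul (by positivity), mul_assoc]
        rw [e1, mul_left_comm]
        gcongr
    _ = ENNReal.ofReal (5 ^ m) * ∑' x : U, volume (D ∩ Metric.closedBall (x : E m) (r x)) :=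
        ENNReal.tsum_mul_left
    _ = ENNReal.ofReal (5 ^ m) * volume (⋃ x ∈ U, D ∩ Metric.closedBall (x : E m) (r x)) := by
        rw [measure_biUnion hcount]
        · exact hdisj.mono fun x => inter_subset_right
        · exact fun x _ => hD.inter Metric.isClosed_closedBall.measurableSet
    _ ≤ ENNReal.ofReal (5 ^ m) * volume D := by
        gcongr
        exact iUnion₂_subset fun x _ => inter_subset_left

/-- A nonnegative continuous function with the point-to-measure property that nearly attains
the value zero at a point is small on most of every ball around that point. -/
theorem volume_large_le {s : E m → ℝ} (hs : Continuous s) {ε K : ℝ} (hε : 0 < ε) (hK : 1 < K)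
    (hP : ∀ (y : E m) (ρ t : ℝ), 0 < ρ → 0 < t → (∃ x₁ ∈ Metric.closedBall y (2 * ρ), s x₁ ≤ t) →
      ENNReal.ofReal ε * volume (Metric.closedBall y ρ) ≤
        volume ({x | s x ≤ K * t} ∩ Metric.closedBall y ρ))
    {η : ℝ} (hη : 0 < η) {N : ℕ} {x₀ : E m} (hx₀ : s x₀ ≤ η / K ^ N) {R : ℝ} (hR : 0 < R) :
    ENNReal.ofReal (N * ε) * volume ({x | η < s x} ∩ Metric.closedBall x₀ R) ≤
      ENNReal.ofReal (10 ^ m) * volume (Metric.closedBall x₀ R) := by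
  have hK0 : 0 < K := by linarith
  set D : ℕ → Set (E m) := fun k =>
    {x | η / K ^ (k + 1) < s x ∧ s x ≤ η / K ^ k} ∩ Metric.closedBall x₀ (2 * R) with hD
  have hDm : ∀ k, MeasurableSet (D k) := fun k =>
    ((isOpen_lt continuous_const hs).measurableSet.inter
      (isClosed_le hs continuous_const).measurableSet).inter Metric.isClosed_closedBall.measurableSet
  have hanti : ∀ j k, j ≤ k → η / K ^ k ≤ η / K ^ j := fun j k hjk => by
    gcongr; exact hK.le
  have key : ∀ k < N, ENNReal.ofReal ε * volume ({x | η < s x} ∩ Metric.closedBall x₀ R) ≤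
      ENNReal.ofReal (5 ^ m) * volume (D k) := by
    intro k hk
    refine volume_le_of_density (hDm k) (R := R) ?_
    rintro x ⟨hx, hxR⟩
    set good : ℕ → Prop := fun i => ENNReal.ofReal ε * volume (Metric.closedBall x (R / 2 ^ i)) ≤
      volume ({x | s x ≤ η / K ^ k} ∩ Metric.closedBall x (R / 2 ^ i)) with hgood
    have hKk : K * (η / K ^ (k + 1)) = η / K ^ k := by rw [pow_succ]; field_simp
    have hg0 : good 0 := by
      have := hP x R (η / K ^ (k + 1)) hR (by positivity) ⟨x₀, by
        rw [Metric.mem_closedBall, dist_comm]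
        exact (Metric.mem_closedBall.1 hxR).trans (by linarith), hx₀.trans (hanti _ _ hk)⟩
      rw [hKk] at this
      simpa [hgood] using this
    have hex : ∃ i, good i ∧ ¬ good (i + 1) := by
      by_contra! hc
      have hall : ∀ i, good i := fun i => by
        induction i with
        | zero => exact hg0
        | succ i ih => exact hc i ih
      have hopen : IsOpen {z | η / K ^ k < s z} := isOpen_lt continuous_const hs
      have hxA : η / K ^ k < s x := by
        have := hanti 0 k (Nat.zero_le _)
        rw [pow_zero, div_one] at this
        exact this.trans_lt hx
      obtain ⟨δ, hδ, hsub⟩ := Metric.isOpen_iff.1 hopen x hxA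
      obtain ⟨i, hi⟩ := exists_nat_gt (R / δ)
      have h1 : R / 2 ^ i < δ := by
        have h2 : (i : ℝ) < 2 ^ i := by exact_mod_cast Nat.lt_two_pow_self
        rw [div_lt_iff₀ (by positivity)]
        rw [div_lt_iff₀ hδ] at hi
        nlinarith
      have h3 := hall i
      have h4 : {x | s x ≤ η / K ^ k} ∩ Metric.closedBall x (R / 2 ^ i) = ∅ := by
        refine eq_empty_of_forall_notMem ?_
        rintro z ⟨hz1, hz2⟩
        have : η / K ^ k < s z := hsub (Metric.closedBall_subset_ball h1 hz2)
        exact absurd hz1 (not_le.2 this)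
      rw [hgood] at h3
      simp only [h4, measure_empty, nonpos_iff_eq_zero, mul_eq_zero] at h3
      rcases h3 with h3 | h3
      · exact absurd (ENNReal.ofReal_eq_zero.1 h3) (not_le.2 hε)
      · exact (Metric.measure_closedBall_pos volume x (by positivity : 0 < R / 2 ^ i)).ne' h3
    obtain ⟨i, hi, hi'⟩ := hex
    have hle : R / 2 ^ i ≤ R := div_le_self hR.le (one_le_pow₀ (by norm_num))
    refine ⟨R / 2 ^ i, by positivity, hle, le_trans hi ?_⟩
    refine measure_mono ?_
    rintro z ⟨hz1, hz2⟩
    refine ⟨⟨⟨?_, hz1⟩, ?_⟩, hz2⟩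
    · by_contra! hc
      refine hi' ?_
      have h2 : 2 * (R / 2 ^ (i + 1)) = R / 2 ^ i := by rw [pow_succ]; field_simp
      have := hP x (R / 2 ^ (i + 1)) (η / K ^ (k + 1)) (by positivity) (by positivity)
        ⟨z, by rwa [h2], hc⟩
      rwa [hKk] at this
    · rw [Metric.mem_closedBall] at hz2 hxR ⊢
      linarith [dist_triangle z x x₀]
  have hsum : ∑ k ∈ Finset.range N, volume (D k) ≤ volume (Metric.closedBall x₀ (2 * R)) := by
    rw [← measure_biUnion_finset _ fun k _ => hDm k]
    · exact measure_mono (iUnion₂_subset fun k _ => inter_subset_right)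
    · intro j _ k _ hjk
      refine Set.disjoint_left.2 ?_
      rintro z ⟨⟨h1, h2⟩, _⟩ ⟨⟨h3, h4⟩, _⟩
      rcases lt_or_gt_of_ne hjk with h | h
      · exact absurd (h1.trans_le h4) (not_lt.2 (hanti _ _ h))
      · exact absurd (h3.trans_le h2) (not_lt.2 (hanti _ _ h))
  calc ENNReal.ofReal (N * ε) * volume ({x | η < s x} ∩ Metric.closedBall x₀ R)
      = ∑ k ∈ Finset.range N,
          ENNReal.ofReal ε * volume ({x | η < s x} ∩ Metric.closedBall x₀ R) := by
        rw [Finset.sum_const, Finset.card_range, nsmul_eq_mul,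
          ENNReal.ofReal_mul (by positivity), ENNReal.ofReal_natCast, mul_assoc]
    _ ≤ ∑ k ∈ Finset.range N, ENNReal.ofReal (5 ^ m) * volume (D k) :=
        Finset.sum_le_sum fun k hk => key k (Finset.mem_range.1 hk)
    _ = ENNReal.ofReal (5 ^ m) * ∑ k ∈ Finset.range N, volume (D k) := by rw [Finset.mul_sum]
    _ ≤ ENNReal.ofReal (5 ^ m) * volume (Metric.closedBall x₀ (2 * R)) := by gcongr
    _ = _ := by
        rw [Measure.addHaar_closedBall' _ _ (by positivity),
          Measure.addHaar_closedBall' _ _ hR.le, finrank_euclideanSpace_fin, mul_pow,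
          ENNReal.ofReal_mul (p := 2 ^ m) (by positivity), ← mul_assoc, ← mul_assoc, ← mul_assoc,
          ← ENNReal.ofReal_mul (by positivity), ← mul_pow]
        norm_num

end InkSpots

section Liouville

variable {m : ℕ} {C L : ℝ} {u : E m → ℝ} {g : E m → E m}

/-- The supremum of a second difference. -/
def supD2 (u : E m → ℝ) (e : E m) : ℝ := ⨆ x, D2 u e x

lemma bddAbove_D2 (hL : ∀ e x, D2 u e x ≤ L * ‖e‖ ^ 2) (e : E m) :
    BddAbove (range (D2 u e)) := ⟨L * ‖e‖ ^ 2, by rintro _ ⟨x, rfl⟩; exact hL e x⟩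

lemma D2_le_supD2 (hL : ∀ e x, D2 u e x ≤ L * ‖e‖ ^ 2) (e x : E m) : D2 u e x ≤ supD2 u e :=
  le_ciSup (bddAbove_D2 hL e) x

lemma Sol.exists_volume_defect_le (h : Sol C u g) (hm : 0 < m) (hL0 : 0 < L)
    (hL : ∀ e x, D2 u e x ≤ L * ‖e‖ ^ 2) (e : E m) {η : ℝ} (hη : 0 < η) (N : ℕ) :
    ∃ x₀ : E m, ∀ R : ℝ, 0 < R →
      N * volume ({x | η < supD2 u e - D2 u e x} ∩ Metric.closedBall x₀ R) ≤
        volume (Metric.closedBall x₀ R) := by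
  obtain ⟨ε, K, hε, hK, hP⟩ := h.point_to_measure hm hL0 hL
  obtain ⟨N', hN'⟩ := exists_nat_gt (10 ^ m * N / ε)
  have hK0 : 0 < K := by linarith
  obtain ⟨x₀, hx₀⟩ := exists_lt_of_lt_ciSup (show supD2 u e - η / K ^ N' < ⨆ x, D2 u e x from
    sub_lt_self _ (by positivity))
  refine ⟨x₀, fun R hR => ?_⟩
  have h1 := volume_large_le (s := fun x => supD2 u e - D2 u e x)
    (continuous_const.sub (D2_continuous h.grad e)) hε hK
    (fun y ρ t hρ ht hx => hP e y ρ t _ hρ ht (D2_le_supD2 hL e) hx) hη (N := N') (x₀ := x₀)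
    (by linarith) hR
  have h2 : ENNReal.ofReal (10 ^ m) * N ≤ ENNReal.ofReal (N' * ε) := by
    rw [← ENNReal.ofReal_natCast N, ← ENNReal.ofReal_mul (by positivity)]
    refine ENNReal.ofReal_le_ofReal ?_
    rw [div_lt_iff₀ hε] at hN'
    exact hN'.le
  have h3 := (mul_le_mul_left h2 (volume ({x | η < supD2 u e - D2 u e x} ∩
    Metric.closedBall x₀ R))).trans h1
  rw [mul_assoc] at h3
  exact (ENNReal.mul_le_mul_iff_right (by simp) ENNReal.ofReal_ne_top).1 h3

/-- Finitely many second differences are simultaneously almost maximal. -/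
lemma Sol.exists_common_point (h : Sol C u g) (hm : 0 < m) (hL0 : 0 < L)
    (hL : ∀ e x, D2 u e x ≤ L * ‖e‖ ^ 2) (S : Finset (E m × E m)) {η : ℝ} (hη : 0 < η) :
    ∃ x, ∀ p ∈ S, supD2 u p.1 - D2 u p.1 (x + p.2) ≤ η := by
  set N : ℕ := (2 ^ m) * (S.card + 1) with hN
  choose x₀ hx₀ using fun e => h.exists_volume_defect_le hm hL0 hL e hη N
  obtain ⟨R, hR1, hR⟩ : ∃ R : ℝ, 0 < R ∧ ∀ p ∈ S, ‖p.2‖ + ‖x₀ p.1‖ ≤ R := by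
    refine ⟨1 + ∑ p ∈ S, (‖p.2‖ + ‖x₀ p.1‖), by positivity, fun p hp => ?_⟩
    have := Finset.single_le_sum (f := fun p : E m × E m => ‖p.2‖ + ‖x₀ p.1‖)
      (fun p _ => by positivity) hp
    linarith
  by_contra! hcon
  set V := volume (Metric.closedBall (0 : E m) R) with hV
  have hV0 : V ≠ 0 := (Metric.measure_closedBall_pos volume _ hR1).ne'
  have hVt : V ≠ ∞ := (isCompact_closedBall _ _).measure_lt_top.ne
  have hcov : Metric.closedBall (0 : E m) R ⊆
      ⋃ p ∈ S, {x | η < supD2 u p.1 - D2 u p.1 (x + p.2)} ∩ Metric.closedBall 0 R := fun x hx => by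
    obtain ⟨p, hp, hpx⟩ := hcon x
    exact mem_biUnion hp ⟨hpx, hx⟩
  have hone : ∀ p ∈ S, ((S.card : ℝ≥0∞) + 1) *
      volume ({x | η < supD2 u p.1 - D2 u p.1 (x + p.2)} ∩ Metric.closedBall 0 R) ≤ V := by
    intro p hp
    have h1 := hx₀ p.1 (2 * R) (by positivity)
    have h2 : volume ({x | η < supD2 u p.1 - D2 u p.1 (x + p.2)} ∩ Metric.closedBall 0 R) ≤
        volume ({x | η < supD2 u p.1 - D2 u p.1 x} ∩ Metric.closedBall (x₀ p.1) (2 * R)) := by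
      rw [← measure_preimage_add_right volume p.2
        ({x | η < supD2 u p.1 - D2 u p.1 x} ∩ Metric.closedBall (x₀ p.1) (2 * R))]
      refine measure_mono ?_
      rintro x ⟨hx1, hx2⟩
      refine ⟨hx1, ?_⟩
      rw [mem_closedBall_iff_norm]
      rw [mem_closedBall_zero_iff] at hx2
      have := hR p hp
      calc ‖x + p.2 - x₀ p.1‖ ≤ ‖x + p.2‖ + ‖x₀ p.1‖ := norm_sub_le _ _
        _ ≤ ‖x‖ + ‖p.2‖ + ‖x₀ p.1‖ := by gcongr; exact norm_add_le _ _
        _ ≤ _ := by linarith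
    have h3 : volume (Metric.closedBall (x₀ p.1) (2 * R)) = 2 ^ m * V := by
      rw [hV, Measure.addHaar_closedBall' _ _ (by positivity),
        Measure.addHaar_closedBall' _ _ hR1.le, finrank_euclideanSpace_fin, mul_pow,
        ENNReal.ofReal_mul (by positivity), mul_assoc, ENNReal.ofReal_pow (by norm_num)]
      norm_num
    rw [h3, hN] at h1
    push_cast at h1
    rw [mul_assoc] at h1
    exact (mul_le_mul_right h2 _).trans ((ENNReal.mul_le_mul_iff_right (by simp) (by simp)).1 h1)
  have hsum : ((S.card : ℝ≥0∞) + 1) * V ≤ S.card * V := by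
    calc ((S.card : ℝ≥0∞) + 1) * V
        ≤ (S.card + 1) * ∑ p ∈ S,
          volume ({x | η < supD2 u p.1 - D2 u p.1 (x + p.2)} ∩ Metric.closedBall 0 R) := by
          gcongr
          exact (measure_mono hcov).trans (measure_biUnion_finset_le _ _)
      _ = ∑ p ∈ S, (S.card + 1) *
          volume ({x | η < supD2 u p.1 - D2 u p.1 (x + p.2)} ∩ Metric.closedBall 0 R) :=
          Finset.mul_sum _ _ _
      _ ≤ ∑ p ∈ S, V := Finset.sum_le_sum hone
      _ = S.card * V := by rw [Finset.sum_const, nsmul_eq_mul]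
  have h4 := ENNReal.mul_le_mul_iff_left hV0 hVt |>.1 hsum
  exact absurd h4 (not_le.2 (ENNReal.lt_add_right (by simp) (by simp)))

/-- Sections of fixed height of a solution with bounded second differences are uniformly
bounded. -/
lemma Sol.exists_sec_bound (h : Sol C u g) (hC : 1 ≤ C) (hm : 0 < m) (hL0 : 0 < L)
    (hL : ∀ e x, D2 u e x ≤ L * ‖e‖ ^ 2) :
    ∃ ρ' : ℝ, ∀ x z, exc u g x z ≤ 1 → ‖z‖ ≤ ρ' := by
  obtain ⟨r, ρ, hr, hnorm⟩ := exists_normalize hC hm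
  set ρ₁ := max ρ 1 with hρ₁
  have hρ0 : 0 < ρ₁ := by positivity
  set b := ρ₁ * √L with hb
  have hb0 : 0 < b := by positivity
  set d := √2 ^ m * b ^ (m - 1) with hd
  have hd0 : 0 < d := by positivity
  refine ⟨d * ρ₁, fun x z hz => ?_⟩
  obtain ⟨W, hdet, hW⟩ := hnorm u g h x 2 two_pos
  have hV : ∀ w, ‖W.symm w‖ ≤ b * ‖w‖ := by
    intro w
    rcases eq_or_ne (W.symm w) 0 with h0 | h0
    · rw [h0, norm_zero]; positivity
    have hn : 0 < ‖W.symm w‖ := norm_pos_iff.2 h0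
    set y := (ρ₁ / ‖W.symm w‖) • W.symm w with hy
    have hyn : ‖y‖ = ρ₁ := by
      rw [hy, norm_smul, norm_div, norm_norm, div_mul_cancel₀ _ hn.ne',
        Real.norm_of_nonneg hρ0.le]
    have h1 := hW.outer y (by rw [hyn]; exact le_max_left _ _)
    have h2 := h.grad.exc_le_of_D2_le hL x (W y)
    have h3 : W y = (ρ₁ / ‖W.symm w‖) • w := by rw [hy, map_smul, W.apply_symm_apply]
    rw [h3, norm_smul, Real.norm_of_nonneg (by positivity)] at h2
    rw [← h3] at h2
    have h4 : 1 ≤ L * (ρ₁ / ‖W.symm w‖ * ‖w‖) ^ 2 := by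
      have := h.grad.exc_nonneg x (W y)
      linarith
    have h5 : ‖W.symm w‖ ^ 2 ≤ (b * ‖w‖) ^ 2 := by
      rw [hb, mul_pow, mul_pow, Real.sq_sqrt hL0.le]
      have e1 : L * (ρ₁ / ‖W.symm w‖ * ‖w‖) ^ 2 = ρ₁ ^ 2 * L * ‖w‖ ^ 2 / ‖W.symm w‖ ^ 2 := by
        field_simp
      rw [e1, le_div_iff₀ (by positivity), one_mul] at h4
      exact h4
    exact (abs_le_of_sq_le_sq' h5 (by positivity)).2
  have hop : ‖(W.symm : E m →L[ℝ] E m)‖ ≤ b := ContinuousLinearMap.opNorm_le_bound _ hb0.le hV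
  have hdet' : |(W.symm : E m →L[ℝ] E m).det| = (√2 ^ m)⁻¹ := by
    rw [← hdet, ← abs_inv]
    congr 1
    refine eq_inv_of_mul_eq_one_left ?_
    change LinearMap.det (W.symm.toLinearEquiv : E m →ₗ[ℝ] E m) *
      LinearMap.det (W.toLinearEquiv : E m →ₗ[ℝ] E m) = 1
    exact LinearEquiv.det_symm_mul_det _
  have hy : ‖W.symm z‖ ≤ ρ₁ := by
    by_contra! hc
    have h1 := hW.outer (W.symm z) ((le_max_left _ _).trans hc.le)
    rw [W.apply_symm_apply] at h1
    linarith
  rcases eq_or_ne z 0 with h0 | h0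
  · rw [h0, norm_zero]; positivity
  have hn : 0 < ‖z‖ := norm_pos_iff.2 h0
  have h1 := abs_det_le (W.symm : E m →L[ℝ] E m) (e := ‖z‖⁻¹ • z)
    (by rw [norm_smul, norm_inv, norm_norm, inv_mul_cancel₀ hn.ne'])
  rw [hdet', ContinuousLinearEquiv.coe_coe, map_smul, norm_smul, norm_inv, norm_norm] at h1
  have h2 : (√2 ^ m)⁻¹ ≤ b ^ (m - 1) * (‖z‖⁻¹ * ρ₁) :=
    h1.trans (mul_le_mul (pow_le_pow_left₀ (norm_nonneg _) hop _) (by gcongr) (by positivity)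
      (by positivity))
  rw [inv_le_iff_one_le_mul₀ (by positivity)] at h2
  have h3 : b ^ (m - 1) * (‖z‖⁻¹ * ρ₁) * √2 ^ m = d * ρ₁ / ‖z‖ := by rw [hd]; field_simp
  rwa [h3, le_div_iff₀ hn, one_mul] at h2

end Liouville

section Rigidity

variable {m : ℕ} {C L : ℝ} {u : E m → ℝ} {g : E m → E m}

lemma IsGrad.exc_of_affine (h : IsGrad u g) {P : E m →L[ℝ] E m}
    (hP : (P : E m →ₗ[ℝ] E m).IsSymmetric) (hg : ∀ z, g z = P z + g 0) (z : E m) :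
    LpAffine.exc u g 0 z = ⟪P z, z⟫ / 2 := by
  have hd : ∀ z, HasFDerivAt (fun z => u z - ⟪g 0, z⟫ - 2⁻¹ * ⟪P z, z⟫) (0 : E m →L[ℝ] ℝ) z := by
    intro z
    have h1 := ((h.hasFDerivAt z).sub ((innerSL ℝ (g 0)).hasFDerivAt (x := z))).sub
      (((P.hasFDerivAt (x := z)).inner ℝ (hasFDerivAt_id z)).const_mul (2⁻¹ : ℝ))
    refine h1.congr_fderiv ?_
    ext w
    have h2 : ⟪P w, z⟫ = ⟪P z, w⟫ := by rw [real_inner_comm]; exact (hP z w).symm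
    simp [hg z, fderivInnerCLM_apply, h2, inner_add_left]
    ring
  have := is_const_of_fderiv_eq_zero (𝕜 := ℝ) (fun z => (hd z).differentiableAt)
    (fun z => (hd z).fderiv) z 0
  simp only [inner_zero_right, map_zero] at this
  rw [LpAffine.exc, zero_add]; linarith

lemma IsGrad.exc_le_half (h : IsGrad u g) (hL0 : 0 < L) (hL : ∀ e x, D2 u e x ≤ L * ‖e‖ ^ 2)
    (h1 : ∀ e x, D2 u e x ≤ ‖e‖ ^ 2) (x z : E m) : LpAffine.exc u g x z ≤ ‖z‖ ^ 2 / 2 := by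
  have hdouble : ∀ z, LpAffine.exc u g x ((2 : ℝ) • z) - ‖(2 : ℝ) • z‖ ^ 2 / 2 ≤
      2 * (LpAffine.exc u g x z - ‖z‖ ^ 2 / 2) := by
    intro z
    have h2 := h1 z (x + z)
    rw [norm_smul, mul_pow]
    simp only [D2, LpAffine.exc, inner_smul_right, add_sub_cancel_right, add_assoc,
      ← two_smul ℝ z, Real.norm_ofNat] at h2 ⊢
    linarith
  have hpow : ∀ (k : ℕ) z, LpAffine.exc u g x z - ‖z‖ ^ 2 / 2 ≤
      2 ^ k * (LpAffine.exc u g x ((2 ^ k : ℝ)⁻¹ • z) - ‖(2 ^ k : ℝ)⁻¹ • z‖ ^ 2 / 2) := by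
    intro k
    induction k with
    | zero => intro z; simp
    | succ k ih =>
      intro z
      refine (ih z).trans ?_
      have h2 := hdouble ((2 ^ (k + 1) : ℝ)⁻¹ • z)
      have e1 : (2 : ℝ) • (2 ^ (k + 1) : ℝ)⁻¹ • z = (2 ^ k : ℝ)⁻¹ • z := by
        rw [smul_smul]; congr 1; rw [pow_succ]; field_simp
      rw [e1] at h2
      rw [pow_succ (2 : ℝ), mul_assoc]
      rw [pow_succ (2 : ℝ)] at h2
      gcongr
  have hlim : Tendsto (fun k : ℕ => L * ‖z‖ ^ 2 * (2⁻¹ : ℝ) ^ k) atTop (𝓝 (L * ‖z‖ ^ 2 * 0)) :=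
    (tendsto_pow_atTop_nhds_zero_of_lt_one (by norm_num) (by norm_num)).const_mul _
  rw [mul_zero] at hlim
  have := ge_of_tendsto' hlim (b := LpAffine.exc u g x z - ‖z‖ ^ 2 / 2) fun k => ?_
  · linarith
  · refine (hpow k z).trans ?_
    have h2 := h.exc_le_of_D2_le hL x ((2 ^ k : ℝ)⁻¹ • z)
    have h3 : LpAffine.exc u g x ((2 ^ k : ℝ)⁻¹ • z) - ‖(2 ^ k : ℝ)⁻¹ • z‖ ^ 2 / 2 ≤
        L * ((2 ^ k : ℝ)⁻¹ * ‖z‖) ^ 2 := by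
      rw [norm_smul, norm_inv, Real.norm_of_nonneg (by positivity : (0 : ℝ) ≤ 2 ^ k)] at h2 ⊢
      have : 0 ≤ ((2 ^ k : ℝ)⁻¹ * ‖z‖) ^ 2 / 2 := by positivity
      linarith
    calc _ ≤ 2 ^ k * (L * ((2 ^ k : ℝ)⁻¹ * ‖z‖) ^ 2) := by gcongr
      _ = _ := by rw [inv_pow]; field_simp

/-- A convex function with excess at most that of half the squared norm has a nonexpansive
gradient. -/
lemma IsGrad.norm_sub_le_of_exc_le (h : IsGrad u g)
    (h1 : ∀ x z, LpAffine.exc u g x z ≤ ‖z‖ ^ 2 / 2) (x a : E m) : ‖g (x + a) - g x‖ ≤ ‖a‖ := by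
  have key : ∀ x a, ‖g (x + a) - g x‖ ^ 2 / 2 ≤ LpAffine.exc u g x a := by
    intro x a
    set w := g (x + a) - g x with hw
    have h2 := h.exc_nonneg x (a + -w)
    rw [exc_add, ← hw, inner_neg_right, real_inner_self_eq_norm_sq] at h2
    have h3 := h1 (x + a) (-w)
    rw [norm_neg] at h3
    linarith
  have h2 := key x a
  have h3 := key (x + a) (-a)
  have h4 := inner_eq_exc_add (u := u) (g := g) x a
  rw [add_neg_cancel_right, norm_sub_rev] at h3
  have h5 := real_inner_le_norm (g (x + a) - g x) a
  by_contra! hc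
  nlinarith [norm_nonneg a]

lemma Sol.image_closedBall_of_nonexpansive (h : Sol C u g)
    (h1 : ∀ x y, ‖g x - g y‖ ≤ ‖x - y‖) (a : E m) {r : ℝ} (hr : 0 < r) :
    g '' Metric.closedBall a r = Metric.closedBall (g a) r := by
  have hsub : g '' Metric.closedBall a r ⊆ Metric.closedBall (g a) r := by
    rintro _ ⟨x, hx, rfl⟩
    rw [mem_closedBall_iff_norm] at hx ⊢
    exact (h1 _ _).trans hx
  have hcomp : IsCompact (g '' Metric.closedBall a r) :=
    (isCompact_closedBall a r).image h.grad.continuous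
  refine hsub.antisymm ?_
  rw [← closure_ball (g a) hr.ne']
  refine closure_minimal ?_ hcomp.isClosed
  by_contra hcon
  obtain ⟨y, hy, hy'⟩ := not_subset.1 hcon
  have hopen : IsOpen (Metric.ball (g a) r \ g '' Metric.closedBall a r) :=
    Metric.isOpen_ball.sdiff hcomp.isClosed
  have hpos := hopen.measure_pos volume ⟨y, hy, hy'⟩
  have hvol : volume (Metric.closedBall (g a) r \ g '' Metric.closedBall a r) = 0 := by
    rw [measure_sdiff hsub hcomp.measurableSet.nullMeasurableSet hcomp.measure_lt_top.ne,
      h.meas _ (isCompact_closedBall a r), Measure.addHaar_closedBall' _ a hr.le,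
      Measure.addHaar_closedBall' _ (g a) hr.le, tsub_self]
  refine hpos.ne' (le_antisymm (le_trans (measure_mono ?_) hvol.le) bot_le)
  exact sdiff_subset_sdiff_left Metric.ball_subset_closedBall

/-- A solution with second differences dominated by those of half the squared norm is, up to an
affine function, half the squared norm. -/
theorem Sol.exc_eq_of_D2_le (h : Sol C u g) (h1 : ∀ e x, D2 u e x ≤ ‖e‖ ^ 2) (z : E m) :
    exc u g 0 z = ‖z‖ ^ 2 / 2 := by
  have hexc := h.grad.exc_le_half one_pos (fun e x => by rw [one_mul]; exact h1 e x) h1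
  have hne : ∀ x y, ‖g x - g y‖ ≤ ‖x - y‖ := fun x y => by
    have := h.grad.norm_sub_le_of_exc_le hexc y (x - y)
    rwa [add_sub_cancel] at this
  have himg := fun a r (hr : 0 < r) => h.image_closedBall_of_nonexpansive hne a hr
  have hiso : Isometry g := by
    refine Isometry.of_dist_eq fun x y => le_antisymm ?_ ?_
    · rw [dist_eq_norm, dist_eq_norm]; exact hne x y
    · by_contra! hc
      have hpos : 0 < dist (g x) (g y) := dist_pos.2 fun hg => by
        have := h.injective hg
        rw [this, dist_self, dist_self] at hc
        exact lt_irrefl _ hc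
      have h2 : g x ∈ g '' Metric.closedBall y (dist (g x) (g y)) := by
        rw [himg _ _ hpos]; exact Metric.mem_closedBall.2 le_rfl
      obtain ⟨x', hx', hxx⟩ := h2
      rw [h.injective hxx] at hx'
      exact absurd (Metric.mem_closedBall.1 hx') (not_le.2 hc)
  have hsurj : Function.Surjective g := by
    intro y
    have h2 : y ∈ g '' Metric.closedBall 0 (dist y (g 0) + 1) := by
      rw [himg _ _ (by positivity)]; exact Metric.mem_closedBall.2 (by linarith)
    obtain ⟨x, -, hx⟩ := h2
    exact ⟨x, hx⟩
  let φ : E m ≃ᵢ E m := IsometryEquiv.mk (Equiv.ofBijective g ⟨h.injective, hsurj⟩) hiso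
  let A := φ.toRealLinearIsometryEquiv
  have hA : ∀ z, A z = g z - g 0 := fun z => φ.toRealLinearIsometryEquiv_apply z
  let P : E m →L[ℝ] E m := A.toContinuousLinearEquiv
  have hg : ∀ z, g z = P z + g 0 := fun z => by
    change g z = A z + g 0
    rw [hA, sub_add_cancel]
  have hPd : HasFDerivAt g P 0 := by
    have : HasFDerivAt (fun z => P z + g 0) P 0 := P.hasFDerivAt.add_const _
    rwa [show g = fun z => P z + g 0 from funext hg]
  have hpos := h.grad.isPositive_of_hasFDerivAt hPd
  have hid : ∀ z, P z = z := by
    intro z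
    have hPP : P (P z) = z := by
      refine ext_inner_right ℝ fun w => ?_
      have h2 : ⟪P (P z), w⟫ = ⟪P z, P w⟫ := hpos.isSymmetric (P z) w
      rw [h2]
      exact A.inner_map_map z w
    have h3 := hpos.re_inner_nonneg_left (z - P z)
    simp only [ContinuousLinearMap.coe_coe, map_sub, hPP, RCLike.re_to_real] at h3
    rw [← neg_sub z (P z), inner_neg_left, real_inner_self_eq_norm_sq] at h3
    have : ‖z - P z‖ = 0 := by
      have := sq_nonneg ‖z - P z‖
      exact pow_eq_zero_iff two_ne_zero |>.1 (by linarith)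
    exact (sub_eq_zero.1 (norm_eq_zero.1 this)).symm
  rw [h.grad.exc_of_affine hpos.isSymmetric hg, hid, real_inner_self_eq_norm_sq]

/-- A positive operator is of the form `Bᵀ B`. -/
lemma exists_norm_sq_eq {P : E m →L[ℝ] E m} (hP : (P : E m →ₗ[ℝ] E m).IsPositive) :
    ∃ B : E m →L[ℝ] E m, P = B.adjoint.comp B := by
  set M := (Matrix.toEuclideanCLM (n := Fin m) (𝕜 := ℝ)).symm P with hM
  have hPM : Matrix.toEuclideanCLM (n := Fin m) (𝕜 := ℝ) M = P := StarAlgEquiv.apply_symm_apply _ _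
  have hpsd : M.PosSemidef := by
    rw [← Matrix.isPositive_toEuclideanLin_iff, ← Matrix.coe_toEuclideanCLM_eq_toEuclideanLin, hPM]
    exact hP
  obtain ⟨T, hT⟩ : ∃ T : Matrix (Fin m) (Fin m) ℝ, M = star T * T := by
    open scoped MatrixOrder in
    exact CStarAlgebra.nonneg_iff_eq_star_mul_self.1 hpsd.nonneg
  refine ⟨Matrix.toEuclideanCLM (n := Fin m) (𝕜 := ℝ) T, ?_⟩
  rw [← hPM, hT, map_mul, map_star]
  rfl

end Rigidity

section Liouville

variable {m : ℕ} {C L : ℝ} {u : E m → ℝ} {g : E m → E m}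

open Classical in
lemma Sol.exists_D2_eq_sup (h : Sol C u g) (hC : 1 ≤ C) (hm : 0 < m) (hL0 : 0 < L)
    (hL : ∀ e x, D2 u e x ≤ L * ‖e‖ ^ 2) :
    ∃ v q, Sol C v q ∧ q 0 = 0 ∧ ∀ e y, D2 v e y = supD2 u e := by
  obtain ⟨ρ', hρ'⟩ := h.exists_sec_bound hC hm hL0 hL
  choose x hx using fun k : Finset (E m × E m) × ℕ =>
    h.exists_common_point hm hL0 hL k.1 (η := 1 / ((k.2 : ℝ) + 1)) (by positivity)
  let l : Ultrafilter (Finset (E m × E m) × ℕ) := Ultrafilter.of atTop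
  have hl : (l : Filter (Finset (E m × E m) × ℕ)) ≤ atTop := Ultrafilter.of_le _
  have hin : ∀ k z, ‖z‖ ≤ (√L)⁻¹ → exc u g (x k) z ≤ 1 := by
    intro k z hz
    refine (h.grad.exc_le_of_D2_le hL _ z).trans ?_
    have : L * ‖z‖ ^ 2 ≤ L * (√L)⁻¹ ^ 2 := by gcongr
    refine this.trans_eq ?_
    rw [inv_pow, Real.sq_sqrt hL0.le, mul_inv_cancel₀ hL0.ne']
  have hMA : ∀ R ε : ℝ, 0 < ε → ∀ k,
      MABetween (fun z => g (x k + z) - g (x k)) (Metric.closedBall 0 R) (1 - ε) (1 + ε) := by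
    intro R ε hε k F hF _
    obtain ⟨h1, h2⟩ := (h.shift (x k)).ma F hF (subset_univ _)
    exact ⟨le_trans (by gcongr; linarith) h1, h2.trans (by gcongr; linarith)⟩
  obtain ⟨v, q, hv, hsol⟩ := exists_sol_ultralim (l := l) (C := C) (ρ := (√L)⁻¹) (ρ' := ρ')
    (u := fun k => exc u g (x k)) (g := fun k z => g (x k + z) - g (x k))
    (by linarith) (by positivity) (fun k => h.grad.exc (x k)) (fun k => exc_zero _)
    (fun k z => h.grad.exc_nonneg _ _) hin (fun k z => hρ' _ z)
    (fun R => Eventually.of_forall fun k y z _ _ => (h.shift (x k)).dbl y z)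
    (fun R ε hε => Eventually.of_forall (hMA R ε hε))
  refine ⟨v, q, hsol, ?_, fun e y => ?_⟩
  · refine tendsto_nhds_unique (hv.limg 0) ?_
    simp
  · have h1 : Tendsto (fun k => D2 u e (x k + y)) l (𝓝 (D2 v e y)) := by
      simp only [← D2_exc (g := g)]
      exact ((hv.lim _).add (hv.lim _)).sub ((hv.lim _).const_mul 2)
    have h2 : Tendsto (fun k : Finset (E m × E m) × ℕ => supD2 u e - 1 / ((k.2 : ℝ) + 1)) l
        (𝓝 (supD2 u e - 0)) := by
      refine Tendsto.mono_left ?_ hl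
      refine tendsto_const_nhds.sub (tendsto_one_div_add_atTop_nhds_zero_nat.comp ?_)
      rw [← prod_atTop_atTop_eq]; exact tendsto_snd
    rw [sub_zero] at h2
    refine le_antisymm (le_of_tendsto' h1 fun k => D2_le_supD2 hL _ _)
      (le_of_tendsto_of_tendsto h2 h1 ?_)
    filter_upwards [hl (eventually_ge_atTop (({(e, y)} : Finset (E m × E m)), 0))] with k hk
    have := hx k (e, y) (hk.1 (by simp))
    simp only at this
    linarith

lemma Sol.exists_supD2_eq (h : Sol C u g) (hC : 1 ≤ C) (hm : 0 < m) (hL0 : 0 < L)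
    (hL : ∀ e x, D2 u e x ≤ L * ‖e‖ ^ 2) :
    ∃ P : E m →L[ℝ] E m, (P : E m →ₗ[ℝ] E m).IsPositive ∧ LinearMap.det (P : E m →ₗ[ℝ] E m) = 1 ∧
      ∀ e, supD2 u e = ⟪P e, e⟫ := by
  obtain ⟨v, q, hv, hq0, hsup⟩ := h.exists_D2_eq_sup hC hm hL0 hL
  have hD : ∀ e y, D2grad q e y = 0 := by
    intro e y
    have h1 := D2_hasFDerivAt hv.grad e y
    rw [show D2 v e = fun _ => supD2 u e from funext (hsup e)] at h1
    have h2 := h1.unique (hasFDerivAt_const _ _)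
    have h3 := congrArg (fun T : E m →L[ℝ] ℝ => T (D2grad q e y)) h2
    simpa using h3
  have hadd : ∀ a b, q (a + b) = q a + q b := by
    intro a b
    have h1 := hD ((2 : ℝ)⁻¹ • (a - b)) ((2 : ℝ)⁻¹ • (a + b))
    have h2 := hD ((2 : ℝ)⁻¹ • (a + b)) ((2 : ℝ)⁻¹ • (a + b))
    rw [D2grad, sub_eq_zero] at h1 h2
    rw [sub_self, hq0, add_zero, ← h1] at h2
    rwa [← add_smul, ← smul_add, add_add_sub_cancel, ← smul_sub, add_sub_sub_cancel, ← two_smul ℝ a,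
      ← two_smul ℝ b, inv_smul_smul₀ two_ne_zero, inv_smul_smul₀ two_ne_zero,
      show (2 : ℝ)⁻¹ + 2⁻¹ = 1 by norm_num, one_smul] at h2
  let P : E m →L[ℝ] E m := (AddMonoidHom.mk' q hadd).toRealLinearMap hv.grad.continuous
  have hP : ∀ z, q z = P z := fun z => rfl
  have hPd : ∀ x, HasFDerivAt q P x := fun x => by
    rw [show q = P from funext hP]; exact P.hasFDerivAt
  have hpos := hv.grad.isPositive_of_hasFDerivAt (hPd 0)
  obtain ⟨x₀, X, hX, -, hXd⟩ := hv.ae_hasFDerivAt.exists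
  rw [hX.unique (hPd x₀)] at hXd
  refine ⟨P, hpos, hXd, fun e => ?_⟩
  · have h1 := hv.grad.exc_of_affine hpos.isSymmetric (fun z => by rw [hq0, add_zero, hP])
    rw [← hsup e 0, D2_eq_exc (g := q), h1, h1, map_neg, inner_neg_neg]
    ring

/-- Entire solutions of the Monge-Ampère equation `det D²u = 1` (in the sense of Alexandrov) with
doubling sections are quadratic polynomials. -/
theorem Sol.exists_quadratic (h : Sol C u g) (hC : 1 ≤ C) (hm : 0 < m) :
    ∃ B : E m ≃L[ℝ] E m, (B : E m →L[ℝ] E m).det ^ 2 = 1 ∧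
      ∀ z, exc u g 0 z = ‖B z‖ ^ 2 / 2 := by
  obtain ⟨L, hL0, hL⟩ := h.exists_D2_le hC hm
  obtain ⟨P, hpos, hXd, hsupP⟩ := h.exists_supD2_eq hC hm hL0 hL
  obtain ⟨B, hB⟩ := exists_norm_sq_eq hpos
  have hBd : B.det ^ 2 = 1 := by
    rw [hB] at hXd
    have : LinearMap.det ((B.adjoint.comp B : E m →L[ℝ] E m) : E m →ₗ[ℝ] E m) =
        B.adjoint.det * B.det := LinearMap.det_comp _ _
    rw [this, det_adjoint_eq] at hXd
    rw [sq]; exact hXd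
  have hBu : IsUnit B.det := by
    rw [isUnit_iff_ne_zero]; rintro h0; rw [h0] at hBd; norm_num at hBd
  obtain ⟨B', hB'⟩ : ∃ B' : E m ≃L[ℝ] E m, (B' : E m →L[ℝ] E m) = B :=
    ⟨B.toContinuousLinearEquivOfDetNeZero hBu.ne_zero, by ext z; rfl⟩
  have hB'z : ∀ z, B' z = B z := fun z => by rw [← hB']; rfl
  have hDB : ∀ e x, D2 u e x ≤ ‖B' e‖ ^ 2 := by
    intro e x
    refine (D2_le_supD2 hL e x).trans_eq ?_
    rw [hsupP, hB, hB'z, ← real_inner_self_eq_norm_sq (B e), ContinuousLinearMap.comp_apply,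
      ContinuousLinearMap.adjoint_inner_left]
  have hid : (B'.symm : E m →L[ℝ] E m).det * (B' : E m →L[ℝ] E m).det = 1 :=
    B'.toLinearEquiv.det_symm_mul_det
  have hW := h.comp_linear B'.symm one_pos (by
    rw [one_pow, one_mul]
    rw [← hB'] at hBd
    have := congrArg (· ^ 2) hid
    simp only [mul_pow, hBd, mul_one, one_pow] at this
    exact this)
  have hWD : ∀ e x, D2 (fun z => 1 * u (B'.symm z)) e x ≤ ‖e‖ ^ 2 := by
    intro e x
    have := hDB (B'.symm e) (B'.symm x)
    simp only [ContinuousLinearEquiv.apply_symm_apply, D2] at this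
    simpa [D2] using this
  refine ⟨B', by rw [hB']; exact hBd, fun z => ?_⟩
  have := hW.exc_eq_of_D2_le hWD (B' z)
  have h2 := exc_comp_linear (u := u) (g := g) B'.symm 1 0 (B' z)
  rw [this] at h2
  simpa using h2.symm

end Liouville

section BlowUp

variable {m : ℕ} {u : E m → ℝ} {g : E m → E m}

lemma exists_rescale (W : E m ≃L[ℝ] E m) (hm : 0 < m) {P s : ℝ} (hs : 0 < s) (hP : 1 ≤ P)
    (h1 : |(W : E m →L[ℝ] E m).det| ≤ P * s) (h2 : s ≤ P * |(W : E m →L[ℝ] E m).det|) :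
    ∃ (l : ℝ) (W' : E m ≃L[ℝ] E m), 0 < l ∧ l ≤ P ∧ 1 ≤ l * P ∧ (∀ z, W' z = l • W z) ∧
      |(W' : E m →L[ℝ] E m).det| = s := by
  have hP0 : 0 < P := by linarith
  set d := |(W : E m →L[ℝ] E m).det| with hd
  have hd0 : 0 < d := by
    rcases (abs_nonneg (W : E m →L[ℝ] E m).det).eq_or_lt with h0 | h0
    · rw [hd, ← h0] at h2; linarith
    · exact h0
  obtain ⟨l, hl0, hl⟩ : ∃ l : ℝ, 0 < l ∧ l ^ m = s / d :=
    ⟨(s / d) ^ (1 / (m : ℝ)), Real.rpow_pos_of_pos (by positivity) _, by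
      rw [one_div, Real.rpow_inv_natCast_pow (by positivity) hm.ne']⟩
  set W' : E m ≃L[ℝ] E m := W.trans (ContinuousLinearEquiv.smulLeft (Units.mk0 l hl0.ne')) with hW'
  have hWa : ∀ z, W' z = l • W z := fun z => rfl
  have hdet : (W' : E m →L[ℝ] E m).det = l ^ m * (W : E m →L[ℝ] E m).det := by
    have : ((W' : E m →L[ℝ] E m) : E m →ₗ[ℝ] E m) = l • ((W : E m →L[ℝ] E m) : E m →ₗ[ℝ] E m) := by
      ext z; simp [hWa]
    rw [show (W' : E m →L[ℝ] E m).det = LinearMap.det ((W' : E m →L[ℝ] E m) : E m →ₗ[ℝ] E m) from rfl,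
      this, LinearMap.det_smul, finrank_euclideanSpace_fin]
  refine ⟨l, W', hl0, ?_, ?_, hWa, ?_⟩
  · by_contra! hcon
    have h3 : l ≤ l ^ m := le_self_pow₀ (hP.trans hcon.le) hm.ne'
    rw [hl] at h3
    have h4 : s / d ≤ P := (div_le_iff₀ hd0).2 h2
    linarith
  · by_contra! hcon
    have h3 : l < 1 := by nlinarith
    have h4 : l ^ m ≤ l := pow_le_of_le_one hl0.le h3.le hm.ne'
    rw [hl, div_le_iff₀ hd0] at h4
    have h5 := mul_le_mul_of_nonneg_left h1 hl0.le
    nlinarith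
  · rw [hdet, abs_mul, abs_of_pos (pow_pos hl0 m), hl, ← hd]; field_simp

/-- Radius of a ball contained in every normalized section. -/
def frameIn (m : ℕ) : ℝ := 1 / (m * balConst m) / (2 * posConst m)

/-- Radius of a ball containing every normalized section. -/
def frameOut (m : ℕ) : ℝ := √m * (2 * posConst m)

lemma frameIn_pos (hm : 0 < m) : 0 < frameIn m := by
  have := one_le_posConst m
  have hm' : (0 : ℝ) < m := by exact_mod_cast hm
  unfold frameIn balConst; positivity

lemma section_normalization (h : IsGrad u g) (hm : 0 < m) {t : ℝ} (ht : 0 < t)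
    (hF : IsCompact {z | u z ≤ t}) (h0 : u 0 = 0) (hpos : ∀ z, 0 ≤ u z)
    (hMA : MABetween g {z | u z ≤ t} (1 / 2) 2) :
    ∃ W : E m ≃L[ℝ] E m, |(W : E m →L[ℝ] E m).det| = √t ^ m ∧
      (∀ z, ‖z‖ ≤ frameIn m → u (W z) ≤ t) ∧ ∀ z, u (W z) ≤ t → ‖z‖ ≤ frameOut m := by
  obtain ⟨⟨W, hW1, hW2, hW3, hW4⟩, -⟩ := exists_section_position h hm (by norm_num) (by norm_num) ht
    hF h0 hpos hMA
  have hp := one_le_posConst m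
  set P := 2 * posConst m with hP
  have hP1 : 1 ≤ P := by linarith
  have hP0 : 0 < P := by linarith
  set d := (W : E m →L[ℝ] E m).det
  have hs : (√t ^ m) ^ 2 = t ^ m := by rw [← pow_mul, mul_comm, pow_mul, Real.sq_sqrt ht.le]
  have hs0 : 0 < √t ^ m := by positivity
  have hm' : (0 : ℝ) < m := by exact_mod_cast hm
  have hp2 : P ≤ P ^ 2 := by nlinarith
  have hd1 : |d| ≤ P * √t ^ m := by
    refine abs_le_of_sq_le_sq' ?_ (by positivity) |>.2 |> fun hh => hh
    rw [sq_abs, mul_pow, hs]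
    nlinarith [pow_pos ht m]
  have hd2 : √t ^ m ≤ P * |d| := by
    refine abs_le_of_sq_le_sq' ?_ (by positivity) |>.2
    rw [hs, mul_pow, sq_abs]
    nlinarith [sq_nonneg d]
  obtain ⟨l, W', hl0, hlP, hlP', hWa, hdet⟩ := exists_rescale W hm hs0 hP1 hd1 hd2
  have hB0 : 1 ≤ balConst m := by unfold balConst; nlinarith
  have hconv : Convex ℝ {z | u z ≤ t} := by simpa using h.convexOn.convex_le t
  have hscale : ∀ (z : E m) (s : ℝ), u z ≤ t → 0 ≤ s → s ≤ 1 → u (s • z) ≤ t := by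
    intro z s hz hs0 hs1
    have := hconv hz (show (0 : E m) ∈ {z | u z ≤ t} by simpa [h0] using ht.le) hs0
      (sub_nonneg.2 hs1) (by ring)
    simpa using this
  refine ⟨W', hdet, fun z hz => ?_, fun z hz => ?_⟩
  · have hz' : ∀ i, |(l • z) i| ≤ 1 / (m * balConst m) := by
      intro i
      rw [PiLp.smul_apply, smul_eq_mul, abs_mul, abs_of_pos hl0]
      have h1 : |z i| ≤ frameIn m := by
        rw [← Real.norm_eq_abs]; exact (PiLp.norm_apply_le z i).trans hz
      calc l * |z i| ≤ P * frameIn m := mul_le_mul hlP h1 (abs_nonneg _) hP0.le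
        _ = 1 / (m * balConst m) := by unfold frameIn; rw [← hP]; field_simp
    rw [hWa, ← map_smul]
    generalize l • z = w at hz'
    have e : W w = ∑ i : Fin m, (1 / (m : ℝ)) • ((m * w i) • W (EuclideanSpace.single i 1)) := by
      have e1 : w = ∑ i : Fin m, w i • (EuclideanSpace.single i (1 : ℝ)) := by
        ext j; simp [Pi.single_apply]
      conv_lhs => rw [e1]
      rw [map_sum]
      refine Finset.sum_congr rfl fun i _ => ?_
      rw [map_smul, smul_smul]; congr 1; field_simp
    rw [e]
    refine hconv.sum_mem (fun i _ => by positivity) (by simp [hm'.ne']) (fun i _ => ?_)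
    have h1 : |m * w i| ≤ (balConst m)⁻¹ := by
      rw [abs_mul, Nat.abs_cast]
      calc (m : ℝ) * |w i| ≤ m * (1 / (m * balConst m)) := by gcongr; exact hz' i
        _ = (balConst m)⁻¹ := by field_simp
    have h2 : (balConst m)⁻¹ ≤ 1 := inv_le_one_of_one_le₀ hB0
    rcases le_total 0 (m * w i) with h3 | h3
    · rw [abs_of_nonneg h3] at h1
      exact hscale _ _ (hW1 i) h3 (h1.trans h2)
    · rw [abs_of_nonpos h3] at h1
      have h4 := section_balanced h hm (by norm_num) (by norm_num) (by norm_num) ht hF h0 hpos hMA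
        (hW1 i)
      have h5 := hscale _ (balConst m * -(m * w i)) h4 (mul_nonneg (by linarith) (by linarith)) (by
        calc balConst m * -(m * w i) ≤ balConst m * (balConst m)⁻¹ := by gcongr
          _ = 1 := mul_inv_cancel₀ (by linarith))
      have e2 : (balConst m * -(m * w i)) • -((balConst m)⁻¹ • W (EuclideanSpace.single i 1)) =
          (m * w i) • W (EuclideanSpace.single i 1) := by
        rw [smul_neg, smul_smul, ← neg_smul]; congr 1; field_simp
      rwa [e2] at h5
  · have h1 := hW2 _ hz
    have h2 : ∀ i, |z i| ≤ P := by
      intro i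
      have h3 := h1 i
      rw [hWa, map_smul, W.symm_apply_apply, PiLp.smul_apply, smul_eq_mul, abs_mul,
        abs_of_pos hl0] at h3
      have h4 := mul_le_mul_of_nonneg_right h3 hP0.le
      have h5 := mul_le_mul_of_nonneg_right hlP' (abs_nonneg (z i))
      linarith
    rw [frameOut, ← hP, EuclideanSpace.norm_eq, ← Real.sqrt_sq hP0.le,
      ← Real.sqrt_mul (by positivity)]
    refine Real.sqrt_le_sqrt ?_
    calc ∑ i, ‖z i‖ ^ 2 ≤ ∑ _i : Fin m, P ^ 2 := Finset.sum_le_sum fun i _ =>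
          pow_le_pow_left₀ (norm_nonneg _) (h2 i) 2
      _ = m * P ^ 2 := by simp

lemma IsGrad.exists_lower (h : IsGrad u g) (h0 : u 0 = 0) (hpos : ∀ z, z ≠ 0 → 0 < u z)
    {r : ℝ} (hr : 0 < r) : ∃ c, 0 < c ∧ ∀ z, r ≤ ‖z‖ → c * ‖z‖ ≤ u z := by
  rcases (Metric.sphere (0 : E m) r).eq_empty_or_nonempty with he | hne
  · refine ⟨1, one_pos, fun z hz => absurd he ?_⟩
    have hz0 : 0 < ‖z‖ := hr.trans_le hz
    refine Nonempty.ne_empty ⟨(r / ‖z‖) • z, ?_⟩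
    rw [mem_sphere_zero_iff_norm, norm_smul, Real.norm_of_nonneg (by positivity)]
    field_simp
  obtain ⟨x₀, hx₀, hmin⟩ := (isCompact_sphere (0 : E m) r).exists_isMinOn hne
    h.continuous_fun.continuousOn
  have hx₀' : x₀ ≠ 0 := by
    rintro rfl; rw [mem_sphere_zero_iff_norm, norm_zero] at hx₀; exact hr.ne hx₀
  refine ⟨u x₀ / r, div_pos (hpos _ hx₀') hr, fun z hz => ?_⟩
  have hz0 : 0 < ‖z‖ := hr.trans_le hz
  have h1 : u x₀ ≤ u ((r / ‖z‖) • z) := hmin (by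
    rw [mem_sphere_zero_iff_norm, norm_smul, Real.norm_of_nonneg (by positivity)]
    field_simp)
  have h2 := h.convexOn.2 (mem_univ z) (mem_univ 0) (show 0 ≤ r / ‖z‖ by positivity)
    (sub_nonneg.2 ((div_le_one hz0).2 hz)) (by ring)
  simp only [smul_zero, add_zero, smul_eq_mul, h0, mul_zero] at h2
  have h3 := h1.trans h2
  rw [div_mul_eq_mul_div, div_le_iff₀ hr]
  calc u x₀ * ‖z‖ ≤ r / ‖z‖ * u z * ‖z‖ := by gcongr
    _ = u z * r := by field_simp

lemma IsGrad.exists_doubling_radius (h : IsGrad u g) (hm : 0 < m) (h0 : u 0 = 0)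
    (hpos : ∀ z, z ≠ 0 → 0 < u z) {r : ℝ} (hr : 0 < r)
    (hMA : MABetween g (Metric.closedBall 0 r) (1 / 2) 2) :
    ∃ r₁, 0 < r₁ ∧ ∀ x z, ‖x‖ ≤ r₁ → ‖z‖ ≤ r₁ →
      LpAffine.exc u g x ((2 : ℝ) • z) ≤ dblConst m * LpAffine.exc u g x z := by
  have hpos' : ∀ z, 0 ≤ u z := fun z => by
    rcases eq_or_ne z 0 with rfl | hz
    · rw [h0]
    · exact (hpos z hz).le
  have hg0 : g 0 = 0 := (h.uniq 0 0 fun z => by simp [h0, hpos']).symm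
  obtain ⟨c, hc, hcl⟩ := h.exists_lower h0 hpos hr
  have hD := one_le_dblConst m
  set t₁ := c * r / 4 with ht₁
  have ht₁0 : 0 < t₁ := by positivity
  obtain ⟨r₂, hr₂, hr₂g⟩ : ∃ r₂ > 0, ∀ x, ‖x‖ ≤ r₂ → ‖g x‖ ≤ min (c / 4) 1 := by
    have h1 : ∀ᶠ x in 𝓝 (0 : E m), ‖g x‖ < min (c / 4) 1 := by
      refine (h.continuous.norm.tendsto 0).eventually_lt_const ?_
      rw [hg0, norm_zero]; positivity
    obtain ⟨r₂, hr₂, hb⟩ := Metric.nhds_basis_closedBall.mem_iff.1 h1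
    exact ⟨r₂, hr₂, fun x hx => (hb (mem_closedBall_zero_iff.2 hx)).le⟩
  refine ⟨min (r₂ / 2) (min r (t₁ / (2 * dblConst m))), by positivity, fun x z hx hz => ?_⟩
  simp only [le_inf_iff] at hx hz
  have hgx := hr₂g x (by linarith [hx.1])
  have hgxz := hr₂g (x + z) ((norm_add_le _ _).trans (by linarith [hx.1, hz.1]))
  have hux : u x ≤ c * r / 4 := by
    have h1 := h.sub x 0
    rw [h0, zero_sub, inner_neg_right] at h1
    have h2 := real_inner_le_norm (g x) x
    have h3 : ‖g x‖ * ‖x‖ ≤ c / 4 * r := mul_le_mul (hgx.trans (min_le_left _ _)) hx.2.1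
      (norm_nonneg _) (by positivity)
    linarith
  have hsub : {w | LpAffine.exc u g x w ≤ t₁} ⊆ (fun w => x + w) ⁻¹' Metric.closedBall 0 r := by
    intro w hw
    by_contra hcon
    rw [mem_preimage, mem_closedBall_zero_iff, not_le] at hcon
    have h1 := hcl _ hcon.le
    have h2 := real_inner_le_norm (g x) w
    have h3 : ‖w‖ ≤ ‖x + w‖ + r := by
      have := norm_sub_le (x + w) x
      rw [add_sub_cancel_left] at this; linarith [hx.2.1]
    have h4 : ‖g x‖ * ‖w‖ ≤ c / 4 * (‖x + w‖ + r) := mul_le_mul (hgx.trans (min_le_left _ _)) h3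
      (norm_nonneg _) (by positivity)
    have h5 : u (x + w) - u x - ⟪g x, w⟫ ≤ t₁ := hw
    have h6 : c * r < c * ‖x + w‖ := by gcongr
    linarith
  have hF : IsCompact {w | LpAffine.exc u g x w ≤ t₁} := by
    refine ((isCompact_closedBall (0 : E m) (r + r)).of_isClosed_subset
      (isClosed_le (exc_continuous h x) continuous_const) fun w hw => ?_)
    have h1 := mem_closedBall_zero_iff.1 (hsub hw)
    rw [mem_closedBall_zero_iff]
    have := norm_sub_le (x + w) x
    rw [add_sub_cancel_left] at this; linarith [hx.2.1]
  refine section_doubling (h.exc x) hm (by norm_num) (by norm_num) (by norm_num) ht₁0 hF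
    (exc_zero x) (h.exc_nonneg x) ((hMA.exc x).mono hsub) ?_
  have h1 := inner_eq_exc_add (u := u) (g := g) x z
  have h2 := h.exc_nonneg (x + z) (-z)
  have h3 : ⟪g (x + z) - g x, z⟫ ≤ 2 * ‖z‖ := by
    refine (real_inner_le_norm _ _).trans ?_
    gcongr
    refine (norm_sub_le _ _).trans ?_
    linarith [min_le_right (c / 4) 1]
  calc dblConst m * LpAffine.exc u g x z ≤ dblConst m * (2 * (t₁ / (2 * dblConst m))) := by
        gcongr; linarith [hz.2.2]
    _ = t₁ := by field_simp

end BlowUp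

section BlowUp

variable {m : ℕ} {u : E m → ℝ} {g : E m → E m}

lemma abs_det_trans (A B : E m ≃L[ℝ] E m) :
    |(A.trans B : E m →L[ℝ] E m).det| =
      |(A : E m →L[ℝ] E m).det| * |(B : E m →L[ℝ] E m).det| := by
  rw [← abs_mul, mul_comm]
  congr 1
  exact LinearMap.det_comp (B : E m →ₗ[ℝ] E m) (A : E m →ₗ[ℝ] E m)

lemma abs_det_symm {B : E m ≃L[ℝ] E m} (h : (B : E m →L[ℝ] E m).det ^ 2 = 1) :
    |(B.symm : E m →L[ℝ] E m).det| = 1 := by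
  have hid : (B.symm : E m →L[ℝ] E m).det * (B : E m →L[ℝ] E m).det = 1 :=
    B.toLinearEquiv.det_symm_mul_det
  have h1 := congrArg (fun x => |x|) hid
  have h2 : |(B : E m →L[ℝ] E m).det| = 1 := by
    rw [← sq_abs] at h
    exact (pow_eq_one_iff_of_nonneg (abs_nonneg _) two_ne_zero).1 h
  simpa only [abs_mul, h2, mul_one, abs_one] using h1

/-- Solutions of `det D²u = 1 + o(1)` near `0` are, after normalization of the sections, close to
`‖z‖² / 2`. -/
theorem IsGrad.exists_normal_form_one (h : IsGrad u g) (hm : 0 < m) (h0 : u 0 = 0)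
    (hpos : ∀ z, z ≠ 0 → 0 < u z)
    (hMA : ∀ ε : ℝ, 0 < ε → ∃ r, 0 < r ∧ MABetween g (Metric.closedBall 0 r) (1 - ε) (1 + ε))
    {ε : ℝ} (hε : 0 < ε) :
    ∃ t₀, 0 < t₀ ∧ ∀ t, 0 < t → t < t₀ → ∃ W : E m ≃L[ℝ] E m,
      |(W : E m →L[ℝ] E m).det| = √t ^ m ∧
        ∀ z, ‖z‖ ≤ 1 / ε → |t⁻¹ * u (W z) - ‖z‖ ^ 2 / 2| ≤ ε := by
  have hpos' : ∀ z, 0 ≤ u z := fun z => by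
    rcases eq_or_ne z 0 with rfl | hz
    · rw [h0]
    · exact (hpos z hz).le
  have hg0 : g 0 = 0 := (h.uniq 0 0 fun z => by simp [h0, hpos']).symm
  have hsec : ∀ r : ℝ, 0 < r → ∃ t, 0 < t ∧ ∀ z, u z ≤ t → ‖z‖ ≤ r := by
    intro r hr
    obtain ⟨c, hc, hcl⟩ := h.exists_lower h0 hpos hr
    refine ⟨c * r, by positivity, fun z hz => ?_⟩
    by_contra! hcon
    have h1 := hcl z hcon.le
    have : c * r < c * ‖z‖ := by gcongr
    linarith
  obtain ⟨r, hr, hMAr⟩ := hMA (1 / 2) (by norm_num)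
  have hMAr' : MABetween g (Metric.closedBall 0 r) (1 / 2) 2 := by
    intro F hF hFU
    obtain ⟨h1, h2⟩ := hMAr F hF hFU
    exact ⟨le_trans (by gcongr; norm_num) h1, h2.trans (by gcongr; norm_num)⟩
  obtain ⟨r₁, hr₁, hdbl⟩ := h.exists_doubling_radius hm h0 hpos hr hMAr'
  obtain ⟨tr, htr, hsecr⟩ := hsec r hr
  have hfr : ∀ t, 0 < t → t < tr → ∃ W : E m ≃L[ℝ] E m, |(W : E m →L[ℝ] E m).det| = √t ^ m ∧
      (∀ z, ‖z‖ ≤ frameIn m → u (W z) ≤ t) ∧ ∀ z, u (W z) ≤ t → ‖z‖ ≤ frameOut m := by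
    intro t ht htt
    have hsub : {z | u z ≤ t} ⊆ Metric.closedBall 0 r := fun z hz =>
      mem_closedBall_zero_iff.2 (hsecr z (le_trans hz htt.le))
    exact section_normalization h hm ht ((isCompact_closedBall 0 r).of_isClosed_subset
      (isClosed_le h.continuous_fun continuous_const) hsub) h0 hpos' (hMAr'.mono hsub)
  by_contra! hcon
  have hk : ∀ k : ℕ, 0 < min tr (1 / ((k : ℝ) + 1)) := fun k => by positivity
  choose t ht htt hbad using fun k => hcon _ (hk k)
  choose W hWd hWin hWout using fun k => hfr (t k) (ht k) ((htt k).trans_le (min_le_left _ _))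
  have ht0 : Tendsto t atTop (𝓝 0) := squeeze_zero (fun k => (ht k).le)
    (fun k => (htt k).le.trans (min_le_right _ _)) tendsto_one_div_add_atTop_nhds_zero_nat
  have hfi := frameIn_pos hm
  have hsmall : ∀ R s : ℝ, 0 < s → ∀ᶠ k in atTop, ∀ z, ‖z‖ ≤ R → ‖W k z‖ ≤ s := by
    intro R s hs
    set R' := max R (frameIn m) with hR'
    have hR'0 : 0 < R' := lt_max_of_lt_right hfi
    obtain ⟨τ, hτ, hτs⟩ := hsec (s * (frameIn m / R')) (by positivity)
    filter_upwards [ht0.eventually_le_const hτ] with k hk z hz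
    have h1 := hτs (W k ((frameIn m / R') • z)) ((hWin k _ (by
      rw [norm_smul, Real.norm_of_nonneg (by positivity)]
      calc frameIn m / R' * ‖z‖ ≤ frameIn m / R' * R' := by
            gcongr; exact hz.trans (le_max_left _ _)
        _ = frameIn m := by field_simp)).trans hk)
    rw [map_smul, norm_smul, Real.norm_of_nonneg (by positivity), mul_comm] at h1
    exact le_of_mul_le_mul_right h1 (by positivity)
  let l : Ultrafilter ℕ := hyperfilter ℕ
  have hl : (l : Filter ℕ) ≤ atTop := Nat.hyperfilter_le_atTop
  have hdetc : ∀ k, (t k)⁻¹ ^ m * (W k : E m →L[ℝ] E m).det ^ 2 = 1 := fun k => by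
    rw [← sq_abs, hWd, ← pow_mul, mul_comm m 2, pow_mul, Real.sq_sqrt (ht k).le, ← mul_pow,
      inv_mul_cancel₀ (ht k).ne', one_pow]
  obtain ⟨v, q, hv, hsol⟩ := exists_sol_ultralim (l := l) (C := dblConst m) (ρ := frameIn m)
    (ρ' := frameOut m) (u := fun k z => (t k)⁻¹ * u (W k z))
    (g := fun k z => (t k)⁻¹ • (W k : E m →L[ℝ] E m).adjoint (g (W k z)))
    (by linarith [one_le_dblConst m]) hfi (fun k => h.comp_linear (W k) (inv_pos.2 (ht k)))
    (fun k => by simp [h0]) (fun k z => mul_nonneg (inv_nonneg.2 (ht k).le) (hpos' _))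
    (fun k z hz => by
      rw [inv_mul_le_iff₀ (ht k), mul_one]; exact hWin k z hz)
    (fun k z hz => by
      rw [inv_mul_le_iff₀ (ht k), mul_one] at hz; exact hWout k z hz)
    (fun R => hl ((hsmall R r₁ hr₁).mono fun k hk x z hx hz => by
      rw [exc_comp_linear, exc_comp_linear, map_smul, mul_left_comm]
      exact mul_le_mul_of_nonneg_left (hdbl _ _ (hk x hx) (hk z hz)) (inv_nonneg.2 (ht k).le)))
    (fun R η hη => by
      obtain ⟨s, hs, hMAs⟩ := hMA η hη
      refine hl ((hsmall R s hs).mono fun k hk => ?_)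
      have h1 := hMAs.comp_linear (W k) (inv_pos.2 (ht k))
      rw [hdetc k, mul_one, mul_one] at h1
      exact h1.mono fun z hz => mem_closedBall_zero_iff.2 (hk z (mem_closedBall_zero_iff.1 hz)))
  obtain ⟨B, hBd, hB⟩ := hsol.exists_quadratic (one_le_dblConst m) hm
  have hv0 : v 0 = 0 := tendsto_nhds_unique (hv.lim 0) (by simp [h0])
  have hq0 : q 0 = 0 := tendsto_nhds_unique (hv.limg 0) (by simp [hg0])
  have hvB : ∀ z, v z = ‖B z‖ ^ 2 / 2 := fun z => by
    rw [← hB z]; simp [LpAffine.exc, hv0, hq0]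
  obtain ⟨k, hkk⟩ := (hv.unif (‖(B.symm : E m →L[ℝ] E m)‖ * (1 / ε)) hε).exists
  obtain ⟨z, hz, hzb⟩ := hbad k (B.symm.trans (W k)) (by
    rw [abs_det_trans, abs_det_symm hBd, one_mul, hWd])
  have h1 := hkk (B.symm z) (((B.symm : E m →L[ℝ] E m).le_opNorm z).trans (by gcongr))
  rw [hvB, ContinuousLinearEquiv.apply_symm_apply] at h1
  exact absurd h1 (not_le.2 hzb)

/-- Solutions of `det D²u = f₀ + o(1)` near `0` are, after normalization of the sections, close to
`‖z‖² / 2`. -/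
theorem IsGrad.exists_normal_form (h : IsGrad u g) (hm : 0 < m) (h0 : u 0 = 0)
    (hpos : ∀ z, z ≠ 0 → 0 < u z) {f₀ : ℝ} (hf₀ : 0 < f₀)
    (hMA : ∀ ε : ℝ, 0 < ε → ∃ r, 0 < r ∧
      MABetween g (Metric.closedBall 0 r) ((1 - ε) * f₀) ((1 + ε) * f₀))
    {ε : ℝ} (hε : 0 < ε) :
    ∃ t₀, 0 < t₀ ∧ ∀ t, 0 < t → t < t₀ → ∃ W : E m ≃L[ℝ] E m,
      f₀ * |(W : E m →L[ℝ] E m).det| ^ 2 = t ^ m ∧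
        ∀ z, ‖z‖ ≤ 1 / ε → |t⁻¹ * u (W z) - ‖z‖ ^ 2 / 2| ≤ ε := by
  obtain ⟨c, hc0, hc⟩ : ∃ c : ℝ, 0 < c ∧ c ^ m = f₀⁻¹ :=
    ⟨f₀⁻¹ ^ (1 / (m : ℝ)), Real.rpow_pos_of_pos (by positivity) _, by
      rw [one_div, Real.rpow_inv_natCast_pow (by positivity) hm.ne']⟩
  have hdet1 : ((ContinuousLinearEquiv.refl ℝ (E m) : E m ≃L[ℝ] E m) : E m →L[ℝ] E m).det = 1 :=
    LinearMap.det_id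
  obtain ⟨t₀, ht₀, H⟩ := (h.comp_linear (ContinuousLinearEquiv.refl ℝ (E m)) hc0).exists_normal_form_one
    hm (by simp [h0]) (fun z hz => mul_pos hc0 (hpos z hz)) (fun η hη => by
      obtain ⟨r, hr, hMAr⟩ := hMA η hη
      have h1 := hMAr.comp_linear (ContinuousLinearEquiv.refl ℝ (E m)) hc0
      rw [hdet1, one_pow, mul_one, hc, mul_inv_cancel_right₀ hf₀.ne',
        mul_inv_cancel_right₀ hf₀.ne'] at h1
      exact ⟨r, hr, h1⟩) hε
  refine ⟨t₀ / c, by positivity, fun t ht htt => ?_⟩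
  obtain ⟨W, hW, hWz⟩ := H (c * t) (by positivity) (by rwa [lt_div_iff₀' hc0] at htt)
  refine ⟨W, ?_, fun z hz => ?_⟩
  · rw [hW, ← pow_mul, mul_comm m 2, pow_mul, Real.sq_sqrt (by positivity), mul_pow, hc,
      mul_inv_cancel_left₀ hf₀.ne']
  · have h1 := hWz z hz
    have e : (c * t)⁻¹ * (c * u (W z)) = t⁻¹ * u (W z) := by field_simp
    rw [← e]; exact h1

end BlowUp

section Density

variable {m : ℕ}

/-- Bounds on the volume of images of small balls around every point give bounds on the volume
of the images of all compact sets. -/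
theorem MABetween.of_small_balls {g : E m → E m} {r r' a b : ℝ} (hr : r' < r)
    (hinj : InjOn g (Metric.closedBall 0 r)) (hcont : ContinuousOn g (Metric.closedBall 0 r))
    (h : ∀ η ∈ Metric.closedBall (0 : E m) r', ∀ᶠ ρ in 𝓝[>] (0 : ℝ),
      ENNReal.ofReal a * volume (Metric.closedBall η ρ) ≤ volume (g '' Metric.closedBall η ρ) ∧
        volume (g '' Metric.closedBall η ρ) ≤ ENNReal.ofReal b * volume (Metric.closedBall η ρ)) :
    MABetween g (Metric.closedBall 0 r') a b := by
  set s : Set (E m) := Metric.closedBall 0 r with hs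
  have hsc : IsCompact s := isCompact_closedBall _ _
  have : CompactSpace s := isCompact_iff_compactSpace.1 hsc
  set g' : s → E m := s.domRestrict g with hg'
  have hg'c : Continuous g' := continuousOn_iff_continuous_domRestrict.1 hcont
  have hg'i : Function.Injective g' := injOn_iff_injective.1 hinj
  have hemb : MeasurableEmbedding g' := (hg'c.isClosedEmbedding hg'i).measurableEmbedding
  set μ : Measure (E m) := Measure.map Subtype.val (Measure.comap g' volume) with hμ
  have hμv : ∀ F, MeasurableSet F → μ F = volume (g '' (F ∩ s)) := by
    intro F hF
    rw [hμ, Measure.map_apply measurable_subtype_coe hF, hemb.comap_apply]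
    congr 1
    ext y
    simp only [mem_image, mem_preimage, mem_inter_iff]
    constructor
    · rintro ⟨z, hz, rfl⟩; exact ⟨z, ⟨hz, z.2⟩, rfl⟩
    · rintro ⟨z, ⟨hz, hzs⟩, rfl⟩; exact ⟨⟨z, hzs⟩, hz, rfl⟩
  have hfin : IsFiniteMeasure μ := ⟨by
    rw [hμv _ MeasurableSet.univ, univ_inter]
    exact (hsc.image_of_continuousOn hcont).measure_lt_top⟩
  intro F hF hFs
  have hFs' : F ⊆ s := hFs.trans (Metric.closedBall_subset_closedBall hr.le)
  have hFv : μ F = volume (g '' F) := by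
    rw [hμv F hF.measurableSet, inter_eq_self_of_subset_left hFs']
  rw [← hFv]
  constructor
  · have := (Besicovitch.vitaliFamily (volume : Measure (E m))).measure_le_of_frequently_le
      (ρ := ENNReal.ofReal a • volume) μ Measure.smul_absolutelyContinuous F ?_
    · simpa using this
    intro x hx
    refine (Besicovitch.tendsto_filterAt volume x).frequently ?_
    have hx' := Metric.mem_closedBall.1 (hFs hx)
    refine Eventually.frequently ?_
    filter_upwards [h x (hFs hx), Ioo_mem_nhdsGT (sub_pos.2 hr)] with ρ hρ hρr
    rw [hμv _ Metric.isClosed_closedBall.measurableSet, inter_eq_self_of_subset_left]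
    · simpa using hρ.1
    · exact Metric.closedBall_subset_closedBall' (by linarith [hρr.2])
  · have hlf : IsLocallyFiniteMeasure (ENNReal.ofReal b • (volume : Measure (E m))) :=
      inferInstanceAs (IsLocallyFiniteMeasure (b.toNNReal • (volume : Measure (E m))))
    have := (Besicovitch.vitaliFamily μ).measure_le_of_frequently_le (ρ := μ)
      (ENNReal.ofReal b • (volume : Measure (E m))) Measure.AbsolutelyContinuous.rfl F ?_
    · simpa using this
    intro x hx
    refine (Besicovitch.tendsto_filterAt μ x).frequently ?_
    refine Eventually.frequently ?_
    filter_upwards [h x (hFs hx)] with ρ hρ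
    rw [hμv _ Metric.isClosed_closedBall.measurableSet]
    refine (measure_mono (image_mono inter_subset_left)).trans ?_
    simpa using hρ.2

/-- A map that expands distances up to the factor `1 / K` expands the Hausdorff measure. -/
lemma hausdorffMeasure_le_of_expanding {X Y : Type*} [MetricSpace X] [MeasurableSpace X]
    [BorelSpace X] [MetricSpace Y] [MeasurableSpace Y] [BorelSpace Y] {f : X → Y} {s : Set X}
    {K : ℝ≥0} {d : ℝ} (hd : 0 ≤ d) (h : ∀ a ∈ s, ∀ b ∈ s, dist a b ≤ K * dist (f a) (f b)) :
    μH[d] s ≤ (K : ℝ≥0∞) ^ d * μH[d] (f '' s) := by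
  rcases s.eq_empty_or_nonempty with rfl | ⟨a₀, -⟩
  · simp
  have : Nonempty X := ⟨a₀⟩
  have hinj : InjOn f s := fun a ha b hb hab => by
    have := h a ha b hb
    rw [hab, dist_self, mul_zero] at this
    exact dist_le_zero.1 this
  have hlip : LipschitzOnWith K (Function.invFunOn f s) (f '' s) := by
    refine LipschitzOnWith.of_dist_le_mul ?_
    rintro _ ⟨a, ha, rfl⟩ _ ⟨b, hb, rfl⟩
    rw [hinj.leftInvOn_invFunOn ha, hinj.leftInvOn_invFunOn hb]
    exact h a ha b hb
  have h2 := hlip.hausdorffMeasure_image_le hd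
  rwa [hinj.leftInvOn_invFunOn.image_image] at h2

/-- The volume of a euclidean space is a multiple of the Hausdorff measure. -/
lemma exists_hausdorffMeasure_eq_smul (m : ℕ) : ∃ c : ℝ≥0∞, c ≠ 0 ∧ c ≠ ∞ ∧
    (μH[(m : ℝ)] : Measure (E m)) = c • (volume : Measure (E m)) := by
  have h := Measure.isAddLeftInvariant_eq_smul (μH[(m : ℝ)] : Measure (E m)) volume
  refine ⟨_, ?_, ENNReal.coe_ne_top, h⟩
  exact ENNReal.coe_ne_zero.2 (Measure.addHaarScalarFactor_pos_of_isAddHaarMeasure _ _).ne'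

/-- Volume distortion of `g = Γ ∘ N ∘ Θ` when `Θ`, `Γ` are bi-Lipschitz and `N` is a map between
hypersurfaces whose volume distortion on small balls lies between `a` and `b`. -/
theorem MABetween.of_parametrization {n : ℕ} {S : Set (E n)} {N : E n → E n} {Θ : E m → E n}
    {Γ : E n → E m} {g : E m → E m} {r r' a b : ℝ} (hr : r' < r) {Λ L₁ L₂ : ℝ≥0} (hΛ : 1 < Λ)
    (hL₂ : 0 < L₂) (hinj : InjOn g (Metric.closedBall 0 r))
    (hcont : ContinuousOn g (Metric.closedBall 0 r))
    (hg : ∀ η ∈ Metric.closedBall (0 : E m) r, g η = Γ (N (Θ η)))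
    (hΘS : ∀ η ∈ Metric.closedBall (0 : E m) r, Θ η ∈ S)
    (hΘ₁ : LipschitzOnWith Λ Θ (Metric.closedBall 0 r))
    (hΘ₂ : ∀ η ∈ Metric.closedBall (0 : E m) r, ∀ ζ ∈ Metric.closedBall (0 : E m) r,
      dist η ζ ≤ Λ * dist (Θ η) (Θ ζ))
    (hΓ₁ : LipschitzOnWith L₁ Γ (N '' (Θ '' Metric.closedBall 0 r)))
    (hΓ₂ : ∀ σ ∈ N '' (Θ '' Metric.closedBall 0 r), ∀ τ ∈ N '' (Θ '' Metric.closedBall 0 r),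
      dist σ τ ≤ L₂ * dist (Γ σ) (Γ τ))
    (hloc : ∀ η ∈ Metric.closedBall (0 : E m) r', ∀ᶠ ρ in 𝓝[>] (0 : ℝ),
      S ∩ Metric.ball (Θ η) ρ ⊆ Θ '' Metric.closedBall 0 r)
    (hN : ∀ η ∈ Metric.closedBall (0 : E m) r', ∀ᶠ ρ in 𝓝[>] (0 : ℝ),
      ENNReal.ofReal a * μH[(m : ℝ)] (S ∩ Metric.ball (Θ η) ρ) ≤
          μH[(m : ℝ)] (N '' (S ∩ Metric.ball (Θ η) ρ)) ∧
        μH[(m : ℝ)] (N '' (S ∩ Metric.ball (Θ η) ρ)) ≤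
          ENNReal.ofReal b * μH[(m : ℝ)] (S ∩ Metric.ball (Θ η) ρ)) :
    MABetween g (Metric.closedBall 0 r') (a / (L₂ * Λ ^ 4) ^ m) (b * (L₁ * Λ ^ 5) ^ m) := by
  have hm0 : (0 : ℝ) ≤ m := Nat.cast_nonneg m
  have hΛ0 : (0 : ℝ) < Λ := by exact_mod_cast zero_lt_one.trans hΛ
  have hΛ1 : (1 : ℝ) < Λ := by exact_mod_cast hΛ
  have hL0 : (0 : ℝ) < L₂ := by exact_mod_cast hL₂
  obtain ⟨c, hc0, hct, hc⟩ := exists_hausdorffMeasure_eq_smul m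
  have hball : ∀ (η : E m) (ρ k : ℝ), 0 < ρ → 0 ≤ k → μH[(m : ℝ)] (Metric.closedBall η (k * ρ)) =
      ENNReal.ofReal (k ^ m) * μH[(m : ℝ)] (Metric.closedBall η ρ) := by
    intro η ρ k hρ hk
    rw [Measure.addHaar_closedBall' _ _ (by positivity),
      Measure.addHaar_closedBall' _ _ hρ.le, finrank_euclideanSpace_fin, mul_pow,
      ENNReal.ofReal_mul (by positivity), mul_assoc]
  have hpow : ∀ L : ℝ≥0, (L : ℝ≥0∞) ^ (m : ℝ) = ENNReal.ofReal ((L : ℝ) ^ m) := fun L => by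
    rw [ENNReal.rpow_natCast, ENNReal.ofReal_pow L.coe_nonneg, ENNReal.ofReal_coe_nnreal]
  refine MABetween.of_small_balls hr hinj hcont fun η hη => ?_
  have hηr : ‖η‖ ≤ r' := by simpa using hη
  have hηb : η ∈ Metric.closedBall (0 : E m) r := by
    rw [mem_closedBall_zero_iff]; linarith
  have hsmall : ∀ᶠ ρ in 𝓝[>] (0 : ℝ), Λ ^ 3 * ρ < r - r' := by
    have : Tendsto (fun ρ : ℝ => (Λ : ℝ) ^ 3 * ρ) (𝓝[>] 0) (𝓝 ((Λ : ℝ) ^ 3 * 0)) :=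
      (tendsto_id.mono_left nhdsWithin_le_nhds).const_mul _
    rw [mul_zero] at this
    exact this.eventually_lt_const (sub_pos.2 hr)
  have hscale : ∀ k : ℝ, 0 < k → Tendsto (fun ρ : ℝ => k * ρ) (𝓝[>] 0) (𝓝[>] 0) := by
    intro k hk
    refine tendsto_nhdsWithin_iff.2 ⟨?_, ?_⟩
    · have : Tendsto (fun ρ : ℝ => k * ρ) (𝓝[>] 0) (𝓝 (k * 0)) :=
        (tendsto_id.mono_left nhdsWithin_le_nhds).const_mul _
      rwa [mul_zero] at this
    · filter_upwards [self_mem_nhdsWithin] with ρ hρ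
      exact mul_pos hk hρ
  have e1 := (hscale ((Λ : ℝ) ^ 2) (by positivity)).eventually ((hloc η hη).and (hN η hη))
  have e2 := (hscale ((Λ : ℝ)⁻¹) (by positivity)).eventually ((hloc η hη).and (hN η hη))
  filter_upwards [e1, e2, hsmall, self_mem_nhdsWithin] with ρ h1 h2 h3 hρ
  have hρ0 : 0 < ρ := hρ
  have hsub : ∀ k : ℝ, k ≤ Λ ^ 3 → Metric.closedBall η (k * ρ) ⊆ Metric.closedBall 0 r := by
    intro k hk
    refine Metric.closedBall_subset_closedBall' ?_
    have : k * ρ ≤ Λ ^ 3 * ρ := by gcongr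
    rw [dist_zero_right]; linarith
  have hΛ3 : (1 : ℝ) ≤ Λ ^ 3 := one_le_pow₀ hΛ1.le
  have hsub1 : Metric.closedBall η ρ ⊆ Metric.closedBall 0 r := by
    simpa using hsub 1 hΛ3
  have himg : g '' Metric.closedBall η ρ = Γ '' (N '' (Θ '' Metric.closedBall η ρ)) := by
    rw [image_image, image_image]
    exact image_congr fun ζ hζ => hg ζ (hsub1 hζ)
  have key : ENNReal.ofReal (a / (L₂ * Λ ^ 4) ^ m) * μH[(m : ℝ)] (Metric.closedBall η ρ) ≤
        μH[(m : ℝ)] (g '' Metric.closedBall η ρ) ∧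
      μH[(m : ℝ)] (g '' Metric.closedBall η ρ) ≤
        ENNReal.ofReal (b * (L₁ * Λ ^ 5) ^ m) * μH[(m : ℝ)] (Metric.closedBall η ρ) := by
    constructor
    · have i1 : μH[(m : ℝ)] (N '' (Θ '' Metric.closedBall η ρ)) ≤
          ENNReal.ofReal ((L₂ : ℝ) ^ m) * μH[(m : ℝ)] (g '' Metric.closedBall η ρ) := by
        rw [himg, ← hpow]
        refine hausdorffMeasure_le_of_expanding hm0 fun σ hσ τ hτ => hΓ₂ σ ?_ τ ?_
        · exact image_mono (image_mono hsub1) hσ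
        · exact image_mono (image_mono hsub1) hτ
      have i2 : μH[(m : ℝ)] (N '' (S ∩ Metric.ball (Θ η) ((Λ : ℝ)⁻¹ * ρ))) ≤
          μH[(m : ℝ)] (N '' (Θ '' Metric.closedBall η ρ)) := by
        refine measure_mono (image_mono fun w hw => ?_)
        obtain ⟨ζ, hζ, rfl⟩ := h2.1 hw
        refine ⟨ζ, ?_, rfl⟩
        have := hΘ₂ ζ hζ η hηb
        have h4 := Metric.mem_ball.1 hw.2
        rw [Metric.mem_closedBall]
        calc dist ζ η ≤ Λ * dist (Θ ζ) (Θ η) := this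
          _ ≤ Λ * ((Λ : ℝ)⁻¹ * ρ) := by gcongr
          _ = ρ := by field_simp
      have i3 : Θ '' Metric.closedBall η (((Λ : ℝ) ^ 3)⁻¹ * ρ) ⊆
          S ∩ Metric.ball (Θ η) ((Λ : ℝ)⁻¹ * ρ) := by
        have h5 : ((Λ : ℝ) ^ 3)⁻¹ ≤ Λ ^ 3 := (inv_le_one_of_one_le₀ hΛ3).trans hΛ3
        rintro _ ⟨ζ, hζ, rfl⟩
        refine ⟨hΘS ζ (hsub _ h5 hζ), ?_⟩
        rw [Metric.mem_ball]
        calc dist (Θ ζ) (Θ η) ≤ Λ * dist ζ η := hΘ₁.dist_le_mul _ (hsub _ h5 hζ) _ hηb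
          _ ≤ Λ * (((Λ : ℝ) ^ 3)⁻¹ * ρ) := by gcongr; exact hζ
          _ = (Λ : ℝ)⁻¹ * ((Λ : ℝ)⁻¹ * ρ) := by field_simp
          _ < 1 * ((Λ : ℝ)⁻¹ * ρ) := by
              gcongr; exact inv_lt_one_of_one_lt₀ hΛ1
          _ = _ := one_mul _
      have i4 : μH[(m : ℝ)] (Metric.closedBall η (((Λ : ℝ) ^ 3)⁻¹ * ρ)) ≤
          ENNReal.ofReal ((Λ : ℝ) ^ m) *
            μH[(m : ℝ)] (S ∩ Metric.ball (Θ η) ((Λ : ℝ)⁻¹ * ρ)) := by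
        have h5 : ((Λ : ℝ) ^ 3)⁻¹ ≤ Λ ^ 3 := (inv_le_one_of_one_le₀ hΛ3).trans hΛ3
        rw [← hpow]
        refine (hausdorffMeasure_le_of_expanding (f := Θ) (K := Λ) hm0 fun σ hσ τ hτ =>
          hΘ₂ σ (hsub _ h5 hσ) τ (hsub _ h5 hτ)).trans ?_
        gcongr
      rcases le_or_gt a 0 with ha | ha
      · rw [ENNReal.ofReal_of_nonpos (div_nonpos_of_nonpos_of_nonneg ha (by positivity)), zero_mul]
        exact zero_le
      have i5 : ENNReal.ofReal (((Λ : ℝ) ^ 3)⁻¹ ^ m) * μH[(m : ℝ)] (Metric.closedBall η ρ) ≤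
          ENNReal.ofReal ((Λ : ℝ) ^ m) *
            μH[(m : ℝ)] (S ∩ Metric.ball (Θ η) ((Λ : ℝ)⁻¹ * ρ)) := by
        rwa [hball η ρ _ hρ0 (by positivity)] at i4
      have e : a / (L₂ * (Λ : ℝ) ^ 4) ^ m =
          ((L₂ : ℝ) ^ m)⁻¹ * (a * (((Λ : ℝ) ^ m)⁻¹ * ((Λ : ℝ) ^ 3)⁻¹ ^ m)) := by
        rw [mul_pow, inv_pow, div_eq_mul_inv, mul_inv, show ((Λ : ℝ) ^ 4) ^ m =
          (Λ : ℝ) ^ m * ((Λ : ℝ) ^ 3) ^ m by rw [← mul_pow]; ring, mul_inv]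
        ring
      have hcancel : ∀ (t : ℝ) (X Y : ℝ≥0∞), 0 < t → X ≤ ENNReal.ofReal t * Y →
          ENNReal.ofReal t⁻¹ * X ≤ Y := by
        intro t X Y ht hXY
        calc ENNReal.ofReal t⁻¹ * X ≤ ENNReal.ofReal t⁻¹ * (ENNReal.ofReal t * Y) := by gcongr
          _ = Y := by
            rw [← mul_assoc, ← ENNReal.ofReal_mul (by positivity), inv_mul_cancel₀ ht.ne',
              ENNReal.ofReal_one, one_mul]
      rw [e, ENNReal.ofReal_mul (by positivity), ENNReal.ofReal_mul ha.le,
        ENNReal.ofReal_mul (by positivity), mul_assoc, mul_assoc, mul_assoc]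
      refine hcancel _ _ _ (by positivity) (le_trans ?_ i1)
      refine le_trans ?_ (h2.2.1.trans i2)
      gcongr
      exact hcancel _ _ _ (by positivity) i5
    · have i1 : μH[(m : ℝ)] (g '' Metric.closedBall η ρ) ≤
          ENNReal.ofReal ((L₁ : ℝ) ^ m) * μH[(m : ℝ)] (N '' (Θ '' Metric.closedBall η ρ)) := by
        rw [himg, ← hpow]
        exact (hΓ₁.mono (image_mono (image_mono hsub1))).hausdorffMeasure_image_le hm0
      have i2 : Θ '' Metric.closedBall η ρ ⊆ S ∩ Metric.ball (Θ η) ((Λ : ℝ) ^ 2 * ρ) := by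
        rintro _ ⟨ζ, hζ, rfl⟩
        refine ⟨hΘS ζ (hsub1 hζ), ?_⟩
        rw [Metric.mem_ball]
        calc dist (Θ ζ) (Θ η) ≤ Λ * dist ζ η := hΘ₁.dist_le_mul _ (hsub1 hζ) _ hηb
          _ ≤ Λ * ρ := by gcongr; exact hζ
          _ < (Λ : ℝ) ^ 2 * ρ := by nlinarith [mul_pos hΛ0 hρ0]
      have i3 : S ∩ Metric.ball (Θ η) ((Λ : ℝ) ^ 2 * ρ) ⊆
          Θ '' Metric.closedBall η ((Λ : ℝ) ^ 3 * ρ) := by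
        intro w hw
        obtain ⟨ζ, hζ, rfl⟩ := h1.1 hw
        refine ⟨ζ, ?_, rfl⟩
        have := hΘ₂ ζ hζ η hηb
        have h4 := Metric.mem_ball.1 hw.2
        rw [Metric.mem_closedBall]
        calc dist ζ η ≤ Λ * dist (Θ ζ) (Θ η) := this
          _ ≤ Λ * ((Λ : ℝ) ^ 2 * ρ) := by gcongr
          _ = (Λ : ℝ) ^ 3 * ρ := by ring
      have i4 : μH[(m : ℝ)] (Θ '' Metric.closedBall η ((Λ : ℝ) ^ 3 * ρ)) ≤
          ENNReal.ofReal ((Λ : ℝ) ^ m) * μH[(m : ℝ)] (Metric.closedBall η ((Λ : ℝ) ^ 3 * ρ)) := by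
        rw [← hpow]
        exact (hΘ₁.mono (hsub _ le_rfl)).hausdorffMeasure_image_le hm0
      rw [hball η ρ _ hρ0 (by positivity)] at i4
      rcases le_or_gt b 0 with hb | hb
      · rw [ENNReal.ofReal_of_nonpos (mul_nonpos_of_nonpos_of_nonneg hb (by positivity)), zero_mul]
        have h5 := h1.2.2
        rw [ENNReal.ofReal_of_nonpos hb, zero_mul] at h5
        refine i1.trans ?_
        rw [show μH[(m : ℝ)] (N '' (Θ '' Metric.closedBall η ρ)) = 0 from
          le_antisymm ((measure_mono (image_mono i2)).trans h5) zero_le, mul_zero]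
      have e : b * (L₁ * (Λ : ℝ) ^ 5) ^ m ≥
          (L₁ : ℝ) ^ m * (b * ((Λ : ℝ) ^ m * ((Λ : ℝ) ^ 3) ^ m)) := by
        rw [show (L₁ : ℝ) ^ m * (b * ((Λ : ℝ) ^ m * ((Λ : ℝ) ^ 3) ^ m)) =
          b * (L₁ * (Λ : ℝ) ^ 4) ^ m by simp only [mul_pow]; ring]
        gcongr
        · exact hΛ1.le
        · norm_num
      calc μH[(m : ℝ)] (g '' Metric.closedBall η ρ)
          ≤ ENNReal.ofReal ((L₁ : ℝ) ^ m) * μH[(m : ℝ)] (N '' (Θ '' Metric.closedBall η ρ)) := i1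
        _ ≤ ENNReal.ofReal ((L₁ : ℝ) ^ m) * (ENNReal.ofReal b * (ENNReal.ofReal ((Λ : ℝ) ^ m) *
            (ENNReal.ofReal (((Λ : ℝ) ^ 3) ^ m) * μH[(m : ℝ)] (Metric.closedBall η ρ)))) := by
            gcongr
            refine (measure_mono (image_mono i2)).trans (h1.2.2.trans ?_)
            gcongr
            exact (measure_mono i3).trans i4
        _ = ENNReal.ofReal ((L₁ : ℝ) ^ m * (b * ((Λ : ℝ) ^ m * ((Λ : ℝ) ^ 3) ^ m))) *
            μH[(m : ℝ)] (Metric.closedBall η ρ) := by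
            rw [ENNReal.ofReal_mul (by positivity), ENNReal.ofReal_mul hb.le,
              ENNReal.ofReal_mul (by positivity), mul_assoc, mul_assoc, mul_assoc]
        _ ≤ _ := by gcongr
  rw [hc] at key
  simp only [Measure.smul_apply, smul_eq_mul, mul_left_comm _ c] at key
  exact ⟨(ENNReal.mul_le_mul_iff_right hc0 hct).1 key.1,
    (ENNReal.mul_le_mul_iff_right hc0 hct).1 key.2⟩

end Density

section SupportFunction

variable {n : ℕ} {K : Set (E n)}

lemma suppFn_bddAbove (hK : IsCompact K) (w : E n) : BddAbove ((fun x => ⟪x, w⟫) '' K) :=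
  (hK.image (by fun_prop)).bddAbove

lemma inner_le_suppFn (hK : IsCompact K) {z : E n} (hz : z ∈ K) (w : E n) :
    ⟪z, w⟫ ≤ suppFn K w :=
  le_csSup (suppFn_bddAbove hK w) ⟨z, hz, rfl⟩

lemma exists_inner_eq_suppFn (hK : IsCompact K) (hne : K.Nonempty) (w : E n) :
    ∃ z ∈ K, ⟪z, w⟫ = suppFn K w := by
  obtain ⟨z, hz, h⟩ := (hK.image (f := fun x => ⟪x, w⟫) (by fun_prop)).sSup_mem (hne.image _)
  exact ⟨z, hz, h⟩

lemma suppFn_le (hne : K.Nonempty) {w : E n} {c : ℝ} (h : ∀ z ∈ K, ⟪z, w⟫ ≤ c) :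
    suppFn K w ≤ c :=
  csSup_le (hne.image _) (by rintro _ ⟨z, hz, rfl⟩; exact h z hz)

lemma suppFn_smul (hK : IsCompact K) (hne : K.Nonempty) {c : ℝ} (hc : 0 ≤ c) (w : E n) :
    suppFn K (c • w) = c * suppFn K w := by
  apply le_antisymm
  · refine suppFn_le hne fun z hz => ?_
    rw [inner_smul_right]
    exact mul_le_mul_of_nonneg_left (inner_le_suppFn hK hz w) hc
  · obtain ⟨z, hz, h⟩ := exists_inner_eq_suppFn hK hne w
    rw [← h, ← inner_smul_right]
    exact inner_le_suppFn hK hz _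

lemma suppFn_sub_le (hK : IsCompact K) (hne : K.Nonempty) {R : ℝ} (hR : ∀ z ∈ K, ‖z‖ ≤ R)
    (w w' : E n) : suppFn K w - suppFn K w' ≤ R * ‖w - w'‖ := by
  obtain ⟨z, hz, h⟩ := exists_inner_eq_suppFn hK hne w
  have h1 := inner_le_suppFn hK hz w'
  have h2 : ⟪z, w⟫ - ⟪z, w'⟫ ≤ R * ‖w - w'‖ := by
    rw [← inner_sub_right]
    exact (real_inner_le_norm _ _).trans (by gcongr; exact hR z hz)
  linarith

lemma abs_suppFn_sub_le (hK : IsCompact K) (hne : K.Nonempty) {R : ℝ} (hR : ∀ z ∈ K, ‖z‖ ≤ R)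
    (w w' : E n) : |suppFn K w - suppFn K w'| ≤ R * ‖w - w'‖ := by
  rw [abs_sub_le_iff]
  refine ⟨suppFn_sub_le hK hne hR w w', ?_⟩
  rw [norm_sub_rev]
  exact suppFn_sub_le hK hne hR w' w

lemma exists_norm_le (hK : IsCompact K) : ∃ R, 0 < R ∧ ∀ z ∈ K, ‖z‖ ≤ R := by
  obtain ⟨R, hR⟩ := hK.isBounded.exists_norm_le
  exact ⟨max R 1, by positivity, fun z hz => (hR z hz).trans (le_max_left _ _)⟩

lemma suppFn_continuous (hK : IsCompact K) (hne : K.Nonempty) : Continuous (suppFn K) := by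
  obtain ⟨R, hR0, hR⟩ := exists_norm_le hK
  refine (LipschitzWith.of_dist_le_mul (K := R.toNNReal) fun w w' => ?_).continuous
  rw [Real.dist_eq, dist_eq_norm, Real.coe_toNNReal _ hR0.le]
  exact abs_suppFn_sub_le hK hne hR w w'

lemma exists_closedBall_subset (h0 : (0 : E n) ∈ interior K) :
    ∃ ρ, 0 < ρ ∧ ∀ z, ‖z‖ ≤ ρ → z ∈ K := by
  obtain ⟨ρ, hρ, h⟩ := Metric.nhds_basis_closedBall.mem_iff.1 (mem_interior_iff_mem_nhds.1 h0)
  exact ⟨ρ, hρ, fun z hz => h (by simpa using hz)⟩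

lemma mul_norm_le_suppFn (hK : IsCompact K) {ρ : ℝ} (hρ : 0 < ρ) (h : ∀ z, ‖z‖ ≤ ρ → z ∈ K)
    (w : E n) : ρ * ‖w‖ ≤ suppFn K w := by
  rcases eq_or_ne w 0 with rfl | hw
  · rw [norm_zero, mul_zero]
    simpa using inner_le_suppFn hK (h 0 (by simpa using hρ.le)) (0 : E n)
  have hw' := norm_pos_iff.2 hw
  have h1 := inner_le_suppFn hK (h ((ρ / ‖w‖) • w) (by
    rw [norm_smul, Real.norm_of_nonneg (by positivity)]; field_simp; exact le_rfl)) w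
  rw [real_inner_smul_left, real_inner_self_eq_norm_sq] at h1
  calc ρ * ‖w‖ = ρ / ‖w‖ * ‖w‖ ^ 2 := by field_simp
    _ ≤ _ := h1

lemma suppFn_pos (hK : IsCompact K) (h0 : (0 : E n) ∈ interior K) {w : E n} (hw : w ≠ 0) :
    0 < suppFn K w := by
  obtain ⟨ρ, hρ, h⟩ := exists_closedBall_subset h0
  exact (mul_pos hρ (norm_pos_iff.2 hw)).trans_le (mul_norm_le_suppFn hK hρ h w)

lemma mem_polarBody_iff (hK : IsCompact K) (hne : K.Nonempty) {w : E n} :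
    w ∈ polarBody K ↔ suppFn K w ≤ 1 :=
  ⟨fun h => suppFn_le hne h, fun h _ hz => (inner_le_suppFn hK hz w).trans h⟩

lemma suppFn_eq_one_of_mem_frontier (hK : IsCompact K) (hne : K.Nonempty) {w : E n}
    (h : w ∈ frontier (polarBody K)) : suppFn K w = 1 := by
  have hset : polarBody K = {w | suppFn K w ≤ 1} := by
    ext w; exact mem_polarBody_iff hK hne
  rw [hset] at h
  exact frontier_le_subset_eq (suppFn_continuous hK hne) continuous_const h

lemma mem_frontier_polarBody_iff (hK : IsCompact K) (h0 : (0 : E n) ∈ interior K) {w : E n} :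
    w ∈ frontier (polarBody K) ↔ suppFn K w = 1 := by
  have hne : K.Nonempty := ⟨0, interior_subset h0⟩
  constructor
  · exact suppFn_eq_one_of_mem_frontier hK hne
  · intro h
    refine ⟨subset_closure ((mem_polarBody_iff hK hne).2 h.le), fun hin => ?_⟩
    have h1 : Tendsto (fun t : ℝ => (1 + t) • w) (𝓝[>] 0) (𝓝 w) := by
      have : Tendsto (fun t : ℝ => (1 + t) • w) (𝓝 0) (𝓝 ((1 + (0 : ℝ)) • w)) :=
        Continuous.tendsto (by fun_prop) 0
      rw [add_zero, one_smul] at this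
      exact this.mono_left nhdsWithin_le_nhds
    have h2 := h1.eventually (mem_interior_iff_mem_nhds.1 hin)
    obtain ⟨t, ht, ht0⟩ := (h2.and self_mem_nhdsWithin).exists
    have ht0' : 0 < t := ht0
    have h3 := (mem_polarBody_iff hK hne).1 ht
    rw [suppFn_smul hK hne (by linarith), h] at h3
    linarith

/-- A point outside a convex body is separated from it by its support function. -/
lemma exists_suppFn_lt (hK : IsCompact K) (hc : Convex ℝ K) (hne : K.Nonempty) {z : E n}
    (hz : z ∉ K) : ∃ w, suppFn K w < ⟪z, w⟫ := by
  obtain ⟨f, u, h1, h2⟩ := geometric_hahn_banach_closed_point hc hK.isClosed hz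
  refine ⟨(InnerProductSpace.toDual ℝ (E n)).symm f, ?_⟩
  have e : ∀ v, ⟪v, (InnerProductSpace.toDual ℝ (E n)).symm f⟫ = f v := fun v => by
    rw [real_inner_comm, InnerProductSpace.toDual_symm_apply]
  rw [e]
  refine lt_of_le_of_lt (suppFn_le hne fun z hz => ?_) h2
  rw [e]; exact (h1 z hz).le

lemma mem_of_inner_le_suppFn (hK : IsCompact K) (hc : Convex ℝ K) (hne : K.Nonempty) {z : E n}
    (h : ∀ w, ⟪z, w⟫ ≤ suppFn K w) : z ∈ K := by
  by_contra hz
  obtain ⟨w, hw⟩ := exists_suppFn_lt hK hc hne hz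
  exact absurd (h w) (not_le.2 hw)

end SupportFunction

section Gradient

variable {n : ℕ} {K : Set (E n)} {G : E n → E n}

/-- `G` is a continuous choice of boundary points of `K` with prescribed outer normals, i.e. the
gradient of the support function, and it is injective up to scaling. -/
structure IsSuppGrad (K : Set (E n)) (G : E n → E n) : Prop where
  compact : IsCompact K
  conv : Convex ℝ K
  zero_mem : (0 : E n) ∈ interior K
  mem : ∀ w, w ≠ 0 → G w ∈ K
  inner_eq : ∀ w, w ≠ 0 → ⟪w, G w⟫ = suppFn K w
  cont : ContinuousOn G {0}ᶜ
  inj : ∀ w w', suppFn K w = 1 → suppFn K w' = 1 → G w = G w' → w = w'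

lemma IsSuppGrad.nonempty (h : IsSuppGrad K G) : K.Nonempty := ⟨0, interior_subset h.zero_mem⟩

lemma IsSuppGrad.sub_le (h : IsSuppGrad K G) {w : E n} (hw : w ≠ 0) (w' : E n) :
    suppFn K w + ⟪w' - w, G w⟫ ≤ suppFn K w' := by
  rw [inner_sub_left, h.inner_eq w hw, real_inner_comm]
  linarith [inner_le_suppFn h.compact (h.mem w hw) w']

lemma zero_mem_interior_polarBody (hK : IsCompact K) : (0 : E n) ∈ interior (polarBody K) := by
  obtain ⟨R, hR0, hR⟩ := exists_norm_le hK
  rw [mem_interior_iff_mem_nhds]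
  filter_upwards [Metric.closedBall_mem_nhds (0 : E n) (inv_pos.2 hR0)] with w hw z hz
  calc ⟪z, w⟫ ≤ ‖z‖ * ‖w‖ := real_inner_le_norm _ _
    _ ≤ R * R⁻¹ := by
      gcongr
      · exact hR z hz
      · simpa using hw
    _ = 1 := mul_inv_cancel₀ hR0.ne'

lemma IsOuterNormal.inner_pos {Q : Set (E n)} {ν : E n → E n} (hν : IsOuterNormal Q ν)
    (h0 : (0 : E n) ∈ interior Q) {w : E n} (hw : w ∈ frontier Q) : 0 < ⟪w, ν w⟫ := by
  obtain ⟨ρ, hρ, h⟩ := exists_closedBall_subset h0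
  obtain ⟨h1, h2⟩ := hν w hw
  have h3 := h2 (ρ • ν w) (h _ (by rw [norm_smul, h1, Real.norm_of_nonneg hρ.le, mul_one]))
  rw [real_inner_smul_left, real_inner_self_eq_norm_sq, h1] at h3
  linarith

/-- The gradient of the support function of `K`, in terms of the normal map of the polar body. -/
def normalGrad (K : Set (E n)) (ν : E n → E n) (w : E n) : E n :=
  ⟪(suppFn K w)⁻¹ • w, ν ((suppFn K w)⁻¹ • w)⟫⁻¹ • ν ((suppFn K w)⁻¹ • w)

lemma normalGrad_of_suppFn_eq_one {ν : E n → E n} {w : E n} (hw : suppFn K w = 1) :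
    normalGrad K ν w = ⟪w, ν w⟫⁻¹ • ν w := by
  rw [normalGrad, hw, inv_one, one_smul]

lemma isSuppGrad_normalGrad {ν : E n → E n} {κ : E n → ℝ} (hK : IsConvexBody K)
    (h0 : (0 : E n) ∈ interior K) (hQ : IsC2PlusBody (polarBody K) ν κ) :
    IsSuppGrad K (normalGrad K ν) := by
  obtain ⟨hc, hcp, -⟩ := hK
  obtain ⟨-, hν, hνc, -, hbij, -⟩ := hQ
  have hne : K.Nonempty := ⟨0, interior_subset h0⟩
  have hfr : ∀ w, w ≠ 0 → (suppFn K w)⁻¹ • w ∈ frontier (polarBody K) := fun w hw => by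
    have := suppFn_pos hcp h0 hw
    rw [mem_frontier_polarBody_iff hcp h0, suppFn_smul hcp hne (by positivity),
      inv_mul_cancel₀ this.ne']
  have hpos : ∀ v ∈ frontier (polarBody K), 0 < ⟪v, ν v⟫ := fun v hv =>
    hν.inner_pos (zero_mem_interior_polarBody hcp) hv
  have hinner : ∀ w, w ≠ 0 → ⟪w, normalGrad K ν w⟫ = suppFn K w := fun w hw => by
    have h1 := suppFn_pos hcp h0 hw
    have h2 := hpos _ (hfr w hw)
    have h3 : ⟪w, ν ((suppFn K w)⁻¹ • w)⟫ =
        suppFn K w * ⟪(suppFn K w)⁻¹ • w, ν ((suppFn K w)⁻¹ • w)⟫ := by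
      rw [real_inner_smul_left]; field_simp
    rw [normalGrad, real_inner_smul_right, h3, mul_left_comm, inv_mul_cancel₀ h2.ne', mul_one]
  refine ⟨hcp, hc, h0, fun w hw => ?_, hinner, ?_, fun w w' hw hw' h => ?_⟩
  · refine mem_of_inner_le_suppFn hcp hc hne fun v => ?_
    rcases eq_or_ne v 0 with rfl | hv
    · rw [inner_zero_right]
      simpa using inner_le_suppFn hcp (interior_subset h0) (0 : E n)
    have h1 := suppFn_pos hcp h0 hv
    have h2 := hpos _ (hfr w hw)
    have h3 := (hν _ (hfr w hw)).2 _ ((mem_polarBody_iff hcp hne).2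
      ((mem_frontier_polarBody_iff hcp h0).1 (hfr v hv)).le)
    rw [real_inner_smul_left] at h3
    rw [normalGrad, real_inner_comm, real_inner_smul_right]
    rw [inv_mul_le_iff₀ h2, mul_comm]
    rwa [inv_mul_le_iff₀ h1] at h3
  · have hcH := suppFn_continuous hcp hne
    have c1 : ContinuousOn (fun w => (suppFn K w)⁻¹ • w) {0}ᶜ :=
      (hcH.continuousOn.inv₀ fun w hw => (suppFn_pos hcp h0 hw).ne').smul continuousOn_id
    have c2 : ContinuousOn (fun w => ν ((suppFn K w)⁻¹ • w)) {0}ᶜ :=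
      hνc.comp c1 fun w hw => hfr w hw
    exact ((c1.inner c2).inv₀ fun w hw => (hpos _ (hfr w hw)).ne').smul c2
  · have f1 := (mem_frontier_polarBody_iff hcp h0).2 hw
    have f2 := (mem_frontier_polarBody_iff hcp h0).2 hw'
    rw [normalGrad_of_suppFn_eq_one hw, normalGrad_of_suppFn_eq_one hw'] at h
    have p1 := hpos _ f1
    have p2 := hpos _ f2
    have n1 := congrArg norm h
    rw [norm_smul, norm_smul, (hν _ f1).1, (hν _ f2).1, mul_one, mul_one,
      Real.norm_of_nonneg (by positivity), Real.norm_of_nonneg (by positivity)] at n1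
    rw [n1] at h
    exact hbij.injOn f1 f2 (smul_right_injective _ (by positivity) h)

end Gradient

section Frame

variable {m : ℕ}

/-- An isometric embedding of `E m` onto the hyperplane orthogonal to `y`. -/
structure IsFrame (y : E (m + 1)) (ι : E m →ₗᵢ[ℝ] E (m + 1)) : Prop where
  ne_zero : y ≠ 0
  orth : ∀ η, ⟪ι η, y⟫ = 0
  range : ∀ w, ⟪w, y⟫ = 0 → ∃ η, ι η = w

lemma exists_isFrame {y : E (m + 1)} (hy : y ≠ 0) : ∃ ι, IsFrame y ι := by
  have : Fact (Module.finrank ℝ (E (m + 1)) = m + 1) := ⟨finrank_euclideanSpace_fin⟩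
  set b := OrthonormalBasis.fromOrthogonalSpanSingleton (𝕜 := ℝ) m hy
  refine ⟨(Submodule.subtypeₗᵢ _).comp b.repr.symm.toLinearIsometry, hy, fun η => ?_,
    fun w hw => ?_⟩
  · have := (b.repr.symm η).2
    rw [Submodule.mem_orthogonal_singleton_iff_inner_left] at this
    exact this
  · refine ⟨b.repr ⟨w, ?_⟩, ?_⟩
    · rw [Submodule.mem_orthogonal_singleton_iff_inner_left]; exact hw
    · simp

/-- The orthogonal projection onto the image of an isometric embedding, in coordinates. -/
def tr (ι : E m →ₗᵢ[ℝ] E (m + 1)) : E (m + 1) →L[ℝ] E m := ι.toContinuousLinearMap.adjoint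

variable {ι : E m →ₗᵢ[ℝ] E (m + 1)} {y : E (m + 1)}

lemma inner_tr (z : E (m + 1)) (η : E m) : ⟪tr ι z, η⟫ = ⟪z, ι η⟫ := by
  rw [tr, ContinuousLinearMap.adjoint_inner_left]; rfl

lemma tr_apply (η : E m) : tr ι (ι η) = η :=
  ext_inner_right ℝ fun ζ => by rw [inner_tr, ι.inner_map_map]

lemma IsFrame.apply_tr (h : IsFrame y ι) {w : E (m + 1)} (hw : ⟪w, y⟫ = 0) : ι (tr ι w) = w := by
  obtain ⟨η, rfl⟩ := h.range w hw
  rw [tr_apply]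

lemma IsFrame.tr_self (h : IsFrame y ι) : tr ι y = 0 :=
  ext_inner_right ℝ fun ζ => by rw [inner_tr, real_inner_comm, h.orth, inner_zero_left]

lemma IsFrame.decomp (h : IsFrame y ι) (z : E (m + 1)) :
    z = ι (tr ι z) + (⟪z, y⟫ / ‖y‖ ^ 2) • y := by
  have hy := norm_pos_iff.2 h.ne_zero
  have h1 : ⟪z - (⟪z, y⟫ / ‖y‖ ^ 2) • y, y⟫ = 0 := by
    rw [inner_sub_left, real_inner_smul_left, real_inner_self_eq_norm_sq]
    field_simp
    ring
  have h2 := h.apply_tr h1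
  rw [map_sub, map_smul, h.tr_self, smul_zero, sub_zero] at h2
  rw [h2]; abel

lemma IsFrame.norm_sq (h : IsFrame y ι) (z : E (m + 1)) :
    ‖z‖ ^ 2 = ‖tr ι z‖ ^ 2 + (⟪z, y⟫ / ‖y‖) ^ 2 := by
  have hy := norm_pos_iff.2 h.ne_zero
  conv_lhs => rw [h.decomp z]
  rw [norm_add_sq_real, real_inner_smul_right, h.orth, ι.norm_map, norm_smul, mul_pow,
    Real.norm_eq_abs, sq_abs]
  field_simp
  ring

lemma IsFrame.norm_tr_le (h : IsFrame y ι) (z : E (m + 1)) : ‖tr ι z‖ ≤ ‖z‖ := by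
  have := h.norm_sq z
  exact le_of_sq_le_sq (by nlinarith [sq_nonneg (⟪z, y⟫ / ‖y‖)]) (norm_nonneg _)

end Frame

section Graph

variable {m : ℕ} {K : Set (E (m + 1))} {G : E (m + 1) → E (m + 1)} {x : E (m + 1)}
  {ι : E m →ₗᵢ[ℝ] E (m + 1)}

/-- The support function of `K` on an affine hyperplane, normalised to vanish at the base point. -/
def graphFn (K : Set (E (m + 1))) (x : E (m + 1)) (ι : E m →ₗᵢ[ℝ] E (m + 1)) (η : E m) : ℝ :=
  suppFn K (x + ι η) - 1

/-- The gradient of `graphFn`. -/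
def graphGrad (G : E (m + 1) → E (m + 1)) (x : E (m + 1)) (ι : E m →ₗᵢ[ℝ] E (m + 1)) (η : E m) :
    E m := tr ι (G (x + ι η))

/-- A boundary point of the polar body together with a frame of its tangent hyperplane. -/
structure IsBase (K : Set (E (m + 1))) (G : E (m + 1) → E (m + 1)) (x : E (m + 1))
    (ι : E m →ₗᵢ[ℝ] E (m + 1)) : Prop where
  grad : IsSuppGrad K G
  supp : suppFn K x = 1
  frame : IsFrame (G x) ι

lemma IsBase.base_ne_zero (h : IsBase K G x ι) : x ≠ 0 := by
  rintro rfl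
  have := h.supp
  have h2 := suppFn_smul h.grad.compact h.grad.nonempty le_rfl (0 : E (m + 1))
  rw [smul_zero, zero_mul] at h2
  linarith

lemma IsBase.inner_base (h : IsBase K G x ι) : ⟪x, G x⟫ = 1 := by
  rw [h.grad.inner_eq x h.base_ne_zero, h.supp]

lemma IsBase.inner_add (h : IsBase K G x ι) (η : E m) : ⟪x + ι η, G x⟫ = 1 := by
  rw [inner_add_left, h.inner_base, h.frame.orth, add_zero]

lemma IsBase.add_ne_zero (h : IsBase K G x ι) (η : E m) : x + ι η ≠ 0 := fun h0 => by
  have := h.inner_add η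
  rw [h0, inner_zero_left] at this
  exact zero_ne_one this

lemma IsBase.graphFn_zero (h : IsBase K G x ι) : graphFn K x ι 0 = 0 := by
  rw [graphFn, map_zero, add_zero, h.supp, sub_self]

lemma IsBase.graphGrad_zero (h : IsBase K G x ι) : graphGrad G x ι 0 = 0 := by
  rw [graphGrad, map_zero, add_zero, h.frame.tr_self]

lemma IsBase.graphFn_nonneg (h : IsBase K G x ι) (η : E m) : 0 ≤ graphFn K x ι η := by
  have h1 := inner_le_suppFn h.grad.compact (h.grad.mem x h.base_ne_zero) (x + ι η)
  rw [real_inner_comm, h.inner_add] at h1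
  rw [graphFn]; linarith

lemma IsBase.isGrad (h : IsBase K G x ι) : IsGrad (graphFn K x ι) (graphGrad G x ι) := by
  refine isGrad_of_continuous (fun η ζ => ?_) ?_
  · have h1 := h.grad.sub_le (h.add_ne_zero η) (x + ι ζ)
    have h2 : ⟪graphGrad G x ι η, ζ - η⟫ = ⟪x + ι ζ - (x + ι η), G (x + ι η)⟫ := by
      rw [graphGrad, inner_tr, real_inner_comm, map_sub]
      congr 1; abel
    rw [h2, graphFn, graphFn]
    linarith
  · have h1 : Continuous fun η => G (x + ι η) :=
      h.grad.cont.comp_continuous (by fun_prop) fun η => h.add_ne_zero η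
    exact (tr ι).continuous.comp h1

lemma IsBase.graphFn_pos (h : IsBase K G x ι) {η : E m} (hη : η ≠ 0) : 0 < graphFn K x ι η := by
  refine lt_of_le_of_ne (h.graphFn_nonneg η) fun h0 => hη ?_
  have h1 : graphGrad G x ι η = 0 := by
    refine (h.isGrad.uniq η 0 fun z => ?_).symm
    rw [inner_zero_left, add_zero, ← h0]
    exact h.graphFn_nonneg z
  have h2 := h.frame.decomp (G (x + ι η))
  rw [graphGrad] at h1
  rw [h1, map_zero, zero_add] at h2
  have h3 : suppFn K (x + ι η) = 1 := by rw [graphFn] at h0; linarith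
  have h4 := h.grad.inner_eq _ (h.add_ne_zero η)
  rw [h2, real_inner_smul_right, h.inner_add, h3, mul_one] at h4
  rw [h4, one_smul] at h2
  have h5 := h.grad.inj _ _ h3 h.supp h2
  have h6 : ι η = 0 := by simpa using h5
  exact ι.injective (by rw [h6, map_zero])

/-- The radial projection of the tangent hyperplane to the boundary of the polar body. -/
def graphMap (K : Set (E (m + 1))) (x : E (m + 1)) (ι : E m →ₗᵢ[ℝ] E (m + 1)) (η : E m) :
    E (m + 1) := (suppFn K (x + ι η))⁻¹ • (x + ι η)

lemma IsBase.one_le_suppFn (h : IsBase K G x ι) (η : E m) : 1 ≤ suppFn K (x + ι η) := by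
  have := h.graphFn_nonneg η
  rw [graphFn] at this; linarith

lemma IsBase.graphMap_mem (h : IsBase K G x ι) (η : E m) :
    graphMap K x ι η ∈ frontier (polarBody K) := by
  have h1 := h.one_le_suppFn η
  rw [mem_frontier_polarBody_iff h.grad.compact h.grad.zero_mem, graphMap,
    suppFn_smul h.grad.compact h.grad.nonempty (by positivity), inv_mul_cancel₀ (by positivity)]

lemma IsBase.graphMap_continuous (h : IsBase K G x ι) : Continuous (graphMap K x ι) := by
  have hc := suppFn_continuous h.grad.compact h.grad.nonempty
  have h1 : Continuous fun η => suppFn K (x + ι η) := hc.comp (by fun_prop)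
  exact (h1.inv₀ fun η => by have := h.one_le_suppFn η; positivity).smul (by fun_prop)

lemma IsBase.graphMap_zero (h : IsBase K G x ι) : graphMap K x ι 0 = x := by
  rw [graphMap, map_zero, add_zero, h.supp, inv_one, one_smul]

lemma IsBase.graphMap_eq (h : IsBase K G x ι) {z : E (m + 1)}
    (hz : z ∈ frontier (polarBody K)) (hpos : 0 < ⟪z, G x⟫) :
    graphMap K x ι (tr ι (⟪z, G x⟫⁻¹ • z - x)) = z := by
  have h1 : ⟪⟪z, G x⟫⁻¹ • z - x, G x⟫ = 0 := by
    rw [inner_sub_left, h.inner_base, real_inner_smul_left, inv_mul_cancel₀ hpos.ne', sub_self]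
  rw [graphMap, h.frame.apply_tr h1, add_sub_cancel,
    suppFn_smul h.grad.compact h.grad.nonempty (by positivity),
    (mem_frontier_polarBody_iff h.grad.compact h.grad.zero_mem).1 hz, mul_one, inv_inv, smul_smul,
    mul_inv_cancel₀ hpos.ne', one_smul]

lemma IsBase.inner_graphMap (h : IsBase K G x ι) (η : E m) :
    ⟪graphMap K x ι η, G x⟫ = (suppFn K (x + ι η))⁻¹ := by
  rw [graphMap, real_inner_smul_left, h.inner_add, mul_one]

lemma IsBase.eventually_subset_image (h : IsBase K G x ι) {r : ℝ} {η : E m} (hη : ‖η‖ < r) :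
    ∀ᶠ ρ in 𝓝[>] (0 : ℝ), frontier (polarBody K) ∩ Metric.ball (graphMap K x ι η) ρ ⊆
      graphMap K x ι '' Metric.closedBall 0 r := by
  have hp : 0 < ⟪graphMap K x ι η, G x⟫ := by
    have := h.one_le_suppFn η
    rw [h.inner_graphMap]; positivity
  set f : E (m + 1) → E m := fun z => tr ι (⟪z, G x⟫⁻¹ • z - x) with hf
  have hfη : f (graphMap K x ι η) = η := by
    have h1 := h.one_le_suppFn η
    rw [hf]
    simp only
    rw [h.inner_graphMap, graphMap, inv_inv, smul_smul, mul_inv_cancel₀ (by positivity), one_smul,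
      add_sub_cancel_left, tr_apply]
  have hc1 : ContinuousAt (fun z => ⟪z, G x⟫) (graphMap K x ι η) :=
    Continuous.continuousAt (by fun_prop)
  have hc : ContinuousAt f (graphMap K x ι η) :=
    (tr ι).continuous.continuousAt.comp (((hc1.inv₀ hp.ne').smul continuousAt_id).sub
      continuousAt_const)
  have e1 : ∀ᶠ z in 𝓝 (graphMap K x ι η), 0 < ⟪z, G x⟫ ∧ ‖f z‖ < r :=
    (hc1.eventually_const_lt hp).and (hc.norm.eventually_lt_const (by simpa only [hfη] using hη))
  obtain ⟨ρ₀, hρ₀, hsub⟩ := Metric.eventually_nhds_iff_ball.1 e1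
  filter_upwards [Ioo_mem_nhdsGT hρ₀] with ρ hρ z hz
  obtain ⟨h1, h2⟩ := hsub z (Metric.ball_subset_ball hρ.2.le hz.2)
  exact ⟨f z, by simpa using h2.le, h.graphMap_eq hz.1 h1⟩

lemma IsBase.exists_small_lipschitz (h : IsBase K G x ι) {ε : ℝ} (hε : 0 < ε) :
    ∃ r, 0 < r ∧ ∀ η ζ : E m, ‖η‖ ≤ r → ‖ζ‖ ≤ r →
      |suppFn K (x + ι η) - suppFn K (x + ι ζ)| ≤ ε * ‖η - ζ‖ := by
  have hc : ContinuousAt (fun η => ‖graphGrad G x ι η‖) 0 :=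
    h.isGrad.continuous.norm.continuousAt
  have h0 : ‖graphGrad G x ι 0‖ < ε := by rwa [h.graphGrad_zero, norm_zero]
  obtain ⟨r, hr, hsub⟩ := Metric.nhds_basis_closedBall.mem_iff.1 (hc.eventually_lt_const h0)
  have key : ∀ η ζ : E m, ‖ζ‖ ≤ r → suppFn K (x + ι ζ) - suppFn K (x + ι η) ≤ ε * ‖ζ - η‖ := by
    intro η ζ hζ
    have h1 := h.isGrad.sub ζ η
    have h2 := real_inner_le_norm (graphGrad G x ι ζ) (ζ - η)
    have h3 : ‖graphGrad G x ι ζ‖ < ε := hsub (by simpa using hζ)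
    have h4 : ‖graphGrad G x ι ζ‖ * ‖ζ - η‖ ≤ ε * ‖ζ - η‖ := by gcongr
    rw [← neg_sub ζ η, inner_neg_right, graphFn, graphFn] at h1
    linarith
  refine ⟨r, hr, fun η ζ hη hζ => abs_sub_le_iff.2 ⟨key ζ η hη, ?_⟩⟩
  rw [norm_sub_rev]
  exact key η ζ hζ

lemma IsBase.exists_graphMap_biLipschitz (h : IsBase K G x ι) {Λ : ℝ≥0} (hΛ : 1 < Λ) :
    ∃ r₀, 0 < r₀ ∧ ∀ r ≤ r₀, LipschitzOnWith Λ (graphMap K x ι) (Metric.closedBall 0 r) ∧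
      ∀ η ∈ Metric.closedBall (0 : E m) r, ∀ ζ ∈ Metric.closedBall (0 : E m) r,
        dist η ζ ≤ Λ * dist (graphMap K x ι η) (graphMap K x ι ζ) := by
  have hΛ1 : (1 : ℝ) < Λ := by exact_mod_cast hΛ
  set M := ‖x‖ + 1 with hM
  have hM0 : 0 < M := by positivity
  have hlim : Tendsto (fun ε : ℝ => (Λ : ℝ) * (1 / (1 + ε) - M * ε)) (𝓝[>] 0)
      (𝓝 (Λ * (1 / (1 + 0) - M * 0))) := by
    refine Tendsto.mono_left ?_ nhdsWithin_le_nhds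
    exact ((tendsto_const_nhds.div (tendsto_const_nhds.add tendsto_id) (by norm_num)).sub
      (tendsto_const_nhds.mul tendsto_id)).const_mul _
  have hlim2 : Tendsto (fun ε : ℝ => 1 + M * ε) (𝓝[>] 0) (𝓝 (1 + M * 0)) :=
    Tendsto.mono_left (tendsto_const_nhds.add (tendsto_const_nhds.mul tendsto_id))
      nhdsWithin_le_nhds
  obtain ⟨ε, ⟨h1, h2⟩, hε⟩ := (((hlim.eventually_const_lt (u := 1) (by simpa using hΛ1)).and
    (hlim2.eventually_lt_const (u := (Λ : ℝ)) (by simpa using hΛ1))).and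
      self_mem_nhdsWithin).exists
  have hε0 : 0 < ε := hε
  obtain ⟨r₁, hr₁, hlip⟩ := h.exists_small_lipschitz hε0
  refine ⟨min r₁ 1, by positivity, fun r hr => ?_⟩
  have key : ∀ η ∈ Metric.closedBall (0 : E m) r, ∀ ζ ∈ Metric.closedBall (0 : E m) r,
      graphMap K x ι η - graphMap K x ι ζ = (suppFn K (x + ι η))⁻¹ • ι (η - ζ) +
        ((suppFn K (x + ι η))⁻¹ - (suppFn K (x + ι ζ))⁻¹) • (x + ι ζ) := by
    intro η _ ζ _
    rw [graphMap, graphMap, map_sub]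
    module
  have e1 : ∀ η ∈ Metric.closedBall (0 : E m) r, ∀ ζ ∈ Metric.closedBall (0 : E m) r,
      ‖((suppFn K (x + ι η))⁻¹ - (suppFn K (x + ι ζ))⁻¹) • (x + ι ζ)‖ ≤ M * ε * ‖η - ζ‖ := by
    intro η hη ζ hζ
    rw [mem_closedBall_zero_iff] at hη hζ
    have a1 := h.one_le_suppFn η
    have a2 := h.one_le_suppFn ζ
    have a3 := hlip η ζ (hη.trans (hr.trans (min_le_left _ _)))
      (hζ.trans (hr.trans (min_le_left _ _)))
    have a4 : ‖x + ι ζ‖ ≤ M := (norm_add_le _ _).trans (by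
      rw [ι.norm_map]; linarith [hζ.trans (hr.trans (min_le_right _ _))])
    rw [norm_smul, Real.norm_eq_abs, inv_sub_inv (by positivity) (by positivity), abs_div,
      abs_sub_comm, abs_of_pos (show 0 < suppFn K (x + ι η) * suppFn K (x + ι ζ) by positivity)]
    have a5 : |suppFn K (x + ι η) - suppFn K (x + ι ζ)| /
        (suppFn K (x + ι η) * suppFn K (x + ι ζ)) ≤ ε * ‖η - ζ‖ :=
      (div_le_self (abs_nonneg _) (one_le_mul_of_one_le_of_one_le a1 a2)).trans a3
    calc _ ≤ ε * ‖η - ζ‖ * M := by gcongr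
      _ = _ := by ring
  constructor
  · refine LipschitzOnWith.of_dist_le_mul fun η hη ζ hζ => ?_
    have a1 := h.one_le_suppFn η
    rw [dist_eq_norm, dist_eq_norm, key η hη ζ hζ]
    refine (norm_add_le _ _).trans ?_
    have a2 : ‖(suppFn K (x + ι η))⁻¹ • ι (η - ζ)‖ ≤ ‖η - ζ‖ := by
      rw [norm_smul, ι.norm_map, Real.norm_of_nonneg (by positivity)]
      exact mul_le_of_le_one_left (norm_nonneg _) (inv_le_one_of_one_le₀ a1)
    nlinarith [e1 η hη ζ hζ, norm_nonneg (η - ζ)]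
  · intro η hη ζ hζ
    have a1 := h.one_le_suppFn η
    have a3 : suppFn K (x + ι η) ≤ 1 + ε := by
      have hη' := mem_closedBall_zero_iff.1 hη
      have := hlip η 0 (hη'.trans (hr.trans (min_le_left _ _))) (by simpa using hr₁.le)
      rw [map_zero, add_zero, h.supp, sub_zero] at this
      have h3 := (abs_le.1 this).2
      have h4 : ε * ‖η‖ ≤ ε * 1 := by
        gcongr; exact hη'.trans (hr.trans (min_le_right _ _))
      linarith
    have a2 : 1 / (1 + ε) * ‖η - ζ‖ ≤ ‖(suppFn K (x + ι η))⁻¹ • ι (η - ζ)‖ := by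
      rw [norm_smul, ι.norm_map, Real.norm_of_nonneg (by positivity), one_div]
      gcongr
    rw [dist_eq_norm, dist_eq_norm, key η hη ζ hζ]
    have a4 := norm_sub_le_norm_add ((suppFn K (x + ι η))⁻¹ • ι (η - ζ))
      (((suppFn K (x + ι η))⁻¹ - (suppFn K (x + ι ζ))⁻¹) • (x + ι ζ))
    have a5 := e1 η hη ζ hζ
    calc ‖η - ζ‖ = 1 * ‖η - ζ‖ := (one_mul _).symm
      _ ≤ (Λ * (1 / (1 + ε) - M * ε)) * ‖η - ζ‖ := by gcongr
      _ = Λ * (1 / (1 + ε) * ‖η - ζ‖ - M * ε * ‖η - ζ‖) := by ring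
      _ ≤ _ := by gcongr; linarith

end Graph

section GaussMap

variable {m : ℕ}

/-- The map taking a normal direction to the tangential part of the gradient of the support
function. -/
def normalChart (Q : Set (E (m + 1))) (ι : E m →ₗᵢ[ℝ] E (m + 1)) (σ : E (m + 1)) : E m :=
  (suppFn Q σ)⁻¹ • tr ι σ

lemma IsFrame.norm_tr_sub_ge {y ŷ : E (m + 1)} {ι : E m →ₗᵢ[ℝ] E (m + 1)} (h : IsFrame y ι)
    (hŷ : ŷ = ‖y‖⁻¹ • y) {σ τ : E (m + 1)} (hσ : ‖σ‖ = 1) (hτ : ‖τ‖ = 1) {ε : ℝ} (hε1 : ε ≤ 1)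
    (h1 : ‖σ - ŷ‖ ≤ ε) (h2 : ‖τ - ŷ‖ ≤ ε) : (1 - ε) * ‖σ - τ‖ ≤ ‖tr ι (σ - τ)‖ := by
  have hε : 0 ≤ ε := (norm_nonneg _).trans h1
  have e1 : ⟪σ - τ, σ + τ⟫ = 0 := by
    rw [inner_sub_left, inner_add_right, inner_add_right, real_inner_self_eq_norm_sq,
      real_inner_self_eq_norm_sq, hσ, hτ, real_inner_comm]; ring
  have e2 : 2 * ⟪σ - τ, ŷ⟫ = - ⟪σ - τ, σ - ŷ⟫ - ⟪σ - τ, τ - ŷ⟫ := by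
    have : -⟪σ - τ, σ - ŷ⟫ - ⟪σ - τ, τ - ŷ⟫ = 2 * ⟪σ - τ, ŷ⟫ - ⟪σ - τ, σ + τ⟫ := by
      simp only [inner_sub_right, inner_add_right]; ring
    rw [this, e1, sub_zero]
  have e3 : |⟪σ - τ, ŷ⟫| ≤ ε * ‖σ - τ‖ := by
    have a1 := abs_real_inner_le_norm (σ - τ) (σ - ŷ)
    have a2 := abs_real_inner_le_norm (σ - τ) (τ - ŷ)
    have a3 : ‖σ - τ‖ * ‖σ - ŷ‖ ≤ ‖σ - τ‖ * ε := by gcongr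
    have a4 : ‖σ - τ‖ * ‖τ - ŷ‖ ≤ ‖σ - τ‖ * ε := by gcongr
    rw [abs_le] at a1 a2 ⊢
    constructor <;> nlinarith [a1.1, a1.2, a2.1, a2.2]
  have e4 : ⟪σ - τ, y⟫ / ‖y‖ = ⟪σ - τ, ŷ⟫ := by
    rw [hŷ, real_inner_smul_right]; ring
  have e5 := h.norm_sq (σ - τ)
  rw [e4] at e5
  have e6 : ⟪σ - τ, ŷ⟫ ^ 2 ≤ (ε * ‖σ - τ‖) ^ 2 := by
    rw [← sq_abs]; gcongr
  refine le_of_sq_le_sq ?_ (norm_nonneg _)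
  nlinarith [mul_nonneg (mul_nonneg hε (sub_nonneg.2 hε1)) (sq_nonneg ‖σ - τ‖)]

lemma exists_normalChart_biLipschitz {Q : Set (E (m + 1))} (hQ : IsCompact Q) (hne : Q.Nonempty)
    {y ŷ : E (m + 1)} {ι : E m →ₗᵢ[ℝ] E (m + 1)} (h : IsFrame y ι) (hŷ : ŷ = ‖y‖⁻¹ • y)
    {s : ℝ} (hs : 0 < s) (hsupp : suppFn Q ŷ = s) {Λ : ℝ} (hΛ : 1 < Λ) :
    ∃ ε, 0 < ε ∧ ∀ σ τ : E (m + 1), ‖σ‖ = 1 → ‖τ‖ = 1 → ‖σ - ŷ‖ ≤ ε → ‖τ - ŷ‖ ≤ ε →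
      dist (normalChart Q ι σ) (normalChart Q ι τ) ≤ Λ / s * dist σ τ ∧
        dist σ τ ≤ Λ * s * dist (normalChart Q ι σ) (normalChart Q ι τ) := by
  obtain ⟨R, hR0, hR⟩ := exists_norm_le hQ
  have l0 : Tendsto (fun ε : ℝ => s - R * ε) (𝓝[>] 0) (𝓝 (s - R * 0)) :=
    Tendsto.mono_left (tendsto_const_nhds.sub (tendsto_const_nhds.mul tendsto_id))
      nhdsWithin_le_nhds
  have l1 : Tendsto (fun ε : ℝ => 1 / (s - R * ε) + R * ε / (s - R * ε) ^ 2) (𝓝[>] 0)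
      (𝓝 (1 / (s - R * 0) + R * 0 / (s - R * 0) ^ 2)) :=
    (tendsto_const_nhds.div l0 (by simpa using hs.ne')).add
      ((Tendsto.mono_left (tendsto_const_nhds.mul tendsto_id) nhdsWithin_le_nhds).div (l0.pow 2)
        (by simpa using hs.ne'))
  have l2 : Tendsto (fun ε : ℝ => Λ * s * ((1 - ε) / (s + R * ε) - R * ε / (s - R * ε) ^ 2))
      (𝓝[>] 0) (𝓝 (Λ * s * ((1 - 0) / (s + R * 0) - R * 0 / (s - R * 0) ^ 2))) := by
    refine Tendsto.const_mul _ (Tendsto.sub (Tendsto.div ?_ ?_ (by simpa using hs.ne'))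
      ((Tendsto.mono_left (tendsto_const_nhds.mul tendsto_id) nhdsWithin_le_nhds).div (l0.pow 2)
        (by simpa using hs.ne')))
    · exact Tendsto.mono_left (tendsto_const_nhds.sub tendsto_id) nhdsWithin_le_nhds
    · exact Tendsto.mono_left (tendsto_const_nhds.add (tendsto_const_nhds.mul tendsto_id))
        nhdsWithin_le_nhds
  have hΛ0 : 0 < Λ := by linarith
  have v1 : 1 / (s - R * 0) + R * 0 / (s - R * 0) ^ 2 < Λ / s := by
    simp only [mul_zero, sub_zero, zero_div, add_zero]
    gcongr
  have v2 : 1 < Λ * s * ((1 - 0) / (s + R * 0) - R * 0 / (s - R * 0) ^ 2) := by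
    simp only [mul_zero, sub_zero, zero_div, add_zero]
    field_simp
    exact hΛ
  obtain ⟨ε, ⟨⟨⟨b0, b1⟩, b2⟩, hε⟩, hε1⟩ := (((((l0.eventually_const_lt (u := 0)
    (by simpa using hs)).and (l1.eventually_lt_const v1)).and (l2.eventually_const_lt v2)).and
      self_mem_nhdsWithin).and (Ioo_mem_nhdsGT one_pos)).exists
  have hε0 : 0 < ε := hε
  refine ⟨ε, hε0, fun σ τ hσ hτ h1 h2 => ?_⟩
  have q : ∀ σ : E (m + 1), ‖σ - ŷ‖ ≤ ε →
      s - R * ε ≤ suppFn Q σ ∧ suppFn Q σ ≤ s + R * ε := by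
    intro σ hσ
    have a1 := abs_suppFn_sub_le hQ hne hR σ ŷ
    have a2 : R * ‖σ - ŷ‖ ≤ R * ε := by gcongr
    rw [hsupp, abs_le] at a1
    constructor <;> linarith [a1.1, a1.2]
  obtain ⟨q1, q2⟩ := q σ h1
  obtain ⟨q3, q4⟩ := q τ h2
  have q1p : 0 < suppFn Q σ := b0.trans_le q1
  have q3p : 0 < suppFn Q τ := b0.trans_le q3
  have key : normalChart Q ι σ - normalChart Q ι τ = (suppFn Q σ)⁻¹ • tr ι (σ - τ) +
      ((suppFn Q σ)⁻¹ - (suppFn Q τ)⁻¹) • tr ι τ := by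
    rw [normalChart, normalChart, map_sub]
    module
  have trτ : ‖tr ι τ‖ ≤ ε := by
    have : tr ι τ = tr ι (τ - ŷ) := by
      rw [map_sub, hŷ, map_smul, h.tr_self, smul_zero, sub_zero]
    rw [this]
    exact (h.norm_tr_le _).trans h2
  have e1 : ‖((suppFn Q σ)⁻¹ - (suppFn Q τ)⁻¹) • tr ι τ‖ ≤
      R * ε / (s - R * ε) ^ 2 * ‖σ - τ‖ := by
    have a1 := abs_suppFn_sub_le hQ hne hR σ τ
    rw [norm_smul, Real.norm_eq_abs, inv_sub_inv q1p.ne' q3p.ne', abs_div,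
      abs_sub_comm, abs_of_pos (mul_pos q1p q3p)]
    calc |suppFn Q σ - suppFn Q τ| / (suppFn Q σ * suppFn Q τ) * ‖tr ι τ‖
        ≤ R * ‖σ - τ‖ / ((s - R * ε) * (s - R * ε)) * ε := by gcongr
      _ = _ := by ring
  rw [dist_eq_norm, dist_eq_norm, key]
  constructor
  · refine (norm_add_le _ _).trans ?_
    have a2 : ‖(suppFn Q σ)⁻¹ • tr ι (σ - τ)‖ ≤ 1 / (s - R * ε) * ‖σ - τ‖ := by
      rw [norm_smul, Real.norm_of_nonneg (by positivity), one_div]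
      gcongr
      exact h.norm_tr_le _
    calc _ ≤ 1 / (s - R * ε) * ‖σ - τ‖ + R * ε / (s - R * ε) ^ 2 * ‖σ - τ‖ := add_le_add a2 e1
      _ = (1 / (s - R * ε) + R * ε / (s - R * ε) ^ 2) * ‖σ - τ‖ := by ring
      _ ≤ _ := by gcongr
  · have a2 : (1 - ε) / (s + R * ε) * ‖σ - τ‖ ≤ ‖(suppFn Q σ)⁻¹ • tr ι (σ - τ)‖ := by
      rw [norm_smul, Real.norm_of_nonneg (by positivity)]
      have := h.norm_tr_sub_ge hŷ hσ hτ hε1.2.le h1 h2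
      have p : 0 ≤ (1 - ε) * ‖σ - τ‖ := mul_nonneg (by linarith [hε1.2]) (norm_nonneg _)
      calc (1 - ε) / (s + R * ε) * ‖σ - τ‖ = (s + R * ε)⁻¹ * ((1 - ε) * ‖σ - τ‖) := by ring
        _ ≤ (suppFn Q σ)⁻¹ * ‖tr ι (σ - τ)‖ := by gcongr
    have a4 := norm_sub_le_norm_add ((suppFn Q σ)⁻¹ • tr ι (σ - τ))
      (((suppFn Q σ)⁻¹ - (suppFn Q τ)⁻¹) • tr ι τ)
    calc ‖σ - τ‖ = 1 * ‖σ - τ‖ := (one_mul _).symm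
      _ ≤ (Λ * s * ((1 - ε) / (s + R * ε) - R * ε / (s - R * ε) ^ 2)) * ‖σ - τ‖ := by gcongr
      _ = Λ * s * ((1 - ε) / (s + R * ε) * ‖σ - τ‖ - R * ε / (s - R * ε) ^ 2 * ‖σ - τ‖) := by ring
      _ ≤ _ := by gcongr; linarith

/-- Two-sided bounds on the spherical image of small boundary balls, from the curvature. -/
lemma IsGaussCurvatureAt.eventually_bounds {Q : Set (E (m + 1))} {ν : E (m + 1) → E (m + 1)}
    {w : E (m + 1)} {k a b : ℝ} (h : IsGaussCurvatureAt Q ν w k) (ha : 0 < a) (hak : a < k)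
    (hkb : k < b) : ∀ᶠ ρ in 𝓝[>] (0 : ℝ),
      ENNReal.ofReal a * μH[(m : ℝ)] (frontier Q ∩ Metric.ball w ρ) ≤
          μH[(m : ℝ)] (ν '' (frontier Q ∩ Metric.ball w ρ)) ∧
        μH[(m : ℝ)] (ν '' (frontier Q ∩ Metric.ball w ρ)) ≤
          ENNReal.ofReal b * μH[(m : ℝ)] (frontier Q ∩ Metric.ball w ρ) := by
  have hbd : bdMeasure (m + 1) = μH[(m : ℝ)] := by
    rw [bdMeasure]; push_cast; rw [add_sub_cancel_right]
  rw [IsGaussCurvatureAt, hbd] at h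
  filter_upwards [h.eventually_const_lt hak, h.eventually_lt_const hkb] with ρ h1 h2
  set D := μH[(m : ℝ)] (frontier Q ∩ Metric.ball w ρ)
  set N := μH[(m : ℝ)] (ν '' (frontier Q ∩ Metric.ball w ρ))
  have hb : 0 < b := ha.trans (hak.trans hkb)
  have hD : 0 < D.toReal := by
    rcases (ENNReal.toReal_nonneg (a := D)).eq_or_lt with h0 | h0
    · rw [← h0, div_zero] at h1; linarith
    · exact h0
  have hN : 0 < N.toReal := by
    rcases (ENNReal.toReal_nonneg (a := N)).eq_or_lt with h0 | h0
    · rw [← h0, zero_div] at h1; linarith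
    · exact h0
  have hDt := (ENNReal.toReal_pos_iff.1 hD).2.ne
  have hNt := (ENNReal.toReal_pos_iff.1 hN).2.ne
  rw [lt_div_iff₀ hD] at h1
  rw [div_lt_iff₀ hD] at h2
  rw [← ENNReal.ofReal_toReal hDt, ← ENNReal.ofReal_toReal hNt, ← ENNReal.ofReal_mul ha.le,
    ← ENNReal.ofReal_mul hb.le]
  exact ⟨ENNReal.ofReal_le_ofReal h1.le, ENNReal.ofReal_le_ofReal h2.le⟩

lemma MABetween.weaken {g : E m → E m} {U : Set (E m)} {a b a' b' : ℝ} (h : MABetween g U a b)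
    (ha : a' ≤ a) (hb : b ≤ b') : MABetween g U a' b' := fun F hF hFU =>
  ⟨le_trans (by gcongr) (h F hF hFU).1, (h F hF hFU).2.trans (by gcongr)⟩

lemma normalGrad_add_eq {K : Set (E (m + 1))} {ν : E (m + 1) → E (m + 1)} (x : E (m + 1))
    (ι : E m →ₗᵢ[ℝ] E (m + 1)) (η : E m) :
    normalGrad K ν (x + ι η) =
      ⟪graphMap K x ι η, ν (graphMap K x ι η)⟫⁻¹ • ν (graphMap K x ι η) := rfl

lemma IsOuterNormal.suppFn_eq {Q : Set (E (m + 1))} {ν : E (m + 1) → E (m + 1)}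
    (hν : IsOuterNormal Q ν) (hQ : IsCompact Q) {w : E (m + 1)} (hw : w ∈ frontier Q) :
    suppFn Q (ν w) = ⟪w, ν w⟫ := by
  have hwQ : w ∈ Q := hQ.isClosed.frontier_subset hw
  exact le_antisymm (suppFn_le ⟨w, hwQ⟩ (hν w hw).2) (inner_le_suppFn hQ hwQ _)

/-- The tangential gradient of the support function has Monge-Ampere density close to a constant
near the base point. -/
theorem exists_graphGrad_MABetween {K : Set (E (m + 1))} {ν : E (m + 1) → E (m + 1)}
    {κ : E (m + 1) → ℝ} {x : E (m + 1)} {ι : E m →ₗᵢ[ℝ] E (m + 1)}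
    (hQ : IsC2PlusBody (polarBody K) ν κ) (h : IsBase K (normalGrad K ν) x ι) {ε : ℝ}
    (hε : 0 < ε) : ∃ r, 0 < r ∧ MABetween (graphGrad (normalGrad K ν) x ι)
      (Metric.closedBall 0 r) ((1 - ε) * (κ x / ⟪x, ν x⟫ ^ m))
      ((1 + ε) * (κ x / ⟪x, ν x⟫ ^ m)) := by
  obtain ⟨⟨-, hQc, -⟩, hν, hνc, hκc, hbij, hcurv⟩ := hQ
  have hx : x ∈ frontier (polarBody K) :=
    (mem_frontier_polarBody_iff h.grad.compact h.grad.zero_mem).2 h.supp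
  have h0Q := zero_mem_interior_polarBody h.grad.compact
  have hneQ : (polarBody K).Nonempty := ⟨0, interior_subset h0Q⟩
  set s := ⟪x, ν x⟫ with hs
  have hs0 : 0 < s := hν.inner_pos h0Q hx
  have hGx : normalGrad K ν x = s⁻¹ • ν x := normalGrad_of_suppFn_eq_one h.supp
  have hnorm : ‖normalGrad K ν x‖ = s⁻¹ := by
    rw [hGx, norm_smul, (hν x hx).1, mul_one, Real.norm_of_nonneg (by positivity)]
  have hŷ : ν x = ‖normalGrad K ν x‖⁻¹ • normalGrad K ν x := by
    rw [hnorm, hGx, inv_inv, smul_smul, mul_inv_cancel₀ hs0.ne', one_smul]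
  have hκ0 := (hcurv x hx).2
  have hΘ := h.graphMap_continuous
  have hlim : Tendsto (fun Λ : ℝ => Λ * (Λ ^ 6) ^ m) (𝓝[>] 1) (𝓝 (1 * (1 ^ 6) ^ m)) :=
    (Continuous.tendsto (by fun_prop) 1).mono_left nhdsWithin_le_nhds
  obtain ⟨Λ', hΛε, hΛ1⟩ := ((hlim.eventually_lt_const (u := 1 + ε) (by simpa using hε)).and
    self_mem_nhdsWithin).exists
  have hΛ1' : 1 < Λ' := hΛ1
  lift Λ' to ℝ≥0 using by linarith with Λ
  have hΛ : 1 < Λ := by exact_mod_cast hΛ1'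
  have hΛ0 : (0 : ℝ) < Λ := by linarith
  lift s to ℝ≥0 using hs0.le with s' hs'
  obtain ⟨ε₁, hε₁, hΓ⟩ := exists_normalChart_biLipschitz hQc hneQ h.frame hŷ hs0
    ((hν.suppFn_eq hQc hx).trans hs.symm) hΛ1'
  obtain ⟨r₀, hr₀, hbi⟩ := h.exists_graphMap_biLipschitz hΛ
  have c1 : Continuous fun η => ν (graphMap K x ι η) :=
    hνc.comp_continuous hΘ h.graphMap_mem
  have c2 : Continuous fun η => κ (graphMap K x ι η) :=
    hκc.comp_continuous hΘ h.graphMap_mem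
  have e1 : ∀ᶠ η in 𝓝 (0 : E m), ‖ν (graphMap K x ι η) - ν x‖ < ε₁ :=
    ((c1.sub continuous_const).norm.continuousAt (x := 0)).eventually_lt_const
      (by simpa [h.graphMap_zero] using hε₁)
  have e2 : ∀ᶠ η in 𝓝 (0 : E m), κ x / Λ < κ (graphMap K x ι η) :=
    (c2.continuousAt (x := 0)).eventually_const_lt (by
      simp only [h.graphMap_zero]; exact div_lt_self hκ0 hΛ1')
  have e3 : ∀ᶠ η in 𝓝 (0 : E m), κ (graphMap K x ι η) < κ x * Λ :=
    (c2.continuousAt (x := 0)).eventually_lt_const (by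
      simp only [h.graphMap_zero]; exact lt_mul_of_one_lt_right hκ0 hΛ1')
  obtain ⟨r₁, hr₁, hsub⟩ := Metric.nhds_basis_closedBall.mem_iff.1 (e1.and (e2.and e3))
  set r := min r₀ r₁ with hr
  have hr0 : 0 < r := lt_min hr₀ hr₁
  obtain ⟨hΘ₁, hΘ₂⟩ := hbi r (min_le_left _ _)
  have hin : ∀ η ∈ Metric.closedBall (0 : E m) r, ‖ν (graphMap K x ι η) - ν x‖ < ε₁ ∧
      κ x / Λ < κ (graphMap K x ι η) ∧ κ (graphMap K x ι η) < κ x * Λ := fun η hη =>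
    hsub (Metric.closedBall_subset_closedBall (min_le_right _ _) hη)
  have hΓ' : ∀ η ∈ Metric.closedBall (0 : E m) r, ∀ ζ ∈ Metric.closedBall (0 : E m) r, _ :=
    fun η hη ζ hζ => hΓ _ _ (hν _ (h.graphMap_mem η)).1 (hν _ (h.graphMap_mem ζ)).1
      (hin η hη).1.le (hin ζ hζ).1.le
  have hg : ∀ η : E m, graphGrad (normalGrad K ν) x ι η =
      normalChart (polarBody K) ι (ν (graphMap K x ι η)) := fun η => by
    rw [graphGrad, normalGrad_add_eq, normalChart, hν.suppFn_eq hQc (h.graphMap_mem η), map_smul]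
  have hcast1 : ((Λ / s' : ℝ≥0) : ℝ) = Λ / s' := NNReal.coe_div _ _
  have hcast2 : ((Λ * s' : ℝ≥0) : ℝ) = Λ * s' := NNReal.coe_mul _ _
  refine ⟨r / 2, by positivity, MABetween.weaken (MABetween.of_parametrization
    (S := frontier (polarBody K)) (N := ν) (Θ := graphMap K x ι)
    (Γ := normalChart (polarBody K) ι) (Λ := Λ) (L₁ := Λ / s') (L₂ := Λ * s')
    (a := κ x / Λ) (b := κ x * Λ) (half_lt_self hr0) hΛ ?_ ?_ h.isGrad.continuous.continuousOn
    (fun η _ => hg η) (fun η _ => h.graphMap_mem η) hΘ₁ hΘ₂ ?_ ?_ (fun η hη => ?_)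
    fun η hη => ?_) ?_ ?_⟩
  · have : 0 < s' := by exact_mod_cast hs0
    exact mul_pos (zero_lt_one.trans hΛ) this
  · intro η hη ζ hζ hηζ
    have a1 := (hΓ' η hη ζ hζ).2
    rw [← hg, ← hg, hηζ, dist_self, mul_zero] at a1
    have a2 := hbij.injOn (h.graphMap_mem η) (h.graphMap_mem ζ) (dist_le_zero.1 a1)
    have a3 := hΘ₂ η hη ζ hζ
    rw [a2, dist_self, mul_zero] at a3
    exact dist_le_zero.1 a3
  · refine LipschitzOnWith.of_dist_le_mul ?_
    rintro _ ⟨_, ⟨η, hη, rfl⟩, rfl⟩ _ ⟨_, ⟨ζ, hζ, rfl⟩, rfl⟩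
    rw [hcast1]
    exact (hΓ' η hη ζ hζ).1
  · rintro _ ⟨_, ⟨η, hη, rfl⟩, rfl⟩ _ ⟨_, ⟨ζ, hζ, rfl⟩, rfl⟩
    rw [hcast2]
    exact (hΓ' η hη ζ hζ).2
  · have := mem_closedBall_zero_iff.1 hη
    exact h.eventually_subset_image (by linarith)
  · have hη' := Metric.closedBall_subset_closedBall (half_le_self hr0.le) hη
    exact (hcurv _ (h.graphMap_mem η)).1.eventually_bounds (by positivity) (hin η hη').2.1
      (hin η hη').2.2
  · rw [hcast2, div_div, mul_div_assoc', div_le_div_iff₀ (by positivity) (by positivity)]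
    have e : (Λ : ℝ) * (Λ * s' * Λ ^ 4) ^ m = (Λ : ℝ) * (Λ ^ 5) ^ m * (s' : ℝ) ^ m := by
      rw [show (Λ : ℝ) * s' * Λ ^ 4 = Λ ^ 5 * s' by ring, mul_pow]; ring
    rw [e]
    have e2 : (Λ : ℝ) * (Λ ^ 5) ^ m ≤ 1 + ε := by
      refine le_trans ?_ hΛε.le
      gcongr
      · exact hΛ1'.le
      · norm_num
    have e3 : (1 - ε) * ((Λ : ℝ) * (Λ ^ 5) ^ m) ≤ 1 := by
      rcases le_or_gt ε 1 with h1 | h1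
      · calc (1 - ε) * ((Λ : ℝ) * (Λ ^ 5) ^ m) ≤ (1 - ε) * (1 + ε) := by
              gcongr
          _ ≤ 1 := by nlinarith [sq_nonneg ε]
      · exact (mul_nonpos_of_nonpos_of_nonneg (by linarith) (by positivity)).trans zero_le_one
    calc (1 - ε) * κ x * ((Λ : ℝ) * (Λ ^ 5) ^ m * (s' : ℝ) ^ m)
        = κ x * (s' : ℝ) ^ m * ((1 - ε) * ((Λ : ℝ) * (Λ ^ 5) ^ m)) := by ring
      _ ≤ κ x * (s' : ℝ) ^ m * 1 := by gcongr
      _ = _ := mul_one _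
  · rw [hcast1]
    calc κ x * Λ * ((Λ : ℝ) / s' * Λ ^ 5) ^ m = ((Λ : ℝ) * (Λ ^ 6) ^ m) * (κ x / (s' : ℝ) ^ m) := by
          rw [show (Λ : ℝ) / s' * Λ ^ 5 = Λ ^ 6 / s' by ring, div_pow]; ring
      _ ≤ _ := by gcongr

end GaussMap

section Coord

variable {m : ℕ} {ι : E m →ₗᵢ[ℝ] E (m + 1)} {y : E (m + 1)}

lemma IsFrame.measurePreserving (h : IsFrame y ι) :
    MeasurePreserving (fun q : E m × ℝ => ι q.1 + q.2 • (‖y‖⁻¹ • y))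
      (volume.prod volume) volume := by
  have hy := norm_pos_iff.2 h.ne_zero
  let A : WithLp 2 (E m × ℝ) →ₗᵢ[ℝ] E (m + 1) :=
    { toFun := fun q => ι q.fst + q.snd • (‖y‖⁻¹ • y)
      map_add' := fun p q => by
        simp only [WithLp.add_fst, WithLp.add_snd, map_add, add_smul]; abel
      map_smul' := fun c q => by
        simp only [WithLp.smul_fst, WithLp.smul_snd, map_smul, smul_add, smul_eq_mul, mul_smul,
          RingHom.id_apply]
      norm_map' := fun q => by
        refine (sq_eq_sq₀ (norm_nonneg _) (norm_nonneg _)).1 ?_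
        rw [WithLp.prod_norm_sq_eq_of_L2]
        change ‖ι q.fst + q.snd • (‖y‖⁻¹ • y)‖ ^ 2 = _
        rw [norm_add_sq_real, real_inner_smul_right, real_inner_smul_right, h.orth, ι.norm_map,
          norm_smul, norm_smul, norm_inv, norm_norm, inv_mul_cancel₀ hy.ne']
        ring }
  have hfin : Module.finrank ℝ (WithLp 2 (E m × ℝ)) = Module.finrank ℝ (E (m + 1)) := by
    rw [(WithLp.linearEquiv 2 ℝ (E m × ℝ)).finrank_eq, Module.finrank_prod]
    simp
  exact (A.toLinearIsometryEquiv hfin).measurePreserving.comp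
    (WithLp.volume_preserving_toLp (E m) ℝ)

lemma lintegral_comp_equiv (L : E m ≃L[ℝ] E m) (F : E m → ℝ≥0∞) (hF : Measurable F) :
    ∫⁻ v, F (L v) = ENNReal.ofReal |(L : E m →L[ℝ] E m).det|⁻¹ * ∫⁻ v, F v := by
  have hd : LinearMap.det (L : E m →ₗ[ℝ] E m) ≠ 0 := by
    have := L.toLinearEquiv.isUnit_det'
    exact this.ne_zero
  have h1 := Measure.map_linearMap_addHaar_eq_smul_addHaar (volume : Measure (E m)) hd
  have h2 : ∫⁻ v, F v ∂(Measure.map (L : E m →ₗ[ℝ] E m) volume) = ∫⁻ v, F (L v) :=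
    lintegral_map hF L.continuous.measurable
  rw [← h2, h1, lintegral_smul_measure, smul_eq_mul, abs_inv]
  rfl

lemma IsFrame.volume_region (h : IsFrame y ι) {x : E (m + 1)} (hx : ⟪x, y⟫ = 1) {t : ℝ}
    (ht : 0 < t) (L : E m ≃L[ℝ] E m) {f₁ f₂ : E m → ℝ} (h1 : Continuous f₁) (h2 : Continuous f₂) :
    volume {z : E (m + 1) | f₁ (L (tr ι z)) ≤ (1 - ⟪z, x⟫) / t ∧
      (1 - ⟪z, x⟫) / t ≤ f₂ (L (tr ι z))} =
    ENNReal.ofReal (‖y‖ * t * |(L : E m →L[ℝ] E m).det|⁻¹) *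
      ∫⁻ η, ENNReal.ofReal (f₂ η - f₁ η) := by
  have hy := norm_pos_iff.2 h.ne_zero
  have hcl : MeasurableSet {z : E (m + 1) | f₁ (L (tr ι z)) ≤ (1 - ⟪z, x⟫) / t ∧
      (1 - ⟪z, x⟫) / t ≤ f₂ (L (tr ι z))} := by
    have hc1 : Continuous fun z : E (m + 1) => L (tr ι z) := by fun_prop
    have hc2 : Continuous fun z : E (m + 1) => (1 - ⟪z, x⟫) / t := by fun_prop
    exact ((isClosed_le (h1.comp hc1) hc2).inter (isClosed_le hc2 (h2.comp hc1))).measurableSet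
  have htr : ∀ q : E m × ℝ, tr ι (ι q.1 + q.2 • (‖y‖⁻¹ • y)) = q.1 := fun q => by
    rw [map_add, map_smul, map_smul, tr_apply, h.tr_self, smul_zero, smul_zero, add_zero]
  rw [← h.measurePreserving.measure_preimage hcl.nullMeasurableSet,
    Measure.prod_apply (h.measurePreserving.measurable hcl)]
  have hsl : ∀ v : E m, volume (Prod.mk v ⁻¹' ((fun q : E m × ℝ => ι q.1 + q.2 • (‖y‖⁻¹ • y)) ⁻¹'
      {z : E (m + 1) | f₁ (L (tr ι z)) ≤ (1 - ⟪z, x⟫) / t ∧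
        (1 - ⟪z, x⟫) / t ≤ f₂ (L (tr ι z))})) =
      ENNReal.ofReal (‖y‖ * t) * ENNReal.ofReal (f₂ (L v) - f₁ (L v)) := fun v => by
    have : (Prod.mk v ⁻¹' ((fun q : E m × ℝ => ι q.1 + q.2 • (‖y‖⁻¹ • y)) ⁻¹'
      {z : E (m + 1) | f₁ (L (tr ι z)) ≤ (1 - ⟪z, x⟫) / t ∧
        (1 - ⟪z, x⟫) / t ≤ f₂ (L (tr ι z))})) =
        Icc (‖y‖ * (1 - ⟪ι v, x⟫ - t * f₂ (L v))) (‖y‖ * (1 - ⟪ι v, x⟫ - t * f₁ (L v))) := by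
      ext s
      have h3 := htr (v, s)
      simp only at h3
      simp only [mem_preimage, Set.mem_ofPred_eq, mem_Icc, h3, inner_add_left,
        real_inner_smul_left, real_inner_comm x y, hx, mul_one]
      rw [le_div_iff₀ ht, div_le_iff₀ ht, ← div_eq_mul_inv, ← le_div_iff₀' hy, ← div_le_iff₀' hy]
      constructor <;> rintro ⟨a, b⟩ <;> constructor <;> linarith
    rw [this, Real.volume_Icc, ← ENNReal.ofReal_mul (by positivity)]
    congr 1; ring
  simp_rw [hsl]
  have hm : Measurable fun η => ENNReal.ofReal (f₂ η - f₁ η) :=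
    (h2.sub h1).measurable.ennreal_ofReal
  have hm' : Measurable fun v => ENNReal.ofReal (f₂ (L v) - f₁ (L v)) :=
    hm.comp L.continuous.measurable
  rw [lintegral_const_mul _ hm', lintegral_comp_equiv L _ hm, ← mul_assoc, ← ENNReal.ofReal_mul (by positivity)]

end Coord

/-- The volume of the region over `E m` between the paraboloid `‖η‖² / 2` and height `τ`. -/
def capVol (m : ℕ) (τ : ℝ) : ℝ≥0∞ := ∫⁻ η : E m, ENNReal.ofReal (τ - ‖η‖ ^ 2 / 2)

lemma capVol_eq {m : ℕ} (hm : 0 < m) {τ : ℝ} (hτ : 0 ≤ τ) :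
    capVol m τ = ENNReal.ofReal ((volume (Metric.closedBall (0 : E m) 1)).toReal *
      (√(2 * τ) ^ (m + 2) / (m + 2))) := by
  have : NeZero m := ⟨hm.ne'⟩
  have : Nonempty (Fin m) := ⟨0⟩
  have hR := Real.sq_sqrt (by positivity : 0 ≤ 2 * τ)
  set R := √(2 * τ)
  have hR0 : 0 ≤ R := Real.sqrt_nonneg _
  have hmax : ∀ η : E m, ENNReal.ofReal (τ - ‖η‖ ^ 2 / 2)
      = ENNReal.ofReal (max (τ - ‖η‖ ^ 2 / 2) 0) := fun η => by
    rw [ENNReal.ofReal, ENNReal.ofReal, Real.toNNReal, Real.toNNReal]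
    congr 1; ext; simp
  have hc : HasCompactSupport fun η : E m => max (τ - ‖η‖ ^ 2 / 2) 0 := by
    refine HasCompactSupport.intro (isCompact_closedBall (0 : E m) R) fun η hη => ?_
    rw [mem_closedBall_zero_iff, not_le] at hη
    exact max_eq_right (by nlinarith)
  have hcont : Continuous fun η : E m => max (τ - ‖η‖ ^ 2 / 2) 0 := by fun_prop
  rw [capVol, lintegral_congr hmax, ← ofReal_integral_eq_lintegral_ofReal
    (hcont.integrable_of_hasCompactSupport hc) (Eventually.of_forall fun _ => le_max_right _ _)]
  congr 1
  have h1 := integral_fun_norm_addHaar (volume : Measure (E m))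
    (fun r : ℝ => max (τ - r ^ 2 / 2) 0)
  have h2 : ∫ r in Ioi (0 : ℝ), r ^ (m - 1) • max (τ - r ^ 2 / 2) 0 = R ^ (m + 2) / (m * (m + 2)) := by
    have h3 : ∀ r ∈ Ioi (0 : ℝ), r ^ (m - 1) • max (τ - r ^ 2 / 2) 0 =
        (Ioc 0 R).indicator (fun r => r ^ (m - 1) * (τ - r ^ 2 / 2)) r := fun r hr => by
      have hr : 0 < r := hr
      by_cases h4 : r ≤ R
      · rw [indicator_of_mem (show r ∈ Ioc 0 R from ⟨hr, h4⟩), max_eq_left (by nlinarith)]; rfl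
      · rw [indicator_of_notMem (fun h => h4 h.2), max_eq_right (by nlinarith), smul_zero]
    rw [setIntegral_congr_fun measurableSet_Ioi h3, setIntegral_indicator measurableSet_Ioc,
      inter_eq_right.2 Ioc_subset_Ioi_self, ← intervalIntegral.integral_of_le hR0]
    obtain ⟨k, rfl⟩ : ∃ k, m = k + 1 := ⟨m - 1, by omega⟩
    have h5 : ∀ r ∈ uIcc 0 R, HasDerivAt (fun r : ℝ => τ * r ^ (k + 1) / (k + 1) -
        r ^ (k + 3) / (2 * (k + 3))) (r ^ (k + 1 - 1) * (τ - r ^ 2 / 2)) r := fun r _ => by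
      have h6 := (((hasDerivAt_pow (k + 1) r).const_mul τ).div_const ((k : ℝ) + 1)).sub
        ((hasDerivAt_pow (k + 3) r).div_const (2 * ((k : ℝ) + 3)))
      refine h6.congr_deriv ?_
      simp only [Nat.add_sub_cancel, show k + 3 - 1 = k + 2 from rfl]
      push_cast
      field_simp
      ring
    rw [intervalIntegral.integral_eq_sub_of_hasDerivAt h5
      (Continuous.intervalIntegrable (by fun_prop) _ _)]
    have : τ = R ^ 2 / 2 := by linarith
    rw [this]
    push_cast
    field_simp
    ring
  rw [h1, finrank_euclideanSpace_fin, h2, Measure.addHaar_unitClosedBall_eq_addHaar_unitBall]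
  have : (m : ℝ) ≠ 0 := by positivity
  simp only [nsmul_eq_mul, smul_eq_mul, Measure.real]
  field_simp

lemma capVol_lt_capVol {m : ℕ} (hm : 0 < m) {σ τ : ℝ} (hσ : 0 ≤ σ) (h : σ < τ) :
    capVol m σ < capVol m τ := by
  rw [capVol_eq hm hσ, capVol_eq hm (hσ.trans h.le)]
  have hB : 0 < (volume (Metric.closedBall (0 : E m) 1)).toReal :=
    ENNReal.toReal_pos (Metric.measure_closedBall_pos _ _ one_pos).ne' measure_closedBall_lt_top.ne
  have h1 : √(2 * σ) < √(2 * τ) := Real.sqrt_lt_sqrt (by positivity) (by linarith)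
  have h2 : √(2 * σ) ^ (m + 2) < √(2 * τ) ^ (m + 2) :=
    pow_lt_pow_left₀ h1 (Real.sqrt_nonneg _) (by omega)
  refine (ENNReal.ofReal_lt_ofReal_iff_of_nonneg (by positivity)).2 ?_
  gcongr

variable {m : ℕ}

/-- The scaled adjoint of an equivalence. -/
lemma exists_scaled_adjoint (W : E m ≃L[ℝ] E m) {t : ℝ} (ht : 0 < t) :
    ∃ L : E m ≃L[ℝ] E m, (∀ v η, ⟪L v, η⟫ = t⁻¹ * ⟪v, W η⟫) ∧
      |(L : E m →L[ℝ] E m).det| = |(W : E m →L[ℝ] E m).det| / t ^ m := by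
  have hW : (W : E m →L[ℝ] E m).det ≠ 0 := W.toLinearEquiv.isUnit_det'.ne_zero
  set A : E m →L[ℝ] E m := t⁻¹ • (W : E m →L[ℝ] E m).adjoint
  have hA : A.det = (t⁻¹) ^ m * (W : E m →L[ℝ] E m).det := by
    rw [← det_adjoint_eq (W : E m →L[ℝ] E m)]
    have := LinearMap.det_smul t⁻¹ ((W : E m →L[ℝ] E m).adjoint : E m →ₗ[ℝ] E m)
    rwa [finrank_euclideanSpace_fin] at this
  have hA0 : A.det ≠ 0 := by rw [hA]; positivity
  refine ⟨A.toContinuousLinearEquivOfDetNeZero hA0, fun v η => ?_, ?_⟩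
  · rw [ContinuousLinearMap.toContinuousLinearEquivOfDetNeZero_apply]
    change ⟪t⁻¹ • (W : E m →L[ℝ] E m).adjoint v, η⟫ = _
    rw [real_inner_smul_left, ContinuousLinearMap.adjoint_inner_left]
    rfl
  · rw [ContinuousLinearMap.coe_toContinuousLinearEquivOfDetNeZero, hA, abs_mul, abs_pow,
      abs_of_pos (inv_pos.2 ht), inv_pow]
    field_simp

/-- Affine coordinates at scale `t` in which `graphFn` is `ε`-close to `t * ‖η‖² / 2`. -/
structure IsChart (K : Set (E (m + 1))) (x : E (m + 1)) (ι : E m →ₗᵢ[ℝ] E (m + 1)) (t ε : ℝ)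
    (W L : E m ≃L[ℝ] E m) : Prop where
  pos : 0 < t
  eps_pos : 0 < ε
  eps_le : ε ≤ 1 / 5
  approx : ∀ η, ‖η‖ ≤ 1 / ε → |t⁻¹ * graphFn K x ι (W η) - ‖η‖ ^ 2 / 2| ≤ ε
  inner_eq : ∀ v η, ⟪L v, η⟫ = t⁻¹ * ⟪v, W η⟫

variable {K : Set (E (m + 1))} {G : E (m + 1) → E (m + 1)} {x : E (m + 1)}
  {ι : E m →ₗᵢ[ℝ] E (m + 1)} {t ε : ℝ} {W L : E m ≃L[ℝ] E m}

/-- The lens between two paraboloids in the coordinates of a chart, centred at height `b`. -/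
def lens (x : E (m + 1)) (ι : E m →ₗᵢ[ℝ] E (m + 1)) (t ε b : ℝ) (L : E m ≃L[ℝ] E m) :
    Set (E (m + 1)) :=
  {z | ‖L (tr ι z)‖ ^ 2 / 2 + ε ≤ (1 - ⟪z, x⟫) / t ∧
    (1 - ⟪z, x⟫) / t ≤ 2 * b - ‖L (tr ι z)‖ ^ 2 / 2 - ε}

lemma IsChart.cap_subset (hC : IsChart K x ι t ε W L) (h : IsBase K G x ι) {ε' : ℝ}
    (hε' : 0 < ε') :
    {z ∈ K | (1 - ⟪z, x⟫) / t ≤ 1 - ε'} ⊆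
      {z | ‖L (tr ι z)‖ ^ 2 / 2 - ε ≤ (1 - ⟪z, x⟫) / t ∧ (1 - ⟪z, x⟫) / t ≤ 1 - ε'} := by
  rintro z ⟨hzK, hz⟩
  refine ⟨?_, hz⟩
  have ht := hC.pos
  have hε := hC.eps_pos
  set ζ := L (tr ι z)
  have key : ∀ η, ‖η‖ ≤ 1 / ε → ⟪ζ, η⟫ - ‖η‖ ^ 2 / 2 - ε ≤ (1 - ⟪z, x⟫) / t := fun η hη => by
    have h1 := inner_le_suppFn h.grad.compact hzK (x + ι (W η))
    rw [inner_add_right, ← inner_tr] at h1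
    have h2 := (abs_le.1 (hC.approx η hη)).2
    rw [hC.inner_eq, le_div_iff₀ ht]
    unfold graphFn at h2
    have h3 : suppFn K (x + ι (W η)) - 1 ≤ t * (‖η‖ ^ 2 / 2 + ε) := by
      rw [← inv_mul_le_iff₀ ht]; linarith
    have h4 : (t⁻¹ * ⟪tr ι z, W η⟫ - ‖η‖ ^ 2 / 2 - ε) * t =
        ⟪tr ι z, W η⟫ - t * (‖η‖ ^ 2 / 2 + ε) := by field_simp; ring
    rw [h4]; linarith
  by_cases hζ : ‖ζ‖ ≤ 1 / ε
  · have := key ζ hζ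
    rw [real_inner_self_eq_norm_sq] at this
    linarith
  · push Not at hζ
    have hζ0 : 0 < ‖ζ‖ := lt_trans (by positivity) hζ
    have hn : ‖(1 / (ε * ‖ζ‖)) • ζ‖ = 1 / ε := by
      rw [norm_smul, Real.norm_of_nonneg (by positivity)]; field_simp
    have := key _ hn.le
    rw [hn, real_inner_smul_right, real_inner_self_eq_norm_sq] at this
    have h5 : 1 / (ε * ‖ζ‖) * ‖ζ‖ ^ 2 = ‖ζ‖ / ε := by field_simp
    have h6 : 1 / ε * (1 / ε) ≤ ‖ζ‖ / ε := by
      rw [div_eq_mul_one_div ‖ζ‖]; gcongr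
    have h7 : 5 ≤ 1 / ε := by rw [le_div_iff₀ hε]; linarith [hC.eps_le]
    rw [h5] at this
    nlinarith [hC.eps_le]

lemma IsBase.exists_gauge_le {c : ℝ} (h : IsBase K G x ι) (hc : 0 < c) :
    ∃ t₁ > 0, ∀ t ε : ℝ, ∀ W L : E m ≃L[ℝ] E m, t < t₁ → IsChart K x ι t ε W L →
      ∀ η, t * ‖η‖ ≤ c * ‖W η‖ := by
  have hg := h.isGrad.continuous.continuousAt (x := 0)
  rw [Metric.continuousAt_iff] at hg
  obtain ⟨r, hr, hgr⟩ := hg (c / 4) (by positivity)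
  obtain ⟨a, ha, hlow⟩ := h.isGrad.exists_lower h.graphFn_zero
    (fun z hz => h.graphFn_pos hz) hr
  refine ⟨a * r, by positivity, fun t ε W L ht hC => ?_⟩
  have ht0 := hC.pos
  have hunit : ∀ η : E m, ‖η‖ = 1 → t ≤ c * ‖W η‖ := fun η hη => by
    have h1 : 1 ≤ 1 / ε := by rw [le_div_iff₀ hC.eps_pos]; linarith [hC.eps_le]
    have h2 := abs_le.1 (hC.approx η (hη.le.trans h1))
    rw [hη] at h2
    have hεl := hC.eps_le
    have h3 : graphFn K x ι (W η) ≤ t * 1 := by rw [← inv_mul_le_iff₀ ht0]; linarith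
    have h4 : t * (1 / 4) ≤ graphFn K x ι (W η) := by rw [← le_inv_mul_iff₀ ht0]; linarith
    have h5 : ‖W η‖ < r := by
      by_contra! h6
      have := hlow _ h6
      nlinarith
    have h6 := h.isGrad.sub (W η) 0
    rw [h.graphFn_zero, zero_sub, inner_neg_right] at h6
    have h7 := hgr (x := W η) (by rwa [dist_zero_right])
    rw [h.graphGrad_zero, dist_zero_right] at h7
    have h8 := real_inner_le_norm (graphGrad G x ι (W η)) (W η)
    have h9 : ‖graphGrad G x ι (W η)‖ * ‖W η‖ ≤ c / 4 * ‖W η‖ := by gcongr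
    linarith
  intro η
  rcases eq_or_ne η 0 with rfl | hη
  · simp
  · have hp := norm_pos_iff.2 hη
    have := hunit (‖η‖⁻¹ • η) (by rw [norm_smul, norm_inv, norm_norm, inv_mul_cancel₀ hp.ne'])
    rw [map_smul, norm_smul, norm_inv, norm_norm] at this
    calc t * ‖η‖ ≤ (c * (‖η‖⁻¹ * ‖W η‖)) * ‖η‖ := by gcongr
      _ = c * ‖W η‖ := by field_simp

lemma IsChart.le_graphFn (hC : IsChart K x ι t ε W L) (h : IsBase K G x ι) {η : E m}
    (hη : 1 / ε < ‖η‖) : 2 * t * ‖η‖ ≤ graphFn K x ι (W η) := by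
  have ht := hC.pos
  have hε := hC.eps_pos
  have hη0 : 0 < ‖η‖ := lt_trans (by positivity) hη
  have h7 : 5 ≤ 1 / ε := by rw [le_div_iff₀ hε]; linarith [hC.eps_le]
  set c := 1 / (ε * ‖η‖)
  have hc0 : 0 < c := by positivity
  have hcη : c * ‖η‖ = 1 / ε := by simp only [c]; field_simp
  have hc1 : c ≤ 1 := by
    by_contra! hc
    nlinarith
  have hn : ‖c • η‖ = 1 / ε := by rw [norm_smul, Real.norm_of_nonneg hc0.le, hcη]
  have h1 := (abs_le.1 (hC.approx _ hn.le)).1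
  have h2 := h.isGrad.convexOn.2 (mem_univ (W η)) (mem_univ (0 : E m)) hc0.le
    (sub_nonneg.2 hc1) (add_sub_cancel c 1)
  rw [smul_zero, add_zero, h.graphFn_zero, smul_zero, add_zero, ← map_smul, smul_eq_mul] at h2
  rw [hn] at h1
  have h3 : t * (2 * (1 / ε)) ≤ graphFn K x ι (W (c • η)) := by
    rw [← le_inv_mul_iff₀ ht]
    nlinarith [hC.eps_le]
  rw [← hcη] at h3
  have : c * (2 * t * ‖η‖) ≤ c * graphFn K x ι (W η) := by linarith
  exact le_of_mul_le_mul_left this hc0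

lemma IsBase.exists_lens_subset (h : IsBase K G x ι) :
    ∃ t₁ > 0, ∀ t ε b : ℝ, ∀ W L : E m ≃L[ℝ] E m, t < t₁ → b ≤ 2 → IsChart K x ι t ε W L →
      lens x ι t ε b L ⊆ K := by
  obtain ⟨ρ, hρ, hball⟩ := exists_closedBall_subset h.grad.zero_mem
  have hy := norm_pos_iff.2 h.frame.ne_zero
  set y := G x
  have hx0 := norm_pos_iff.2 h.base_ne_zero
  obtain ⟨c, hc, hcρ⟩ : ∃ c > 0, 2 * c * (1 + ‖x‖ * ‖y‖) = ρ / 2 :=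
    ⟨ρ / (4 * (1 + ‖x‖ * ‖y‖)), by positivity, by field_simp; ring⟩
  obtain ⟨t₁, ht₁, hgauge⟩ := h.exists_gauge_le hc
  refine ⟨min t₁ (ρ / (8 * ‖y‖)), by positivity, fun t ε b W L ht hb hC z hz => ?_⟩
  have ht0 := hC.pos
  have hε := hC.eps_pos
  have hgauge := hgauge t ε W L (ht.trans_le (min_le_left _ _)) hC
  have htρ : t * (8 * ‖y‖) ≤ ρ := by
    rw [← le_div_iff₀ (by positivity)]; exact (ht.trans_le (min_le_right _ _)).le
  obtain ⟨hz1, hz2⟩ := hz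
  set ζ := L (tr ι z)
  set σ := (1 - ⟪z, x⟫) / t
  have hσ : t * σ = 1 - ⟪z, x⟫ := by simp only [σ]; field_simp
  have hσ0 : 0 ≤ σ := by nlinarith [sq_nonneg ‖ζ‖]
  have hσ4 : σ ≤ 4 := by nlinarith [sq_nonneg ‖ζ‖]
  have hζ : ‖ζ‖ ≤ 2 := by
    refine le_of_sq_le_sq ?_ (by norm_num)
    linarith
  have hinner : ∀ η, ⟪z, ι (W η)⟫ = t * ⟪ζ, η⟫ := fun η => by
    rw [← inner_tr, hC.inner_eq]; field_simp
  refine mem_of_inner_le_suppFn h.grad.compact h.grad.conv h.grad.nonempty fun w => ?_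
  rcases lt_or_ge 0 ⟪w, y⟫ with hw | hw
  · obtain ⟨v, hv⟩ := h.frame.range (⟪w, y⟫⁻¹ • w - x) (by
      rw [inner_sub_left, real_inner_smul_left, h.inner_base, inv_mul_cancel₀ hw.ne', sub_self])
    obtain ⟨η, rfl⟩ := W.surjective v
    have hwe : w = ⟪w, y⟫ • (x + ι (W η)) := by
      rw [hv, add_sub_cancel, smul_smul, mul_inv_cancel₀ hw.ne', one_smul]
    rw [hwe, suppFn_smul h.grad.compact h.grad.nonempty hw.le, real_inner_smul_right]
    refine mul_le_mul_of_nonneg_left ?_ hw.le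
    rw [inner_add_right, hinner]
    suffices hs : t * ⟪ζ, η⟫ ≤ t * σ + graphFn K x ι (W η) by
      unfold graphFn at hs; linarith
    rcases le_or_gt ‖η‖ (1 / ε) with hη | hη
    · have h1 := (abs_le.1 (hC.approx η hη)).1
      have h2 : ⟪ζ, η⟫ ≤ ‖ζ‖ ^ 2 / 2 + ‖η‖ ^ 2 / 2 := by
        have := real_inner_le_norm ζ η
        nlinarith [sq_nonneg (‖ζ‖ - ‖η‖)]
      have h3 : t * (‖η‖ ^ 2 / 2 - ε) ≤ graphFn K x ι (W η) := by
        rw [← le_inv_mul_iff₀ ht0]; linarith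
      nlinarith
    · have h1 := hC.le_graphFn h hη
      have h2 : ⟪ζ, η⟫ ≤ 2 * ‖η‖ := (real_inner_le_norm ζ η).trans (by gcongr)
      nlinarith
  · set v := tr ι z
    have hv : ‖v‖ ≤ 2 * c := by
      have h1 := hinner (W.symm v)
      rw [W.apply_symm_apply, ← inner_tr, real_inner_self_eq_norm_sq] at h1
      have h2 := hgauge (W.symm v)
      rw [W.apply_symm_apply] at h2
      have h3 := real_inner_le_norm ζ (W.symm v)
      have h4 : ‖ζ‖ * ‖W.symm v‖ ≤ 2 * ‖W.symm v‖ := by gcongr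
      have h5 : ‖v‖ ^ 2 ≤ 2 * c * ‖v‖ := by nlinarith
      rcases (norm_nonneg v).eq_or_lt with h6 | h6
      · rw [← h6]; positivity
      · rw [sq] at h5
        exact le_of_mul_le_mul_right h5 h6
    have hdec := h.frame.decomp (z - y)
    rw [map_sub, h.frame.tr_self, sub_zero] at hdec
    set a := ⟪z - y, y⟫ / ‖y‖ ^ 2
    have hxa : ⟪z - y, x⟫ = ⟪ι v, x⟫ + a := by
      conv_lhs => rw [hdec]
      rw [inner_add_left, real_inner_smul_left, real_inner_comm x (G x), h.inner_base,
        mul_one]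
    rw [inner_sub_left, real_inner_comm x y, h.inner_base] at hxa
    have hιx : |⟪ι v, x⟫| ≤ 2 * c * ‖x‖ := (abs_real_inner_le_norm _ _).trans (by
      rw [ι.norm_map]; gcongr)
    have ha : |a| ≤ 4 * t + 2 * c * ‖x‖ := by
      have := abs_le.1 hιx
      rw [abs_le]; constructor <;> nlinarith
    have hzy : ‖z - y‖ ≤ ρ := by
      rw [hdec]
      refine (norm_add_le _ _).trans ?_
      rw [ι.norm_map, norm_smul, Real.norm_eq_abs]
      have : |a| * ‖y‖ ≤ (4 * t + 2 * c * ‖x‖) * ‖y‖ := by gcongr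
      nlinarith
    have h1 : ⟪z, w⟫ = ⟪w, y⟫ + ⟪z - y, w⟫ := by rw [inner_sub_left, real_inner_comm w y]; ring
    have h2 : ⟪z - y, w⟫ ≤ ρ * ‖w‖ := (real_inner_le_norm _ _).trans (by gcongr)
    have h3 := mul_norm_le_suppFn h.grad.compact hρ hball w
    linarith

section Float

variable {n : ℕ} {K : Set (E n)}

lemma volume_level_eq_zero {u : E n} (hu : u ≠ 0) (c : ℝ) : volume {z : E n | ⟪z, u⟫ = c} = 0 := by
  have h1 : {z : E n | ⟪z, u⟫ = c} =
      (fun z => z + -((c / ‖u‖ ^ 2) • u)) ⁻¹' ((ℝ ∙ u)ᗮ : Submodule ℝ (E n)) := by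
    ext z
    have hu := norm_pos_iff.2 hu
    simp only [Set.mem_ofPred_eq, mem_preimage, SetLike.mem_coe,
      Submodule.mem_orthogonal_singleton_iff_inner_left, inner_add_left, inner_neg_left,
      real_inner_smul_left, real_inner_self_eq_norm_sq]
    rw [div_mul_cancel₀ _ (by positivity), ← sub_eq_add_neg, sub_eq_zero]
  rw [h1, measure_preimage_add_right]
  refine Measure.addHaar_submodule _ _ fun htop => hu ?_
  have : u ∈ (ℝ ∙ u)ᗮ := htop ▸ Submodule.mem_top
  rw [Submodule.mem_orthogonal_singleton_iff_inner_left] at this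
  exact inner_self_eq_zero.1 this

lemma measurableSet_halfspace (u : E n) (s : ℝ) : MeasurableSet {z : E n | s ≤ ⟪z, u⟫} :=
  (isClosed_le continuous_const (by fun_prop)).measurableSet

lemma continuous_cut (hK : IsCompact K) {u : E n} (hu : u ≠ 0) :
    Continuous fun s => vol (K ∩ {z | s ≤ ⟪z, u⟫}) := by
  have h1 : ∀ s, vol (K ∩ {z | s ≤ ⟪z, u⟫}) =
      ∫ z in K, {z | s ≤ ⟪z, u⟫}.indicator (fun _ => (1 : ℝ)) z := fun s => by
    simp_rw [← Pi.one_def]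
    rw [integral_indicator_one (measurableSet_halfspace u s), Measure.real,
      Measure.restrict_apply (measurableSet_halfspace u s), inter_comm]
    rfl
  simp_rw [h1]
  rw [continuous_iff_continuousAt]
  intro s₀
  refine continuousAt_of_dominated (bound := fun _ => 1) (Eventually.of_forall fun s =>
    (measurable_const.indicator (measurableSet_halfspace u s)).aestronglyMeasurable)
    (Eventually.of_forall fun s => Eventually.of_forall fun z => ?_)
    (integrableOn_const hK.measure_lt_top.ne) ?_
  · by_cases hz : z ∈ {z | s ≤ ⟪z, u⟫}
    · rw [indicator_of_mem hz]; simp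
    · rw [indicator_of_notMem hz]; simp
  · have h2 : ∀ᵐ z ∂(volume.restrict K), ⟪z, u⟫ ≠ s₀ :=
      ae_restrict_of_ae (by
        rw [ae_iff]; simpa using volume_level_eq_zero hu s₀)
    filter_upwards [h2] with z hz
    rcases lt_or_gt_of_ne hz with h3 | h3
    · have : (fun s => {z | s ≤ ⟪z, u⟫}.indicator (fun _ => (1 : ℝ)) z) =ᶠ[𝓝 s₀] fun _ => 0 := by
        filter_upwards [lt_mem_nhds h3] with s hs
        exact indicator_of_notMem (by simpa using hs) _
      exact continuousAt_const.congr this.symm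
    · have : (fun s => {z | s ≤ ⟪z, u⟫}.indicator (fun _ => (1 : ℝ)) z) =ᶠ[𝓝 s₀] fun _ => 1 := by
        filter_upwards [gt_mem_nhds h3] with s hs
        exact indicator_of_mem (show z ∈ {z | s ≤ ⟪z, u⟫} from hs.le) _
      exact continuousAt_const.congr this.symm

lemma exists_cut_eq (hK : IsCompact K) {u : E n} (hu : u ≠ 0) {δ c : ℝ}
    (hc : vol (K ∩ {z | c ≤ ⟪z, u⟫}) ≤ δ) (hδ : δ ≤ vol K) :
    ∃ s ≤ c, vol (K ∩ {z | s ≤ ⟪z, u⟫}) = δ := by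
  obtain ⟨R, -, hR⟩ := exists_norm_le hK
  set a := min c (-(R * ‖u‖))
  have ha : vol (K ∩ {z | a ≤ ⟪z, u⟫}) = vol K := by
    congr 1
    refine inter_eq_left.2 fun z hz => ?_
    have h1 := (abs_le.1 (abs_real_inner_le_norm z u)).1
    have h2 : ‖z‖ * ‖u‖ ≤ R * ‖u‖ := by gcongr; exact hR z hz
    change a ≤ ⟪z, u⟫
    exact (min_le_right _ _).trans (by linarith)
  obtain ⟨s, hs, hsδ⟩ := intermediate_value_Icc' (min_le_left c (-(R * ‖u‖)))
    (continuous_cut hK hu).continuousOn ⟨hc, ha.symm ▸ hδ⟩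
  exact ⟨s, hs.2, hsδ⟩

lemma inner_le_of_mem_floatingBody (hK : IsCompact K) {x : E n} (hx : x ≠ 0) {δ c : ℝ}
    (hc : vol (K ∩ {z | c ≤ ⟪z, x⟫}) ≤ δ) (hδ : δ ≤ vol K) {z : E n}
    (hz : z ∈ floatingBody K δ) : ⟪z, x⟫ ≤ c := by
  obtain ⟨s, hsc, hs⟩ := exists_cut_eq hK hx hc hδ
  have hx' := norm_pos_iff.2 hx
  have hin : ∀ z : E n, ⟪z, ‖x‖⁻¹ • x⟫ = ⟪z, x⟫ / ‖x‖ := fun z => by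
    rw [real_inner_smul_right]; field_simp
  have h1 : vol (K ∩ {z | s / ‖x‖ ≤ ⟪z, ‖x‖⁻¹ • x⟫}) = δ := by
    rw [← hs]
    simp_rw [hin, div_le_div_iff_of_pos_right hx']
  have h2 : ‖‖x‖⁻¹ • x‖ = 1 := by rw [norm_smul, norm_inv, norm_norm, inv_mul_cancel₀ hx'.ne']
  simp only [floatingBody, mem_iInter] at hz
  have h3 : ⟪z, ‖x‖⁻¹ • x⟫ ≤ s / ‖x‖ := hz _ _ ⟨h2, h1⟩
  rw [hin, div_le_div_iff_of_pos_right hx'] at h3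
  exact h3.trans hsc

lemma isClosed_floatingBody (K : Set (E n)) (δ : ℝ) : IsClosed (floatingBody K δ) :=
  isClosed_iInter fun u => isClosed_iInter fun s => isClosed_iInter fun _ =>
    isClosed_le (by fun_prop) continuous_const

lemma floatingBody_subset (hK : IsCompact K) (hc : Convex ℝ K) (hne : K.Nonempty) {δ : ℝ}
    (hδ0 : 0 ≤ δ) (hδ : δ ≤ vol K) : floatingBody K δ ⊆ K := fun z hz => by
  refine mem_of_inner_le_suppFn hK hc hne fun w => ?_
  rcases eq_or_ne w 0 with rfl | hw
  · obtain ⟨v, hv⟩ := hne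
    have := inner_le_suppFn hK hv (0 : E n)
    rwa [inner_zero_right] at this ⊢
  · refine inner_le_of_mem_floatingBody hK hw (hδ0.trans' (le_of_eq ?_)) hδ hz
    have : K ∩ {z | suppFn K w ≤ ⟪z, w⟫} ⊆ {z | ⟪z, w⟫ = suppFn K w} := fun v hv =>
      le_antisymm (inner_le_suppFn hK hv.1 w) hv.2
    rw [vol, measure_mono_null this (volume_level_eq_zero hw _), ENNReal.toReal_zero]

lemma isCompact_floatingBody (hK : IsCompact K) (hc : Convex ℝ K) (hne : K.Nonempty) {δ : ℝ}
    (hδ0 : 0 ≤ δ) (hδ : δ ≤ vol K) : IsCompact (floatingBody K δ) :=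
  hK.of_isClosed_subset (isClosed_floatingBody K δ) (floatingBody_subset hK hc hne hδ0 hδ)

lemma mem_floatingBody_of_symm (hK : IsCompact K) {A : Set (E n)} (hA : MeasurableSet A)
    (hAK : A ⊆ K) {z₀ : E n} (hsymm : ∀ z ∈ A, z₀ + z₀ - z ∈ A) {δ : ℝ}
    (hδ : 2 * ENNReal.ofReal δ < volume A) : z₀ ∈ floatingBody K δ := by
  simp only [floatingBody, mem_iInter]
  rintro u s ⟨-, hs⟩
  by_contra hlt
  have hlt : s < ⟪z₀, u⟫ := not_le.1 hlt
  set B := A ∩ {z | s ≤ ⟪z, u⟫}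
  have hB : MeasurableSet B := hA.inter (measurableSet_halfspace u s)
  have h1 : A ⊆ B ∪ (fun z => z₀ + z₀ - z) ⁻¹' B := fun z hz => by
    by_cases h2 : s ≤ ⟪z, u⟫
    · exact Or.inl ⟨hz, h2⟩
    · refine Or.inr ⟨hsymm z hz, ?_⟩
      change s ≤ ⟪z₀ + z₀ - z, u⟫
      rw [inner_sub_left, inner_add_left]
      linarith
  have h2 : volume ((fun z => z₀ + z₀ - z) ⁻¹' B) = volume B :=
    (Measure.measurePreserving_sub_left volume (z₀ + z₀)).measure_preimage hB.nullMeasurableSet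
  have h3 : volume B ≤ ENNReal.ofReal δ := by
    rw [← hs, vol, ENNReal.ofReal_toReal (measure_ne_top_of_subset inter_subset_left
      hK.measure_lt_top.ne)]
    exact measure_mono (inter_subset_inter_left _ hAK)
  have h4 : volume A ≤ volume B + volume B :=
    (measure_mono h1).trans ((measure_union_le B _).trans_eq (by rw [h2]))
  rw [← two_mul] at h4
  exact absurd (hδ.trans_le h4) (not_lt.2 (by gcongr))

end Float

section Assembly

variable {m : ℕ} {K : Set (E (m + 1))} {G : E (m + 1) → E (m + 1)} {x : E (m + 1)}
  {ι : E m →ₗᵢ[ℝ] E (m + 1)} {t ε : ℝ} {W L : E m ≃L[ℝ] E m}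

lemma IsBase.volume_lens (h : IsBase K G x ι) (ht : 0 < t) (ε b : ℝ) (L : E m ≃L[ℝ] E m) :
    volume (lens x ι t ε b L) = ENNReal.ofReal (‖G x‖ * t * |(L : E m →L[ℝ] E m).det|⁻¹) *
      (2 * capVol m (b - ε)) := by
  rw [lens, h.frame.volume_region h.inner_base ht L (f₁ := fun v => ‖v‖ ^ 2 / 2 + ε)
    (f₂ := fun v => 2 * b - ‖v‖ ^ 2 / 2 - ε) (by fun_prop) (by fun_prop), capVol,
    ← lintegral_const_mul (μ := (volume : Measure (E m))) 2
      (f := fun v : E m => ENNReal.ofReal (b - ε - ‖v‖ ^ 2 / 2)) (by fun_prop)]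
  congr 1
  refine lintegral_congr fun v => ?_
  have h2 : (2 : ℝ≥0∞) * ENNReal.ofReal (b - ε - ‖v‖ ^ 2 / 2) =
      ENNReal.ofReal (2 * (b - ε - ‖v‖ ^ 2 / 2)) := by
    rw [ENNReal.ofReal_mul zero_le_two, ENNReal.ofReal_ofNat]
  rw [h2]
  congr 1; ring

lemma measurableSet_lens (t ε b : ℝ) : MeasurableSet (lens x ι t ε b L) := by
  have h1 : Continuous fun z : E (m + 1) => L (tr ι z) := by fun_prop
  have h2 : Continuous fun z : E (m + 1) => (1 - ⟪z, x⟫) / t := by fun_prop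
  exact ((isClosed_le (by fun_prop) h2).inter (isClosed_le h2 (by fun_prop))).measurableSet

lemma IsBase.lens_symm (h : IsBase K G x ι) (ht : 0 < t) (b : ℝ) :
    ∀ z ∈ lens x ι t ε b L, (1 - t * b) • G x + (1 - t * b) • G x - z ∈ lens x ι t ε b L := by
  intro z hz
  have h1 : tr ι ((1 - t * b) • G x + (1 - t * b) • G x - z) = - tr ι z := by
    simp [h.frame.tr_self]
  have h2 : (1 - ⟪(1 - t * b) • G x + (1 - t * b) • G x - z, x⟫) / t =
      2 * b - (1 - ⟪z, x⟫) / t := by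
    rw [inner_sub_left, inner_add_left, real_inner_smul_left, real_inner_comm x (G x),
      h.inner_base]
    field_simp
    ring
  obtain ⟨hz1, hz2⟩ := hz
  simp only [lens, Set.mem_ofPred_eq, h1, h2, map_neg, norm_neg]
  constructor <;> linarith

lemma IsBase.volume_cap_le (h : IsBase K G x ι) (hC : IsChart K x ι t ε W L) {ε' : ℝ}
    (hε' : ε ≤ ε') :
    volume (K ∩ {z | 1 - t * (1 - ε') ≤ ⟪z, x⟫}) ≤
      ENNReal.ofReal (‖G x‖ * t * |(L : E m →L[ℝ] E m).det|⁻¹) * capVol m 1 := by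
  have ht := hC.pos
  have hsub : K ∩ {z | 1 - t * (1 - ε') ≤ ⟪z, x⟫} ⊆ {z ∈ K | (1 - ⟪z, x⟫) / t ≤ 1 - ε'} :=
    fun z hz => ⟨hz.1, by
      have : 1 - t * (1 - ε') ≤ ⟪z, x⟫ := hz.2
      rw [div_le_iff₀ ht]; linarith⟩
  refine (measure_mono (hsub.trans (hC.cap_subset h (hC.eps_pos.trans_le hε')))).trans ?_
  rw [h.frame.volume_region h.inner_base ht L (f₁ := fun v => ‖v‖ ^ 2 / 2 - ε)
    (f₂ := fun v => 1 - ε') (by fun_prop) (by fun_prop), capVol]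
  refine mul_le_mul_right (lintegral_mono fun v => ENNReal.ofReal_le_ofReal ?_) _
  linarith

/-- Two-sided bounds for the support function of the floating body. -/
theorem IsBase.exists_floatingBody_bounds (h : IsBase K G x ι) (hm : 0 < m) {f₀ : ℝ}
    (hf₀ : 0 < f₀)
    (hMA : ∀ ε > 0, ∃ r, 0 < r ∧
      MABetween (graphGrad G x ι) (Metric.closedBall 0 r) ((1 - ε) * f₀) ((1 + ε) * f₀))
    {ε' : ℝ} (hε' : 0 < ε') (hε'1 : ε' ≤ 1) :
    ∃ t₂ > 0, ∀ t δ : ℝ, 0 < t → t < t₂ → 0 < δ →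
      δ ^ 2 = ‖G x‖ ^ 2 * f₀ * t ^ (m + 2) * (capVol m 1).toReal ^ 2 →
      IsCompact (floatingBody K δ) ∧ (floatingBody K δ).Nonempty ∧
        1 - t * (1 + ε') ≤ suppFn (floatingBody K δ) x ∧
        suppFn (floatingBody K δ) x ≤ 1 - t * (1 - ε') := by
  set ε := min (1 / 5) (ε' / 2)
  have hε : 0 < ε := by positivity
  have hεε' : ε < ε' := (min_le_right _ _).trans_lt (by linarith)
  have hy := norm_pos_iff.2 h.frame.ne_zero
  obtain ⟨t₀, ht₀, hW⟩ := h.isGrad.exists_normal_form hm h.graphFn_zero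
    (fun z hz => h.graphFn_pos hz) hf₀ hMA hε
  obtain ⟨t₁, ht₁, hlens⟩ := h.exists_lens_subset
  refine ⟨min t₀ t₁, by positivity, fun t δ ht htt hδ hδt => ?_⟩
  obtain ⟨W, hdet, happ⟩ := hW t ht (htt.trans_le (min_le_left _ _))
  obtain ⟨L, hL, hLdet⟩ := exists_scaled_adjoint W ht
  have hC : IsChart K x ι t ε W L := ⟨ht, hε, min_le_left _ _, happ, hL⟩
  set J := ‖G x‖ * t * |(L : E m →L[ℝ] E m).det|⁻¹ with hJ
  have hdW : 0 < |(W : E m →L[ℝ] E m).det| := by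
    have : 0 < t ^ m := by positivity
    refine (abs_nonneg _).lt_of_ne fun h0 => ?_
    rw [← h0] at hdet
    simp only [ne_eq, OfNat.ofNat_ne_zero, not_false_eq_true, zero_pow, mul_zero] at hdet
    exact this.ne hdet
  have hdL : 0 < |(L : E m →L[ℝ] E m).det| := by rw [hLdet]; positivity
  have hJ0 : 0 < J := by positivity
  have hcap := capVol_eq hm zero_le_one
  have hcap_top : capVol m 1 ≠ ⊤ := by rw [hcap]; exact ENNReal.ofReal_ne_top
  have hδJ : ENNReal.ofReal δ = ENNReal.ofReal J * capVol m 1 := by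
    have : δ = J * (capVol m 1).toReal := by
      refine (sq_eq_sq₀ hδ.le (by positivity)).1 ?_
      rw [hδt, hJ, hLdet, mul_pow, mul_pow, mul_pow, inv_pow, div_pow]
      have : |(W : E m →L[ℝ] E m).det| ^ 2 = t ^ m / f₀ := by rw [← hdet]; field_simp
      rw [this, inv_div, pow_add]
      field_simp
    rw [this, ENNReal.ofReal_mul hJ0.le, ENNReal.ofReal_toReal hcap_top]
  have hlt : 2 * ENNReal.ofReal δ < volume (lens x ι t ε (1 + ε') L) := by
    rw [h.volume_lens ht, ← hJ, hδJ, mul_left_comm]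
    refine (ENNReal.mul_lt_mul_iff_right (ENNReal.ofReal_pos.2 hJ0).ne' ENNReal.ofReal_ne_top).2 ?_
    refine (ENNReal.mul_lt_mul_iff_right two_ne_zero ENNReal.ofNat_ne_top).2 ?_
    exact capVol_lt_capVol hm zero_le_one (by linarith)
  have hsub : lens x ι t ε (1 + ε') L ⊆ K :=
    hlens t ε (1 + ε') W L (htt.trans_le (min_le_right _ _)) (by linarith) hC
  have hK := h.grad.compact
  have hmem := mem_floatingBody_of_symm hK (measurableSet_lens t ε (1 + ε')) hsub
    (h.lens_symm ht (1 + ε')) hlt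
  have hvol : δ ≤ vol K := by
    refine (ENNReal.ofReal_le_iff_le_toReal hK.measure_lt_top.ne).1 ?_
    refine le_trans ?_ (hlt.le.trans (measure_mono hsub))
    rw [two_mul]
    exact le_self_add
  have hcomp := isCompact_floatingBody hK h.grad.conv h.grad.nonempty hδ.le hvol
  refine ⟨hcomp, ⟨_, hmem⟩, ?_, suppFn_le ⟨_, hmem⟩ fun z hz =>
    inner_le_of_mem_floatingBody hK h.base_ne_zero ?_ hvol hz⟩
  · have := inner_le_suppFn hcomp hmem x
    rwa [real_inner_smul_left, real_inner_comm x (G x), h.inner_base, mul_one] at this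
  · refine ENNReal.toReal_le_of_le_ofReal hδ.le ?_
    rw [hδJ]
    exact h.volume_cap_le hC hεε'.le

end Assembly

lemma tendsto_inv_pow_sub_one_div {l : Filter ℝ} {τ t : ℝ → ℝ} (ht0 : ∀ᶠ δ in l, 0 < t δ)
    (ht : Tendsto t l (𝓝 0)) (hτ : Tendsto (fun δ => τ δ / t δ) l (𝓝 1)) (n : ℕ) :
    Tendsto (fun δ => (((1 - τ δ)⁻¹) ^ n - 1) / t δ) l (𝓝 n) := by
  have hτ0 : Tendsto τ l (𝓝 0) := by
    have := hτ.mul ht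
    rw [one_mul] at this
    refine this.congr' ?_
    filter_upwards [ht0] with δ hδ
    field_simp
  set f : ℝ → ℝ := fun y => ((1 - y)⁻¹) ^ n with hf
  have hd : HasDerivAt f n 0 := by
    have h1 : HasDerivAt (fun y : ℝ => 1 - y) (-1) 0 := by
      simpa using (hasDerivAt_id (0 : ℝ)).const_sub 1
    have h2 := (h1.fun_inv (by norm_num)).fun_pow n
    exact h2.congr_deriv (by simp)
  have hc : Tendsto (fun δ => dslope f 0 (τ δ)) l (𝓝 n) := by
    have h1 := (continuousAt_dslope_same.2 hd.differentiableAt).tendsto.comp hτ0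
    rwa [dslope_same, hd.deriv] at h1
  have := hc.mul hτ
  rw [mul_one] at this
  refine this.congr fun δ => ?_
  have h1 := sub_smul_dslope f 0 (τ δ)
  rw [sub_zero, smul_eq_mul] at h1
  have h2 : f 0 = 1 := by simp [hf]
  rw [h2] at h1
  rw [← mul_div_assoc, mul_comm, h1]

lemma cn_succ {m : ℕ} (hm : 0 < m) :
    ((capVol m 1).toReal ^ 2) ^ (1 / ((m : ℝ) + 2)) = cn (m + 1) := by
  have hB : 0 ≤ (volume (Metric.closedBall (0 : E m) 1)).toReal := ENNReal.toReal_nonneg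
  have hp : ((m : ℝ) + 2) * (1 / ((m : ℝ) + 2)) = 1 := by field_simp
  have e1 : ((m + 1 : ℕ) : ℝ) + 1 = (m : ℝ) + 2 := by push_cast; ring
  rw [capVol_eq hm zero_le_one, ENNReal.toReal_ofReal (by positivity), cn, e1]
  change _ = 2 * ((volume (Metric.closedBall (0 : E m) 1)).toReal / ((m : ℝ) + 2)) ^
    (2 / ((m : ℝ) + 2))
  set B := (volume (Metric.closedBall (0 : E m) 1)).toReal
  have h1 : (B * (√(2 * 1) ^ (m + 2) / ((m : ℝ) + 2))) ^ 2 =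
      (B / ((m : ℝ) + 2)) ^ 2 * 2 ^ (m + 2) := by
    have : (√(2 * 1) ^ (m + 2)) ^ 2 = 2 ^ (m + 2) := by
      rw [← pow_mul, mul_comm (m + 2) 2, pow_mul, Real.sq_sqrt (by norm_num)]; norm_num
    rw [← this]; ring
  rw [h1, Real.mul_rpow (by positivity) (by positivity), ← Real.rpow_natCast 2 (m + 2),
    ← Real.rpow_mul (by norm_num), ← Real.rpow_natCast _ 2, ← Real.rpow_mul (by positivity)]
  push_cast
  rw [hp, Real.rpow_one, mul_comm]
  congr 2
  ring

section Limit

variable {m : ℕ} {K : Set (E (m + 1))} {G : E (m + 1) → E (m + 1)} {x : E (m + 1)}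
  {ι : E m →ₗᵢ[ℝ] E (m + 1)}

/-- The support function of the floating body to first order in the scale `δ ^ (2 / (m + 2))`. -/
theorem IsBase.tendsto_norm_ratio (h : IsBase K G x ι) (hm : 0 < m) {f₀ : ℝ} (hf₀ : 0 < f₀)
    (hMA : ∀ ε > 0, ∃ r, 0 < r ∧
      MABetween (graphGrad G x ι) (Metric.closedBall 0 r) ((1 - ε) * f₀) ((1 + ε) * f₀))
    {w : ℝ → E (m + 1)}
    (hw : ∀ᶠ δ in 𝓝[>] (0 : ℝ),
      w δ ∈ frontier (polarBody (floatingBody K δ)) ∧ ∃ r : ℝ, 0 < r ∧ w δ = r • x) :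
    Tendsto (fun δ : ℝ => ((‖w δ‖ / ‖x‖) ^ (m + 1) - 1) / δ ^ (2 / ((m : ℝ) + 2))) (𝓝[>] 0)
      (𝓝 ((m + 1 : ℕ) *
        ((‖G x‖ ^ 2 * f₀ * (capVol m 1).toReal ^ 2) ^ (1 / ((m : ℝ) + 2)))⁻¹)) := by
  have hy := norm_pos_iff.2 h.frame.ne_zero
  have hx := norm_pos_iff.2 h.base_ne_zero
  have hV : 0 < (capVol m 1).toReal := by
    have h1 := capVol_lt_capVol hm le_rfl one_pos
    refine ENNReal.toReal_pos (pos_of_gt h1).ne' ?_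
    rw [capVol_eq hm zero_le_one]; exact ENNReal.ofReal_ne_top
  set M := ‖G x‖ ^ 2 * f₀ * (capVol m 1).toReal ^ 2 with hM
  have hM0 : 0 < M := by positivity
  set a := (M ^ (1 / ((m : ℝ) + 2)))⁻¹ with ha
  have ha0 : 0 < a := by positivity
  have hp : 0 < 2 / ((m : ℝ) + 2) := by positivity
  set t : ℝ → ℝ := fun δ => a * δ ^ (2 / ((m : ℝ) + 2)) with ht
  have hpos : ∀ᶠ δ in 𝓝[>] (0 : ℝ), 0 < δ := self_mem_nhdsWithin
  have ht0 : ∀ᶠ δ in 𝓝[>] (0 : ℝ), 0 < t δ := by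
    filter_upwards [hpos] with δ hδ
    positivity
  have htl : Tendsto t (𝓝[>] 0) (𝓝 0) := by
    have h1 := ((Real.continuous_rpow_const hp.le).tendsto 0).const_mul a
    rw [Real.zero_rpow hp.ne', mul_zero] at h1
    exact h1.mono_left nhdsWithin_le_nhds
  have htδ : ∀ δ, 0 < δ → δ ^ 2 = ‖G x‖ ^ 2 * f₀ * t δ ^ (m + 2) * (capVol m 1).toReal ^ 2 := by
    intro δ hδ
    have e : ((m + 2 : ℕ) : ℝ) = (m : ℝ) + 2 := by push_cast; ring
    have h1 : a ^ (m + 2) = M⁻¹ := by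
      rw [ha, inv_pow, ← Real.rpow_natCast _ (m + 2), ← Real.rpow_mul hM0.le, e,
        one_div_mul_cancel (by positivity), Real.rpow_one]
    have h2 : (δ ^ (2 / ((m : ℝ) + 2))) ^ (m + 2) = δ ^ 2 := by
      rw [← Real.rpow_natCast _ (m + 2), ← Real.rpow_mul hδ.le, e,
        div_mul_cancel₀ _ (by positivity), Real.rpow_two]
    rw [ht, mul_pow, h1, h2, hM]
    field_simp
  have hbd : ∀ ε', 0 < ε' → ε' ≤ 1 → ∀ᶠ δ in 𝓝[>] (0 : ℝ),
      IsCompact (floatingBody K δ) ∧ (floatingBody K δ).Nonempty ∧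
        1 - t δ * (1 + ε') ≤ suppFn (floatingBody K δ) x ∧
        suppFn (floatingBody K δ) x ≤ 1 - t δ * (1 - ε') := fun ε' hε' hε'1 => by
    obtain ⟨t₂, ht₂, hb⟩ := h.exists_floatingBody_bounds hm hf₀ hMA hε' hε'1
    filter_upwards [hpos, ht0, htl.eventually (gt_mem_nhds ht₂)] with δ h1 h2 h3
    exact hb (t δ) δ h2 h3 h1 (htδ δ h1)
  have hτ : Tendsto (fun δ => (1 - suppFn (floatingBody K δ) x) / t δ) (𝓝[>] 0) (𝓝 1) := by
    rw [Metric.tendsto_nhds]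
    intro e he
    filter_upwards [hbd (min 1 (e / 2)) (by positivity) (min_le_left _ _), ht0] with δ h1 h2
    obtain ⟨-, -, h3, h4⟩ := h1
    have h5 : min 1 (e / 2) < e := (min_le_right _ _).trans_lt (by linarith)
    refine lt_of_le_of_lt ?_ h5
    rw [Real.dist_eq, abs_le, neg_le_sub_iff_le_add, sub_le_iff_le_add, div_le_iff₀ h2,
      ← sub_le_iff_le_add, le_div_iff₀ h2]
    constructor <;> linarith
  have hlim := (tendsto_inv_pow_sub_one_div ht0 htl hτ (m + 1)).mul_const a
  refine hlim.congr' ?_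
  filter_upwards [hbd 1 one_pos le_rfl, hw, hpos] with δ h1 h2 h3
  obtain ⟨hcp, hne, -⟩ := h1
  obtain ⟨hfr, r, hr, hwr⟩ := h2
  have h4 := suppFn_eq_one_of_mem_frontier hcp hne hfr
  rw [hwr, suppFn_smul hcp hne hr.le] at h4
  have h5 : (1 - (1 - suppFn (floatingBody K δ) x))⁻¹ = r := by
    rw [sub_sub_cancel]; exact inv_eq_of_mul_eq_one_left h4
  have h6 : ‖w δ‖ / ‖x‖ = r := by
    rw [hwr, norm_smul, Real.norm_of_nonneg hr.le]; field_simp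
  rw [h5, h6, ht]
  field_simp

end Limit

/-- Pointwise limit on ∂K° for the floating-body volume difference. -/
theorem statement1 (n : ℕ) (hn : 2 ≤ n)
    (K : Set (E n)) (ν ν' : E n → E n) (κ κ' : E n → ℝ)
    (hK : IsC2PlusBody K ν κ) (h0 : (0 : E n) ∈ interior K)
    (hK' : IsC2PlusBody (polarBody K) ν' κ')
    (x : E n) (hx : x ∈ frontier (polarBody K))
    (xδ : ℝ → E n)
    (hxδ : ∀ᶠ δ in 𝓝[>] (0 : ℝ),
      xδ δ ∈ frontier (polarBody (floatingBody K δ)) ∧ ∃ r : ℝ, 0 < r ∧ xδ δ = r • x) :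
    Tendsto (fun δ : ℝ =>
        ⟪x, ν' x⟫ / ((n : ℝ) * δ ^ (2 / ((n : ℝ) + 1))) * ((‖xδ δ‖ / ‖x‖) ^ n - 1))
      (𝓝[>] 0)
      (𝓝 (⟪x, ν' x⟫ ^ 2 / (cn n * κ' x ^ (1 / ((n : ℝ) + 1))))) := by
  obtain ⟨m, rfl⟩ : ∃ m, n = m + 1 := ⟨n - 1, by omega⟩
  have hm : 0 < m := by omega
  have hG := isSuppGrad_normalGrad hK.1 h0 hK'
  have hx1 : suppFn K x = 1 := (mem_frontier_polarBody_iff hK.1.2.1 h0).1 hx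
  have hy : normalGrad K ν' x ≠ 0 := fun h1 => by
    have hx0 : x ≠ 0 := by
      rintro rfl
      have := suppFn_smul hG.compact hG.nonempty le_rfl (0 : E (m + 1))
      rw [smul_zero, zero_mul] at this
      linarith
    have := hG.inner_eq x hx0
    rw [h1, inner_zero_right] at this
    linarith
  obtain ⟨ι, hι⟩ := exists_isFrame hy
  have h : IsBase K (normalGrad K ν') x ι := ⟨hG, hx1, hι⟩
  have hs : 0 < ⟪x, ν' x⟫ := hK'.2.1.inner_pos (zero_mem_interior_polarBody hK.1.2.1) hx
  have hκ : 0 < κ' x := (hK'.2.2.2.2.2 x hx).2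
  have hnorm : ‖normalGrad K ν' x‖ = ⟪x, ν' x⟫⁻¹ := by
    rw [normalGrad_of_suppFn_eq_one hx1, norm_smul, (hK'.2.1 x hx).1, mul_one,
      Real.norm_of_nonneg (inv_nonneg.2 hs.le)]
  set s := ⟪x, ν' x⟫ with hs_def
  have hlim := (h.tendsto_norm_ratio hm (f₀ := κ' x / s ^ m) (by positivity)
    (fun ε hε => exists_graphGrad_MABetween hK' h hε) hxδ).const_mul (s / ((m + 1 : ℕ) : ℝ))
  have e1 : ((m + 1 : ℕ) : ℝ) + 1 = (m : ℝ) + 2 := by push_cast; ring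
  have hM : (s⁻¹ ^ 2 * (κ' x / s ^ m) * (capVol m 1).toReal ^ 2) ^ (1 / ((m : ℝ) + 2)) =
      s⁻¹ * κ' x ^ (1 / ((m : ℝ) + 2)) * cn (m + 1) := by
    have h1 : s⁻¹ ^ 2 * (κ' x / s ^ m) = s⁻¹ ^ (m + 2) * κ' x := by
      rw [pow_add, inv_pow s m]; field_simp
    rw [h1, Real.mul_rpow (by positivity) (by positivity), cn_succ hm,
      Real.mul_rpow (by positivity) hκ.le, ← Real.rpow_natCast _ (m + 2),
      ← Real.rpow_mul (by positivity)]
    push_cast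
    rw [mul_one_div_cancel (by positivity), Real.rpow_one]
  rw [hnorm, hM] at hlim
  rw [e1]
  convert! hlim using 2
  · ring
  · rw [mul_inv, mul_inv, inv_inv]
    field_simp
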